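/- Let n be an odd prime and let H be a finitely generated subgroup of SL(n,ℤ) that is infinite, non-solvable, primitive (acting on ℚ^n), and not an isometry group (there is no invertible Φ ∈ GL(n,ℚ) with h Φ hᵀ = Φ for all h ∈ H). Then the set Π(H) of primes p with φ_p(H) ≠ SL(n,ℤ/pℤ) is finite. -/

import Mathlib

open Matrix

/-- `SL n R` : the special linear group of `n × n` matrices over `R`. -/
abbrev SL (n : ℕ) (R : Type*) [CommRing R] := Matrix.SpecialLinearGroup (Fin n) R

/-- The reduction-mod-`p` homomorphism `φ_p : SL(n,ℤ) → SL(n,ℤ/pℤ)`. -/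
def redMod (n p : ℕ) : SL n ℤ →* SL n (ZMod p) :=
  Matrix.SpecialLinearGroup.map (Int.castRingHom (ZMod p))

/-- The rational matrix underlying an element of `SL(n,ℤ)`. -/
def matQ {n : ℕ} (g : SL n ℤ) : Matrix (Fin n) (Fin n) ℚ :=
  (g : Matrix (Fin n) (Fin n) ℤ).map ((↑) : ℤ → ℚ)

/-- A subgroup of `SL(n,ℤ)` is absolutely irreducible over `ℚ` if its elements generate the
full matrix algebra over `ℚ`. -/
def AbsIrredQ {n : ℕ} (H : Subgroup (SL n ℤ)) : Prop :=
  Algebra.adjoin ℚ (matQ '' (H : Set (SL n ℤ))) = ⊤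

/-- A subgroup of `SL(n, ℤ/pℤ)` is absolutely irreducible if its elements generate the
full matrix algebra over `ℤ/pℤ`. -/
def AbsIrredMod {n p : ℕ} (G : Subgroup (SL n (ZMod p))) : Prop :=
  Algebra.adjoin (ZMod p)
    ((fun g : SL n (ZMod p) => (g : Matrix (Fin n) (Fin n) (ZMod p))) '' (G : Set _)) = ⊤

/-- Irreducibility of the natural action of a subgroup of `SL(n,R)` on `R^n`. -/
def IrreducibleSub (R : Type*) [CommRing R] {n : ℕ} (G : Subgroup (SL n R)) : Prop :=
  ∀ W : Submodule R (Fin n → R),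
    (∀ g ∈ G, W.map (Matrix.toLin' (g : Matrix (Fin n) (Fin n) R)) ≤ W) → W = ⊥ ∨ W = ⊤

/-- Imprimitivity: a nontrivial direct-sum decomposition whose summands are permuted by `G`. -/
def ImprimitiveSub (R : Type*) [CommRing R] {n : ℕ} (G : Subgroup (SL n R)) : Prop :=
  ∃ m : ℕ, 2 ≤ m ∧ ∃ W : Fin m → Submodule R (Fin n → R),
    (∀ i, W i ≠ ⊥) ∧ DirectSum.IsInternal W ∧
    ∀ g ∈ G, ∀ i, ∃ j, (W i).map (Matrix.toLin' (g : Matrix (Fin n) (Fin n) R)) = W j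

/-- Primitivity: irreducible and not imprimitive. -/
def PrimitiveSub (R : Type*) [CommRing R] {n : ℕ} (G : Subgroup (SL n R)) : Prop :=
  IrreducibleSub R G ∧ ¬ ImprimitiveSub R G

/-- Monomiality: a direct sum of `n` one-dimensional subspaces permuted by `G`. -/
def MonomialSub (R : Type*) [CommRing R] {n : ℕ} (G : Subgroup (SL n R)) : Prop :=
  ∃ L : Fin n → Submodule R (Fin n → R),
    (∀ i, Module.finrank R (L i) = 1) ∧ DirectSum.IsInternal L ∧
    ∀ g ∈ G, ∀ i, ∃ j, (L i).map (Matrix.toLin' (g : Matrix (Fin n) (Fin n) R)) = L j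

/-- Irreducibility of a subgroup of `SL(n,ℤ)` acting on `ℚ^n`. -/
def IrreducibleQ {n : ℕ} (H : Subgroup (SL n ℤ)) : Prop :=
  ∀ W : Submodule ℚ (Fin n → ℚ),
    (∀ g ∈ H, W.map (Matrix.toLin' (matQ g)) ≤ W) → W = ⊥ ∨ W = ⊤

/-- Imprimitivity of a subgroup of `SL(n,ℤ)` acting on `ℚ^n`. -/
def ImprimitiveQ {n : ℕ} (H : Subgroup (SL n ℤ)) : Prop :=
  ∃ m : ℕ, 2 ≤ m ∧ ∃ W : Fin m → Submodule ℚ (Fin n → ℚ),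
    (∀ i, W i ≠ ⊥) ∧ DirectSum.IsInternal W ∧
    ∀ g ∈ H, ∀ i, ∃ j, (W i).map (Matrix.toLin' (matQ g)) = W j

/-- Primitivity of a subgroup of `SL(n,ℤ)` acting on `ℚ^n`. -/
def PrimitiveQ {n : ℕ} (H : Subgroup (SL n ℤ)) : Prop :=
  IrreducibleQ H ∧ ¬ ImprimitiveQ H

/-- A group is solvable-by-finite if it has a solvable subgroup of finite index. -/
def SolvableByFinite (G : Type*) [Group G] : Prop :=
  ∃ K : Subgroup G, IsSolvable K ∧ K.FiniteIndex

/-- A subgroup of `SL(n,ℤ)` is an isometry group if it preserves a nondegenerate bilinear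
form on `ℚ^n`. -/
def IsometryGroupQ {n : ℕ} (H : Subgroup (SL n ℤ)) : Prop :=
  ∃ Φ : Matrix (Fin n) (Fin n) ℚ, IsUnit Φ ∧ ∀ h ∈ H, matQ h * Φ * (matQ h)ᵀ = Φ

set_option linter.unusedSectionVars false
set_option linter.unusedVariables false
set_option linter.unusedSimpArgs false
set_option linter.deprecated false

section
/-- abstract reflection group data -/
structure ReflData (K M G I : Type*) [Field K] [AddCommGroup M] [Module K M] [Group G] where
  act : G →* (M ≃ₗ[K] M)
  sgn : G →* Kˣ
  s : I → G
  α : I → M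
  c : I → M →ₗ[K] K
  ht : M →+ ℚ
  act_s : ∀ i ν, act (s i) ν = ν - c i ν • α i
  sgn_s : ∀ i, sgn (s i) = -1
  ht_α : ∀ i, ht (α i) = 2

namespace ReflData

variable {K M G I : Type*} [Field K] [CharZero K] [AddCommGroup M] [Module K M] [Group G]
  (D : ReflData K M G I)

def Anti (F : AddMonoidAlgebra K M) : Prop :=
  ∀ g ν, F.coeff (D.act g ν) = D.sgn g * F.coeff ν

def Integral (F : AddMonoidAlgebra K M) : Prop :=
  ∀ ν, F.coeff ν ≠ 0 → ∀ i, ∃ z : ℤ, D.c i ν = z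

def SDom (ν : M) : Prop := ∀ i, ∃ k : ℕ, 0 < k ∧ D.c i ν = k

lemma key (F : AddMonoidAlgebra K M) (hA : D.Anti F) (hI : D.Integral F)
    (hd : ∀ ν, F.coeff ν ≠ 0 → ¬ D.SDom ν) : F = 0 := by
  by_contra hF
  have hne : F.coeff.support.Nonempty := by
    rw [Finsupp.support_nonempty_iff]
    simpa using hF
  obtain ⟨ν, hν, hmax⟩ := F.coeff.support.exists_max_image D.ht hne
  rw [Finsupp.mem_support_iff] at hν
  apply hd ν hν
  intro i
  obtain ⟨z, hz⟩ := hI ν hν i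
  have h1 := hA (D.s i) ν
  rw [D.sgn_s, D.act_s, hz, Int.cast_smul_eq_zsmul] at h1
  have h2 : F.coeff (ν - z • D.α i) ≠ 0 := by
    rw [h1]; simpa using hν
  have h3 := hmax _ (Finsupp.mem_support_iff.2 h2)
  rw [map_sub, map_zsmul, D.ht_α] at h3
  simp only [zsmul_eq_mul] at h3
  have h4 : (0:ℚ) ≤ z := by linarith
  have h5 : 0 ≤ z := by exact_mod_cast h4
  have h6 : z ≠ 0 := by
    rintro rfl
    simp only [zero_smul, sub_zero, Units.val_neg, Units.val_one, neg_mul, one_mul] at h1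
    exact hν (self_eq_neg.1 h1)
  refine ⟨z.toNat, by omega, ?_⟩
  rw [hz]
  have : ((z.toNat : ℤ) : K) = z := by rw [Int.toNat_of_nonneg h5]
  exact_mod_cast this.symm

noncomputable def alt [Fintype G] (ν : M) : AddMonoidAlgebra K M :=
  ∑ g, AddMonoidAlgebra.single (D.act g ν) (D.sgn g : K)

lemma alt_anti [Fintype G] (ν : M) : D.Anti (D.alt ν) := by
  classical
  intro g μ
  simp only [alt, AddMonoidAlgebra.coeff_sum, Finsupp.finsetSum_apply,
    AddMonoidAlgebra.coeff_single, Finsupp.single_apply]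
  rw [Finset.mul_sum, ← Equiv.sum_comp (Equiv.mulLeft g)]
  refine Finset.sum_congr rfl fun x _ => ?_
  simp [mul_ite]

lemma alt_eq [Fintype G] (F : AddMonoidAlgebra K M) (hA : D.Anti F) (hI : D.Integral F) (ν : M)
    (hν : F.coeff ν ≠ 0) (hu : ∀ μ, F.coeff μ ≠ 0 → D.SDom μ → μ = ν) :
    ∃ κ : K, κ ≠ 0 ∧ F = κ • D.alt ν := by
  classical
  have hst : ∀ g, D.act g ν = ν → (D.sgn g : K) = 1 := by
    intro g hg
    have := hA g ν
    rw [hg] at this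
    exact (mul_eq_right₀ hν).1 this.symm
  have hcoef : (D.alt ν).coeff ν = ((Finset.univ.filter fun g => D.act g ν = ν).card : K) := by
    simp only [alt, AddMonoidAlgebra.coeff_sum, Finsupp.finsetSum_apply,
      AddMonoidAlgebra.coeff_single, Finsupp.single_apply]
    rw [Finset.card_filter, Nat.cast_sum]
    refine Finset.sum_congr rfl fun g _ => ?_
    split_ifs with h
    · simp [hst g h]
    · simp
  have hc0 : (D.alt ν).coeff ν ≠ 0 := by
    rw [hcoef]
    have : 0 < (Finset.univ.filter fun g => D.act g ν = ν).card :=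
      Finset.card_pos.2 ⟨1, by simp⟩
    exact_mod_cast this.ne'
  have hsupp : ∀ μ, (D.alt ν).coeff μ ≠ 0 → F.coeff μ ≠ 0 := by
    intro μ hμ
    have : ∃ g, D.act g ν = μ := by
      by_contra hcon
      push Not at hcon
      apply hμ
      simp only [alt, AddMonoidAlgebra.coeff_sum, Finsupp.finsetSum_apply,
        AddMonoidAlgebra.coeff_single, Finsupp.single_apply]
      exact Finset.sum_eq_zero fun g _ => by simp [hcon g]
    obtain ⟨g, rfl⟩ := this
    rw [hA]
    exact mul_ne_zero (Units.ne_zero _) hν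
  refine ⟨F.coeff ν / (D.alt ν).coeff ν, div_ne_zero hν hc0, ?_⟩
  rw [← sub_eq_zero]
  set κ := F.coeff ν / (D.alt ν).coeff ν
  have hor : ∀ μ, (F - κ • D.alt ν).coeff μ ≠ 0 → F.coeff μ ≠ 0 := by
    intro μ hμ hF
    apply hμ
    have : (D.alt ν).coeff μ = 0 := by
      by_contra h; exact hsupp μ h hF
    simp [hF, this]
  apply D.key
  · intro g μ
    have h1 := hA g μ
    have h2 := D.alt_anti ν g μ
    simp only [AddMonoidAlgebra.coeff_sub, AddMonoidAlgebra.coeff_smul, Finsupp.coe_sub,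
      Finsupp.coe_smul, Pi.sub_apply, Pi.smul_apply, h1, h2, smul_eq_mul]
    ring
  · intro μ hμ
    exact hI μ (hor μ hμ)
  · intro μ hμ hd
    have := hu μ (hor μ hμ) hd
    subst this
    apply hμ
    simp [κ, hc0]

end ReflData
end

section
structure WeylData (K M N ι G : Type*) [Field K] [AddCommGroup M] [Module K M]
    [AddCommGroup N] [Module K N] [Group G] where
  pair : M →ₗ[K] N →ₗ[K] K
  root : ι → M
  coroot : ι → N
  simple : Set ι
  perm : simple → Equiv.Perm ι
  a : G →* (M ≃ₗ[K] M)
  a' : G →* (N ≃ₗ[K] N)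
  s : simple → G
  sgn : G →* Kˣ
  pair_a : ∀ g m n, pair (a g m) (a' g n) = pair m n
  a_s : ∀ (j : simple) m, a (s j) m = m - pair m (coroot j) • root j
  a'_s : ∀ (j : simple) n, a' (s j) n = n - pair (root j) n • coroot j
  sgn_s : ∀ j, sgn (s j) = -1
  gen : Subgroup.closure (Set.range s) = ⊤
  perm_self : ∀ j : simple, perm j j = j
  root_perm : ∀ (j : simple) (i : ι), i ≠ j → root (perm j i) = a (s j) (root i)
  coroot_perm : ∀ (j : simple) (i : ι), i ≠ j → coroot (perm j i) = a' (s j) (coroot i)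
  two : ∀ i, pair (root i) (coroot i) = 2
  int : ∀ i j, ∃ z : ℤ, pair (root i) (coroot j) = z
  root_mem : ∀ i, root i ∈ AddSubmonoid.closure (root '' simple)
  coroot_mem : ∀ i, coroot i ∈ AddSubmonoid.closure (coroot '' simple)

namespace WeylData

variable {K M N ι G : Type*} [Field K] [AddCommGroup M] [Module K M]
    [AddCommGroup N] [Module K N] [Group G] (W : WeylData K M N ι G)

def flip : WeylData K N M ι G where
  pair := W.pair.flip
  root := W.coroot
  coroot := W.root
  simple := W.simple
  perm := W.perm
  a := W.a'
  a' := W.a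
  s := W.s
  sgn := W.sgn
  pair_a g m n := W.pair_a g n m
  a_s := W.a'_s
  a'_s := W.a_s
  sgn_s := W.sgn_s
  gen := W.gen
  perm_self := W.perm_self
  root_perm := W.coroot_perm
  coroot_perm := W.root_perm
  two := W.two
  int i j := W.int j i
  root_mem := W.coroot_mem
  coroot_mem := W.root_mem

variable [Fintype ι]

lemma a'_sum (j : W.simple) : W.a' (W.s j) (∑ i, W.coroot i) = (∑ i, W.coroot i) - (2:K) • W.coroot j := by
  classical
  have h1 : ∑ i, W.coroot i = W.coroot j + ∑ i ∈ Finset.univ.erase (j:ι), W.coroot i :=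
    (Finset.add_sum_erase _ _ (Finset.mem_univ _)).symm
  have h2 : ∑ i, W.coroot (W.perm j i) = ∑ i, W.coroot i := Equiv.sum_comp (W.perm j) W.coroot
  rw [← Finset.add_sum_erase _ _ (Finset.mem_univ (j:ι)), W.perm_self] at h2
  have h3 : ∑ i ∈ Finset.univ.erase (j:ι), W.coroot (W.perm j i)
      = ∑ i ∈ Finset.univ.erase (j:ι), W.a' (W.s j) (W.coroot i) :=
    Finset.sum_congr rfl fun i hi => W.coroot_perm j i (Finset.ne_of_mem_erase hi)
  rw [h3, ← map_sum] at h2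
  conv_lhs => rw [h1]
  rw [map_add, ← h2, W.a'_s j (W.coroot j), W.two]
  module

variable [CharZero K]

lemma pair_sum_coroot (j : W.simple) : W.pair (W.root j) (∑ i, W.coroot i) = 2 := by
  have h := W.a'_sum j
  rw [W.a'_s] at h
  have h2 := congrArg (W.pair (W.root j)) (sub_right_injective h)
  simp only [map_smul, W.two, smul_eq_mul] at h2
  exact mul_right_cancel₀ two_ne_zero h2

noncomputable def rho : M := (2⁻¹ : K) • ∑ i, W.root i

lemma pair_rho (j : W.simple) : W.pair W.rho (W.coroot j) = 1 := by
  have h := W.flip.pair_sum_coroot j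
  change W.pair (∑ i, W.root i) (W.coroot j) = 2 at h
  rw [rho, map_smul, LinearMap.smul_apply, h]
  simp

/-- height -/
noncomputable def ht (φ : K →+ ℚ) : M →+ ℚ :=
  φ.comp ((W.pair.flip (∑ i, W.coroot i)).toAddMonoidHom)

lemma ht_apply (φ : K →+ ℚ) (m : M) : W.ht φ m = φ (W.pair m (∑ i, W.coroot i)) := rfl

noncomputable def toRefl (φ : K →+ ℚ) (hφ : φ 1 = 1) : ReflData K M G W.simple where
  act := W.a
  sgn := W.sgn
  s := W.s
  α j := W.root j
  c j := W.pair.flip (W.coroot j)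
  ht := W.ht φ
  act_s j ν := W.a_s j ν
  sgn_s := W.sgn_s
  ht_α j := by
    rw [ht_apply, W.pair_sum_coroot, ← one_add_one_eq_two, map_add, hφ]; norm_num

noncomputable def q (i : ι) : AddMonoidAlgebra K M :=
  AddMonoidAlgebra.single ((2⁻¹:K) • W.root i) 1 - AddMonoidAlgebra.single (-((2⁻¹:K) • W.root i)) 1

noncomputable def Q : AddMonoidAlgebra K M := ∏ i, W.q i

def cone : AddSubmonoid M := AddSubmonoid.closure (W.root '' W.simple)

lemma ht_cone (φ : K →+ ℚ) (hφ : φ 1 = 1) (x : M) (hx : x ∈ W.cone) : x = 0 ∨ 0 < W.ht φ x := by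
  induction hx using AddSubmonoid.closure_induction with
  | mem x hx =>
    obtain ⟨j, hj, rfl⟩ := hx
    right
    rw [ht_apply, W.pair_sum_coroot ⟨j, hj⟩, ← one_add_one_eq_two, map_add, hφ]; norm_num
  | zero => exact Or.inl rfl
  | add x y _ _ hx hy =>
    rcases hx with rfl | hx
    · simpa using hy
    · rcases hy with rfl | hy
      · right; simpa using hx
      · right; rw [map_add]; exact add_pos hx hy

lemma int_cone (x : M) (hx : x ∈ W.cone) (j : ι) : ∃ z : ℤ, W.pair x (W.coroot j) = z := by
  induction hx using AddSubmonoid.closure_induction with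
  | mem x hx =>
    obtain ⟨i, hi, rfl⟩ := hx
    exact W.int i j
  | zero => exact ⟨0, by simp⟩
  | add x y _ _ hx hy =>
    obtain ⟨z, hz⟩ := hx
    obtain ⟨w, hw⟩ := hy
    exact ⟨z + w, by simp [hz, hw]⟩

lemma q_mul_coeff (i : ι) (F : AddMonoidAlgebra K M) (ν : M) :
    (W.q i * F).coeff ν = F.coeff (ν - (2⁻¹:K) • W.root i) - F.coeff (ν + (2⁻¹:K) • W.root i) := by
  rw [q, sub_mul, AddMonoidAlgebra.coeff_sub, Finsupp.sub_apply]
  congr 1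
  · conv_lhs => rw [show ν = (2⁻¹:K) • W.root i + (ν - (2⁻¹:K) • W.root i) by abel]
    rw [AddMonoidAlgebra.coeff_single_mul_add, one_mul]
  · conv_lhs => rw [show ν = -((2⁻¹:K) • W.root i) + (ν + (2⁻¹:K) • W.root i) by abel]
    rw [AddMonoidAlgebra.coeff_single_mul_add, one_mul]

lemma q_mul_supp (i : ι) (F : AddMonoidAlgebra K M) (top : M)
    (hF : ∀ ν, F.coeff ν ≠ 0 → top - ν ∈ W.cone) (ν : M) (hν : (W.q i * F).coeff ν ≠ 0) :
    (2⁻¹:K) • W.root i + top - ν ∈ W.cone := by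
  rw [q_mul_coeff] at hν
  by_cases h : F.coeff (ν - (2⁻¹:K) • W.root i) = 0
  · rw [h, zero_sub, neg_ne_zero] at hν
    have h5 : W.root i + (top - (ν + (2⁻¹:K) • W.root i)) ∈ W.cone :=
      add_mem (show W.root i ∈ W.cone from W.root_mem i) (hF _ hν)
    convert h5 using 1
    have : W.root i = (2⁻¹:K) • W.root i + (2⁻¹:K) • W.root i := by
      rw [← add_smul]; norm_num
    generalize (2⁻¹:K) • W.root i = x at *
    rw [this]
    abel
  · convert hF _ h using 1
    abel

lemma q_mul_top (φ : K →+ ℚ) (hφ : φ 1 = 1) (i : ι) (F : AddMonoidAlgebra K M) (top : M)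
    (hF : ∀ ν, F.coeff ν ≠ 0 → top - ν ∈ W.cone) :
    (W.q i * F).coeff ((2⁻¹:K) • W.root i + top) = F.coeff top := by
  rw [q_mul_coeff]
  have h0 : F.coeff ((2⁻¹:K) • W.root i + top + (2⁻¹:K) • W.root i) = 0 := by
    by_contra h
    have h1 := hF _ h
    have e : top - ((2⁻¹:K) • W.root i + top + (2⁻¹:K) • W.root i) = - W.root i := by
      have : W.root i = (2⁻¹:K) • W.root i + (2⁻¹:K) • W.root i := by
        rw [← add_smul]; norm_num
      conv_rhs => rw [this]
      abel
    rw [e] at h1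
    have hne : W.root i ≠ 0 := by
      intro h0
      have := W.two i
      rw [h0] at this; simp at this
    have h2 := (W.ht_cone φ hφ _ (W.root_mem i)).resolve_left hne
    have h3 := (W.ht_cone φ hφ _ h1).resolve_left (neg_ne_zero.2 hne)
    rw [map_neg] at h3
    linarith
  rw [h0, sub_zero]
  congr 1; abel

lemma prod_q (φ : K →+ ℚ) (hφ : φ 1 = 1) (F : AddMonoidAlgebra K M) (top : M)
    (hF : ∀ ν, F.coeff ν ≠ 0 → top - ν ∈ W.cone) :
    (∀ ν, (W.Q * F).coeff ν ≠ 0 → W.rho + top - ν ∈ W.cone) ∧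
      (W.Q * F).coeff (W.rho + top) = F.coeff top := by
  classical
  have : ∀ t : Finset ι, (∀ ν, ((∏ i ∈ t, W.q i) * F).coeff ν ≠ 0 →
      (2⁻¹:K) • (∑ i ∈ t, W.root i) + top - ν ∈ W.cone) ∧
      ((∏ i ∈ t, W.q i) * F).coeff ((2⁻¹:K) • (∑ i ∈ t, W.root i) + top) = F.coeff top := by
    intro t
    induction t using Finset.induction_on with
    | empty => simpa using hF
    | insert i t hi ih =>
      obtain ⟨h1, h2⟩ := ih
      rw [Finset.prod_insert hi, Finset.sum_insert hi, mul_assoc, smul_add, add_assoc]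
      refine ⟨fun ν hν => W.q_mul_supp i _ _ h1 ν hν, ?_⟩
      rw [W.q_mul_top φ hφ i _ _ h1, h2]
  exact this Finset.univ

lemma Q_map (j : W.simple) :
    AddMonoidAlgebra.mapDomainAlgHom K K ((W.a (W.s j)).toLinearMap.toAddMonoidHom : M →+ M) W.Q = - W.Q := by
  classical
  have hq : ∀ i, AddMonoidAlgebra.mapDomainAlgHom K K ((W.a (W.s j)).toLinearMap.toAddMonoidHom : M →+ M) (W.q i)
    = AddMonoidAlgebra.single ((2⁻¹:K) • W.a (W.s j) (W.root i)) 1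
      - AddMonoidAlgebra.single (-((2⁻¹:K) • W.a (W.s j) (W.root i))) 1 := by
    intro i
    rw [q, map_sub]
    simp [AddMonoidAlgebra.mapDomain_single]
  rw [Q, map_prod, ← Finset.mul_prod_erase _ _ (Finset.mem_univ (j:ι)), hq]
  have h1 : ∏ i, W.q (W.perm j i) = ∏ i, W.q i := Equiv.prod_comp (W.perm j) W.q
  rw [← Finset.mul_prod_erase _ _ (Finset.mem_univ (j:ι)), W.perm_self] at h1
  rw [← h1]
  have h2 : ∏ i ∈ Finset.univ.erase (j:ι), W.q (W.perm j i) = ∏ i ∈ Finset.univ.erase (j:ι),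
      AddMonoidAlgebra.mapDomainAlgHom K K ((W.a (W.s j)).toLinearMap.toAddMonoidHom : M →+ M) (W.q i) := by
    refine Finset.prod_congr rfl fun i hi => ?_
    rw [hq, q, W.root_perm j i (Finset.ne_of_mem_erase hi)]
  rw [h2, ← neg_mul]
  congr 1
  have h3 : W.a (W.s j) (W.root j) = - W.root j := by
    rw [W.a_s, W.two]; module
  rw [h3, q]
  simp

lemma anti_of_map (φ : K →+ ℚ) (hφ : φ 1 = 1) (F : AddMonoidAlgebra K M)
    (h : ∀ j, ∀ ν, F.coeff (W.a (W.s j) ν) = - F.coeff ν) : (W.toRefl φ hφ).Anti F := by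
  intro g
  have hg : g ∈ Subgroup.closure (Set.range W.s) := by rw [W.gen]; trivial
  change ∀ ν, F.coeff (W.a g ν) = W.sgn g * F.coeff ν
  induction hg using Subgroup.closure_induction with
  | mem x hx =>
    obtain ⟨j, rfl⟩ := hx
    intro ν; rw [h, W.sgn_s]; simp
  | one => intro ν; simp
  | mul x y _ _ hx hy =>
    intro ν
    rw [map_mul, LinearEquiv.mul_apply, hx, hy, map_mul, Units.val_mul, mul_assoc]
  | inv x _ hx =>
    intro ν
    have := hx (W.a x⁻¹ ν)
    rw [← LinearEquiv.mul_apply, ← map_mul, mul_inv_cancel, map_one] at this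
    change F.coeff ν = _ at this
    rw [this, map_inv]
    simp

lemma Q_coeff (j : W.simple) (ν : M) : W.Q.coeff (W.a (W.s j) ν) = - W.Q.coeff ν := by
  have h := congrArg (fun F => F.coeff (W.a (W.s j) ν)) (W.Q_map j)
  simp only [AddMonoidAlgebra.coeff_neg, Finsupp.neg_apply] at h
  rw [← neg_eq_iff_eq_neg, ← h]
  exact Finsupp.mapDomain_apply (W.a (W.s j)).injective W.Q.coeff ν

lemma Q_eq_alt [Fintype G] (φ : K →+ ℚ) (hφ : φ 1 = 1) :
    ∃ κ : K, κ ≠ 0 ∧ W.Q = κ • (W.toRefl φ hφ).alt W.rho := by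
  obtain ⟨h1, h2⟩ := W.prod_q φ hφ 1 0 (by
    classical
    intro ν hν
    have : ν = 0 := by
      by_contra h
      apply hν
      rw [AddMonoidAlgebra.one_def, AddMonoidAlgebra.coeff_single, Finsupp.single_apply, if_neg (Ne.symm h)]
    rw [this, sub_zero]; exact zero_mem _)
  rw [mul_one, add_zero] at h1 h2
  refine (W.toRefl φ hφ).alt_eq _ (W.anti_of_map φ hφ _ W.Q_coeff) ?_ _ ?_ ?_
  · intro ν hν j
    obtain ⟨z, hz⟩ := W.int_cone _ (h1 ν hν) j
    refine ⟨1 - z, ?_⟩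
    change W.pair ν (W.coroot j) = _
    rw [map_sub, LinearMap.sub_apply, W.pair_rho] at hz
    push_cast; rw [← hz]; ring
  · rw [h2, AddMonoidAlgebra.one_def, AddMonoidAlgebra.coeff_single]; simp
  · intro μ hμ hd
    have hx := h1 μ hμ
    rcases W.ht_cone φ hφ _ hx with h | h
    · rw [sub_eq_zero] at h; exact h.symm
    exfalso
    have key : ∀ y ∈ AddSubmonoid.closure (W.coroot '' W.simple), φ (W.pair (W.rho - μ) y) ≤ 0 := by
      intro y hy
      induction hy using AddSubmonoid.closure_induction with
      | mem x hx =>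
        obtain ⟨j, hj, rfl⟩ := hx
        obtain ⟨k, hk, hk'⟩ := hd ⟨j, hj⟩
        change W.pair μ (W.coroot j) = k at hk'
        rw [map_sub, LinearMap.sub_apply, W.pair_rho ⟨j, hj⟩, hk', map_sub, hφ]
        have : φ (k:K) = k := by
          rw [← nsmul_one, map_nsmul, hφ]; simp
        rw [this]
        have : (1:ℚ) ≤ k := by exact_mod_cast hk
        linarith
      | zero => simp
      | add x y _ _ hx hy => rw [map_add, map_add]; linarith
    have := key (∑ i, W.coroot i) (sum_mem fun i _ => W.coroot_mem i)
    rw [ht_apply] at h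
    linarith

end WeylData
end

section
namespace RPW
open RootPairing

variable {K M N ι : Type*} [Field K] [CharZero K] [AddCommGroup M] [Module K M]
  [AddCommGroup N] [Module K N] [Finite ι] (P : RootPairing ι K M N) [P.IsRootSystem]
  [P.IsCrystallographic] [P.IsReduced] (b : P.Base)

lemma height_nonneg (i : ι) (h : P.root i ∈ AddSubmonoid.closure (P.root '' b.support)) :
    0 ≤ b.height i := by
  classical
  obtain ⟨f, hf⟩ : ∃ f : ι → ℤ, (∀ i, 0 ≤ f i) ∧ P.root i = ∑ j ∈ b.support, f j • P.root j := by
    generalize P.root i = x at h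
    induction h using AddSubmonoid.closure_induction with
    | mem x hx =>
      obtain ⟨j, hj, rfl⟩ := hx
      refine ⟨Pi.single j 1, fun i => ?_, ?_⟩
      · by_cases h : i = j
        · subst h; simp
        · simp [h]
      · rw [Finset.sum_eq_single_of_mem j hj]
        · simp
        · intro k _ hk; simp [hk]
    | zero => exact ⟨0, by simp, by simp⟩
    | add x y _ _ hx hy =>
      obtain ⟨f, hf, rfl⟩ := hx
      obtain ⟨g, hg, rfl⟩ := hy
      exact ⟨f + g, fun i => add_nonneg (hf i) (hg i), by simp [add_smul, Finset.sum_add_distrib]⟩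
  rw [b.height_eq_sum hf.2]
  exact Finset.sum_nonneg fun i _ => hf.1 i

lemma root_mem_of_pos (i : ι) (h : b.IsPos i) :
    P.root i ∈ AddSubmonoid.closure (P.root '' b.support) := by
  rcases b.root_mem_or_neg_mem i with h1 | h1
  · exact h1
  · exfalso
    have e : P.root (P.reflectionPerm i i) = - P.root i := by
      rw [root_reflectionPerm, reflection_apply_self]
    rw [← e] at h1
    have h2 := height_nonneg P b _ h1
    have h3 := b.height_reflectionPerm_self i
    change b.height (P.reflectionPerm i i) = _ at h3
    rw [h3] at h2
    rw [Base.isPos_iff] at h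
    omega

lemma isPos_refl_iff (i j : ι) (hj : j ∈ b.support) (h1 : i ≠ j) (h2 : i ≠ P.reflectionPerm j j) :
    b.IsPos (P.reflectionPerm j i) ↔ b.IsPos i := by
  constructor
  · intro h
    have := h.reflectionPerm hj (by
      intro h3
      apply h2
      have h4 := congrArg (P.reflectionPerm j) h3
      rwa [reflectionPerm_self] at h4)
    simpa using this
  · intro h
    exact h.reflectionPerm hj h1

lemma isPos_flip (i : ι) : b.IsPos i ↔ b.flip.IsPos i := by
  refine b.induction_reflect i (p := fun i => b.IsPos i ↔ b.flip.IsPos i) ?_ ?_ ?_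
  · intro i h
    have h1 := Base.IsPos.neg_iff_not b i
    have h2 := Base.IsPos.neg_iff_not b.flip i
    change b.IsPos (P.reflectionPerm i i) ↔ _ at h1
    change b.flip.IsPos (P.reflectionPerm i i) ↔ _ at h2
    rw [h1, h2, h]
  · intro i hi
    exact ⟨fun _ => Base.isPos_of_mem_support (b := b.flip) hi, fun _ => Base.isPos_of_mem_support hi⟩
  · intro i j h hj
    have hjj : ∀ j ∈ b.support, ¬ b.IsPos (P.reflectionPerm j j) := by
      intro j hj
      have h1 := Base.IsPos.neg_iff_not b j
      change b.IsPos (P.reflectionPerm j j) ↔ _ at h1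
      rw [h1, not_not]; exact Base.isPos_of_mem_support hj
    have hjj' : ∀ j ∈ b.support, ¬ b.flip.IsPos (P.reflectionPerm j j) := by
      intro j hj
      have h1 := Base.IsPos.neg_iff_not b.flip j
      change b.flip.IsPos (P.reflectionPerm j j) ↔ _ at h1
      rw [h1, not_not]; exact Base.isPos_of_mem_support (b := b.flip) hj
    by_cases h1 : i = j
    · subst h1
      exact iff_of_false (hjj i hj) (hjj' i hj)
    by_cases h2 : i = P.reflectionPerm j j
    · subst h2
      simp only [reflectionPerm_self]
      exact ⟨fun _ => Base.isPos_of_mem_support (b := b.flip) hj, fun _ => Base.isPos_of_mem_support hj⟩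
    · rw [isPos_refl_iff P b i j hj h1 h2, h]
      exact (isPos_refl_iff P.flip b.flip i j hj h1 h2).symm

lemma coroot_mem_of_pos (i : ι) (h : b.IsPos i) :
    P.coroot i ∈ AddSubmonoid.closure (P.coroot '' b.support) :=
  root_mem_of_pos P.flip b.flip i ((isPos_flip P b i).1 h)

/-- Weyl group as pairs -/
def WG : Subgroup ((M ≃ₗ[K] M) × (N ≃ₗ[K] N)) :=
  Subgroup.closure (Set.range fun j : b.support => (P.reflection j, P.coreflection j))

lemma WG_pres (g : (M ≃ₗ[K] M) × (N ≃ₗ[K] N)) (hg : g ∈ WG P b) :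
    (∀ m n, P.toLinearMap (g.1 m) (g.2 n) = P.toLinearMap m n) ∧
    (∀ i, g.1 (P.root i) ∈ Set.range P.root) ∧ (∀ i, g.2 (P.coroot i) ∈ Set.range P.coroot) := by
  have : Finite (Set.range P.root) := Set.finite_range _
  have inv1 : ∀ u : M ≃ₗ[K] M, (∀ i, u (P.root i) ∈ Set.range P.root) →
      ∀ i, u⁻¹ (P.root i) ∈ Set.range P.root := by
    intro u hu i
    have hmaps : Set.MapsTo u (Set.range P.root) (Set.range P.root) := by
      rintro _ ⟨k, rfl⟩; exact hu k
    have hs : Set.SurjOn u (Set.range P.root) (Set.range P.root) :=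
      ((Set.finite_range P.root).injOn_iff_bijOn_of_mapsTo hmaps).1 u.injective.injOn |>.surjOn
    obtain ⟨x, hx, hx'⟩ := hs ⟨i, rfl⟩
    rw [← hx']
    change u.symm (u x) ∈ _
    rwa [LinearEquiv.symm_apply_apply]
  have inv2 : ∀ u : N ≃ₗ[K] N, (∀ i, u (P.coroot i) ∈ Set.range P.coroot) →
      ∀ i, u⁻¹ (P.coroot i) ∈ Set.range P.coroot := by
    intro u hu i
    have hmaps : Set.MapsTo u (Set.range P.coroot) (Set.range P.coroot) := by
      rintro _ ⟨k, rfl⟩; exact hu k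
    have hs : Set.SurjOn u (Set.range P.coroot) (Set.range P.coroot) :=
      ((Set.finite_range P.coroot).injOn_iff_bijOn_of_mapsTo hmaps).1 u.injective.injOn |>.surjOn
    obtain ⟨x, hx, hx'⟩ := hs ⟨i, rfl⟩
    rw [← hx']
    change u.symm (u x) ∈ _
    rwa [LinearEquiv.symm_apply_apply]
  induction hg using Subgroup.closure_induction with
  | mem x hx =>
    obtain ⟨j, rfl⟩ := hx
    refine ⟨fun m n => ?_, fun i => ?_, fun i => ?_⟩
    · have h2 := P.root_coroot_two j
      simp only [reflection_apply, coreflection_apply, map_sub, LinearMap.sub_apply, map_smul,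
        LinearMap.smul_apply, smul_eq_mul]
      simp only [root', coroot', LinearMap.flip_apply] at *
      rw [h2]
      ring
    · exact ⟨P.reflectionPerm j i, P.root_reflectionPerm j i⟩
    · exact ⟨P.reflectionPerm j i, P.coroot_reflectionPerm j i⟩
  | one => exact ⟨fun _ _ => rfl, fun i => ⟨i, rfl⟩, fun i => ⟨i, rfl⟩⟩
  | mul x y _ _ hx hy =>
    refine ⟨fun m n => ?_, fun i => ?_, fun i => ?_⟩
    · exact (hx.1 _ _).trans (hy.1 _ _)
    · obtain ⟨k, hk⟩ := hy.2.1 i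
      change x.1 (y.1 _) ∈ _
      rw [← hk]; exact hx.2.1 k
    · obtain ⟨k, hk⟩ := hy.2.2 i
      change x.2 (y.2 _) ∈ _
      rw [← hk]; exact hx.2.2 k
  | inv x _ hx =>
    refine ⟨fun m n => ?_, inv1 _ hx.2.1, inv2 _ hx.2.2⟩
    rw [← hx.1]
    congr 2
    · exact x.1.apply_symm_apply m
    · exact x.2.apply_symm_apply n

instance WG_finite : Finite (WG P b) := by
  have hf : ({f : (ι → M) × (ι → N) | (∀ i, f.1 i ∈ Set.range P.root) ∧
      ∀ i, f.2 i ∈ Set.range P.coroot} : Set _).Finite := by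
    have h1 : (Set.pi Set.univ fun _ : ι => Set.range P.root).Finite :=
      Set.Finite.pi fun _ => Set.finite_range _
    have h2 : (Set.pi Set.univ fun _ : ι => Set.range P.coroot).Finite :=
      Set.Finite.pi fun _ => Set.finite_range _
    refine (h1.prod h2).subset ?_
    rintro ⟨f, g⟩ ⟨h, h'⟩
    exact ⟨fun i _ => h i, fun i _ => h' i⟩
  have := hf.to_subtype
  let Fm : WG P b → {f : (ι → M) × (ι → N) | (∀ i, f.1 i ∈ Set.range P.root) ∧
      ∀ i, f.2 i ∈ Set.range P.coroot} := fun g =>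
    ⟨(fun i => g.1.1 (P.root i), fun i => g.1.2 (P.coroot i)),
      (WG_pres P b g.1 g.2).2.1, (WG_pres P b g.1 g.2).2.2⟩
  refine Finite.of_injective Fm ?_
  intro g g' h
  have h' := congrArg Subtype.val h
  rw [Prod.ext_iff] at h'
  apply Subtype.ext
  apply Prod.ext
  · apply LinearEquiv.toLinearMap_injective
    refine LinearMap.ext_on_range (v := P.root) IsRootSystem.span_root_eq_top fun i => congrFun h'.1 i
  · apply LinearEquiv.toLinearMap_injective
    refine LinearMap.ext_on_range (v := P.coroot) IsRootSystem.span_coroot_eq_top fun i => congrFun h'.2 i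

open Classical in
noncomputable def posPerm (j : b.support) : Equiv.Perm {i // b.IsPos i} where
  toFun i := if h : i.1 = j then i else ⟨P.reflectionPerm j i, i.2.reflectionPerm j.2 h⟩
  invFun i := if h : i.1 = j then i else ⟨P.reflectionPerm j i, i.2.reflectionPerm j.2 h⟩
  left_inv := by
    intro i
    by_cases h : i.1 = j
    · simp [h]
    · have : ¬ P.reflectionPerm j i = j := by
        intro h'
        have e : i.1 = P.reflectionPerm j j := by
          have h4 := congrArg (P.reflectionPerm j) h'
          rwa [reflectionPerm_self] at h4
        have h1 := Base.IsPos.neg_iff_not b j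
        change b.IsPos (P.reflectionPerm j j) ↔ _ at h1
        exact (h1.1 (e ▸ i.2)) (Base.isPos_of_mem_support j.2)
      simp [h, this]
  right_inv := by
    intro i
    by_cases h : i.1 = j
    · simp [h]
    · have : ¬ P.reflectionPerm j i = j := by
        intro h'
        have e : i.1 = P.reflectionPerm j j := by
          have h4 := congrArg (P.reflectionPerm j) h'
          rwa [reflectionPerm_self] at h4
        have h1 := Base.IsPos.neg_iff_not b j
        change b.IsPos (P.reflectionPerm j j) ↔ _ at h1
        exact (h1.1 (e ▸ i.2)) (Base.isPos_of_mem_support j.2)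
      simp [h, this]

lemma supp_mem_closure {A : Type*} [AddCommMonoid A] (f : ι → A) :
    f '' b.support = (fun i : {i // b.IsPos i} => f i) '' {i | i.1 ∈ b.support} := by
  ext x
  constructor
  · rintro ⟨i, hi, rfl⟩
    exact ⟨⟨i, Base.isPos_of_mem_support hi⟩, hi, rfl⟩
  · rintro ⟨i, hi, rfl⟩
    exact ⟨i, hi, rfl⟩

noncomputable def wd : WeylData K M N {i // b.IsPos i} (WG P b) where
  pair := P.toLinearMap
  root i := P.root i
  coroot i := P.coroot i
  simple := {i | i.1 ∈ b.support}
  perm j := posPerm P b ⟨j.1, j.2⟩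
  a := (MonoidHom.fst _ _).comp (WG P b).subtype
  a' := (MonoidHom.snd _ _).comp (WG P b).subtype
  s j := ⟨(P.reflection j, P.coreflection j), Subgroup.subset_closure ⟨⟨j.1, j.2⟩, rfl⟩⟩
  sgn := LinearEquiv.det.comp ((MonoidHom.fst _ _).comp (WG P b).subtype)
  pair_a g m n := (WG_pres P b g.1 g.2).1 m n
  a_s j m := P.reflection_apply j m
  a'_s j m := P.coreflection_apply j m
  sgn_s j := by
    have : FiniteDimensional K M := Module.Finite.of_basis b.toWeightBasis
    apply Units.ext
    simp only [MonoidHom.comp_apply, LinearEquiv.coe_det]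
    change LinearMap.det ((P.reflection j : M ≃ₗ[K] M) : M →ₗ[K] M) = -1
    have : ((P.reflection j : M ≃ₗ[K] M) : M →ₗ[K] M)
        = LinearMap.transvection (-(P.coroot' j)) (P.root j) := by
      ext m
      simp [reflection_apply, LinearMap.transvection.apply, sub_eq_add_neg]
    rw [this, LinearMap.transvection.det]
    have h2 := P.root_coroot_two j
    simp only [coroot', LinearMap.neg_apply, LinearMap.flip_apply]
    rw [h2]; norm_num
  gen := by
    rw [eq_top_iff]
    rintro ⟨g, hg⟩ -
    have hg' := hg
    unfold WG at hg'
    induction hg' using Subgroup.closure_induction with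
    | mem x hx =>
      obtain ⟨j, rfl⟩ := hx
      exact Subgroup.subset_closure ⟨⟨⟨j, Base.isPos_of_mem_support j.2⟩, j.2⟩, rfl⟩
    | one => exact one_mem _
    | mul x y hx hy h1 h2 => exact mul_mem (h1 hx) (h2 hy)
    | inv x hx h1 => exact inv_mem (h1 hx)
  perm_self j := by simp [posPerm]
  root_perm j i h := by
    have : ¬ i.1 = j.1 := fun h' => h (Subtype.ext h')
    simp [posPerm, this, P.root_reflectionPerm]
  coroot_perm j i h := by
    have : ¬ i.1 = j.1 := fun h' => h (Subtype.ext h')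
    simp [posPerm, this, P.coroot_reflectionPerm]
  two i := P.root_coroot_two i
  int i j := ⟨P.pairingIn ℤ i j, by
    have := P.algebraMap_pairingIn ℤ i j
    rw [pairing] at this
    exact this.symm⟩
  root_mem i := by
    rw [← supp_mem_closure P b P.root]
    exact root_mem_of_pos P b i i.2
  coroot_mem i := by
    rw [← supp_mem_closure P b P.coroot]
    exact coroot_mem_of_pos P b i i.2

end RPW
end

section
/-- truncated exponential -/
noncomputable def texp (K : Type*) {A : Type*} [Field K] [Ring A] [Algebra K A] (N : ℕ) (a : A) : A :=
  ∑ k ∈ Finset.range N, ((k.factorial : K)⁻¹) • a ^ k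

section
variable {K A : Type*} [Field K] [CharZero K] [Ring A] [Algebra K A]

lemma texp_stable (N : ℕ) (a : A) (h : a ^ N = 0) : texp K (N + 1) a = texp K N a := by
  rw [texp, Finset.sum_range_succ, h, smul_zero, add_zero]; rfl

lemma texp_unit (N : ℕ) (a : A) (h : a ^ (N + 1) = 0) : IsUnit (texp K (N+1) a) := by
  rw [texp, Finset.sum_range_succ']
  simp only [pow_zero, Nat.factorial_zero, Nat.cast_one, inv_one, one_smul]
  apply IsNilpotent.isUnit_add_one
  have : ∑ k ∈ Finset.range N, (((k+1).factorial : K)⁻¹) • a ^ (k+1)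
      = a * ∑ k ∈ Finset.range N, (((k+1).factorial : K)⁻¹) • a ^ k := by
    rw [Finset.mul_sum]
    refine Finset.sum_congr rfl fun k _ => ?_
    rw [mul_smul_comm, pow_succ']
  rw [this]
  refine Commute.isNilpotent_mul_right ?_ ⟨N+1, h⟩
  refine Commute.sum_right _ _ _ fun k _ => ?_
  exact ((Commute.refl a).pow_right k).smul_right _

lemma pow_comm_sc (x a : A) (c : K) (h : x * a = a * x + c • a) (k : ℕ) :
    x * a ^ k = a ^ k * x + ((k:K) * c) • a ^ k := by
  induction k with
  | zero => simp
  | succ k ih =>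
    rw [pow_succ, ← mul_assoc, ih, add_mul, mul_assoc, h, mul_add]
    simp only [smul_mul_assoc, mul_smul_comm, mul_assoc]
    push_cast
    rw [add_mul, one_mul, add_smul]
    abel

lemma texp_aux (a : A) (N : ℕ) :
    ∑ k ∈ Finset.range (N+1), ((k:K) * ((k.factorial : K)⁻¹)) • a ^ k = texp K N a * a := by
  rw [Finset.sum_range_succ', texp, Finset.sum_mul]
  simp only [Nat.cast_zero, zero_mul, zero_smul, add_zero]
  refine Finset.sum_congr rfl fun k _ => ?_
  rw [pow_succ, smul_mul_assoc]
  congr 1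
  rw [Nat.factorial_succ]
  have : (k.factorial:K) ≠ 0 := by exact_mod_cast k.factorial_ne_zero
  have : ((k+1:ℕ):K) ≠ 0 := by exact_mod_cast k.succ_ne_zero
  push_cast at *
  field_simp

lemma comm_texp (x a : A) (c : K) (h : x * a = a * x + c • a) (N : ℕ) (hN : a ^ N = 0) :
    x * texp K N a = texp K N a * (x + c • a) := by
  rw [← texp_stable N a hN]
  rw [texp, Finset.mul_sum]
  have : ∀ k ∈ Finset.range (N+1), x * ((k.factorial:K)⁻¹ • a ^ k)
      = ((k.factorial:K)⁻¹ • a ^ k) * x + c • (((k:K) * ((k.factorial : K)⁻¹)) • a ^ k) := by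
    intro k _
    rw [mul_smul_comm, pow_comm_sc x a c h, smul_add, smul_mul_assoc, smul_smul, smul_smul]
    congr 2; ring
  rw [Finset.sum_congr rfl this, Finset.sum_add_distrib, ← Finset.sum_mul, ← Finset.smul_sum,
    texp_aux, mul_add, mul_smul_comm]
  change texp K (N+1) a * x + _ = texp K (N+1) a * x + c • (texp K (N+1) a * a)
  rw [texp_stable N a hN]

lemma pow_comm_ef (e f h : A) (hef : e * f = f * e + h) (hhf : h * f = f * h - (2:K) • f) (k : ℕ) :
    e * f ^ (k+1) = f ^ (k+1) * e + ((k+1:ℕ):K) • (f ^ k * h) - (((k+1:ℕ):K) * k) • f ^ k := by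
  induction k with
  | zero => simp [hef]
  | succ k ih =>
    rw [pow_succ f (k+1), ← mul_assoc, ih, sub_mul, add_mul, mul_assoc _ e, hef, mul_add]
    have e1 : f ^ k * h * f = f ^ (k+1) * h - (2:K) • f ^ (k+1) := by
      rw [mul_assoc, hhf, mul_sub, mul_smul_comm, ← mul_assoc, ← pow_succ]
    simp only [smul_mul_assoc, e1, ← pow_succ, ← mul_assoc]
    push_cast
    module

lemma comm_texp_f (e f h : A) (hef : e * f = f * e + h) (hhf : h * f = f * h - (2:K) • f) (N : ℕ)
    (hN : f ^ N = 0) : e * texp K N (-f) = texp K N (-f) * (e - h - f) := by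
  have hg : (-f) ^ N = 0 := by rw [neg_pow, hN, mul_zero]
  -- use g = -f
  obtain ⟨g, rfl⟩ : ∃ g, f = -g := ⟨-f, by simp⟩
  rw [neg_neg] at *
  have hg1 : g ^ (N+1) = 0 := by rw [pow_succ, hg, zero_mul]
  have hcomm : ∀ k, e * g ^ (k+1) = g ^ (k+1) * e - ((k+1:ℕ):K) • (g ^ k * h)
      + (((k+1:ℕ):K) * k) • g ^ k := by
    intro k
    have h1 := pow_comm_ef e (-g) h hef hhf k
    rcases Nat.even_or_odd k with hk | hk
    · rw [hk.neg_pow, (hk.add_one).neg_pow] at h1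
      rw [← neg_inj, ← mul_neg, h1]; simp only [neg_mul]; module
    · rw [hk.neg_pow, (hk.add_one).neg_pow] at h1
      rw [h1]; simp only [neg_mul]; module
  have e2 : texp K (N+2) g = texp K N g := by rw [texp_stable _ _ hg1, texp_stable _ _ hg]
  have key : e * texp K (N+2) g = texp K (N+2) g * e - texp K (N+1) g * h + texp K N g * g := by
    have h0 : ∀ F : ℕ → A, ∑ k ∈ Finset.range (N+2), F k = ∑ k ∈ Finset.range (N+1), F (k+1) + F 0 :=
      fun F => Finset.sum_range_succ' F (N+1)
    rw [← texp_aux]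
    conv_lhs => rw [texp, h0]
    conv_rhs => rw [texp, h0]
    rw [texp, mul_add, add_mul, Finset.mul_sum, Finset.sum_mul, Finset.sum_mul]
    have : ∀ k ∈ Finset.range (N+1), e * (((k+1).factorial:K)⁻¹ • g ^ (k+1))
      = ((k+1).factorial:K)⁻¹ • g ^ (k+1) * e - (k.factorial:K)⁻¹ • g ^ k * h
        + ((k:K) * (k.factorial:K)⁻¹) • g ^ k := by
      intro k _
      have h1 : (k.factorial:K) ≠ 0 := by exact_mod_cast k.factorial_ne_zero
      have h2 : ((k+1:ℕ):K) ≠ 0 := by exact_mod_cast k.succ_ne_zero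
      rw [mul_smul_comm, hcomm, smul_add, smul_sub, smul_smul, smul_smul, smul_mul_assoc, smul_mul_assoc,
        Nat.factorial_succ]
      congr 2
      · congr 1; push_cast at *; field_simp
      · push_cast at *; field_simp
    rw [Finset.sum_congr rfl this, Finset.sum_add_distrib, Finset.sum_sub_distrib]
    simp
    abel
  rw [e2, texp_stable _ _ hg] at key
  rw [key, mul_sub, mul_sub, mul_neg, sub_neg_eq_add]

/-- theta = exp(e) exp(-f) exp(e) -/
lemma theta_comm (e f h : A) (hef : e * f = f * e + h) (hhe : h * e = e * h + (2:K) • e)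
    (hhf : h * f = f * h - (2:K) • f) (N : ℕ) (heN : e ^ N = 0) (hfN : f ^ N = 0)
    (x : A) (c : K) (hxe : x * e = e * x + c • e) (hxf : x * f = f * x - c • f) :
    x * (texp K N e * texp K N (-f) * texp K N e) =
      (texp K N e * texp K N (-f) * texp K N e) * (x - c • h) := by
  have h1 := comm_texp x e c hxe N heN
  have hg : (-f) ^ N = 0 := by rw [neg_pow, hfN, mul_zero]
  have h2 := comm_texp x (-f) (-c) (by rw [mul_neg, hxf]; simp [sub_eq_add_neg, add_comm]) N hg
  have h3 := comm_texp_f e f h hef hhf N hfN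
  have h4 := comm_texp h e (2:K) hhe N heN
  have h5 := comm_texp e e (0:K) (by simp) N heN
  have h6 : (x + c • e) * texp K N (-f) = texp K N (-f) * (x + c • e - c • h) := by
    rw [add_mul, h2, smul_mul_assoc, h3, ← mul_smul_comm, ← mul_add]
    congr 1; simp only [smul_neg, neg_smul, smul_sub]; abel
  have h7 : (x + c • e - c • h) * texp K N e = texp K N e * (x - c • h) := by
    rw [sub_mul, add_mul, h1, smul_mul_assoc, smul_mul_assoc, h4, h5, ← mul_smul_comm, ← mul_smul_comm,
      ← mul_add, ← mul_sub]
    congr 1; module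
  rw [← mul_assoc, ← mul_assoc, h1, mul_assoc _ (x + c • e), h6, mul_assoc, mul_assoc, h7]
  simp only [mul_assoc]
end
end

section
section
variable {K M N V : Type*} [Field K] [AddCommGroup M] [Module K M]
    [AddCommGroup N] [Module K N] [AddCommGroup V] [Module K V]

/-- weight space -/
def wtSp (pair : M →ₗ[K] N →ₗ[K] K) (T : N →ₗ[K] Module.End K V) (μ : M) : Submodule K V :=
  ⨅ n : N, Module.End.eigenspace (T n) (pair μ n)

lemma mem_wtSp (pair : M →ₗ[K] N →ₗ[K] K) (T : N →ₗ[K] Module.End K V) (μ : M) (v : V) :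
    v ∈ wtSp pair T μ ↔ ∀ n, T n v = pair μ n • v := by
  simp [wtSp]

lemma wtSp_indep (pair : M →ₗ[K] N →ₗ[K] K) (T : N →ₗ[K] Module.End K V)
    (hc : ∀ x y, T x * T y = T y * T x)
    (hnd : ∀ m m', (∀ n, pair m n = pair m' n) → m = m') :
    iSupIndep (wtSp pair T) := by
  have h1 := Module.End.independent_iInf_maxGenEigenspace_of_forall_mapsTo (fun n : N => T n) (by
    intro i j φ
    exact Module.End.mapsTo_maxGenEigenspace_of_comm (hc j i) φ)
  have h2 : iSupIndep fun μ : M => ⨅ n, (T n).maxGenEigenspace (pair μ n) :=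
    h1.comp (f := fun (μ : M) (n : N) => pair μ n) fun a b hab => hnd a b fun n => congrFun hab n
  exact h2.mono fun μ => iInf_mono fun n => by
    exact Module.End.genEigenspace_le_maximal (T n) (pair μ n) 1

/-- projections -/
lemma exists_proj (pair : M →ₗ[K] N →ₗ[K] K) (T : N →ₗ[K] Module.End K V)
    (hc : ∀ x y, T x * T y = T y * T x)
    (hnd : ∀ m m', (∀ n, pair m n = pair m' n) → m = m')
    (hs : ⨆ μ, wtSp pair T μ = ⊤) :
    ∃ π : M → Module.End K V, (∀ μ v, π μ v ∈ wtSp pair T μ) ∧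
      (∀ μ, ∀ v ∈ wtSp pair T μ, π μ v = v) ∧
      (∀ μ ν, μ ≠ ν → ∀ v ∈ wtSp pair T ν, π μ v = 0) := by
  classical
  have hI := DirectSum.isInternal_submodule_of_iSupIndep_of_iSup_eq_top (wtSp_indep pair T hc hnd) hs
  let _ := hI.chooseDecomposition
  refine ⟨fun μ => (wtSp pair T μ).subtype ∘ₗ DirectSum.component K M _ μ ∘ₗ
    (DirectSum.decomposeLinearEquiv (wtSp pair T)).toLinearMap, ?_, ?_, ?_⟩
  · intro μ v
    simp
  · intro μ v hv
    simp [DirectSum.decomposeLinearEquiv_apply, DirectSum.component]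
    exact DirectSum.decompose_of_mem_same _ hv
  · intro μ ν h v hv
    simp only [DirectSum.decomposeLinearEquiv_apply, DirectSum.component, LinearMap.comp_apply,
      Submodule.subtype_apply, LinearEquiv.coe_coe]
    exact DirectSum.decompose_of_mem_ne (wtSp pair T) hv h.symm
end

/-- derivation on the group algebra attached to a functional -/
noncomputable def gD {K M : Type*} [Field K] [AddCommGroup M] [Module K M] (l : M →ₗ[K] K) :
    AddMonoidAlgebra K M →ₗ[K] AddMonoidAlgebra K M where
  toFun F := AddMonoidAlgebra.ofCoeff (Finsupp.onFinset F.coeff.support (fun μ => l μ * F.coeff μ)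
    (fun μ h => by
      rw [Finsupp.mem_support_iff]; intro h0; apply h; rw [h0, mul_zero]))
  map_add' F G := by
    ext μ; simp [mul_add]
  map_smul' c F := by
    ext μ; simp; ring

section
variable {K M : Type*} [Field K] [AddCommGroup M] [Module K M] (l : M →ₗ[K] K)

lemma gD_coeff (F : AddMonoidAlgebra K M) (μ : M) : (gD l F).coeff μ = l μ * F.coeff μ := rfl

lemma gD_single (μ : M) (c : K) : gD l (AddMonoidAlgebra.single μ c) = l μ • AddMonoidAlgebra.single μ c := by
  classical
  ext ν
  rw [gD_coeff, AddMonoidAlgebra.coeff_smul, Finsupp.smul_apply, smul_eq_mul, AddMonoidAlgebra.coeff_single,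
    Finsupp.single_apply]
  split_ifs with h
  · rw [h]
  · simp

lemma gD_mul (F G : AddMonoidAlgebra K M) : gD l (F * G) = gD l F * G + F * gD l G := by
  induction F using AddMonoidAlgebra.induction_linear with
  | zero => simp
  | add F F' h h' => rw [add_mul, map_add, map_add, h, h', add_mul, add_mul]; abel
  | single μ a =>
    induction G using AddMonoidAlgebra.induction_linear with
    | zero => simp
    | add F F' h h' => rw [mul_add, map_add, map_add, h, h', mul_add, mul_add]; abel
    | single ν b =>
      rw [AddMonoidAlgebra.single_mul_single, gD_single, gD_single, gD_single, map_add, add_smul,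
        smul_mul_assoc, mul_smul_comm, AddMonoidAlgebra.single_mul_single]

lemma gD_prod {ι : Type*} [DecidableEq ι] (q : ι → AddMonoidAlgebra K M) (t : Finset ι) :
    gD l (∏ i ∈ t, q i) = ∑ i ∈ t, (∏ k ∈ t.erase i, q k) * gD l (q i) := by
  induction t using Finset.induction_on with
  | empty =>
    simp only [Finset.prod_empty, Finset.sum_empty]
    rw [AddMonoidAlgebra.one_def, gD_single, map_zero, zero_smul]
  | insert a t ha ih =>
    rw [Finset.prod_insert ha, gD_mul, ih, Finset.sum_insert ha, Finset.erase_insert ha, Finset.mul_sum,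
      mul_comm (gD l (q a))]
    congr 1
    refine Finset.sum_congr rfl fun i hi => ?_
    have hne : i ≠ a := fun h => ha (h ▸ hi)
    rw [Finset.erase_insert_of_ne hne.symm, Finset.prod_insert (by simp [ha]), mul_assoc]

lemma gD_sum_l {κ : Type*} (s : Finset κ) (l : κ → M →ₗ[K] K) (c : κ → K) (F : AddMonoidAlgebra K M) :
    gD (∑ k ∈ s, c k • l k) F = ∑ k ∈ s, c k • gD (l k) F := by
  ext μ
  simp only [gD_coeff, AddMonoidAlgebra.coeff_sum, Finsupp.finsetSum_apply, AddMonoidAlgebra.coeff_smul,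
    Finsupp.smul_apply, LinearMap.sum_apply, LinearMap.smul_apply, Finset.sum_mul, smul_eq_mul, mul_assoc]

end
end

section
structure RepData {K M N ι G : Type*} [Field K] [AddCommGroup M] [Module K M]
    [AddCommGroup N] [Module K N] [Group G] [Fintype ι] (W : WeylData K M N ι G) (V κ : Type*) [AddCommGroup V]
    [Module K V] [Fintype κ] where
  T : N →ₗ[K] Module.End K V
  e : ι → Module.End K V
  f : ι → Module.End K V
  T_comm : ∀ x y, T x * T y = T y * T x
  T_e : ∀ n i, T n * e i = e i * T n + W.pair (W.root i) n • e i
  T_f : ∀ n i, T n * f i = f i * T n - W.pair (W.root i) n • f i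
  e_f : ∀ i, e i * f i = f i * e i + T (W.coroot i)
  x : κ → N
  y : κ → N
  d : ι → ℚ
  d_pos : ∀ i, 0 < d i
  form1 : ∀ i, ∑ k, W.pair (W.root i) (x k) • y k = (d i : K) • W.coroot i
  form2 : ∀ i, ∑ k, W.pair (W.root i) (y k) • x k = (d i : K) • W.coroot i
  c : K
  cas : ∑ k, T (x k) * T (y k) + ∑ i, (d i : K) • (e i * f i + f i * e i) = c • 1
  nondeg : ∀ m m', (∀ n, W.pair m n = W.pair m' n) → m = m'
  span : ⨆ μ, wtSp W.pair T μ = ⊤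
  br : ∀ k i, e k * f i - f i * e k ∈ Submodule.span K (Set.range e ∪ Set.range f ∪ Set.range T)
  irr : ∀ U : Submodule K V, U ≠ ⊥ → (∀ i, ∀ v ∈ U, e i v ∈ U) → (∀ i, ∀ v ∈ U, f i v ∈ U) →
    (∀ n, ∀ v ∈ U, T n v ∈ U) → U = ⊤

namespace RepData
variable {K M N ι G V κ : Type*} [Field K] [CharZero K] [AddCommGroup M] [Module K M]
    [AddCommGroup N] [Module K N] [Group G] [Fintype ι] {W : WeylData K M N ι G} [AddCommGroup V]
    [Module K V] [Fintype κ] [FiniteDimensional K V] (R : RepData W V κ)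

abbrev wt (μ : M) : Submodule K V := wtSp W.pair R.T μ

lemma mem_wt (μ : M) (v : V) : v ∈ R.wt μ ↔ ∀ n, R.T n v = W.pair μ n • v := mem_wtSp _ _ _ _

lemma indep : iSupIndep R.wt := wtSp_indep _ _ R.T_comm R.nondeg

noncomputable def pr : M → Module.End K V :=
  (exists_proj W.pair R.T R.T_comm R.nondeg R.span).choose

lemma pr_mem (μ : M) (v : V) : R.pr μ v ∈ R.wt μ :=
  (exists_proj W.pair R.T R.T_comm R.nondeg R.span).choose_spec.1 μ v

lemma pr_same (μ : M) (v : V) (hv : v ∈ R.wt μ) : R.pr μ v = v :=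
  (exists_proj W.pair R.T R.T_comm R.nondeg R.span).choose_spec.2.1 μ v hv

lemma pr_ne (μ ν : M) (h : μ ≠ ν) (v : V) (hv : v ∈ R.wt ν) : R.pr μ v = 0 :=
  (exists_proj W.pair R.T R.T_comm R.nondeg R.span).choose_spec.2.2 μ ν h v hv

lemma ext_wt {A B : Module.End K V} (h : ∀ μ, ∀ v ∈ R.wt μ, A v = B v) : A = B := by
  have : (⊤ : Submodule K V) ≤ LinearMap.eqLocus A B := by
    rw [← R.span]
    exact iSup_le fun μ v hv => h μ v hv
  ext v
  exact this (Submodule.mem_top (x := v))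

lemma e_wt (i : ι) (μ : M) (v : V) (hv : v ∈ R.wt μ) : R.e i v ∈ R.wt (μ + W.root i) := by
  rw [mem_wt] at *
  intro n
  have h := congrArg (fun A => A v) (R.T_e n i)
  simp only [Module.End.mul_apply, LinearMap.add_apply, LinearMap.smul_apply, hv, map_smul] at h
  rw [h, map_add, LinearMap.add_apply, add_smul]

lemma f_wt (i : ι) (μ : M) (v : V) (hv : v ∈ R.wt μ) : R.f i v ∈ R.wt (μ - W.root i) := by
  rw [mem_wt] at *
  intro n
  have h := congrArg (fun A => A v) (R.T_f n i)
  simp only [Module.End.mul_apply, LinearMap.sub_apply, LinearMap.smul_apply, hv, map_smul] at h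
  rw [h, map_sub, LinearMap.sub_apply, sub_smul]

lemma e_pr (i : ι) (μ : M) : R.e i * R.pr μ = R.pr (μ + W.root i) * R.e i := by
  apply R.ext_wt
  intro ν v hv
  simp only [Module.End.mul_apply]
  by_cases h : μ = ν
  · subst h
    rw [R.pr_same _ _ hv, R.pr_same _ _ (R.e_wt i _ _ hv)]
  · rw [R.pr_ne _ _ h _ hv, R.pr_ne _ _ (fun h' => h (add_right_cancel h')) _ (R.e_wt i _ _ hv), map_zero]

lemma pr_T (n : N) (μ : M) : R.pr μ * R.T n = W.pair μ n • R.pr μ := by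
  apply R.ext_wt
  intro ν v hv
  simp only [Module.End.mul_apply, LinearMap.smul_apply]
  have h1 := (R.mem_wt _ _).1 hv n
  by_cases h : μ = ν
  · subst h
    rw [h1, map_smul]
  · rw [h1, map_smul, R.pr_ne _ _ h _ hv]; simp

lemma fin_wts : {μ | R.wt μ ≠ ⊥}.Finite := WellFoundedGT.finite_ne_bot_of_iSupIndep R.indep

noncomputable def wts : Finset M := R.fin_wts.toFinset

lemma mem_wts (μ : M) : μ ∈ R.wts ↔ R.wt μ ≠ ⊥ := by simp [wts]

lemma pr_zero (μ : M) (h : μ ∉ R.wts) : R.pr μ = 0 := by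
  rw [mem_wts, not_not] at h
  ext v
  have := R.pr_mem μ v
  rw [h] at this
  simpa using this

lemma pr_sum : ∑ μ ∈ R.wts, R.pr μ = 1 := by
  classical
  apply R.ext_wt
  intro ν v hv
  rw [LinearMap.sum_apply]
  by_cases hν : ν ∈ R.wts
  · rw [Finset.sum_eq_single_of_mem ν hν, R.pr_same _ _ hv]
    · rfl
    · intro μ _ h
      exact R.pr_ne _ _ h _ hv
  · rw [mem_wts, not_not] at hν
    rw [hν, Submodule.mem_bot] at hv
    rw [hv]; simp

noncomputable def ch (A : Module.End K V) : AddMonoidAlgebra K M :=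
  ∑ μ ∈ R.wts, AddMonoidAlgebra.single μ (LinearMap.trace K V (R.pr μ * A))

lemma ch_coeff (A : Module.End K V) (μ : M) : (R.ch A).coeff μ = LinearMap.trace K V (R.pr μ * A) := by
  classical
  simp only [ch, AddMonoidAlgebra.coeff_sum, Finsupp.finsetSum_apply,
    AddMonoidAlgebra.coeff_single, Finsupp.single_apply]
  rw [Finset.sum_ite_eq']
  split_ifs with h
  · rfl
  · rw [R.pr_zero μ h, zero_mul, map_zero]

lemma ch_T (n : N) (A : Module.End K V) : R.ch (R.T n * A) = gD (W.pair.flip n) (R.ch A) := by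
  ext μ
  rw [gD_coeff, ch_coeff, ch_coeff, ← mul_assoc, pr_T, smul_mul_assoc, map_smul]
  rfl

lemma ch_add (A B : Module.End K V) : R.ch (A + B) = R.ch A + R.ch B := by
  ext μ
  rw [AddMonoidAlgebra.coeff_add, Finsupp.add_apply]
  simp only [ch_coeff, mul_add, map_add]

lemma ch_smul (c : K) (A : Module.End K V) : R.ch (c • A) = c • R.ch A := by
  ext μ
  rw [AddMonoidAlgebra.coeff_smul, Finsupp.smul_apply]
  simp only [ch_coeff, mul_smul_comm, map_smul]

lemma ch_sum {J : Type*} (s : Finset J) (A : J → Module.End K V) :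
    R.ch (∑ i ∈ s, A i) = ∑ i ∈ s, R.ch (A i) := by
  ext μ
  rw [AddMonoidAlgebra.coeff_sum, Finsupp.finsetSum_apply]
  simp only [ch_coeff, Finset.mul_sum, map_sum]

lemma ch_fe (i : ι) : AddMonoidAlgebra.single (W.root i) 1 * R.ch (R.f i * R.e i) = R.ch (R.e i * R.f i) := by
  ext μ
  conv_lhs => rw [show μ = W.root i + (μ - W.root i) by abel]
  rw [AddMonoidAlgebra.coeff_single_mul_add, one_mul, ch_coeff, ch_coeff, ← mul_assoc,
    LinearMap.trace_mul_comm, ← mul_assoc, e_pr, sub_add_cancel, mul_assoc]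

lemma ch_ef_sub (i : ι) : R.ch (R.e i * R.f i) = R.ch (R.f i * R.e i) + gD (W.pair.flip (W.coroot i)) (R.ch 1) := by
  rw [R.e_f, ch_add, ← ch_T, mul_one]

noncomputable def pp (_ : RepData W V κ) (i : ι) : AddMonoidAlgebra K M :=
  AddMonoidAlgebra.single ((2⁻¹:K) • W.root i) 1 + AddMonoidAlgebra.single (-((2⁻¹:K) • W.root i)) 1

lemma q_ch (i : ι) : W.q i * (R.ch (R.e i * R.f i) + R.ch (R.f i * R.e i)) =
    R.pp i * gD (W.pair.flip (W.coroot i)) (R.ch 1) := by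
  set P := R.ch (R.e i * R.f i)
  set Q := R.ch (R.f i * R.e i)
  set D := gD (W.pair.flip (W.coroot i)) (R.ch 1)
  have h1 : P = Q + D := R.ch_ef_sub i
  set E := AddMonoidAlgebra.single (R := K) ((2⁻¹:K) • W.root i) (1:K) with hE
  set E' := AddMonoidAlgebra.single (R := K) (-((2⁻¹:K) • W.root i)) (1:K) with hE'
  have h2 : E * E * Q = P := by
    have := R.ch_fe i
    rw [hE, AddMonoidAlgebra.single_mul_single, ← add_smul]; norm_num
    exact this
  have h3 : E * E' = 1 := by
    rw [hE, hE', AddMonoidAlgebra.single_mul_single, add_neg_cancel, one_mul]; rfl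
  change (E - E') * (P + Q) = (E + E') * D
  have h4 : E * Q = E' * P := by
    rw [← h2, ← mul_assoc, ← mul_assoc, mul_comm E' E, h3, one_mul]
  have h5 : D = P - Q := by rw [h1]; abel
  rw [h5]
  linear_combination 2 * h4

noncomputable def lap (F : AddMonoidAlgebra K M) : AddMonoidAlgebra K M :=
  ∑ k, gD (W.pair.flip (R.x k)) (gD (W.pair.flip (R.y k)) F)

lemma lap_ch : R.lap (R.ch 1) + ∑ i, (R.d i : K) • (R.ch (R.e i * R.f i) + R.ch (R.f i * R.e i))
    = R.c • R.ch 1 := by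
  rw [← R.ch_smul, ← R.cas, ch_add, ch_sum, ch_sum, lap]
  congr 1
  · refine Finset.sum_congr rfl fun k _ => ?_
    rw [ch_T, ← ch_T _ (R.y k), mul_one]
  · refine Finset.sum_congr rfl fun k _ => ?_
    rw [ch_smul, ch_add]

lemma gD_q (i : ι) (l : M →ₗ[K] K) : gD l (W.q i) = (2⁻¹ * l (W.root i)) • R.pp i := by
  rw [WeylData.q, map_sub, gD_single, gD_single, pp, map_neg, map_smul, smul_add, smul_eq_mul]
  rw [neg_smul, sub_neg_eq_add]

noncomputable def Bf (μ ν : M) : K := ∑ k, W.pair μ (R.x k) * W.pair ν (R.y k)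

lemma lap_coeff (F : AddMonoidAlgebra K M) (μ : M) : (R.lap F).coeff μ = R.Bf μ μ * F.coeff μ := by
  simp only [lap, AddMonoidAlgebra.coeff_sum, Finsupp.finsetSum_apply, gD_coeff, Bf, Finset.sum_mul]
  refine Finset.sum_congr rfl fun k _ => ?_
  simp only [LinearMap.flip_apply]; ring

lemma Bf_root_left (i : ι) (ν : M) : R.Bf (W.root i) ν = R.d i * W.pair ν (W.coroot i) := by
  have := congrArg (W.pair ν) (R.form1 i)
  rw [map_sum] at this
  simpa [Bf] using this

lemma Bf_root_right (i : ι) (ν : M) : R.Bf ν (W.root i) = R.d i * W.pair ν (W.coroot i) := by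
  have := congrArg (W.pair ν) (R.form2 i)
  rw [map_sum] at this
  simp only [map_smul, smul_eq_mul] at this
  rw [← this, Bf]
  exact Finset.sum_congr rfl fun k _ => mul_comm _ _

lemma lap_mul (F G : AddMonoidAlgebra K M) : R.lap (F * G) = R.lap F * G + F * R.lap G
    + ∑ k, gD (W.pair.flip (R.x k)) F * gD (W.pair.flip (R.y k)) G
    + ∑ k, gD (W.pair.flip (R.y k)) F * gD (W.pair.flip (R.x k)) G := by
  simp only [lap, Finset.sum_mul, Finset.mul_sum, ← Finset.sum_add_distrib]
  refine Finset.sum_congr rfl fun k _ => ?_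
  rw [gD_mul, map_add, gD_mul, gD_mul]
  ring

lemma cross (x y : κ → N) (h : ∀ i, ∑ k, W.pair (W.root i) (x k) • y k = (R.d i : K) • W.coroot i)
    [DecidableEq ι] (F : AddMonoidAlgebra K M) :
    ∑ k, gD (W.pair.flip (x k)) W.Q * gD (W.pair.flip (y k)) F =
    ∑ i, ((2⁻¹:K) * R.d i) • ((∏ k ∈ Finset.univ.erase i, W.q k) * (R.pp i * gD (W.pair.flip (W.coroot i)) F)) := by
  simp only [WeylData.Q, gD_prod, R.gD_q, Finset.sum_mul]
  rw [Finset.sum_comm]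
  refine Finset.sum_congr rfl fun i _ => ?_
  have h1 : W.pair.flip ((R.d i : K) • W.coroot i) = ∑ k, W.pair (W.root i) (x k) • W.pair.flip (y k) := by
    rw [← h i, map_sum]; simp
  have h2 := congrArg (fun l => gD l F) h1
  simp only [gD_sum_l] at h2
  have h3 : gD (W.pair.flip ((R.d i : K) • W.coroot i)) F = (R.d i : K) • gD (W.pair.flip (W.coroot i)) F := by
    have := gD_sum_l {i} (fun i => W.pair.flip (W.coroot i)) (fun i => (R.d i : K)) F
    simpa using this
  rw [h3] at h2
  have h4 : ((2⁻¹:K) * R.d i) • ((∏ k ∈ Finset.univ.erase i, W.q k) * (R.pp i * gD (W.pair.flip (W.coroot i)) F))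
      = (2⁻¹:K) • ((∏ k ∈ Finset.univ.erase i, W.q k) * (R.pp i * ((R.d i : K) • gD (W.pair.flip (W.coroot i)) F))) := by
    simp only [mul_smul_comm, mul_smul]
  rw [h4, h2, Finset.mul_sum, Finset.mul_sum, Finset.smul_sum]
  refine Finset.sum_congr rfl fun k _ => ?_
  simp only [mul_smul_comm, smul_mul_assoc, smul_smul, mul_assoc, LinearMap.flip_apply]

lemma lap_Qch (hQ : R.lap W.Q = R.Bf W.rho W.rho • W.Q) :
    R.lap (W.Q * R.ch 1) = (R.c + R.Bf W.rho W.rho) • (W.Q * R.ch 1) := by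
  classical
  rw [lap_mul, hQ, R.cross R.x R.y R.form1, R.cross R.y R.x R.form2]
  have h := congrArg (fun F => W.Q * F) R.lap_ch
  simp only [mul_add, mul_smul_comm, Finset.mul_sum] at h
  rw [add_smul, ← h, smul_mul_assoc]
  have : ∀ i, W.Q * R.ch (R.e i * R.f i) + W.Q * R.ch (R.f i * R.e i) =
     (∏ k ∈ Finset.univ.erase i, W.q k) * (R.pp i * gD (W.pair.flip (W.coroot i)) (R.ch 1)) := by
    intro i
    rw [← R.q_ch, ← mul_add, ← mul_assoc, mul_comm _ (W.q i), Finset.mul_prod_erase _ _ (Finset.mem_univ i)]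
    rfl
  simp only [this]
  rw [add_assoc, add_assoc, add_assoc, ← Finset.sum_add_distrib]
  have h6 : ∀ i, ((2⁻¹:K) * R.d i) • ((∏ k ∈ Finset.univ.erase i, W.q k) * (R.pp i * gD (W.pair.flip (W.coroot i)) (R.ch 1)))
    + ((2⁻¹:K) * R.d i) • ((∏ k ∈ Finset.univ.erase i, W.q k) * (R.pp i * gD (W.pair.flip (W.coroot i)) (R.ch 1)))
    = (R.d i : K) • ((∏ k ∈ Finset.univ.erase i, W.q k) * (R.pp i * gD (W.pair.flip (W.coroot i)) (R.ch 1))) := by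
    intro i
    rw [← add_smul]; congr 1; ring
  simp only [h6]
  abel

lemma Bf_inv (g : G) (μ : M) : R.Bf (W.a g μ) (W.a g μ) = R.Bf μ μ := by
  have hg : g ∈ Subgroup.closure (Set.range W.s) := by rw [W.gen]; trivial
  have badd : ∀ a b c, R.Bf (a + b) c = R.Bf a c + R.Bf b c := by
    intro a b c; simp [Bf, add_mul, Finset.sum_add_distrib]
  have badd' : ∀ a b c, R.Bf a (b + c) = R.Bf a b + R.Bf a c := by
    intro a b c; simp [Bf, mul_add, Finset.sum_add_distrib]
  have bs : ∀ (t : K) b c, R.Bf (t • b) c = t * R.Bf b c := by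
    intro a b c; simp [Bf, Finset.mul_sum, mul_assoc]
  have bs' : ∀ (t : K) b c, R.Bf b (t • c) = t * R.Bf b c := by
    intro a b c; simp [Bf, Finset.mul_sum, mul_left_comm]
  induction hg using Subgroup.closure_induction generalizing μ with
  | mem x hx =>
    obtain ⟨j, rfl⟩ := hx
    rw [W.a_s, sub_eq_add_neg, ← neg_smul, badd, badd', badd', bs, bs, bs', bs', Bf_root_left, Bf_root_right,
      Bf_root_left, W.two]
    ring
  | one => simp
  | mul x y _ _ hx hy => rw [map_mul, LinearEquiv.mul_apply, hx, hy]
  | inv x _ hx =>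
    rw [← hx (W.a x⁻¹ μ), ← LinearEquiv.mul_apply, ← map_mul, mul_inv_cancel, map_one]
    rfl

lemma lap_Q [Fintype G] (φ : K →+ ℚ) (hφ : φ 1 = 1) : R.lap W.Q = R.Bf W.rho W.rho • W.Q := by
  classical
  obtain ⟨κ', -, h⟩ := W.Q_eq_alt φ hφ
  ext μ
  rw [lap_coeff, AddMonoidAlgebra.coeff_smul, Finsupp.smul_apply, smul_eq_mul]
  by_cases hμ : W.Q.coeff μ = 0
  · rw [hμ]; simp
  · congr 1
    have : ∃ g, W.a g W.rho = μ := by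
      by_contra hcon
      push Not at hcon
      apply hμ
      rw [h, AddMonoidAlgebra.coeff_smul, Finsupp.smul_apply, ReflData.alt, AddMonoidAlgebra.coeff_sum, Finsupp.finsetSum_apply,
        Finset.sum_eq_zero, smul_zero]
      intro g _
      rw [AddMonoidAlgebra.coeff_single, Finsupp.single_apply, if_neg]
      exact hcon g
    obtain ⟨g, rfl⟩ := this
    exact R.Bf_inv g _

end RepData
end

section
namespace RepData
variable {K M N ι G V κ : Type*} [Field K] [CharZero K] [AddCommGroup M] [Module K M]
    [AddCommGroup N] [Module K N] [Group G] [Fintype ι] {W : WeylData K M N ι G} [AddCommGroup V]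
    [Module K V] [Fintype κ] [FiniteDimensional K V] (R : RepData W V κ)

lemma pr_trace (μ : M) : LinearMap.trace K V (R.pr μ) = (Module.finrank K (R.wt μ) : K) :=
  LinearMap.IsProj.trace ⟨R.pr_mem μ, R.pr_same μ⟩

lemma ch_one_coeff (μ : M) : (R.ch 1).coeff μ = (Module.finrank K (R.wt μ) : K) := by
  rw [ch_coeff, mul_one, pr_trace]

lemma root_ne (_ : RepData W V κ) (i : ι) : W.root i ≠ 0 := by
  intro h
  have := W.two i
  rw [h] at this
  simp at this

lemma mem_wts' {μ : M} {v : V} (h1 : v ∈ R.wt μ) (h : v ≠ 0) : μ ∈ R.wts := by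
  rw [mem_wts]
  intro h0
  rw [h0] at h1
  exact h (by simpa using h1)

lemma pow_wt (A : Module.End K V) (r : M) (hA : ∀ μ, ∀ v ∈ R.wt μ, A v ∈ R.wt (μ + r)) (k : ℕ)
    (μ : M) (v : V) (hv : v ∈ R.wt μ) : (A ^ k) v ∈ R.wt (μ + k • r) := by
  induction k with
  | zero => simpa using hv
  | succ k ih =>
    rw [pow_succ', Module.End.mul_apply, succ_nsmul, ← add_assoc]
    exact hA _ _ ih

lemma nil (A : Module.End K V) (r : M) (hr : r ≠ 0) (hA : ∀ μ, ∀ v ∈ R.wt μ, A v ∈ R.wt (μ + r)) :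
    A ^ (R.wts.card + 1) = 0 := by
  classical
  apply R.ext_wt
  intro μ v hv
  by_contra hne
  rw [LinearMap.zero_apply] at hne
  have h1 : ∀ k ∈ Finset.range (R.wts.card + 1), μ + k • r ∈ R.wts := by
    intro k hk
    refine R.mem_wts' (R.pow_wt A r hA k μ v hv) ?_
    intro h0
    apply hne
    obtain ⟨l, hl⟩ := Nat.exists_eq_add_of_le (Finset.mem_range.1 hk).le
    rw [hl, add_comm, pow_add, Module.End.mul_apply, h0, map_zero]
  have h2 := Finset.card_le_card_of_injOn (fun k : ℕ => μ + k • r) h1 (by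
    intro a _ b _ hab
    have h3 : (a:K) • r = (b:K) • r := by
      simpa [Nat.cast_smul_eq_nsmul] using hab
    have := smul_left_injective K hr h3
    exact_mod_cast this)
  rw [Finset.card_range] at h2
  omega

lemma e_nil (i : ι) : R.e i ^ (R.wts.card + 1) = 0 := R.nil _ _ (R.root_ne i) (R.e_wt i)

lemma f_nil (i : ι) : R.f i ^ (R.wts.card + 1) = 0 :=
  R.nil _ (-W.root i) (by simpa using R.root_ne i) (fun μ v hv => by
    rw [← sub_eq_add_neg]; exact R.f_wt i _ _ hv)

lemma finrank_refl_le (i : ι) (μ : M) :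
    Module.finrank K (R.wt μ) ≤ Module.finrank K (R.wt (μ - W.pair μ (W.coroot i) • W.root i)) := by
  have hc := fun n => theta_comm (K := K) (R.e i) (R.f i) (R.T (W.coroot i)) (R.e_f i)
    (by rw [R.T_e, W.two]) (by rw [R.T_f, W.two]) (R.wts.card + 1) (R.e_nil i) (R.f_nil i)
    (R.T n) (W.pair (W.root i) n) (R.T_e n i) (R.T_f n i)
  have u1 := texp_unit (K := K) R.wts.card (R.e i) (R.e_nil i)
  have u2 := texp_unit (K := K) R.wts.card (-R.f i) (by rw [neg_pow, R.f_nil, mul_zero])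
  have hu := (u1.mul u2).mul u1
  set θ := texp K (R.wts.card + 1) (R.e i) * texp K (R.wts.card + 1) (-R.f i) * texp K (R.wts.card + 1) (R.e i)
  have hinj : Function.Injective θ := ((Module.End.isUnit_iff _).1 hu).1
  refine LinearMap.finrank_le_finrank_of_injective (f := LinearMap.restrict θ (p := R.wt μ) ?_) ?_
  · intro v hv
    rw [mem_wt] at *
    intro n
    have h1 := congrArg (fun A => A v) (hc n)
    simp only [Module.End.mul_apply, LinearMap.sub_apply, LinearMap.smul_apply, hv, map_smul, map_sub] at h1
    rw [h1, map_sub, map_smul, LinearMap.sub_apply, LinearMap.smul_apply, sub_smul, smul_smul, smul_eq_mul, mul_comm]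
  · intro a b hab
    apply Subtype.ext
    apply hinj
    exact congrArg Subtype.val hab

lemma finrank_refl (i : ι) (μ : M) :
    Module.finrank K (R.wt (μ - W.pair μ (W.coroot i) • W.root i)) = Module.finrank K (R.wt μ) := by
  refine le_antisymm ?_ (R.finrank_refl_le i μ)
  have := R.finrank_refl_le i (μ - W.pair μ (W.coroot i) • W.root i)
  have h : μ - W.pair μ (W.coroot i) • W.root i - W.pair (μ - W.pair μ (W.coroot i) • W.root i) (W.coroot i) • W.root i = μ := by
    rw [map_sub, map_smul, LinearMap.sub_apply, LinearMap.smul_apply, W.two]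
    rw [smul_eq_mul, sub_sub, ← add_smul]
    ring_nf
    simp
  rwa [h] at this

lemma ch_inv (j : W.simple) (μ : M) : (R.ch 1).coeff (W.a (W.s j) μ) = (R.ch 1).coeff μ := by
  rw [ch_one_coeff, ch_one_coeff, W.a_s, finrank_refl]

lemma last_ne (A : Module.End K V) (n : ℕ) (hA : A ^ (n + 1) = 0) (v : V) (hv : v ≠ 0) :
    ∃ k, (A ^ k) v ≠ 0 ∧ (A ^ (k+1)) v = 0 := by
  classical
  have hex : ∃ k, (A ^ k) v = 0 := ⟨n + 1, by rw [hA]; rfl⟩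
  obtain ⟨k, hk⟩ := Nat.exists_eq_succ_of_ne_zero (n := Nat.find hex) (by
    intro h0
    have := Nat.find_spec hex
    rw [h0] at this
    exact hv (by simpa using this))
  exact ⟨k, Nat.find_min hex (by omega), by have := Nat.find_spec hex; rwa [hk] at this⟩

lemma nat_prim (i : ι) (μ : M) (w : V) (hw : w ∈ R.wt μ) (hw0 : w ≠ 0) (he : R.e i w = 0) :
    ∃ k : ℕ, W.pair μ (W.coroot i) = k := by
  obtain ⟨k, hk, hk1⟩ := last_ne (R.f i) _ (R.f_nil i) w hw0
  refine ⟨k, ?_⟩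
  have := congrArg (fun A => A w) (pow_comm_ef (K := K) (R.e i) (R.f i) (R.T (W.coroot i)) (R.e_f i)
    (by rw [R.T_f, W.two]) k)
  simp only [Module.End.mul_apply, LinearMap.sub_apply, LinearMap.add_apply, LinearMap.smul_apply, hk1, he, map_zero,
    (R.mem_wt _ _).1 hw, map_smul, zero_add, smul_smul] at this
  rw [← sub_smul, eq_comm, smul_eq_zero_iff_left hk, ← mul_sub, mul_eq_zero] at this
  rcases this with h | h
  · norm_cast at h
  · exact sub_eq_zero.1 h

/-- words in f applied to v -/
def word (v : V) : List ι → V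
  | [] => v
  | i :: l => R.f i (word v l)

def wsum (_ : RepData W V κ) : List ι → M
  | [] => 0
  | i :: l => W.root i + wsum ‹_› l

lemma word_wt (μ : M) (v : V) (hv : v ∈ R.wt μ) (l : List ι) : R.word v l ∈ R.wt (μ - R.wsum l) := by
  induction l with
  | nil => simpa [word, wsum] using hv
  | cons i l ih =>
    have := R.f_wt i _ _ ih
    rw [word, wsum]
    convert this using 2
    abel

lemma wsum_cone (l : List ι) : R.wsum l ∈ W.cone := by
  induction l with
  | nil => exact zero_mem _
  | cons i l ih => exact add_mem (W.root_mem i) ih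

lemma ht_root_pos (R : RepData W V κ) (φ : K →+ ℚ) (hφ : φ 1 = 1) (i : ι) : 0 < W.ht φ (W.root i) := by
  rcases W.ht_cone φ hφ _ (W.root_mem i) with h | h
  · exact absurd h (R.root_ne i)
  · exact h

lemma wsum_ht (φ : K →+ ℚ) (hφ : φ 1 = 1) (l : List ι) (hl : l ≠ []) : 0 < W.ht φ (R.wsum l) := by
  cases l with
  | nil => exact absurd rfl hl
  | cons i l =>
    rw [wsum, map_add]
    have h1 := R.ht_root_pos φ hφ i
    rcases W.ht_cone φ hφ _ (R.wsum_cone l) with h | h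
    · rw [h, map_zero, add_zero]; exact h1
    · linarith

lemma word_top (μ : M) (v : V) (hv : v ∈ R.wt μ) (h0 : v ≠ 0) (he : ∀ i, R.e i v = 0) :
    Submodule.span K (Set.range (R.word v)) = ⊤ := by
  set U := Submodule.span K (Set.range (R.word v)) with hU
  have hw : ∀ l, R.word v l ∈ U := fun l => Submodule.subset_span ⟨l, rfl⟩
  have gen : ∀ A : Module.End K V, (∀ l, A (R.word v l) ∈ U) → ∀ x ∈ U, A x ∈ U := by
    intro A hA x hx
    have : U ≤ U.comap A := by
      conv_lhs => rw [hU]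
      rw [Submodule.span_le]
      rintro _ ⟨l, rfl⟩
      exact hA l
    exact this hx
  have hf : ∀ i, ∀ x ∈ U, R.f i x ∈ U := fun i => gen _ fun l => hw (i :: l)
  have hT : ∀ n, ∀ x ∈ U, R.T n x ∈ U := fun n => gen _ fun l => by
    rw [(R.mem_wt _ _).1 (R.word_wt μ v hv l) n]
    exact U.smul_mem _ (hw l)
  have he' : ∀ l k, R.e k (R.word v l) ∈ U := by
    intro l
    induction l with
    | nil => intro k; rw [word, he]; exact zero_mem _
    | cons i l ih =>
      intro k
      rw [word]
      have h1 : R.e k (R.f i (R.word v l)) = R.f i (R.e k (R.word v l)) +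
          (R.e k * R.f i - R.f i * R.e k) (R.word v l) := by
        simp
      rw [h1]
      refine add_mem (hf _ _ (ih k)) ?_
      have h2 := R.br k i
      have h3 : Submodule.span K (Set.range R.e ∪ Set.range R.f ∪ Set.range R.T) ≤
          U.comap (LinearMap.applyₗ (R.word v l)) := by
        rw [Submodule.span_le]
        rintro _ ((⟨m, rfl⟩ | ⟨m, rfl⟩) | ⟨m, rfl⟩)
        · exact ih m
        · exact hf _ _ (hw l)
        · exact hT _ _ (hw l)
      exact h3 h2
  refine R.irr U ?_ (fun i => gen _ fun l => he' l i) hf hT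
  rw [Submodule.ne_bot_iff]
  exact ⟨v, hw [], h0⟩

lemma exists_highest [Nontrivial V] (φ : K →+ ℚ) (hφ : φ 1 = 1) : ∃ lam : M,
    (∀ μ, (R.ch 1).coeff μ ≠ 0 → lam - μ ∈ W.cone) ∧ (R.ch 1).coeff lam = 1 ∧
    (∀ i, ∃ k : ℕ, W.pair lam (W.coroot i) = k) := by
  classical
  have hne : R.wts.Nonempty := by
    by_contra h
    rw [Finset.not_nonempty_iff_eq_empty] at h
    have := R.pr_sum
    rw [h, Finset.sum_empty] at this
    exact zero_ne_one this
  obtain ⟨lam, hl, hmax⟩ := R.wts.exists_max_image (W.ht φ) hne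
  obtain ⟨v, hv, hv0⟩ := (Submodule.ne_bot_iff _).1 ((R.mem_wts _).1 hl)
  have he : ∀ i, R.e i v = 0 := by
    intro i
    by_contra h
    have h1 := hmax _ (R.mem_wts' (R.e_wt i _ _ hv) h)
    have h2 := R.ht_root_pos φ hφ i
    rw [map_add] at h1
    linarith
  have htop := R.word_top lam v hv hv0 he
  refine ⟨lam, ?_, ?_, fun i => R.nat_prim i lam v hv hv0 (he i)⟩
  · intro μ hμ
    by_contra hcon
    apply hμ
    rw [ch_coeff, mul_one]
    have : R.pr μ = 0 := by
      have h3 : (⊤ : Submodule K V) ≤ LinearMap.ker (R.pr μ) := by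
        rw [← htop, Submodule.span_le]
        rintro _ ⟨l, rfl⟩
        refine R.pr_ne _ (lam - R.wsum l) ?_ _ (R.word_wt _ _ hv l)
        rintro rfl
        apply hcon
        rw [sub_sub_cancel]
        exact R.wsum_cone l
      ext x
      exact h3 (Submodule.mem_top (x := x))
    rw [this, map_zero]
  · rw [ch_one_coeff]
    have h3 : (⊤ : Submodule K V) ≤ (Submodule.span K {v}).comap (R.pr lam) := by
      rw [← htop, Submodule.span_le]
      rintro _ ⟨l, rfl⟩
      change R.pr lam _ ∈ Submodule.span K {v}
      by_cases hl : l = []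
      · subst hl
        rw [word, R.pr_same _ _ hv]
        exact Submodule.mem_span_singleton_self v
      · rw [R.pr_ne _ (lam - R.wsum l) ?_ _ (R.word_wt _ _ hv l)]
        · exact zero_mem _
        · intro h
          have := R.wsum_ht φ hφ l hl
          rw [eq_comm, sub_eq_self] at h
          rw [h, map_zero] at this
          exact lt_irrefl _ this
    have h4 : R.wt lam = Submodule.span K {v} := by
      apply le_antisymm
      · intro x hx
        have := h3 (Submodule.mem_top (x := x))
        rwa [Submodule.mem_comap, R.pr_same _ _ hx] at this
      · rw [Submodule.span_singleton_le_iff_mem]; exact hv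
    rw [h4, finrank_span_singleton hv0, Nat.cast_one]

end RepData
end

section
open Polynomial

lemma c5_rootMult (N : ℕ) (hN : 0 < N) (ζ : ℂ) (hζ : IsPrimitiveRoot ζ N) (a : ℕ) (ha : 0 < a) :
    (1 - X ^ a : ℂ[X]).rootMultiplicity ζ = if N ∣ a then 1 else 0 := by
  have h0 : (1 - X ^ a : ℂ[X]) = C (-1) * (X ^ a - 1) := by simp
  have hne : (X ^ a - 1 : ℂ[X]) ≠ 0 := (monic_X_pow_sub_C (1:ℂ) ha.ne').ne_zero
  have h1 : (1 - X ^ a : ℂ[X]).rootMultiplicity ζ = (X ^ a - 1 : ℂ[X]).rootMultiplicity ζ := by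
    rw [h0, rootMultiplicity_mul (mul_ne_zero (by simp) hne), rootMultiplicity_C, zero_add]
  rw [h1]
  have hsep : (X ^ a - 1 : ℂ[X]).Separable :=
    separable_X_pow_sub_C (1:ℂ) (by exact_mod_cast ha.ne') one_ne_zero
  have hle := rootMultiplicity_le_one_of_separable hsep ζ
  split_ifs with hd
  · have : (X ^ a - 1 : ℂ[X]).IsRoot ζ := by
      simp [(hζ.pow_eq_one_iff_dvd a).2 hd]
    have := (rootMultiplicity_pos hne).2 this
    omega
  · apply rootMultiplicity_eq_zero
    intro h
    apply hd
    rw [← hζ.pow_eq_one_iff_dvd a]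
    simpa [sub_eq_zero] using h

lemma c5_val_sum (n : ℕ) (hn : n.Prime) (a : ℕ) (ha : 0 < a) (B : ℕ) (hB : a < B) :
    padicValNat n a = ∑ j ∈ Finset.Ico 1 B, if n ^ j ∣ a then 1 else 0 := by
  have := Fact.mk hn
  have h := Nat.emultiplicity_eq_card_pow_dvd (b := B) hn.ne_one ha
    (lt_of_le_of_lt (Nat.log_le_self _ _) hB)
  rw [← padicValNat_eq_emultiplicity ha.ne'] at h
  rw [Finset.sum_boole]
  exact_mod_cast h

theorem c5_coeff_le_one {ι : Type*} (n : ℕ) (hn : n.Prime) (F : ℤ[X]) (hF : ∀ k, 0 ≤ F.coeff k)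
    (s : Finset ι) (a b : ι → ℕ) (ha : ∀ i ∈ s, 0 < a i) (hb : ∀ i ∈ s, 0 < b i)
    (h : F * ∏ i ∈ s, (1 - X ^ a i) = ∏ i ∈ s, (1 - X ^ b i)) (h1 : F.eval 1 = n) :
    ∀ k, F.coeff k ≤ 1 := by
  have := Fact.mk hn
  -- value at one
  have hdiv : ∀ m : ℕ, (1 - X ^ m : ℤ[X]) = (1 - X) * ∑ i ∈ Finset.range m, X ^ i := by
    intro m; rw [mul_neg_geom_sum]
  have hcancel : F * ∏ i ∈ s, (∑ k ∈ Finset.range (a i), (X : ℤ[X]) ^ k)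
      = ∏ i ∈ s, (∑ k ∈ Finset.range (b i), (X : ℤ[X]) ^ k) := by
    have hne : (1 - X : ℤ[X]) ^ s.card ≠ 0 := by
      apply pow_ne_zero
      intro h0
      have := congrArg (eval 0) h0
      simp at this
    apply mul_left_cancel₀ hne
    simp_rw [hdiv, Finset.prod_mul_distrib, Finset.prod_const] at h
    linear_combination h
  have hval : n * ∏ i ∈ s, a i = ∏ i ∈ s, b i := by
    have := congrArg (eval 1) hcancel
    simp [eval_prod, eval_finsetSum, h1] at this
    exact_mod_cast this
  -- counting
  obtain ⟨j, hj1, hj⟩ : ∃ j, 1 ≤ j ∧ (s.filter fun i => n ^ j ∣ a i).card <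
      (s.filter fun i => n ^ j ∣ b i).card := by
    by_contra hcon
    push Not at hcon
    have hv := congrArg (padicValNat n) hval
    rw [padicValNat.mul hn.ne_zero (Finset.prod_ne_zero_iff.2 fun i hi => (ha i hi).ne'),
      padicValNat_self] at hv
    have key : ∀ c : ι → ℕ, (∀ i ∈ s, 0 < c i) → ∀ B, (∀ i ∈ s, c i < B) →
        padicValNat n (∏ i ∈ s, c i) = ∑ j ∈ Finset.Ico 1 B, (s.filter fun i => n ^ j ∣ c i).card := by
      intro c hc B hB
      have hprod : ∀ t ⊆ s, padicValNat n (∏ i ∈ t, c i) = ∑ i ∈ t, padicValNat n (c i) := by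
        classical
        intro t
        induction t using Finset.induction_on with
        | empty => simp
        | insert i t hi ih =>
          intro ht
          have ht' : t ⊆ s := fun x hx => ht (Finset.mem_insert_of_mem hx)
          rw [Finset.prod_insert hi, Finset.sum_insert hi, padicValNat.mul, ih ht']
          · exact (hc i (ht (Finset.mem_insert_self _ _))).ne'
          · exact Finset.prod_ne_zero_iff.2 fun k hk => (hc k (ht' hk)).ne'
      rw [hprod s subset_rfl]
      simp_rw [Finset.card_filter]
      rw [Finset.sum_comm]
      exact Finset.sum_congr rfl fun i hi => c5_val_sum n hn _ (hc i hi) B (hB i hi)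
    let B := (∑ i ∈ s, a i) + (∑ i ∈ s, b i) + 1
    have hBa : ∀ i ∈ s, a i < B := fun i hi => by
      have := Finset.single_le_sum (f := a) (fun _ _ => Nat.zero_le _) hi
      omega
    have hBb : ∀ i ∈ s, b i < B := fun i hi => by
      have := Finset.single_le_sum (f := b) (fun _ _ => Nat.zero_le _) hi
      omega
    rw [key a ha B hBa, key b hb B hBb] at hv
    have : ∑ j ∈ Finset.Ico 1 B, (s.filter fun i => n ^ j ∣ b i).card ≤
      ∑ j ∈ Finset.Ico 1 B, (s.filter fun i => n ^ j ∣ a i).card :=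
      Finset.sum_le_sum fun j hj => hcon j (Finset.mem_Ico.1 hj).1
    omega
  have hNpos : 0 < n ^ j := pow_pos hn.pos j
  set N := n ^ j with hN
  set m := n ^ (j-1) with hm
  have hNm : N = n * m := by rw [hN, hm, ← pow_succ']; congr 1; omega
  have hmpos : 0 < m := pow_pos hn.pos _
  obtain ⟨ζ, hζ⟩ : ∃ ζ : ℂ, IsPrimitiveRoot ζ N := ⟨_, Complex.isPrimitiveRoot_exp N hNpos.ne'⟩
  have hF0 : F ≠ 0 := by rintro rfl; simp at h1; exact hn.ne_zero (by exact_mod_cast h1.symm)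
  have hinj : Function.Injective (Int.castRingHom ℂ) := Int.cast_injective
  have hroot : (F.map (Int.castRingHom ℂ)).IsRoot ζ := by
    have hFne : F.map (Int.castRingHom ℂ) ≠ 0 := (Polynomial.map_ne_zero_iff hinj).2 hF0
    rw [← rootMultiplicity_pos hFne]
    have h2 := congrArg (Polynomial.map (Int.castRingHom ℂ)) h
    simp only [Polynomial.map_mul, Polynomial.map_prod, Polynomial.map_sub, Polynomial.map_one,
      Polynomial.map_pow, map_X] at h2
    have hfac : ∀ c : ℕ, 0 < c → (1 - X ^ c : ℂ[X]) ≠ 0 := by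
      intro c hc h0
      have := congrArg (eval 0) h0
      simp [hc.ne'] at this
    have key : ∀ c : ι → ℕ, ∀ t : Finset ι, (∀ i ∈ t, 0 < c i) →
        (∏ i ∈ t, (1 - X ^ c i : ℂ[X])).rootMultiplicity ζ
          = (t.filter fun i => N ∣ c i).card := by
      classical
      intro c t
      induction t using Finset.induction_on with
      | empty => intro _; simp [rootMultiplicity_eq_zero]
      | insert i t hi ih =>
        intro hc
        rw [Finset.prod_insert hi, rootMultiplicity_mul, ih (fun k hk => hc k (by simp [hk])),
          c5_rootMult N hNpos ζ hζ _ (hc i (by simp)), Finset.filter_insert]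
        · split_ifs with hd
          · rw [Finset.card_insert_of_notMem (by simp [hi]), add_comm]
          · simp
        · apply mul_ne_zero (hfac _ (hc i (by simp)))
          exact Finset.prod_ne_zero_iff.2 fun k hk => hfac _ (hc k (by simp [hk]))
    have h3 := congrArg (rootMultiplicity ζ) h2
    rw [rootMultiplicity_mul, key a s ha, key b s hb] at h3
    · omega
    · exact mul_ne_zero hFne (Finset.prod_ne_zero_iff.2 fun k hk => hfac _ (ha k hk))
  have hdvd : cyclotomic N ℤ ∣ F := by
    rw [cyclotomic_eq_minpoly hζ hNpos]
    apply minpoly.isIntegrallyClosed_dvd (hζ.isIntegral hNpos)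
    rw [aeval_def, ← eval_map]; exact hroot
  -- fold
  have hdvd2 : (X ^ N - 1 : ℤ[X]) ∣ (X ^ m - 1) * F := by
    obtain ⟨G, hG⟩ := hdvd
    have : cyclotomic N ℤ * (X ^ m - 1) = X ^ N - 1 := by
      have := cyclotomic_prime_pow_mul_X_pow_sub_one ℤ n (j-1)
      rw [hN, hm, show j = j - 1 + 1 by omega]
      simpa using this
    exact ⟨G, by rw [← this, hG]; ring⟩
  let φ : ℤ[X] →ₐ[ℤ] AddMonoidAlgebra ℤ (ZMod N) := aeval (AddMonoidAlgebra.single (1 : ZMod N) 1)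
  have hφX : ∀ k : ℕ, φ (X ^ k) = AddMonoidAlgebra.single (k : ZMod N) 1 := by
    intro k
    simp only [φ, map_pow, aeval_X]
    rw [AddMonoidAlgebra.single_pow]; simp
  have hφ0 : (AddMonoidAlgebra.single (m : ZMod N) 1 - 1) * φ F = 0 := by
    obtain ⟨G, hG⟩ := hdvd2
    have := congrArg φ hG
    rw [map_mul, map_mul, map_sub, map_sub, hφX, hφX, map_one] at this
    rw [this]
    simp [AddMonoidAlgebra.one_def]
  have hper : ∀ r : ZMod N, (φ F).coeff (r + m) = (φ F).coeff r := by
    intro r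
    rw [sub_mul, one_mul, sub_eq_zero] at hφ0
    have h5 : (AddMonoidAlgebra.single (m : ZMod N) 1 * φ F).coeff (r + m) = (φ F).coeff (r+m) := by
      rw [hφ0]
    rw [← h5, add_comm r, AddMonoidAlgebra.coeff_single_mul_add]
    simp
  have hcoef : ∀ r : ZMod N, (φ F).coeff r =
      ∑ k ∈ F.support, if (k : ZMod N) = r then F.coeff k else 0 := by
    intro r
    conv_lhs => rw [F.as_sum_support_C_mul_X_pow]
    rw [map_sum, AddMonoidAlgebra.coeff_sum, Finset.sum_apply']
    refine Finset.sum_congr rfl fun k _ => ?_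
    rw [map_mul, hφX, ← Polynomial.algebraMap_eq, AlgHom.commutes, ← Algebra.smul_def]
    simp [Finsupp.single_apply]
  have hnn : ∀ r, 0 ≤ (φ F).coeff r := by
    intro r
    rw [hcoef]
    exact Finset.sum_nonneg fun k _ => by split_ifs <;> simp [hF]
  have : NeZero N := ⟨hNpos.ne'⟩
  have htot : ∑ r : ZMod N, (φ F).coeff r = n := by
    simp_rw [hcoef]
    rw [Finset.sum_comm]
    simp only [Finset.sum_ite_eq, Finset.mem_univ, if_true]
    rw [← h1, eval_eq_sum, Polynomial.sum]
    simp
  intro k0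
  by_contra hk0
  push Not at hk0
  have hge : 2 ≤ (φ F).coeff (k0 : ZMod N) := by
    rw [hcoef]
    have hmem : k0 ∈ F.support := by
      rw [mem_support_iff]; omega
    have := Finset.single_le_sum (f := fun k : ℕ => if (k : ZMod N) = k0 then F.coeff k else 0)
      (fun k _ => by split_ifs <;> simp [hF]) hmem
    simp only [if_true] at this
    omega
  have hall : ∀ i : ℕ, (φ F).coeff ((k0 : ZMod N) + (i * m : ℕ)) = (φ F).coeff (k0 : ZMod N) := by
    intro i
    induction i with
    | zero => simp
    | succ i ih =>
      rw [← ih, ← hper ((k0 : ZMod N) + (i * m : ℕ))]; congr 1; push_cast; ring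
  have hinj2 : Set.InjOn (fun i : ℕ => (k0 : ZMod N) + (i * m : ℕ)) (Finset.range n : Set ℕ) := by
    intro i hi i' hi' hii
    simp only [add_right_inj] at hii
    rw [ZMod.natCast_eq_natCast_iff'] at hii
    simp only [Finset.coe_range, Set.mem_Iio] at hi hi'
    rw [Nat.mod_eq_of_lt, Nat.mod_eq_of_lt] at hii
    · exact Nat.eq_of_mul_eq_mul_right hmpos hii
    · rw [hNm]; exact Nat.mul_lt_mul_of_pos_right hi' hmpos
    · rw [hNm]; exact Nat.mul_lt_mul_of_pos_right hi hmpos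
  have hsum : ∑ r ∈ (Finset.range n).image (fun i : ℕ => (k0 : ZMod N) + (i * m : ℕ)),
      (φ F).coeff r ≤ n := by
    rw [← htot]
    exact Finset.sum_le_sum_of_subset_of_nonneg (Finset.subset_univ _) fun r _ _ => hnn r
  rw [Finset.sum_image hinj2] at hsum
  simp_rw [hall] at hsum
  simp only [Finset.sum_const, Finset.card_range, nsmul_eq_mul] at hsum
  have hn2 : (0:ℤ) < n := by exact_mod_cast hn.pos
  nlinarith
end

section
namespace RepData
variable {K M N ι G V κ : Type*} [Field K] [CharZero K] [AddCommGroup M] [Module K M]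
    [AddCommGroup N] [Module K N] [Group G] [Fintype ι] {W : WeylData K M N ι G} [AddCommGroup V]
    [Module K V] [Fintype κ] [FiniteDimensional K V] (R : RepData W V κ)

lemma Qch_coeff (j : W.simple) (ν : M) :
    (W.Q * R.ch 1).coeff (W.a (W.s j) ν) = - (W.Q * R.ch 1).coeff ν := by
  have h1 := W.Q_map j
  have h2 : AddMonoidAlgebra.mapDomainAlgHom K K (W.a (W.s j)).toLinearMap.toAddMonoidHom (R.ch 1) = R.ch 1 := by
    ext μ
    obtain ⟨μ, rfl⟩ := (W.a (W.s j)).surjective μ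
    rw [R.ch_inv]
    exact Finsupp.mapDomain_apply (W.a (W.s j)).injective (R.ch 1).coeff μ
  have h3 := congrArg (fun F => F.coeff (W.a (W.s j) ν)) (map_mul (AddMonoidAlgebra.mapDomainAlgHom K K (W.a (W.s j)).toLinearMap.toAddMonoidHom) W.Q (R.ch 1))
  simp only [h2] at h3
  erw [h1] at h3
  rw [neg_mul, AddMonoidAlgebra.coeff_neg, Finsupp.neg_apply] at h3
  rw [← neg_eq_iff_eq_neg, ← h3]
  exact Finsupp.mapDomain_apply (W.a (W.s j)).injective (W.Q * R.ch 1).coeff ν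

lemma Bf_add_left (a b c) : R.Bf (a + b) c = R.Bf a c + R.Bf b c := by
  simp [Bf, add_mul, Finset.sum_add_distrib]
lemma Bf_add_right (a b c) : R.Bf a (b + c) = R.Bf a b + R.Bf a c := by
  simp [Bf, mul_add, Finset.sum_add_distrib]

lemma Bf_cone (μ ν : M) (hμ : ∀ j : W.simple, ∃ k : ℕ, 0 < k ∧ W.pair μ (W.coroot j) = k)
    (hν : ∀ j : W.simple, ∃ k : ℕ, 0 < k ∧ W.pair ν (W.coroot j) = k) (x : M) (hx : x ∈ W.cone) :
    ∃ q : ℚ, R.Bf x ν + R.Bf μ x = q ∧ 0 ≤ q ∧ (x = 0 ∨ 0 < q) := by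
  rw [WeylData.cone] at hx
  induction hx using AddSubmonoid.closure_induction with
  | mem x hx =>
    obtain ⟨j, hj, rfl⟩ := hx
    obtain ⟨k, hk, hk'⟩ := hμ ⟨j, hj⟩
    obtain ⟨l, hl, hl'⟩ := hν ⟨j, hj⟩
    have hk2 : (0:ℚ) < k := by exact_mod_cast hk
    have hl2 : (0:ℚ) < l := by exact_mod_cast hl
    have hd := R.d_pos j
    have : 0 < R.d j * l + R.d j * k := by positivity
    refine ⟨R.d j * l + R.d j * k, ?_, this.le, Or.inr this⟩
    rw [R.Bf_root_left, R.Bf_root_right, hk', hl']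
    push_cast; rfl
  | zero => exact ⟨0, by simp [Bf], le_rfl, Or.inl rfl⟩
  | add x y _ _ hx hy =>
    obtain ⟨q, hq, h1, h2⟩ := hx
    obtain ⟨q', hq', h1', h2'⟩ := hy
    refine ⟨q + q', ?_, by linarith, ?_⟩
    · rw [R.Bf_add_left, R.Bf_add_right]; push_cast; rw [← hq, ← hq']; ring
    · rcases h2 with h2 | h2
      · rcases h2' with h2' | h2'
        · left; rw [h2, h2', add_zero]
        · right; linarith
      · right; linarith

lemma weyl_char [Fintype G] (φ : K →+ ℚ) (hφ : φ 1 = 1) (lam : M)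
    (h1 : ∀ μ, (R.ch 1).coeff μ ≠ 0 → lam - μ ∈ W.cone) (h2 : (R.ch 1).coeff lam = 1)
    (h3 : ∀ i, ∃ k : ℕ, W.pair lam (W.coroot i) = k) :
    ∃ κ' : K, W.Q * R.ch 1 = κ' • (W.toRefl φ hφ).alt (W.rho + lam) := by
  obtain ⟨h4, h5⟩ := W.prod_q φ hφ _ _ h1
  have hsd : ∀ j : W.simple, ∃ k : ℕ, 0 < k ∧ W.pair (W.rho + lam) (W.coroot j) = k := by
    intro j
    obtain ⟨k, hk⟩ := h3 j
    refine ⟨1 + k, by omega, ?_⟩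
    rw [map_add, LinearMap.add_apply, W.pair_rho, hk]; push_cast; rfl
  refine ((W.toRefl φ hφ).alt_eq _ (W.anti_of_map φ hφ _ R.Qch_coeff) ?_ (W.rho + lam) ?_ ?_).imp fun κ' h => h.2
  · intro ν hν j
    obtain ⟨z, hz⟩ := W.int_cone _ (h4 ν hν) j
    obtain ⟨k, hk, hk'⟩ := hsd j
    refine ⟨k - z, ?_⟩
    change W.pair ν (W.coroot j) = _
    rw [map_sub, LinearMap.sub_apply, hk'] at hz
    push_cast; rw [← hz]; ring
  · rw [h5, h2]; exact one_ne_zero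
  · intro μ hμ hd
    have hl := R.lap_Qch (R.lap_Q φ hφ)
    have e1 : ∀ ν, (W.Q * R.ch 1).coeff ν ≠ 0 → R.Bf ν ν = R.c + R.Bf W.rho W.rho := by
      intro ν hν
      have := congrArg (fun F => F.coeff ν) hl
      simp only [lap_coeff, AddMonoidAlgebra.coeff_smul, Finsupp.smul_apply, smul_eq_mul] at this
      exact mul_right_cancel₀ hν this
    have e2 := e1 μ hμ
    have e3 := e1 (W.rho + lam) (by rw [h5, h2]; exact one_ne_zero)
    obtain ⟨q, hq, -, hq2⟩ := R.Bf_cone μ (W.rho + lam) hd hsd _ (h4 μ hμ)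
    rcases hq2 with hq2 | hq2
    · exact (sub_eq_zero.1 hq2).symm
    exfalso
    have e4 : R.Bf (W.rho + lam - μ) (W.rho + lam) + R.Bf μ (W.rho + lam - μ) =
        R.Bf (W.rho + lam) (W.rho + lam) - R.Bf μ μ := by
      obtain ⟨y, hy⟩ : ∃ y, W.rho + lam = μ + y := ⟨W.rho + lam - μ, by abel⟩
      rw [hy, add_sub_cancel_left, R.Bf_add_left, R.Bf_add_right μ]; ring
    rw [e4, e3, e2, sub_self] at hq
    have : q = 0 := by exact_mod_cast hq.symm
    linarith

end RepData
end

section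
namespace WeylData
variable {K M N ι G : Type*} [Field K] [CharZero K] [AddCommGroup M] [Module K M]
    [AddCommGroup N] [Module K N] [Group G] [Fintype ι] (W : WeylData K M N ι G)

noncomputable def h0 : N := ∑ i, W.coroot i

/-- evaluation at h0 -/
noncomputable def ev (n : N) : AddMonoidAlgebra K M →ₐ[K] AddMonoidAlgebra K K :=
  AddMonoidAlgebra.mapDomainAlgHom K K ((W.pair.flip n).toAddMonoidHom)

lemma ev_single (n : N) (m : M) (c : K) : W.ev n (AddMonoidAlgebra.single m c) =
    AddMonoidAlgebra.single (W.pair m n) c := by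
  simp [ev, AddMonoidAlgebra.mapDomain_single]

lemma sgn_inv (g : G) : W.sgn g⁻¹ = W.sgn g := by
  have hg : g ∈ Subgroup.closure (Set.range W.s) := by rw [W.gen]; trivial
  have : W.sgn g * W.sgn g = 1 := by
    induction hg using Subgroup.closure_induction with
    | mem x hx => obtain ⟨j, rfl⟩ := hx; rw [W.sgn_s]; simp
    | one => simp
    | mul x y _ _ hx hy => rw [map_mul, mul_mul_mul_comm, hx, hy, one_mul]
    | inv x _ hx => rw [map_inv, ← mul_inv, hx, inv_one]
  rw [map_inv]
  exact inv_eq_of_mul_eq_one_left this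

lemma ev_alt [Fintype G] (φ : K →+ ℚ) (hφ : φ 1 = 1) (ν : M) :
    W.ev W.h0 ((W.toRefl φ hφ).alt ν) = W.flip.ev ((2:K) • ν) ((W.flip.toRefl φ hφ).alt W.flip.rho) := by
  simp only [ReflData.alt, map_sum]
  rw [← Equiv.sum_comp (Equiv.inv G)]
  refine Finset.sum_congr rfl fun g _ => ?_
  have h1 : (W.toRefl φ hφ).sgn ((Equiv.inv G) g) = W.sgn g := W.sgn_inv g
  have h2 : (W.flip.toRefl φ hφ).sgn g = W.sgn g := rfl
  rw [h1, h2, ev_single]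
  erw [ev_single]
  congr 1
  change W.pair (W.a g⁻¹ ν) W.h0 = W.pair ((2:K) • ν) (W.a' g ((2⁻¹:K) • W.h0))
  rw [map_smul, map_smul, map_smul, LinearMap.smul_apply, smul_smul]
  rw [← W.pair_a g]
  rw [← LinearEquiv.mul_apply, ← map_mul, mul_inv_cancel, map_one]
  simp

lemma ev_Q (n : N) : W.ev n W.Q = ∏ i, (AddMonoidAlgebra.single (2⁻¹ * W.pair (W.root i) n) 1
    - AddMonoidAlgebra.single (-(2⁻¹ * W.pair (W.root i) n)) (1:K)) := by
  rw [Q, map_prod]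
  refine Finset.prod_congr rfl fun i _ => ?_
  rw [q, map_sub, ev_single, ev_single]
  simp

lemma fac (z : K) (a : ℕ) (hz : z = a) : (AddMonoidAlgebra.single z 1 - AddMonoidAlgebra.single (-z) 1 : AddMonoidAlgebra K K)
    = AddMonoidAlgebra.single z 1 * (1 - AddMonoidAlgebra.single (-2:K) 1 ^ a) := by
  rw [AddMonoidAlgebra.single_pow, mul_sub, mul_one, AddMonoidAlgebra.single_mul_single, hz]
  congr 2
  · simp; ring
  · simp

lemma pos_cone (n : N) (h : ∀ j : W.simple, ∃ k : ℕ, 0 < k ∧ W.pair (W.root j) n = 2 * (k:K)) (x : M) (hx : x ∈ W.cone) :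
    ∃ k : ℕ, W.pair x n = 2 * (k:K) ∧ (x = 0 ∨ 0 < k) := by
  rw [cone] at hx
  induction hx using AddSubmonoid.closure_induction with
  | mem x hx =>
    obtain ⟨j, hj, rfl⟩ := hx
    obtain ⟨k, hk, hk'⟩ := h ⟨j, hj⟩
    exact ⟨k, hk', Or.inr hk⟩
  | zero => exact ⟨0, by simp, Or.inl rfl⟩
  | add x y _ _ hx hy =>
    obtain ⟨k, hk, hk'⟩ := hx
    obtain ⟨l, hl, hl'⟩ := hy
    refine ⟨k + l, by rw [map_add, LinearMap.add_apply, hk, hl]; push_cast; ring, ?_⟩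
    rcases hk' with h | h
    · rcases hl' with h' | h'
      · left; rw [h, h', add_zero]
      · right; omega
    · right; omega

end WeylData

open Polynomial in
lemma aevalY_inj {K : Type*} [Field K] [CharZero K] :
    Function.Injective (aeval (R := K) (AddMonoidAlgebra.single (-2:K) (1:K))) := by
  classical
  have key : ∀ (A : K[X]) (k : ℕ), (aeval (R := K) (AddMonoidAlgebra.single (-2:K) (1:K)) A).coeff (-2 * (k:K)) = A.coeff k := by
    intro A k
    induction A using Polynomial.induction_on' with
    | add p q hp hq => rw [map_add, AddMonoidAlgebra.coeff_add, Finsupp.add_apply, hp, hq, coeff_add]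
    | monomial m c =>
      rw [aeval_monomial, AddMonoidAlgebra.single_pow, ← Algebra.smul_def, AddMonoidAlgebra.coeff_smul, Finsupp.smul_apply,
        AddMonoidAlgebra.coeff_single, Finsupp.single_apply, coeff_monomial]
      by_cases h : m = k
      · subst h; simp [mul_comm]
      · rw [if_neg, if_neg h, smul_zero]
        rw [nsmul_eq_mul, mul_comm]
        intro h2
        have := mul_left_cancel₀ (by norm_num) h2
        exact h (by exact_mod_cast this)
  intro A B h
  ext k
  rw [← key, ← key, h]

namespace RepData
variable {K M N ι G V κ : Type*} [Field K] [CharZero K] [AddCommGroup M] [Module K M]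
    [AddCommGroup N] [Module K N] [Group G] [Fintype ι] {W : WeylData K M N ι G} [AddCommGroup V]
    [Module K V] [Fintype κ] [FiniteDimensional K V] (R : RepData W V κ)

lemma sum_finrank : ∑ μ ∈ R.wts, Module.finrank K (R.wt μ) = Module.finrank K V := by
  have h := congrArg (LinearMap.trace K V) R.pr_sum
  rw [map_sum, LinearMap.trace_one] at h
  simp only [pr_trace] at h
  exact_mod_cast h

lemma wts_of_coeff (μ : M) : μ ∈ R.wts ↔ (R.ch 1).coeff μ ≠ 0 := by
  rw [mem_wts, ch_one_coeff, Nat.cast_ne_zero, ne_eq, ne_eq, Submodule.finrank_eq_zero]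

open Polynomial in
lemma mult_le_one [Fintype G] (φ : K →+ ℚ) (hφ : φ 1 = 1) (hp : (Module.finrank K V).Prime) (c : K) :
    Module.finrank K (Module.End.eigenspace (R.T W.h0) c) ≤ 1 := by
  classical
  have : Nontrivial V := Module.nontrivial_of_finrank_pos (R := K) hp.pos
  obtain ⟨lam, h1, h2, h3⟩ := R.exists_highest φ hφ
  obtain ⟨κ', hw⟩ := R.weyl_char φ hφ lam h1 h2 h3
  obtain ⟨κ₂, hκ₂, hf⟩ := W.flip.Q_eq_alt φ hφ
  set ν := W.rho + lam with hν
  -- exponents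
  have ha : ∀ i, ∃ k : ℕ, 2⁻¹ * W.pair (W.root i) W.h0 = k ∧ 0 < k := by
    intro i
    obtain ⟨k, hk, hk'⟩ := W.pos_cone W.h0 (fun j => ⟨1, one_pos, by
      rw [WeylData.h0, W.pair_sum_coroot]; simp⟩) _ (W.root_mem i)
    refine ⟨k, by rw [hk]; field_simp, ?_⟩
    rcases hk' with h | h
    · exact absurd h (R.root_ne i)
    · exact h
  have hb : ∀ i, ∃ k : ℕ, 2⁻¹ * W.pair ((2:K) • ν) (W.coroot i) = k ∧ 0 < k := by
    intro i
    obtain ⟨k, hk, hk'⟩ := W.flip.pos_cone ((2:K) • ν) (fun j => by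
      obtain ⟨k, hk⟩ := h3 j
      refine ⟨1 + k, by omega, ?_⟩
      change W.pair _ (W.coroot j) = _
      rw [map_smul, LinearMap.smul_apply, hν, map_add, LinearMap.add_apply, W.pair_rho ⟨j.1, j.2⟩, hk]
      simp) _ (W.coroot_mem i)
    change W.pair _ _ = _ at hk
    refine ⟨k, by rw [hk]; field_simp, ?_⟩
    rcases hk' with h | h
    · change W.coroot i = 0 at h
      have := W.two i
      rw [h] at this; simp at this
    · exact h
  have hk : ∀ μ, ∃ k : ℕ, μ ∈ R.wts → W.pair μ W.h0 = W.pair lam W.h0 - 2 * k ∧ (k = 0 → μ = lam) := by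
    intro μ
    by_cases hμ : μ ∈ R.wts
    · obtain ⟨k, hk, hk'⟩ := W.pos_cone W.h0 (fun j => ⟨1, one_pos, by
        rw [WeylData.h0, W.pair_sum_coroot]; simp⟩) _ (h1 μ ((R.wts_of_coeff μ).1 hμ))
      refine ⟨k, fun _ => ⟨?_, ?_⟩⟩
      · rw [map_sub, LinearMap.sub_apply] at hk
        rw [← hk]; ring
      · rintro rfl
        rcases hk' with h | h
        · exact (sub_eq_zero.1 h).symm
        · exact absurd h (lt_irrefl _)
    · exact ⟨0, fun h => absurd h hμ⟩
  choose a ha ha0 using ha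
  choose b hb hb0 using hb
  choose k hk using hk
  set P : ℤ[X] := ∑ μ ∈ R.wts, (Module.finrank K (R.wt μ) : ℤ[X]) * X ^ k μ with hP
  set Y := AddMonoidAlgebra.single (R := K) (-2:K) (1:K) with hY
  have evch : W.ev W.h0 (R.ch 1) = AddMonoidAlgebra.single (W.pair lam W.h0) 1 * aeval Y (P.map (Int.castRingHom K)) := by
    rw [ch, map_sum, hP, Polynomial.map_sum, map_sum, Finset.mul_sum]
    refine Finset.sum_congr rfl fun μ hμ => ?_
    rw [WeylData.ev_single, mul_one, pr_trace, (hk μ hμ).1]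
    simp only [Polynomial.map_mul, Polynomial.map_natCast, Polynomial.map_pow, map_X, map_mul, map_pow, aeval_X, map_natCast]
    rw [hY, AddMonoidAlgebra.single_pow, AddMonoidAlgebra.natCast_def, AddMonoidAlgebra.single_mul_single, AddMonoidAlgebra.single_mul_single]
    congr 1
    · simp; ring
    · simp
  have evQ : ∀ (z : ι → K) (a : ι → ℕ), (∀ i, z i = a i) →
     (∏ i, (AddMonoidAlgebra.single (z i) 1 - AddMonoidAlgebra.single (-(z i)) (1:K)) : AddMonoidAlgebra K K) =
     AddMonoidAlgebra.single (∑ i, z i) 1 * aeval Y (Polynomial.map (Int.castRingHom K) (∏ i, (1 - X ^ a i))) := by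
    intro z a hz
    have : (AddMonoidAlgebra.single (∑ i, z i) 1 : AddMonoidAlgebra K K) = ∏ i, AddMonoidAlgebra.single (z i) 1 := by
      have := map_prod (AddMonoidAlgebra.of K K) (fun i => Multiplicative.ofAdd (z i)) Finset.univ
      simp only [AddMonoidAlgebra.of_apply, toAdd_prod, toAdd_ofAdd] at this
      exact this
    rw [this, Polynomial.map_prod, map_prod, ← Finset.prod_mul_distrib]
    refine Finset.prod_congr rfl fun i _ => ?_
    rw [WeylData.fac _ _ (hz i)]
    simp [hY]
  have E := congrArg (W.ev W.h0) hw
  rw [map_mul, map_smul, W.ev_alt, evch, W.ev_Q, evQ _ _ ha] at E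
  have E2 := congrArg (W.flip.ev ((2:K) • ν)) hf
  rw [map_smul, W.flip.ev_Q] at E2
  change ∏ i, (AddMonoidAlgebra.single (2⁻¹ * W.pair ((2:K) • ν) (W.coroot i)) 1 - AddMonoidAlgebra.single (-(2⁻¹ * W.pair ((2:K) • ν) (W.coroot i))) 1) = _ at E2
  rw [evQ _ _ hb] at E2
  have hAB : ∑ i, 2⁻¹ * W.pair (W.root i) W.h0 + W.pair lam W.h0 = ∑ i, 2⁻¹ * W.pair ((2:K) • ν) (W.coroot i) := by
    have e1 : ∀ i, 2⁻¹ * W.pair ((2:K) • ν) (W.coroot i) = W.pair ν (W.coroot i) := by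
      intro i; simp
    simp only [e1]
    rw [← map_sum, hν, map_add, LinearMap.add_apply, WeylData.rho, ← Finset.mul_sum]
    simp [WeylData.h0]
    rw [← Finset.mul_sum, Finset.sum_comm]
  have E3 : κ₂ • (AddMonoidAlgebra.single (∑ i, 2⁻¹ * W.pair (W.root i) W.h0) 1 * aeval Y (Polynomial.map (Int.castRingHom K) (∏ i, (1 - X ^ a i)))
     * (AddMonoidAlgebra.single (W.pair lam W.h0) 1 * aeval Y (P.map (Int.castRingHom K)))) = κ' • (AddMonoidAlgebra.single (∑ i, 2⁻¹ * W.pair ((2:K) • ν) (W.coroot i)) 1 * aeval Y (Polynomial.map (Int.castRingHom K) (∏ i, (1 - X ^ b i)))) := by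
    rw [E, E2, smul_comm]
  rw [← hAB] at E3
  have gen : ∀ (x y : K) (A B C : AddMonoidAlgebra K K),
      κ₂ • (AddMonoidAlgebra.single x 1 * A * (AddMonoidAlgebra.single y 1 * B)) = κ' • (AddMonoidAlgebra.single (x + y) 1 * C) →
      κ₂ • (A * B) = κ' • C := by
    intro x y A B C h
    have h' := congrArg (fun F => AddMonoidAlgebra.single (-(x + y)) 1 * F) h
    simp only [mul_smul_comm] at h'
    rw [mul_mul_mul_comm, AddMonoidAlgebra.single_mul_single, ← mul_assoc, ← mul_assoc, ← mul_assoc, AddMonoidAlgebra.single_mul_single,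
      AddMonoidAlgebra.single_mul_single, neg_add_cancel, one_mul, one_mul, ← AddMonoidAlgebra.one_def, one_mul, one_mul] at h'
    exact h'
  have E4 := gen _ _ _ _ _ E3
  rw [← map_mul, ← map_smul, ← map_smul] at E4
  have E5 := aevalY_inj E4
  have c0 : ∀ a : ι → ℕ, (∀ i, 0 < a i) → (∏ i, (1 - X ^ a i) : ℤ[X]).coeff 0 = 1 := by
    intro a ha
    rw [coeff_zero_eq_eval_zero, eval_prod]
    apply Finset.prod_eq_one
    intro i _
    simp [(ha i).ne']
  have hlam : lam ∈ R.wts := by rw [wts_of_coeff, h2]; exact one_ne_zero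
  have P0 : P.coeff 0 = 1 := by
    rw [coeff_zero_eq_eval_zero, hP, eval_finsetSum, Finset.sum_eq_single_of_mem lam hlam]
    · have hk0 : k lam = 0 := by
        have := (hk lam hlam).1
        rw [eq_comm, sub_eq_self] at this
        simpa using this
      have : (Module.finrank K (R.wt lam) : K) = 1 := by rw [← ch_one_coeff, h2]
      have : Module.finrank K (R.wt lam) = 1 := by exact_mod_cast this
      simp [hk0, this]
    · intro μ hμ hne
      have : k μ ≠ 0 := fun h => hne ((hk μ hμ).2 h)
      simp [this]
  have E6 := congrArg (fun F => F.coeff 0) E5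
  simp only [coeff_smul, ← Polynomial.map_mul, coeff_map, mul_coeff_zero, c0 a ha0, c0 b hb0, P0] at E6
  simp only [mul_one, map_one, smul_eq_mul] at E6
  rw [← E6, ← Polynomial.map_mul] at E5
  have E7 := Polynomial.map_injective (Int.castRingHom K) Int.cast_injective (smul_right_injective _ hκ₂ E5)
  rw [mul_comm] at E7
  have Pco : ∀ l, P.coeff l = ((∑ μ ∈ R.wts with k μ = l, Module.finrank K (R.wt μ) : ℕ) : ℤ) := by
    intro l
    rw [hP, finsetSum_coeff, Finset.sum_filter]
    push_cast
    refine Finset.sum_congr rfl fun μ _ => ?_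
    rw [← Polynomial.C_eq_natCast, coeff_C_mul, coeff_X_pow]
    by_cases h : k μ = l
    · simp [h]
    · simp [h, Ne.symm h]
  have fin := c5_coeff_le_one _ hp P (fun l => by rw [Pco]; positivity) Finset.univ a b (fun i _ => ha0 i) (fun i _ => hb0 i) E7 (by
    rw [hP, eval_finsetSum, ← R.sum_finrank]; simp)
  -- eigenspaces
  have le : Module.End.eigenspace (R.T W.h0) c ≤ (R.wts.filter fun μ => W.pair μ W.h0 = c).sup R.wt := by
    intro v hv
    rw [Module.End.mem_eigenspace_iff] at hv
    have e1 : v = ∑ μ ∈ R.wts, R.pr μ v := by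
      rw [← LinearMap.sum_apply, R.pr_sum]; rfl
    rw [e1]
    refine sum_mem fun μ hμ => ?_
    by_cases h : W.pair μ W.h0 = c
    · exact (Finset.le_sup (f := R.wt) (Finset.mem_filter.2 ⟨hμ, h⟩)) (R.pr_mem μ v)
    · have e2 := congrArg (fun A => A v) (R.pr_T W.h0 μ)
      simp only [Module.End.mul_apply, hv, map_smul, LinearMap.smul_apply] at e2
      have : R.pr μ v = 0 := by
        by_contra h0
        exact h (smul_left_injective K h0 e2).symm
      rw [this]; exact zero_mem _
  have fs : ∀ s : Finset M, Module.finrank K (s.sup R.wt : Submodule K V) ≤ ∑ μ ∈ s, Module.finrank K (R.wt μ) := by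
    intro s
    induction s using Finset.induction_on with
    | empty => simp
    | insert x s hx ih =>
      rw [Finset.sup_insert, Finset.sum_insert hx]
      exact (Submodule.finrank_add_le_finrank_add_finrank _ _).trans (by omega)
  refine (Submodule.finrank_mono le).trans ((fs _).trans ?_)
  by_cases hne : ∃ μ ∈ R.wts, W.pair μ W.h0 = c
  · obtain ⟨μ, hμ, hc⟩ := hne
    have h7 := fin (k μ)
    rw [Pco] at h7
    have h8 : ∑ μ' ∈ R.wts with k μ' = k μ, Module.finrank K (R.wt μ') ≤ 1 := by exact_mod_cast h7
    refine le_trans (Finset.sum_le_sum_of_subset ?_) h8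
    intro μ' h'
    rw [Finset.mem_filter] at h' ⊢
    refine ⟨h'.1, ?_⟩
    have := h'.2
    rw [← hc, (hk μ' h'.1).1, (hk μ hμ).1] at this
    have := sub_right_injective this
    have := mul_left_cancel₀ (by norm_num : (2:K) ≠ 0) this
    exact_mod_cast this
  · push Not at hne
    rw [Finset.filter_false_of_mem hne]
    simp

end RepData
end

section
namespace LieC1
open LieAlgebra LieModule LieAlgebra.IsKilling Module

lemma casimir_comm {K L V I : Type*} [Field K] [LieRing L] [LieAlgebra K L] [AddCommGroup V] [Module K V]
    [LieRingModule L V] [LieModule K L V] [Fintype I] (B : L →ₗ[K] L →ₗ[K] K)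
    (hinv : ∀ x y z : L, B ⁅x, y⁆ z = - B y ⁅x, z⁆) (hs : ∀ x y, B x y = B y x) (X Y : I → L)
    (h1 : ∀ z, z = ∑ i, B (X i) z • Y i) (h2 : ∀ z, z = ∑ i, B (Y i) z • X i) (z : L) :
    toEnd K L V z * (∑ i, toEnd K L V (X i) * toEnd K L V (Y i)) =
      (∑ i, toEnd K L V (X i) * toEnd K L V (Y i)) * toEnd K L V z := by
  set ρ := toEnd K L V
  have hl : ∀ a b : L, ρ ⁅a, b⁆ = ρ a * ρ b - ρ b * ρ a := fun a b => by
    ext v; simp [ρ, Module.End.mul_apply, lie_lie]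
  rw [← sub_eq_zero, Finset.mul_sum, Finset.sum_mul, ← Finset.sum_sub_distrib]
  have e1 : ∀ i, ρ z * (ρ (X i) * ρ (Y i)) - ρ (X i) * ρ (Y i) * ρ z
      = ρ ⁅z, X i⁆ * ρ (Y i) + ρ (X i) * ρ ⁅z, Y i⁆ := by
    intro i; rw [hl, hl]; noncomm_ring
  have e2 : ∀ i, ρ ⁅z, X i⁆ * ρ (Y i) = ∑ j, B (Y j) ⁅z, X i⁆ • (ρ (X j) * ρ (Y i)) := by
    intro i
    conv_lhs => rw [h2 ⁅z, X i⁆]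
    simp [map_sum, Finset.sum_mul]
  have e3 : ∀ i, ρ (X i) * ρ ⁅z, Y i⁆ = ∑ j, B (X j) ⁅z, Y i⁆ • (ρ (X i) * ρ (Y j)) := by
    intro i
    conv_lhs => rw [h1 ⁅z, Y i⁆]
    simp [map_sum, Finset.mul_sum]
  simp_rw [e1, e2, e3, Finset.sum_add_distrib]
  conv_lhs => rw [add_comm, Finset.sum_comm]
  rw [← Finset.sum_add_distrib]
  refine Finset.sum_eq_zero fun i _ => ?_
  rw [← Finset.sum_add_distrib]
  refine Finset.sum_eq_zero fun j _ => ?_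
  rw [← add_smul, ← hs, hinv, neg_add_cancel, zero_smul]

variable {K L V : Type*} [Field K] [CharZero K] [IsAlgClosed K] [LieRing L] [LieAlgebra K L]
  [FiniteDimensional K L] [IsKilling K L] (H : LieSubalgebra K L) [H.IsCartanSubalgebra]
  [AddCommGroup V] [Module K V] [LieRingModule L V] [LieModule K L V] [FiniteDimensional K V]

lemma triple_exists (α : H.root) : ∃ ef : L × L, ef.1 ∈ rootSpace H α.1 ∧ ef.2 ∈ rootSpace H (-α.1) ∧
    ⁅ef.1, ef.2⁆ = (coroot α.1 : L) ∧ ef.1 ≠ 0 ∧ ef.2 ≠ 0 := by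
  have hα := LieSubalgebra.isNonZero_coe_root α
  obtain ⟨h, e, f, ht, he, hf⟩ := exists_isSl2Triple_of_weight_isNonZero hα
  refine ⟨(e, f), he, hf, ?_, ht.e_ne_zero, ht.f_ne_zero⟩
  rw [ht.lie_e_f]
  exact ht.h_eq_coroot hα he hf

noncomputable def eα (α : H.root) : L := (triple_exists H α).choose.1
noncomputable def fα (α : H.root) : L := (triple_exists H α).choose.2

lemma eα_mem (α : H.root) : eα H α ∈ rootSpace H α.1 := (triple_exists H α).choose_spec.1
lemma fα_mem (α : H.root) : fα H α ∈ rootSpace H (-α.1) := (triple_exists H α).choose_spec.2.1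
lemma lie_ef (α : H.root) : ⁅eα H α, fα H α⁆ = (coroot α.1 : L) := (triple_exists H α).choose_spec.2.2.1
lemma eα_ne (α : H.root) : eα H α ≠ 0 := (triple_exists H α).choose_spec.2.2.2.1
lemma fα_ne (α : H.root) : fα H α ≠ 0 := (triple_exists H α).choose_spec.2.2.2.2

lemma d_exists (α : H.root) : ∃ d : ℚ, 0 < d ∧ (d : K) * killingForm K L (eα H α) (fα H α) = 1 ∧
    (cartanEquivDual H).symm α.1 = (d : K) • coroot α.1 := by
  have hα := LieSubalgebra.isNonZero_coe_root α
  have hne := root_apply_cartanEquivDual_symm_ne_zero hα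
  set α' := (cartanEquivDual H).symm α.1.toLinear with hα'
  have hcor : coroot α.1 = (2 * (α.1 α')⁻¹) • α' := by
    rw [coroot, mul_smul, two_nsmul, two_smul]
  have hα'0 : (α' : L) ≠ 0 := by
    intro h
    have : α' = 0 := by simpa using h
    rw [this] at hne; simp at hne
  have h1 : killingForm K L (eα H α) (fα H α) = 2 * (α.1 α')⁻¹ := by
    have h := lie_eq_killingForm_smul_of_mem_rootSpace_of_mem_rootSpace_neg (eα_mem H α) (fα_mem H α)
    rw [lie_ef, hcor] at h
    exact (smul_left_injective K hα'0 h).symm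
  have h2 : traceForm K H L (coroot α.1) (coroot α.1) = 4 * (α.1 α')⁻¹ := by
    rw [traceForm_coroot, root_apply_coroot hα]; simp [smul_eq_mul, nsmul_eq_mul]; ring
  have h3 : ∃ q : ℚ, 0 ≤ q ∧ traceForm K H L (coroot α.1) (coroot α.1) = (q : K) := by
    have h := congrArg (fun F => F (coroot α.1) (coroot α.1)) (restrict_killingForm_eq_sum (K := K) (L := L) (H := H))
    have hz : ∀ β : Weight K H L, ∃ z : ℤ, β (coroot α.1) = z := fun β => ⟨_, apply_coroot_eq_cast α.1 β⟩
    choose z hz using hz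
    refine ⟨∑ β ∈ H.root, (z β : ℚ)^2, Finset.sum_nonneg fun _ _ => sq_nonneg _, ?_⟩
    rw [restrict_killingForm] at h
    rw [h]
    simp only [LinearMap.sum_apply, LinearMap.smulRight_apply, LinearMap.smul_apply, smul_eq_mul]
    push_cast
    refine Finset.sum_congr rfl fun β _ => ?_
    change β (coroot α.1) * β (coroot α.1) = _
    rw [hz, sq]
  obtain ⟨q, hq, h3⟩ := h3
  have hq0 : q ≠ 0 := by
    rintro rfl
    rw [h3] at h2
    simp [hne] at h2
  have hq0' : (q : K) ≠ 0 := by exact_mod_cast hq0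
  have h4 : α.1 α' = 4 / q := by
    rw [h3] at h2; field_simp at h2 ⊢; exact h2
  refine ⟨2 / q, div_pos two_pos (lt_of_le_of_ne hq hq0.symm), ?_, ?_⟩
  · rw [h1, h4]; push_cast; field_simp; norm_num
  · rw [hcor, smul_smul, h4]; push_cast; field_simp; norm_num

noncomputable def dα (α : H.root) : ℚ := (d_exists H α).choose
lemma dα_pos (α : H.root) : 0 < dα H α := (d_exists H α).choose_spec.1
lemma dα_kil (α : H.root) : (dα H α : K) * killingForm K L (eα H α) (fα H α) = 1 := (d_exists H α).choose_spec.2.1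
lemma dα_dual (α : H.root) : (cartanEquivDual H).symm α.1 = (dα H α : K) • coroot α.1 :=
  (d_exists H α).choose_spec.2.2

end LieC1
end

section
namespace LieC1
open LieAlgebra LieModule LieAlgebra.IsKilling Module

variable {K L V : Type*} [Field K] [CharZero K] [IsAlgClosed K] [LieRing L] [LieAlgebra K L]
  [FiniteDimensional K L] [IsKilling K L] (H : LieSubalgebra K L) [H.IsCartanSubalgebra]
  [AddCommGroup V] [Module K V] [LieRingModule L V] [LieModule K L V] [FiniteDimensional K V]
  (b : (rootSystem H).Base)

abbrev PI := {i : H.root // b.IsPos i}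

lemma mem_span_of_root (α : Weight K H L) (hα : α.IsNonZero) (e : L) (he : e ∈ rootSpace H α) (he0 : e ≠ 0)
    (x : L) (hx : x ∈ rootSpace H α) : ∃ c : K, x = c • e := by
  have h := finrank_rootSpace_eq_one α hα
  obtain ⟨c, hc⟩ := (finrank_eq_one_iff_of_nonzero' (⟨e, he⟩ : rootSpace H α) (by simpa using he0)).1 h ⟨x, hx⟩
  exact ⟨c, by simpa using (congrArg Subtype.val hc).symm⟩

lemma span_top (U : Submodule K L) (hH : ∀ h : H, (h : L) ∈ U) (he : ∀ i : PI H b, eα H i.1 ∈ U)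
    (hf : ∀ i : PI H b, fα H i.1 ∈ U) : U = ⊤ := by
  rw [eq_top_iff]
  have h := congrArg LieSubmodule.toSubmodule (iSup_genWeightSpace_eq_top' K H L)
  rw [LieSubmodule.iSup_toSubmodule, LieSubmodule.top_toSubmodule] at h
  rw [← h]
  refine iSup_le fun α => ?_
  intro x hx
  by_cases hα : α.IsZero
  · have : x ∈ rootSpace H (0 : H → K) := by rw [← hα]; exact hx
    rw [rootSpace_zero_eq] at this
    exact hH ⟨x, by simpa using this⟩
  · have hmem : α ∈ H.root := by simpa using hα
    by_cases hp : b.IsPos ⟨α, hmem⟩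
    · obtain ⟨c, rfl⟩ := mem_span_of_root H α hα _ (eα_mem H ⟨α, hmem⟩) (eα_ne H _) x hx
      exact U.smul_mem _ (he ⟨⟨α, hmem⟩, hp⟩)
    · have hmem' : -α ∈ H.root := by simpa using hα
      have hp' : b.IsPos ⟨-α, hmem'⟩ := by
        have h1 := b.height_ne_zero ⟨α, hmem⟩
        rw [RootPairing.Base.isPos_iff] at hp ⊢
        have h2 : b.height ⟨-α, hmem'⟩ = - b.height ⟨α, hmem⟩ := by
          rw [← RootPairing.Base.height_reflectionPerm_self]
          congr 1
          change _ = (rootSystem H).reflectionPerm _ _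
          apply (rootSystem H).root.injective
          rw [RootPairing.root_reflectionPerm, RootPairing.reflection_apply_self]
          simp
        omega
      obtain ⟨c, rfl⟩ := mem_span_of_root H α hα (fα H ⟨-α, hmem'⟩)
        (by have := fα_mem H ⟨-α, hmem'⟩; simpa using this) (fα_ne H _) x hx
      exact U.smul_mem _ (hf ⟨⟨-α, hmem'⟩, hp'⟩)

lemma H_mem (h : H) : (h : L) ∈ rootSpace H (0 : H → K) := by
  rw [rootSpace_zero_eq]; simp

lemma pos_add_ne (i j : PI H b) : ((i.1.1 : Weight K H L) : H → K) + (j.1.1 : Weight K H L) ≠ 0 := by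
  intro h
  have h2 : b.height j.1 = - b.height i.1 := by
    rw [← RootPairing.Base.height_reflectionPerm_self]
    congr 1
    change _ = (rootSystem H).reflectionPerm _ _
    apply (rootSystem H).root.injective
    rw [RootPairing.root_reflectionPerm, RootPairing.reflection_apply_self]
    ext x
    have := congrFun h x
    simp at this ⊢
    linear_combination this
  have h3 := i.2
  have h4 := j.2
  rw [RootPairing.Base.isPos_iff] at h3 h4
  omega

lemma ne_zero (i : H.root) : ((i.1 : Weight K H L) : H → K) ≠ 0 := LieSubalgebra.isNonZero_coe_root i

lemma kil0 {α β : H → K} {x y : L}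
    (hx : x ∈ rootSpace H α) (hy : y ∈ rootSpace H β) (hαβ : α + β ≠ 0) :
    killingForm K L x y = 0 := killingForm_apply_eq_zero_of_mem_rootSpace_of_add_ne_zero K L H hx hy hαβ

lemma expand {κ : Type*} [Fintype κ] [Fintype (PI H b)] (x y : κ → H)
    (hxy : ∀ z : H, z = ∑ k, killingForm K L (x k) z • y k) (z : L) :
    z = ∑ k, killingForm K L (x k) z • (y k : L) +
      (∑ i : PI H b, killingForm K L (eα H i.1) z • ((dα H i.1 : K) • fα H i.1) +
      ∑ i : PI H b, killingForm K L (fα H i.1) z • ((dα H i.1 : K) • eα H i.1)) := by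
  classical
  let F : L →ₗ[K] L := ∑ k, (killingForm K L (x k)).smulRight (y k : L) +
      (∑ i : PI H b, (killingForm K L (eα H i.1)).smulRight ((dα H i.1 : K) • fα H i.1) +
      ∑ i : PI H b, (killingForm K L (fα H i.1)).smulRight ((dα H i.1 : K) • eα H i.1))
  have hF : ∀ z, F z = ∑ k, killingForm K L (x k) z • (y k : L) +
      (∑ i : PI H b, killingForm K L (eα H i.1) z • ((dα H i.1 : K) • fα H i.1) +
      ∑ i : PI H b, killingForm K L (fα H i.1) z • ((dα H i.1 : K) • eα H i.1)) := fun z => by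
    simp only [F, LinearMap.add_apply, LinearMap.sum_apply, LinearMap.smulRight_apply]
  rw [← hF]
  suffices h : LinearMap.eqLocus F LinearMap.id = ⊤ by
    have : z ∈ LinearMap.eqLocus F LinearMap.id := by rw [h]; trivial
    exact this.symm
  apply span_top H b
  · intro h
    change F h = h
    rw [hF]
    have e1 : ∀ i : PI H b, killingForm K L (eα H i.1) h = 0 := fun i =>
      kil0 H (eα_mem H i.1) (H_mem H h) (by rw [add_zero]; exact ne_zero H i.1)
    have e2 : ∀ i : PI H b, killingForm K L (fα H i.1) h = 0 := fun i =>
      kil0 H (fα_mem H i.1) (H_mem H h) (by rw [add_zero, neg_ne_zero]; exact ne_zero H i.1)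
    simp only [e1, e2, zero_smul, Finset.sum_const_zero, add_zero]
    have h3 := congrArg (Subtype.val) (hxy h)
    conv_rhs => rw [h3]
    simp
  · intro j
    change F _ = _
    rw [hF]
    have e0 : ∀ k, killingForm K L (x k) (eα H j.1) = 0 := fun k =>
      kil0 H (H_mem H _) (eα_mem H j.1) (by rw [zero_add]; exact ne_zero H _)
    have e1 : ∀ i : PI H b, killingForm K L (eα H i.1) (eα H j.1) = 0 := fun i =>
      kil0 H (eα_mem H i.1) (eα_mem H j.1) (pos_add_ne H b i j)
    simp only [e0, e1, zero_smul, Finset.sum_const_zero, zero_add]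
    rw [Finset.sum_eq_single j, smul_smul, LieModule.traceForm_comm, mul_comm, dα_kil, one_smul]
    · rfl
    · intro i _ hij
      rw [kil0 H (fα_mem H i.1) (eα_mem H j.1), zero_smul]
      intro h
      apply hij
      apply Subtype.ext; apply Subtype.ext
      ext t
      have := congrFun h t
      simp at this
      linear_combination -this
    · simp
  · intro j
    change F _ = _
    rw [hF]
    have e0 : ∀ k, killingForm K L (x k) (fα H j.1) = 0 := fun k =>
      kil0 H (H_mem H _) (fα_mem H j.1) (by rw [zero_add, neg_ne_zero]; exact ne_zero H _)
    have e1 : ∀ i : PI H b, killingForm K L (fα H i.1) (fα H j.1) = 0 := fun i =>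
      kil0 H (fα_mem H i.1) (fα_mem H j.1) (by rw [← neg_add, neg_ne_zero]; exact pos_add_ne H b i j)
    simp only [e0, e1, zero_smul, Finset.sum_const_zero, zero_add, add_zero]
    rw [Finset.sum_eq_single j, smul_smul, mul_comm, dα_kil, one_smul]
    · rfl
    · intro i _ hij
      rw [kil0 H (eα_mem H i.1) (fα_mem H j.1), zero_smul]
      intro h
      apply hij
      apply Subtype.ext; apply Subtype.ext
      ext t
      have := congrFun h t
      simp at this
      linear_combination this
    · simp

end LieC1
end

section
namespace LieC1
open LieAlgebra LieModule LieAlgebra.IsKilling Module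

variable {K L V : Type*} [Field K] [CharZero K] [IsAlgClosed K] [LieRing L] [LieAlgebra K L]
  [FiniteDimensional K L] [IsKilling K L] (H : LieSubalgebra K L) [H.IsCartanSubalgebra]
  (V) [AddCommGroup V] [Module K V] [LieRingModule L V] [LieModule K L V] [FiniteDimensional K V]
  (b : (rootSystem H).Base)

lemma toEnd_lie (a c : L) : toEnd K L V a * toEnd K L V c = toEnd K L V c * toEnd K L V a + toEnd K L V ⁅a, c⁆ := by
  ext v; simp [Module.End.mul_apply]

noncomputable def TT : H →ₗ[K] Module.End K V := (toEnd K L V : L →ₗ[K] Module.End K V).comp H.toSubmodule.subtype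

lemma TT_apply (h : H) : TT H V h = toEnd K L V (h : L) := rfl

lemma exists_dual : ∃ x y : Fin (finrank K H) → H, (∀ z : H, z = ∑ k, killingForm K L (x k) z • y k) ∧
    (∀ z : H, z = ∑ k, killingForm K L (y k) z • x k) := by
  let B := traceForm K H L
  have hB : B.Nondegenerate := traceForm_cartan_nondegenerate K L H
  have hs : B.IsSymm := ⟨fun x y => LieModule.traceForm_comm K H L x y⟩
  let x := Module.finBasis K H
  let y := LinearMap.BilinForm.dualBasis B hB x
  have hk : ∀ u v : H, killingForm K L u v = B u v := fun u v => rfl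
  refine ⟨x, y, fun z => ?_, fun z => ?_⟩
  · conv_lhs => rw [← y.sum_repr z]
    refine Finset.sum_congr rfl fun k _ => ?_
    rw [LinearMap.BilinForm.dualBasis_repr_apply, hk, hs.eq]
  · have hxy : LinearMap.BilinForm.dualBasis B hB y = x := LinearMap.BilinForm.dualBasis_dualBasis hB hs x
    conv_lhs => rw [← x.sum_repr z]
    refine Finset.sum_congr rfl fun k _ => ?_
    conv_lhs => rw [← hxy]
    rw [LinearMap.BilinForm.dualBasis_repr_apply, hk, hs.eq, hxy]

variable [LieModule.IsIrreducible K L V]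

lemma irr_lem (U : Submodule K V) (hU : U ≠ ⊥) (h : ∀ (x : L), ∀ v ∈ U, ⁅x, v⁆ ∈ U) : U = ⊤ := by
  let N : LieSubmodule K L V := { U with lie_mem := fun {x v} hv => h x v hv }
  have hN : N.toSubmodule = U := rfl
  rcases eq_bot_or_eq_top N with h1 | h1
  · exfalso; apply hU; rw [← hN, h1]; simp
  · rw [← hN, h1]; simp

lemma schur_lem (A : Module.End K V) (hA : ∀ x : L, toEnd K L V x * A = A * toEnd K L V x) : ∃ c : K, A = c • 1 := by
  have : Nontrivial V := nontrivial_of_isIrreducible K L V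
  obtain ⟨c, hc⟩ := Module.End.exists_eigenvalue A
  refine ⟨c, ?_⟩
  have h := irr_lem V (A.eigenspace c) hc (L := L) (fun x v hv => by
    rw [Module.End.mem_eigenspace_iff] at hv ⊢
    have := congrArg (fun F => F v) (hA x)
    simp only [Module.End.mul_apply, toEnd_apply_apply] at this
    rw [← this, hv, lie_smul])
  ext v
  have hv : v ∈ A.eigenspace c := by rw [h]; trivial
  simpa using Module.End.mem_eigenspace_iff.1 hv

lemma stable_lem (U : Submodule K V) (he : ∀ i : PI H b, ∀ v ∈ U, toEnd K L V (eα H i.1) v ∈ U)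
    (hf : ∀ i : PI H b, ∀ v ∈ U, toEnd K L V (fα H i.1) v ∈ U) (hT : ∀ n, ∀ v ∈ U, TT H V n v ∈ U) (x : L) :
    ∀ v ∈ U, ⁅x, v⁆ ∈ U := by
  let S : Submodule K L :=
    { carrier := {x | ∀ v ∈ U, ⁅x, v⁆ ∈ U}
      add_mem' := fun {a c} ha hc v hv => by rw [add_lie]; exact U.add_mem (ha v hv) (hc v hv)
      zero_mem' := fun v hv => by rw [zero_lie]; exact U.zero_mem
      smul_mem' := fun c a ha v hv => by rw [smul_lie]; exact U.smul_mem _ (ha v hv) }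
  have : S = ⊤ := span_top H b S (fun h v hv => hT h v hv) (fun i v hv => he i v hv) (fun i v hv => hf i v hv)
  have hx : x ∈ S := by rw [this]; trivial
  exact hx

lemma T_lie (h : H) (α : H → K) (x : L) (hx : x ∈ rootSpace H α) :
    TT H V h * toEnd K L V x = toEnd K L V x * TT H V h + α h • toEnd K L V x := by
  rw [TT_apply, toEnd_lie]
  have := lie_eq_smul_of_mem_rootSpace hx h
  rw [LieSubalgebra.coe_bracket_of_module] at this
  rw [this, map_smul]


lemma exists_rep [Fintype (PI H b)] : ∃ R : RepData (RPW.wd (rootSystem H) b) V (Fin (finrank K H)), R.T = TT H V ∧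
    (∀ i, R.e i = toEnd K L V (eα H i.1)) ∧ (∀ i, R.f i = toEnd K L V (fα H i.1)) := by
  classical
  obtain ⟨x, y, hx, hy⟩ := exists_dual H
  have hcas := casimir_comm (V := V) (killingForm K L) (fun a c z => LieModule.traceForm_apply_lie_apply' K L L a c z)
    (fun a c => LieModule.traceForm_comm K L L a c)
    (Sum.elim (fun k => (x k : L)) (Sum.elim (fun i : PI H b => eα H i.1) (fun i : PI H b => fα H i.1)))
    (Sum.elim (fun k => (y k : L)) (Sum.elim (fun i : PI H b => (dα H i.1 : K) • fα H i.1)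
      (fun i : PI H b => (dα H i.1 : K) • eα H i.1)))
    (fun z => by
      simp only [Fintype.sum_sum_type, Sum.elim_inl, Sum.elim_inr]
      exact expand H b x y hx z)
    (fun z => by
      simp only [Fintype.sum_sum_type, Sum.elim_inl, Sum.elim_inr]
      conv_lhs => rw [expand H b y x hy z]
      rw [add_right_inj, add_comm]
      simp only [map_smul, LinearMap.smul_apply, smul_smul, smul_eq_mul, mul_comm])
  obtain ⟨c, hc⟩ := schur_lem V _ hcas
  simp only [Fintype.sum_sum_type, Sum.elim_inl, Sum.elim_inr] at hc
  have hT_e : ∀ (n : H) (i : PI H b), TT H V n * toEnd K L V (eα H i.1) =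
      toEnd K L V (eα H i.1) * TT H V n + i.1.1 n • toEnd K L V (eα H i.1) :=
    fun n i => T_lie H V n _ _ (eα_mem H i.1)
  have hT_f : ∀ (n : H) (i : PI H b), TT H V n * toEnd K L V (fα H i.1) =
      toEnd K L V (fα H i.1) * TT H V n - i.1.1 n • toEnd K L V (fα H i.1) :=
    fun n i => by
      rw [T_lie H V n _ _ (fα_mem H i.1), sub_eq_add_neg, Pi.neg_apply, neg_smul]
  have hT_comm : ∀ x y, TT H V x * TT H V y = TT H V y * TT H V x := fun u v => by
      rw [TT_apply, TT_apply, toEnd_lie]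
      have : ⁅(u : L), (v : L)⁆ = 0 := by
        have := congrArg Subtype.val (trivial_lie_zero H H u v)
        simpa using this
      rw [this]; simp
  have hform : ∀ (x y : Fin (finrank K H) → H) (hx : ∀ z : H, z = ∑ k, killingForm K L (x k) z • y k) (i : PI H b),
      ∑ k, i.1.1 (x k) • y k = (dα H i.1 : K) • coroot i.1.1 := by
    intro x y hx i
    rw [← dα_dual, hx ((cartanEquivDual H).symm i.1.1.toLinear)]
    refine Finset.sum_congr rfl fun k _ => ?_
    congr 1
    have h1 : cartanEquivDual H ((cartanEquivDual H).symm i.1.1.toLinear) (x k) = i.1.1 (x k) := by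
      rw [LinearEquiv.apply_symm_apply, Weight.toLinear_apply]
    rw [← h1, cartanEquivDual_apply_apply, LieModule.traceForm_comm]
    rfl
  have hirr : ∀ U : Submodule K V, U ≠ ⊥ → (∀ i : PI H b, ∀ v ∈ U, toEnd K L V (eα H i.1) v ∈ U) →
     (∀ i : PI H b, ∀ v ∈ U, toEnd K L V (fα H i.1) v ∈ U) →
    (∀ n, ∀ v ∈ U, TT H V n v ∈ U) → U = ⊤ := fun U h0 h1 h2 h3 =>
      irr_lem V U h0 (stable_lem H V b U h1 h2 h3)
  refine ⟨{ T := TT H V, e := fun i => toEnd K L V (eα H i.1), f := fun i => toEnd K L V (fα H i.1)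
            T_comm := hT_comm, T_e := hT_e, T_f := hT_f
            e_f := fun i => by
              rw [toEnd_lie, lie_ef]; rfl
            x := x, y := y, d := fun i => dα H i.1, d_pos := fun i => dα_pos H i.1
            form1 := hform x y hx, form2 := hform y x hy, c := c
            cas := ?_
            nondeg := fun m m' h => LinearMap.ext h
            span := ?_
            br := ?_
            irr := hirr }, rfl, fun _ => rfl, fun _ => rfl⟩
  · rw [← hc]
    congr 1
    rw [← Finset.sum_add_distrib]
    refine Finset.sum_congr rfl fun i _ => ?_
    simp
  · set U := ⨆ μ, wtSp (RPW.wd (rootSystem H) b).pair (TT H V) μ with hU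
    have hst : ∀ A : Module.End K V, (∀ μ, ∀ v ∈ wtSp (RPW.wd (rootSystem H) b).pair (TT H V) μ, A v ∈ U) →
        ∀ v ∈ U, A v ∈ U := by
      intro A hA
      have : U ≤ U.comap A := iSup_le fun μ v hv => hA μ v hv
      exact this
    have hle : ∀ μ, wtSp (RPW.wd (rootSystem H) b).pair (TT H V) μ ≤ U := fun μ => le_iSup _ μ
    apply hirr
    · have : Nontrivial V := nontrivial_of_isIrreducible K L V
      obtain ⟨χ, hχ⟩ := LieModule.exists_nontrivial_weightSpace_of_isSolvable K H V
      obtain ⟨⟨v, hv⟩, hv0⟩ := exists_ne (0 : weightSpace V χ)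
      have hv0' : v ≠ 0 := by simpa using hv0
      rw [LieModule.mem_weightSpace] at hv
      intro h
      have : v ∈ U := hle χ ((mem_wtSp _ _ _ _).2 fun n => hv n)
      rw [h] at this
      exact hv0' (by simpa using this)
    · intro i
      refine hst _ fun μ v hv => hle (μ + i.1.1.toLinear) ?_
      rw [mem_wtSp] at hv ⊢
      intro n
      have h := congrArg (fun A => A v) (hT_e n i)
      simp only [Module.End.mul_apply, LinearMap.add_apply, LinearMap.smul_apply, hv, map_smul] at h
      rw [h, map_add, LinearMap.add_apply, add_smul]
      rfl
    · intro i
      refine hst _ fun μ v hv => hle (μ - i.1.1.toLinear) ?_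
      rw [mem_wtSp] at hv ⊢
      intro n
      have h := congrArg (fun A => A v) (hT_f n i)
      simp only [Module.End.mul_apply, LinearMap.sub_apply, LinearMap.smul_apply, hv, map_smul] at h
      rw [h, map_sub, LinearMap.sub_apply, sub_smul]
      rfl
    · intro n
      refine hst _ fun μ v hv => ?_
      have h := (mem_wtSp _ _ _ _).1 hv n
      rw [h]
      exact U.smul_mem _ (hle μ hv)
  · intro k i
    rw [toEnd_lie, add_sub_cancel_left]
    generalize ⁅eα H k.1, fα H i.1⁆ = z
    have := span_top H b (Submodule.comap (toEnd K L V : L →ₗ[K] Module.End K V) (Submodule.span K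
      (Set.range (fun i : PI H b => toEnd K L V (eα H i.1)) ∪ Set.range (fun i : PI H b => toEnd K L V (fα H i.1)) ∪ Set.range (TT H V))))
      (fun h => Submodule.subset_span (Or.inr ⟨h, rfl⟩))
      (fun h => Submodule.subset_span (Or.inl (Or.inl ⟨h, rfl⟩)))
      (fun h => Submodule.subset_span (Or.inl (Or.inr ⟨h, rfl⟩)))
    have hz : z ∈ (⊤ : Submodule K L) := trivial
    rw [← this] at hz
    exact hz

end LieC1
end

section
namespace LieC1
open LieAlgebra LieModule LieAlgebra.IsKilling Module

lemma exists_phi (K : Type*) [Field K] [CharZero K] : ∃ φ : K →+ ℚ, φ 1 = 1 := by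
  obtain ⟨g, hg⟩ := LinearMap.exists_leftInverse_of_injective (Algebra.linearMap ℚ K)
    (LinearMap.ker_eq_bot.2 (algebraMap ℚ K).injective)
  refine ⟨g.toAddMonoidHom, ?_⟩
  have := LinearMap.congr_fun hg 1
  simpa using this

section
variable {K L : Type*} [Field K] [CharZero K] [IsAlgClosed K] [LieRing L] [LieAlgebra K L]
  [FiniteDimensional K L] [IsKilling K L] (H : LieSubalgebra K L) [H.IsCartanSubalgebra]
  (b : (rootSystem H).Base)

/-- `[e_i, f_j] = 0` for distinct simple roots -/
lemma lie_e_f_ne (i j : H.root) (hi : i ∈ b.support) (hj : j ∈ b.support) (hij : i ≠ j) :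
    ⁅eα H i, fα H j⁆ = 0 := by
  have hmem : ⁅eα H i, fα H j⁆ ∈ rootSpace H (i.1 + -j.1 : H → K) :=
    lie_mem_genWeightSpace_of_mem_genWeightSpace (eα_mem H i) (fα_mem H j)
  by_contra hne
  have hw : genWeightSpace L (i.1 + -j.1 : H → K) ≠ ⊥ := by
    intro h
    change _ ∈ genWeightSpace L _ at hmem
    rw [h] at hmem
    exact hne (by simpa using hmem)
  let γ : Weight K H L := ⟨_, hw⟩
  have hγ : γ.IsNonZero := by
    intro h0
    apply hij
    apply Subtype.ext
    ext t
    have := congrFun h0 t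
    change i.1 t + -j.1 t = 0 at this
    linear_combination this
  have hγm : γ ∈ H.root := by simpa using hγ
  apply b.sub_notMem_range_root hi hj
  refine ⟨⟨γ, hγm⟩, ?_⟩
  ext t
  change i.1 t + -j.1 t = i.1 t - j.1 t
  ring

lemma exists_triple [Fintype (PI H b)] : ∃ e f : L, ⁅e, f⁆ = ((RPW.wd (rootSystem H) b).h0 : L) ∧
    ⁅((RPW.wd (rootSystem H) b).h0 : L), e⁆ = (2:K) • e ∧ ⁅((RPW.wd (rootSystem H) b).h0 : L), f⁆ = -((2:K) • f) := by
  classical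
  set W := RPW.wd (rootSystem H) b with hW
  have hc : ∃ c : H.root → K, W.h0 = ∑ i ∈ b.support, c i • coroot i.1 := by
    have h1 : ∀ i, ∃ c : H.root → K, W.coroot i = ∑ i ∈ b.support, c i • coroot i.1 := by
      intro i
      have := W.coroot_mem i
      generalize W.coroot i = x at this
      induction this using AddSubmonoid.closure_induction with
      | mem x hx =>
        obtain ⟨j, hj, rfl⟩ := hx
        refine ⟨Pi.single j.1 1, ?_⟩
        rw [Finset.sum_eq_single_of_mem j.1 hj]
        · simp; rfl
        · intro k _ hk; simp [hk]
      | zero => exact ⟨0, by simp⟩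
      | add x y _ _ hx hy =>
        obtain ⟨c, rfl⟩ := hx
        obtain ⟨d, rfl⟩ := hy
        exact ⟨c + d, by simp [add_smul, Finset.sum_add_distrib]⟩
    choose c hc using h1
    refine ⟨fun j => ∑ i, c i j, ?_⟩
    rw [WeylData.h0, Finset.sum_congr rfl fun i _ => hc i, Finset.sum_comm]
    refine Finset.sum_congr rfl fun j _ => ?_
    rw [Finset.sum_smul]
  obtain ⟨c, hc⟩ := hc
  have h2 : ∀ i ∈ b.support, (i.1 : Weight K H L) W.h0 = 2 := fun i hi =>
    W.pair_sum_coroot ⟨⟨i, RootPairing.Base.isPos_of_mem_support hi⟩, hi⟩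
  refine ⟨∑ i ∈ b.support, eα H i, ∑ i ∈ b.support, c i • fα H i, ?_, ?_, ?_⟩
  · rw [sum_lie, hc]
    have hcoe : ((∑ i ∈ b.support, c i • coroot i.1 : H) : L) = ∑ i ∈ b.support, c i • (coroot i.1 : L) := by
      simp
    rw [hcoe]
    refine Finset.sum_congr rfl fun i hi => ?_
    rw [lie_sum, Finset.sum_eq_single_of_mem i hi, lie_smul, lie_ef]
    intro j hj hji
    rw [lie_smul, lie_e_f_ne H b i j hi hj hji.symm, smul_zero]
  · rw [lie_sum, Finset.smul_sum]
    refine Finset.sum_congr rfl fun i hi => ?_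
    have := lie_eq_smul_of_mem_rootSpace (eα_mem H i) W.h0
    rw [LieSubalgebra.coe_bracket_of_module, h2 i hi] at this
    exact this
  · rw [lie_sum, Finset.smul_sum, ← Finset.sum_neg_distrib]
    refine Finset.sum_congr rfl fun i hi => ?_
    have := lie_eq_smul_of_mem_rootSpace (fα_mem H i) W.h0
    rw [LieSubalgebra.coe_bracket_of_module, Pi.neg_apply, h2 i hi] at this
    rw [lie_smul, this, smul_comm, neg_smul]

end

lemma even_span {K M N ι G V κ : Type*} [Field K] [CharZero K] [IsAlgClosed K] [AddCommGroup M] [Module K M]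
    [AddCommGroup N] [Module K N] [Group G] [Fintype ι] {W : WeylData K M N ι G} [AddCommGroup V]
    [Module K V] [Fintype κ] [FiniteDimensional K V] (R : RepData W V κ) [Nontrivial V] :
    ∃ c : K, ⨆ k : ℤ, Module.End.eigenspace (R.T W.h0) (c + 2 * k) = ⊤ := by
  obtain ⟨c, hc⟩ := Module.End.exists_eigenvalue (R.T W.h0)
  have hev : ∀ i, ∃ m : ℤ, W.pair (W.root i) W.h0 = 2 * m := by
    intro i
    have := W.root_mem i
    generalize W.root i = x at this
    induction this using AddSubmonoid.closure_induction with
    | mem x hx =>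
      obtain ⟨j, hj, rfl⟩ := hx
      exact ⟨1, by rw [show W.pair (W.root j) W.h0 = 2 from W.pair_sum_coroot ⟨j, hj⟩]; simp⟩
    | zero => exact ⟨0, by simp⟩
    | add x y _ _ hx hy =>
      obtain ⟨c, hx⟩ := hx
      obtain ⟨d, hy⟩ := hy
      exact ⟨c + d, by rw [map_add, LinearMap.add_apply, hx, hy]; push_cast; ring⟩
  refine ⟨c, ?_⟩
  set U := ⨆ k : ℤ, Module.End.eigenspace (R.T W.h0) (c + 2 * k) with hU
  have hle : ∀ k : ℤ, Module.End.eigenspace (R.T W.h0) (c + 2 * k) ≤ U := fun k => le_iSup (fun k : ℤ => Module.End.eigenspace (R.T W.h0) (c + 2 * k)) k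
  have hst : ∀ A : Module.End K V, (∀ k : ℤ, ∀ v, R.T W.h0 v = (c + 2 * k) • v → ∃ m : ℤ, R.T W.h0 (A v) = (c + 2 * m) • A v) →
        ∀ v ∈ U, A v ∈ U := by
    intro A hA
    have : U ≤ U.comap A := iSup_le fun μ v hv => by
      obtain ⟨m, hm⟩ := hA μ v (Module.End.mem_eigenspace_iff.1 hv)
      exact hle m (Module.End.mem_eigenspace_iff.2 hm)
    exact this
  apply R.irr
  · intro h
    apply hc
    rw [eq_bot_iff, ← h]
    have := hle 0
    simpa using this
  · intro i
    refine hst _ fun k v hv => ?_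
    obtain ⟨m, hm⟩ := hev i
    refine ⟨k + m, ?_⟩
    have h := congrArg (fun A => A v) (R.T_e W.h0 i)
    simp only [Module.End.mul_apply, LinearMap.add_apply, LinearMap.smul_apply, hv, map_smul] at h
    rw [h, hm, ← add_smul]; push_cast; ring_nf
  · intro i
    refine hst _ fun k v hv => ?_
    obtain ⟨m, hm⟩ := hev i
    refine ⟨k - m, ?_⟩
    have h := congrArg (fun A => A v) (R.T_f W.h0 i)
    simp only [Module.End.mul_apply, LinearMap.sub_apply, LinearMap.smul_apply, hv, map_smul] at h
    rw [h, hm, ← sub_smul]; push_cast; ring_nf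
  · intro n
    refine hst _ fun k v hv => ⟨k, ?_⟩
    have h := congrArg (fun A => A v) (R.T_comm W.h0 n)
    simp only [Module.End.mul_apply, hv, map_smul] at h
    exact h

theorem exists_principal {K L V : Type*} [Field K] [CharZero K] [IsAlgClosed K] [LieRing L] [LieAlgebra K L]
    [FiniteDimensional K L] [AddCommGroup V] [Module K V] [LieRingModule L V] [LieModule K L V]
    [FiniteDimensional K V] [LieModule.IsIrreducible K L V] [LieModule.IsFaithful K L V]
    (htr : ∀ x : L, LinearMap.trace K V (toEnd K L V x) = 0) (hp : (finrank K V).Prime) :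
    ∃ h e f : L, ⁅e, f⁆ = h ∧ ⁅h, e⁆ = (2:K) • e ∧ ⁅h, f⁆ = -((2:K) • f) ∧
      (∀ c, finrank K (Module.End.eigenspace (toEnd K L V h) c) ≤ 1) ∧
      ∃ c : K, ⨆ k : ℤ, Module.End.eigenspace (toEnd K L V h) (c + 2 * k) = ⊤ := by
  classical
  have := LieAlgebra.hasTrivialRadical_of_isIrreducible_of_isFaithful K L V htr
  have : IsKilling K L := inferInstance
  obtain ⟨x0, hH⟩ := LieAlgebra.exists_isCartanSubalgebra_engel K L
  set H := LieSubalgebra.engel K x0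
  obtain ⟨b⟩ := (rootSystem H).nonempty_base
  let _ : Fintype (PI H b) := Fintype.ofFinite _
  let _ : Fintype (RPW.WG (rootSystem H) b) := Fintype.ofFinite _
  obtain ⟨R, hT, he', hf'⟩ := exists_rep H V b
  obtain ⟨φ, hφ⟩ := exists_phi K
  obtain ⟨e, f, h1, h2, h3⟩ := exists_triple H b
  refine ⟨_, e, f, h1, h2, h3, fun c => ?_, ?_⟩
  · have := R.mult_le_one φ hφ hp c
    rw [hT] at this
    exact this
  have : Nontrivial V := nontrivial_of_isIrreducible K L V
  have := even_span R
  rw [hT] at this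
  exact this

end LieC1
end

section
namespace C6
open Polynomial

def wz (n : ℤ) (j : ℤ) : ℤ := j * (n - j)

lemma comb (n : ℕ) (hn : 3 ≤ n) (B : ℕ → Prop) [DecidablePred B] (h1 : B 1)
    (hrev : ∀ j, 0 < j → j < n → B j → ¬ B (n - j))
    (ht : ∀ j, 0 < j → j < n → B j →
      2 * wz n j * (if B j then 1 else 0) - wz n (j-1) * (if B (j-1) then 1 else 0)
        - wz n (j+1) * (if B (j+1) then 1 else 0) = 2 * wz n 1 * 1 - wz n 2 * (if B 2 then 1 else 0)) :
    ∀ j, 1 < j → j < n → ¬ B j := by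
  classical
  have hN : ¬ B (n - 1) := hrev 1 one_pos (by omega) h1
  by_cases h2 : B 2
  · exfalso
    have hex : ∃ k, 2 ≤ k ∧ ¬ B k := ⟨n - 1, by omega, hN⟩
    obtain ⟨hk2, hkB⟩ := Nat.find_spec hex
    have hmin : ∀ m < Nat.find hex, ¬ (2 ≤ m ∧ ¬ B m) := fun m hm => Nat.find_min hex hm
    have hle : Nat.find hex ≤ n - 1 := Nat.find_min' hex ⟨by omega, hN⟩
    generalize Nat.find hex = k at *
    have hk3 : 3 ≤ k := by
      by_contra h
      have : k = 2 := by omega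
      subst this; exact hkB h2
    obtain ⟨j, rfl⟩ : ∃ j, k = j + 1 := ⟨k - 1, by omega⟩
    have hj : B j := by
      have := hmin j (by omega); push Not at this; exact this (by omega)
    have hj1 : B (j - 1) := by
      by_cases h : j = 2
      · subst h; exact h1
      · have := hmin (j-1) (by omega); push Not at this; exact this (by omega)
    have := ht j (by omega) (by omega) hj
    rw [if_pos hj, if_pos hj1, if_neg hkB, if_pos h2] at this
    simp only [wz] at this
    have hpos : (0:ℤ) < (j + 1) * (n - (j + 1)) := by
      have hlt : ((j+1:ℕ):ℤ) < n := by exact_mod_cast (by omega : j+1<n)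
      push_cast at hlt
      exact mul_pos (by positivity) (by linarith)
    nlinarith
  · intro j0 hj0 hj0n hBj0
    -- maximal element
    have hmax : ∃ j, 1 < j ∧ j < n ∧ B j ∧ ∀ k, j < k → k < n → ¬ B k := by
      refine ⟨Nat.findGreatest (fun k => k < n ∧ B k) n, ?_⟩
      have hs := Nat.findGreatest_spec (P := fun k => k < n ∧ B k) (n := n) (by omega) ⟨hj0n, hBj0⟩
      have hge := Nat.le_findGreatest (P := fun k => k < n ∧ B k) (n := n) (by omega) ⟨hj0n, hBj0⟩
      refine ⟨by omega, hs.1, hs.2, fun k hk hkn hB => ?_⟩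
      exact Nat.findGreatest_is_greatest (P := fun k => k < n ∧ B k) hk (by omega) ⟨hkn, hB⟩
    obtain ⟨j, hj1, hjn, hjB, hjm⟩ := hmax
    have hjne : j ≠ n - 1 := by rintro rfl; exact hN hjB
    have hjs : ¬ B (j + 1) := hjm _ (by omega) (by omega)
    have hj2 : j ≠ 2 := by rintro rfl; exact h2 hjB
    have ht1 := ht j (by omega) hjn hjB
    have hjn' : (j : ℤ) < n - 1 := by have : ((j + 1 : ℕ) : ℤ) < n := by exact_mod_cast (by omega)
                                      push_cast at this; linarith
    have hj3' : (3 : ℤ) ≤ j := by exact_mod_cast (by omega : 3 ≤ j)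
    rw [if_pos hjB, if_neg hjs, if_neg h2] at ht1
    by_cases hjp : B (j - 1)
    · rw [if_pos hjp] at ht1
      simp only [wz] at ht1
      have hz : ((j:ℤ) - 1) * (n - j - 3) = 0 := by linear_combination ht1
      have hj3 : (n : ℤ) = j + 3 := by
        rcases mul_eq_zero.1 hz with h | h
        · linarith
        · linarith
      have hj3n : n = j + 3 := by exact_mod_cast hj3
      -- bottom of run
      have hex : ∃ a, a < j ∧ ∀ k, a < k → k ≤ j → B k := ⟨j - 1, by omega, fun k h h' => by
        have : k = j := by omega
        rw [this]; exact hjB⟩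
      obtain ⟨haj, hak⟩ := Nat.find_spec hex
      have hle : Nat.find hex ≤ j - 2 := Nat.find_min' hex ⟨by omega, fun k h h' => by
        have : k = j ∨ k = j - 1 := by omega
        rcases this with rfl | rfl
        · exact hjB
        · exact hjp⟩
      have hmin : ∀ m < Nat.find hex, ¬ (m < j ∧ ∀ k, m < k → k ≤ j → B k) := fun m hm => Nat.find_min hex hm
      generalize Nat.find hex = a at *
      have ha2 : 2 ≤ a := by
        by_contra h
        exact h2 (hak 2 (by omega) (by omega))
      have haB : ¬ B a := by
        intro haB
        apply hmin (a - 1) (by omega)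
        refine ⟨by omega, fun k hk hkj => ?_⟩
        by_cases hka : k = a
        · rw [hka]; exact haB
        · exact hak k (by omega) hkj
      have hta := ht (a+1) (by omega) (by omega) (hak _ (by omega) (by omega))
      rw [if_pos (hak (a+1) (by omega) (by omega)), if_pos (hak (a+1+1) (by omega) (by omega)), Nat.add_sub_cancel,
        if_neg haB, if_neg h2] at hta
      simp only [wz] at hta
      push_cast at hta
      have hz : ((a:ℤ) - 2) * (n - 2 - a) = 0 := by linear_combination hta
      have ha : a = 2 := by
        rcases mul_eq_zero.1 hz with h | h
        · have : (a:ℤ) = 2 := by linarith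
          exact_mod_cast this
        · exfalso
          have : (n : ℤ) = a + 2 := by linarith
          have : n = a + 2 := by exact_mod_cast this
          omega
      subst ha
      have h3 : B 3 := hak 3 (by omega) (by omega)
      apply hrev j (by omega) hjn hjB
      have : n - j = 3 := by omega
      rw [this]; exact h3
    · rw [if_neg hjp] at ht1
      simp only [wz] at ht1
      have hz : ((j:ℤ) - 1) * (n - 1 - j) = 0 := by linarith
      rcases mul_eq_zero.1 hz with h | h <;> linarith

end C6
end

section
namespace C6
open Polynomial

variable {K : Type*} [Field K] [CharZero K]

def wk (K : Type*) [Field K] (n j : ℕ) : K := (j : K) * ((n : K) - j)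

lemma wk_zero (n : ℕ) : wk K n 0 = 0 := by simp [wk]
lemma wk_self (n : ℕ) : wk K n n = 0 := by simp [wk]
lemma wk_ne {n j : ℕ} (h : 0 < j) (h' : j < n) : wk K n j ≠ 0 := by
  unfold wk
  refine mul_ne_zero (by exact_mod_cast h.ne') (sub_ne_zero.2 (by exact_mod_cast h'.ne'))
lemma wk_rev {n j : ℕ} (h' : j ≤ n) : wk K n (n - j) = wk K n j := by
  unfold wk; push_cast [h']; ring

def TT (K : Type*) [Field K] (n : ℕ) : (ℕ → K) →ₗ[K] (ℕ → K) where
  toFun g j := 2 * wk K n j * g j - wk K n (j-1) * g (j-1) - wk K n (j+1) * g (j+1)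
  map_add' := by intro a b; ext j; simp; ring
  map_smul' := by intro a b; ext j; simp; ring

lemma TT_apply (n : ℕ) (g : ℕ → K) (j : ℕ) : TT K n g j =
  2 * wk K n j * g j - wk K n (j-1) * g (j-1) - wk K n (j+1) * g (j+1) := rfl

def EE (n : ℕ) (g g' : ℕ → K) : Prop := ∀ j, 0 < j → j < n → g j = g' j

lemma TT_congr {n : ℕ} {g g' : ℕ → K} (h : EE n g g') : EE n (TT K n g) (TT K n g') := by
  intro j hj hjn
  rw [TT_apply, TT_apply, h j hj hjn]
  congr 1
  · congr 1
    rcases Nat.eq_zero_or_pos (j - 1) with h0 | h0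
    · rw [h0, wk_zero]; simp
    · rw [h _ h0 (by omega)]
  · rcases Nat.lt_or_ge (j + 1) n with h0 | h0
    · rw [h _ (by omega) h0]
    · have : j + 1 = n := by omega
      rw [this, wk_self]; simp

def Sat (n : ℕ) (S : Submodule K (ℕ → K)) : Prop := ∀ g g', EE n g g' → g ∈ S → g' ∈ S

lemma step0 {n : ℕ} (hn : 3 ≤ n) (S : Submodule K (ℕ → K)) (hs : Sat n S)
    (hT : ∀ g ∈ S, TT K n g ∈ S) (h1 : (Pi.single 1 1 : ℕ → K) ∈ S) : S = ⊤ := by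
  classical
  have hd : ∀ j, 0 < j → j < n → (Pi.single j 1 : ℕ → K) ∈ S := by
    intro j
    induction j using Nat.strong_induction_on with
    | _ j ih =>
      intro hj hjn
      obtain rfl | ⟨k, rfl⟩ : j = 1 ∨ ∃ k, j = k + 2 := by
        by_cases h : j = 1
        · exact Or.inl h
        · exact Or.inr ⟨j - 2, by omega⟩
      · exact h1
      have ha := ih (k+1) (by omega) (by omega) (by omega)
      have hb := hT _ ha
      have hc : (Pi.single k (if 0 < k then 1 else 0) : ℕ → K) ∈ S := by
        split_ifs with h
        · exact ih k (by omega) h (by omega)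
        · simp
      have hw : wk K n (k+1) ≠ 0 := wk_ne (by omega) (by omega)
      refine hs _ _ ?_ (S.smul_mem (wk K n (k+1))⁻¹ (S.sub_mem (S.sub_mem (S.smul_mem (2 * wk K n (k+1)) ha) hb)
        (S.smul_mem (wk K n (k+1)) hc)))
      intro i hi hin
      simp only [Pi.smul_apply, Pi.sub_apply, TT_apply, smul_eq_mul, Pi.single_apply]
      rcases (by omega : i = k ∨ i = k + 1 ∨ i = k + 2 ∨ (i ≠ k ∧ i ≠ k + 1 ∧ i ≠ k + 2)) with rfl | rfl | rfl | ⟨h1, h2, h3⟩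
      · have : i - 1 ≠ i + 1 := by omega
        simp [hi, this]
      · simp
      · simp [hw]
      · have : i - 1 ≠ k + 1 := by omega
        have : i + 1 ≠ k + 1 := by omega
        simp [*]
  rw [eq_top_iff]
  intro g _
  refine hs (∑ j ∈ (Finset.range n).filter (0 < ·), g j • Pi.single j 1) g ?_ ?_
  · intro j hj hjn
    rw [Finset.sum_apply, Finset.sum_eq_single j]
    · simp
    · intro b _ hb; simp [Pi.single_apply, hb.symm]
    · simp [hj, hjn]
  · refine S.sum_mem fun j hj => S.smul_mem _ ?_
    simp at hj
    exact hd j hj.2 hj.1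

lemma aeval_congr {n : ℕ} (p : K[X]) {g g' : ℕ → K} (h : EE n g g') :
    EE n (aeval (TT K n) p g) (aeval (TT K n) p g') := by
  induction p using Polynomial.induction_on' with
  | add p q hp hq =>
    intro j hj hjn
    simp only [map_add, LinearMap.add_apply, Pi.add_apply, hp j hj hjn, hq j hj hjn]
  | monomial k a =>
    have : ∀ k : ℕ, EE n ((TT K n ^ k) g) ((TT K n ^ k) g') := by
      intro k
      induction k with
      | zero => simpa using h
      | succ k ih => rw [pow_succ', Module.End.mul_apply, Module.End.mul_apply]; exact TT_congr ih
    intro j hj hjn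
    simp [aeval_monomial, this k j hj hjn, Module.End.mul_apply]

def RR (K : Type*) [Field K] (n : ℕ) : (ℕ → K) →ₗ[K] (ℕ → K) where
  toFun g j := g (n - j)
  map_add' := by intro a b; rfl
  map_smul' := by intro a b; rfl

lemma RR_apply (n : ℕ) (g : ℕ → K) (j : ℕ) : RR K n g j = g (n - j) := rfl

lemma RR_congr {n : ℕ} {g g' : ℕ → K} (h : EE n g g') : EE n (RR K n g) (RR K n g') :=
  fun j hj hjn => h (n - j) (by omega) (by omega)

lemma RR_TT {n : ℕ} (g : ℕ → K) : EE n (RR K n (TT K n g)) (TT K n (RR K n g)) := by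
  intro j hj hjn
  simp only [RR_apply, TT_apply]
  rw [wk_rev hjn.le, ← wk_rev (K := K) (show j - 1 ≤ n by omega), ← wk_rev (K := K) (show j + 1 ≤ n by omega)]
  have h1 : n - j - 1 = n - (j + 1) := by omega
  have h2 : n - j + 1 = n - (j - 1) := by omega
  rw [h1, h2]; ring

lemma EE.symm {n : ℕ} {g g' : ℕ → K} (h : EE n g g') : EE n g' g := fun j a b => (h j a b).symm
lemma EE.trans {n : ℕ} {g g' g'' : ℕ → K} (h : EE n g g') (h' : EE n g' g'') : EE n g g'' :=
  fun j a b => (h j a b).trans (h' j a b)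

lemma aeval_mem {V : Type*} [AddCommGroup V] [Module K V] {T : Module.End K V} (M : Submodule K V)
    (hT : ∀ g ∈ M, T g ∈ M) (p : K[X]) {g : V} (hg : g ∈ M) : aeval T p g ∈ M := by
  induction p using Polynomial.induction_on' with
  | add p q hp hq => rw [map_add, LinearMap.add_apply]; exact M.add_mem hp hq
  | monomial k a =>
    have : ∀ k : ℕ, (T ^ k) g ∈ M := by
      intro k
      induction k with
      | zero => simpa using hg
      | succ k ih => rw [pow_succ', Module.End.mul_apply]; exact hT _ ih
    rw [aeval_monomial, Module.End.mul_apply, Module.algebraMap_end_apply]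
    exact M.smul_mem _ (this k)

/-- T-closed saturated implies R-closed -/
lemma step1 {n : ℕ} (hn : 3 ≤ n) (M : Submodule K (ℕ → K)) (hs : Sat n M)
    (hT : ∀ g ∈ M, TT K n g ∈ M) : ∀ g ∈ M, RR K n g ∈ M := by
  classical
  let S : Submodule K (ℕ → K) :=
    { carrier := {g | ∃ p : K[X], EE n (aeval (TT K n) p (Pi.single 1 1)) g}
      zero_mem' := ⟨0, by intro j _ _; simp⟩
      add_mem' := by
        rintro a b ⟨p, hp⟩ ⟨q, hq⟩
        exact ⟨p + q, fun j hj hjn => by simp [hp j hj hjn, hq j hj hjn]⟩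
      smul_mem' := by
        rintro c a ⟨p, hp⟩
        exact ⟨c • p, fun j hj hjn => by simp [hp j hj hjn]⟩ }
  have hS : S = ⊤ := by
    apply step0 hn
    · rintro g g' h ⟨p, hp⟩; exact ⟨p, hp.trans h⟩
    · rintro g ⟨p, hp⟩
      refine ⟨X * p, ?_⟩
      rw [map_mul, aeval_X, Module.End.mul_apply]
      exact TT_congr hp
    · exact ⟨1, fun j _ _ => by simp⟩
  obtain ⟨p, hp⟩ : RR K n (Pi.single 1 1) ∈ S := by rw [hS]; trivial
  let S2 : Submodule K (ℕ → K) :=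
    { carrier := {g | EE n (aeval (TT K n) p g) (RR K n g)}
      zero_mem' := by intro j _ _; simp
      add_mem' := by
        rintro a b hp hq j hj hjn
        simp [hp j hj hjn, hq j hj hjn]
      smul_mem' := by
        rintro c a hp j hj hjn
        simp [hp j hj hjn] }
  have hS2 : S2 = ⊤ := by
    apply step0 hn
    · intro g g' h hg
      exact (aeval_congr p h).symm.trans (EE.trans hg (RR_congr h))
    · intro g hg
      have : aeval (TT K n) p (TT K n g) = TT K n (aeval (TT K n) p g) := by
        have : aeval (TT K n) p * TT K n = TT K n * aeval (TT K n) p := by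
          have h : aeval (TT K n) (p * X) = aeval (TT K n) (X * p) := by rw [mul_comm]
          simpa using h
        exact congrArg (fun F => F g) this
      show EE n _ _
      rw [this]
      exact (TT_congr hg).trans (RR_TT g).symm
    · exact hp
  intro g hg
  have h : g ∈ S2 := by rw [hS2]; trivial
  refine hs _ _ h ?_
  exact aeval_mem M hT p hg

lemma wk_wz (n j : ℕ) : wk K n j = (wz n j : K) := by simp [wk, wz]

lemma M_top {n : ℕ} (hn : 3 ≤ n) (M : Submodule K (ℕ → K)) (hs : Sat n M)
    (hT : ∀ g ∈ M, TT K n g ∈ M) (hone : (1 : ℕ → K) ∈ M) (hmul : ∀ g ∈ M, ∀ g' ∈ M, g * g' ∈ M)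
    (hodd : ∃ g ∈ M, ∃ j, 0 < j ∧ j < n ∧ g j ≠ g (n - j)) : M = ⊤ := by
  classical
  have hR := step1 hn M hs hT
  -- step 2
  have h2 : ∃ g ∈ M, g 1 ≠ g (n - 1) := by
    by_contra hcon
    push Not at hcon
    obtain ⟨g, hg, j, hj, hjn, hne⟩ := hodd
    have key : ∀ k, ∀ d ∈ M, EE n (RR K n d) (-d) → k + 1 < n → d (k + 1) = 0 := by
      intro k
      induction k using Nat.strong_induction_on with
      | _ k ih =>
        intro d hd hdo hk
        rcases k with _ | k
        · have h1 := hcon d hd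
          have h2 := hdo 1 one_pos (by omega)
          rw [RR_apply, Pi.neg_apply, ← h1] at h2
          simp only [zero_add]
          exact self_eq_neg.1 h2
        · have h1 := ih k (by omega) (TT K n d) (hT d hd) (by
            refine (RR_TT d).trans ((TT_congr hdo).trans ?_)
            rw [map_neg]
            intro j _ _; rfl) (by omega)
          rw [TT_apply, ih k (by omega) d hd hdo (by omega)] at h1
          have h3 : wk K n (k + 1 - 1) * d (k + 1 - 1) = 0 := by
            rw [Nat.add_sub_cancel]
            rcases k with _ | k
            · rw [wk_zero, zero_mul]
            · rw [ih k (by omega) d hd hdo (by omega), mul_zero]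
          rw [h3] at h1
          simpa [wk_ne (K := K) (show 0 < k + 1 + 1 by omega) hk] using h1
    have := key (j - 1) (g - RR K n g) (M.sub_mem hg (hR g hg)) (by
      intro i hi hin
      simp only [RR_apply, Pi.sub_apply, Pi.neg_apply]
      rw [show n - (n - i) = i by omega]; ring) (by omega)
    rw [show j - 1 + 1 = j by omega, Pi.sub_apply, RR_apply] at this
    exact hne (sub_eq_zero.1 this)
  let B : ℕ → Prop := fun j => ∀ g ∈ M, g j = g 1
  have hrev : ∀ j, 0 < j → j < n → B j → ¬ B (n - j) := by
    intro j hj hjn hB hB'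
    obtain ⟨g, hg, hne⟩ := h2
    have h3 := hB _ (hR g hg)
    rw [RR_apply, RR_apply, hB' g hg] at h3
    exact hne h3
  have hh : ∀ i, ∃ h ∈ M, (∀ j, B j → h j = 1) ∧ (¬ B i → h i = 0) := by
    intro i
    by_cases hi : B i
    · exact ⟨1, hone, fun j _ => rfl, fun h => absurd hi h⟩
    · have hi' := hi
      simp only [B] at hi'
      push Not at hi'
      obtain ⟨g, hg, hne⟩ := hi'
      have hne' : g 1 - g i ≠ 0 := sub_ne_zero.2 hne.symm
      refine ⟨(g 1 - g i)⁻¹ • (g - (g i) • (1 : ℕ → K)), M.smul_mem _ (M.sub_mem hg (M.smul_mem _ hone)), ?_, ?_⟩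
      · intro j hj
        simp [hj g hg, hne']
      · intro _; simp
  choose h hhM hh1 hh0 using hh
  have hprod : ∀ s : Finset ℕ, ∏ i ∈ s, h i ∈ M := by
    intro s
    induction s using Finset.induction_on with
    | empty => simpa using hone
    | insert a s ha ih => rw [Finset.prod_insert ha]; exact hmul _ (hhM a) _ ih
  set χ := ∏ i ∈ Finset.range n, h i with hχ
  have hχM : χ ∈ M := hprod _
  have hχv : ∀ j, j < n → χ j = if B j then 1 else 0 := by
    intro j hj
    rw [hχ, Finset.prod_apply]
    split_ifs with hB
    · exact Finset.prod_eq_one fun i _ => hh1 i j hB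
    · exact Finset.prod_eq_zero (Finset.mem_range.2 hj) (hh0 j hB)
  have hB1 : B 1 := fun g _ => rfl
  have hwχ : ∀ j, j ≤ n → wk K n j * χ j = ((wz n j * (if B j then 1 else 0) : ℤ) : K) := by
    intro j hj
    rw [wk_wz]
    rcases hj.lt_or_eq with hj | rfl
    · rw [hχv j hj]; push_cast; rfl
    · simp [wz]
  have hres := comb n hn B hB1 hrev (by
    intro j hj hjn hB
    have e1 := hB _ (hT χ hχM)
    rw [TT_apply, TT_apply, mul_assoc, mul_assoc, hwχ j hjn.le, hwχ (j-1) (by omega), hwχ (j+1) (by omega),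
      hwχ 1 (by omega), Nat.sub_self, wk_zero, zero_mul, sub_zero, hwχ 2 (by omega)] at e1
    have e2 : (2 * (wz n j * (if B j then 1 else 0)) - wz n ((j - 1 : ℕ) : ℤ) * (if B (j-1) then 1 else 0)
        - wz n ((j + 1 : ℕ) : ℤ) * (if B (j+1) then 1 else 0) : ℤ) =
        2 * (wz n ((1 : ℕ) : ℤ) * (if B 1 then 1 else 0)) - wz n ((2 : ℕ) : ℤ) * (if B 2 then 1 else 0) := by
      exact_mod_cast e1
    rw [if_pos hB1] at e2
    rw [show ((j - 1 : ℕ) : ℤ) = j - 1 by omega] at e2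
    push_cast at e2
    linarith)
  refine step0 hn M hs hT (hs χ _ ?_ hχM)
  intro j hj hjn
  rw [hχv j hjn, Pi.single_apply]
  by_cases hj1 : j = 1
  · subst hj1; simp [hB1]
  · rw [if_neg (hres j (by omega) hjn), if_neg hj1]
end C6
end

section
namespace C6
open Polynomial Matrix

variable {K : Type*} [Field K] [CharZero K] {n : ℕ}

def UU (n : ℕ) (g : ℕ → K) : Matrix (Fin n) (Fin n) K :=
  Matrix.of fun i k => if (i : ℕ) + 1 = k then g k else 0
def DD (n : ℕ) (g : ℕ → K) : Matrix (Fin n) (Fin n) K :=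
  Matrix.of fun i k => if (k : ℕ) + 1 = i then g i else 0

lemma UU_mul (g : ℕ → K) (X : Matrix (Fin n) (Fin n) K) {i i' : Fin n} (j) (h : (i' : ℕ) = i + 1) :
    (UU n g * X) i j = g i' * X i' j := by
  rw [Matrix.mul_apply, Finset.sum_eq_single i']
  · simp [UU, h]
  · intro b _ hb
    have : (i : ℕ) + 1 ≠ b := fun h' => hb (Fin.ext (by omega))
    simp [UU, this]
  · simp
lemma UU_mul_last (g : ℕ → K) (X : Matrix (Fin n) (Fin n) K) {i : Fin n} (j) (h : (i : ℕ) + 1 = n) :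
    (UU n g * X) i j = 0 := by
  rw [Matrix.mul_apply]
  refine Finset.sum_eq_zero fun b _ => ?_
  have : (i : ℕ) + 1 ≠ b := by have := b.2; omega
  simp [UU, this]
lemma mul_UU (g : ℕ → K) (X : Matrix (Fin n) (Fin n) K) (i) {j j' : Fin n} (h : (j' : ℕ) + 1 = j) :
    (X * UU n g) i j = X i j' * g j := by
  rw [Matrix.mul_apply, Finset.sum_eq_single j']
  · simp [UU, h]
  · intro b _ hb
    have : (b : ℕ) + 1 ≠ j := fun h' => hb (Fin.ext (by omega))
    simp [UU, this]
  · simp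
lemma mul_UU_zero (g : ℕ → K) (X : Matrix (Fin n) (Fin n) K) (i) {j : Fin n} (h : (j : ℕ) = 0) :
    (X * UU n g) i j = 0 := by
  rw [Matrix.mul_apply]
  refine Finset.sum_eq_zero fun b _ => ?_
  have : (b : ℕ) + 1 ≠ j := by omega
  simp [UU, this]
lemma UU_transpose (g : ℕ → K) : (UU n g)ᵀ = DD n g := by ext i j; simp [UU, DD]
lemma DD_transpose (g : ℕ → K) : (DD n g)ᵀ = UU n g := by ext i j; simp [UU, DD]
lemma mul_DD (g : ℕ → K) (X : Matrix (Fin n) (Fin n) K) (i) {j j' : Fin n} (h : (j' : ℕ) = j + 1) :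
    (X * DD n g) i j = X i j' * g j' := by
  have := UU_mul g Xᵀ i h
  rw [← UU_transpose, ← Matrix.transpose_apply (X * _), transpose_mul, transpose_transpose, this,
    transpose_apply, mul_comm]
lemma mul_DD_last (g : ℕ → K) (X : Matrix (Fin n) (Fin n) K) (i) {j : Fin n} (h : (j : ℕ) + 1 = n) :
    (X * DD n g) i j = 0 := by
  have := UU_mul_last g Xᵀ i h
  rw [← UU_transpose, ← Matrix.transpose_apply (X * _), transpose_mul, transpose_transpose, this]
lemma DD_mul (g : ℕ → K) (X : Matrix (Fin n) (Fin n) K) {i i' : Fin n} (j) (h : (i' : ℕ) + 1 = i) :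
    (DD n g * X) i j = g i * X i' j := by
  have := mul_UU g Xᵀ j h
  rw [← UU_transpose, ← Matrix.transpose_apply (_ * X), transpose_mul, transpose_transpose, this,
    transpose_apply, mul_comm]
lemma DD_mul_zero (g : ℕ → K) (X : Matrix (Fin n) (Fin n) K) {i : Fin n} (j) (h : (i : ℕ) = 0) :
    (DD n g * X) i j = 0 := by
  have := mul_UU_zero g Xᵀ j h
  rw [← UU_transpose, ← Matrix.transpose_apply (_ * X), transpose_mul, transpose_transpose, this]

lemma rowkill (X : Matrix (Fin n) (Fin n) K) (h0 : ∀ i : Fin n, (i : ℕ) = 0 → ∀ j, X i j = 0)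
    (h : ∀ i i' : Fin n, (i' : ℕ) = i + 1 → (∀ j, X i j = 0) → ∀ j, X i' j = 0) : X = 0 := by
  have : ∀ k : ℕ, ∀ i : Fin n, (i : ℕ) = k → ∀ j, X i j = 0 := by
    intro k
    induction k with
    | zero => exact h0
    | succ k ih => intro i hi; exact h ⟨k, by have := i.2; omega⟩ i hi (ih _ rfl)
  ext i j; exact this _ i rfl j

lemma e_kill' {X : Matrix (Fin n) (Fin n) K} (h : UU n 1 * X + X * DD n 1 = 0)
    (h0 : ∀ i : Fin n, (i : ℕ) = 0 → ∀ j, X i j = 0) : X = 0 := by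
  refine rowkill X h0 fun i i' hi hz j => ?_
  have h1 := congrFun (congrFun h i) j
  rw [Matrix.add_apply, UU_mul _ _ _ hi] at h1
  rw [Pi.one_apply, one_mul] at h1
  rw [eq_neg_of_add_eq_zero_left h1, neg_eq_zero]
  rcases Nat.lt_or_ge ((j : ℕ) + 1) n with hj | hj
  · rw [mul_DD (j' := ⟨j + 1, hj⟩) _ _ _ rfl, hz, zero_mul]
  · exact mul_DD_last _ _ _ (by omega)

lemma f_kill {X : Matrix (Fin n) (Fin n) K} (h : DD n (wk K n) * X = X * DD n (wk K n))
    (h0 : ∀ j : Fin n, (j : ℕ) = 0 → ∀ i, X i j = 0) : X = 0 := by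
  have aux : ∀ i : Fin n, (∀ j, (DD n (wk K n) * X) i j = 0) → ∀ j, X i j = 0 := by
    intro i hi j
    rcases Nat.eq_zero_or_pos (j : ℕ) with hj | hj
    · exact h0 j hj i
    · have := hi ⟨j - 1, by omega⟩
      rw [h, mul_DD (j' := j) _ _ _ (by simp; omega)] at this
      exact (mul_eq_zero.1 this).resolve_right (wk_ne hj j.2)
  refine rowkill X (fun i hi => aux i fun j => DD_mul_zero _ _ _ hi) fun i i' hi hz => aux i' fun j => ?_
  rw [DD_mul (i' := i) _ _ _ hi.symm, hz, mul_zero]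

lemma f_kill' {X : Matrix (Fin n) (Fin n) K} (h : DD n (wk K n) * X + X * UU n (wk K n) = 0)
    (h0 : ∀ j : Fin n, (j : ℕ) + 1 = n → ∀ i, X i j = 0) : X = 0 := by
  have aux : ∀ i : Fin n, (∀ j, (DD n (wk K n) * X) i j = 0) → ∀ j, X i j = 0 := by
    intro i hi j
    rcases Nat.lt_or_ge ((j : ℕ) + 1) n with hj | hj
    · have := hi ⟨j + 1, hj⟩
      rw [eq_neg_of_add_eq_zero_left h, Matrix.neg_apply, neg_eq_zero, mul_UU (j' := j) _ _ _ rfl] at this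
      exact (mul_eq_zero.1 this).resolve_right (wk_ne (by simp) hj)
    · exact h0 j (by omega) i
  refine rowkill X (fun i hi => aux i fun j => DD_mul_zero _ _ _ hi) fun i i' hi hz => aux i' fun j => ?_
  rw [DD_mul (i' := i) _ _ _ hi.symm, hz, mul_zero]

def Hom (k : ℤ) (X : Matrix (Fin n) (Fin n) K) : Prop :=
  ∀ i j : Fin n, ((j : ℕ) : ℤ) - (i : ℕ) ≠ k → X i j = 0

lemma Hom.mul {k l : ℤ} {X Y : Matrix (Fin n) (Fin n) K} (hX : Hom k X) (hY : Hom l Y) : Hom (k + l) (X * Y) := by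
  intro i j hij
  rw [Matrix.mul_apply]
  refine Finset.sum_eq_zero fun b _ => ?_
  by_cases h : ((b : ℕ) : ℤ) - (i : ℕ) = k
  · rw [hY b j (by omega), mul_zero]
  · rw [hX i b h, zero_mul]
lemma Hom.sub {k : ℤ} {X Y : Matrix (Fin n) (Fin n) K} (hX : Hom k X) (hY : Hom k Y) : Hom k (X - Y) := by
  intro i j hij
  rw [Matrix.sub_apply, hX i j hij, hY i j hij, sub_zero]
lemma Hom.br {k l : ℤ} {X Y : Matrix (Fin n) (Fin n) K} (hX : Hom k X) (hY : Hom l Y) :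
    Hom (k + l) (X * Y - Y * X) := (hX.mul hY).sub (by rw [add_comm]; exact hY.mul hX)
lemma hom_UU (g : ℕ → K) : Hom 1 (UU n g) := by
  intro i j h; simp only [UU, of_apply]; rw [if_neg]; omega
lemma hom_DD (g : ℕ → K) : Hom (-1) (DD n g) := by
  intro i j h; simp only [DD, of_apply]; rw [if_neg]; omega

def getU (X : Matrix (Fin n) (Fin n) K) : ℕ → K := fun j => if h : 0 < j ∧ j < n then X ⟨j - 1, by omega⟩ ⟨j, h.2⟩ else 0
lemma UU_getU {X : Matrix (Fin n) (Fin n) K} (hX : Hom 1 X) : UU n (getU X) = X := by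
  ext i j
  simp only [UU, of_apply, getU]
  split_ifs with h h'
  · congr 1; ext; simp; omega
  · have := j.2; omega
  · rw [hX i j (by omega)]
lemma hom_zero {X : Matrix (Fin n) (Fin n) K} (hX : Hom 0 X) : X = diagonal fun i => X i i := by
  ext i j
  rw [diagonal_apply]
  split_ifs with h
  · rw [h]
  · rw [hX i j]; intro h'; apply h; ext; omega

lemma UU_EE {g g' : ℕ → K} (h : EE n g g') : UU n g = UU n g' := by
  ext i j; simp only [UU, of_apply]; split_ifs with h'
  · exact h j (by omega) j.2
  · rfl

lemma diag_UU (d : Fin n → K) (g q : ℕ → K)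
    (hd : ∀ i j : Fin n, (i : ℕ) + 1 = j → q j = (d i - d j) * g j) :
    diagonal d * UU n g - UU n g * diagonal d = UU n q := by
  ext i j
  rw [Matrix.sub_apply, diagonal_mul, mul_diagonal]
  simp only [UU, of_apply]
  split_ifs with h
  · rw [hd i j h]; ring
  · simp
lemma diag_DD (d : Fin n → K) (g q : ℕ → K)
    (hd : ∀ i j : Fin n, (j : ℕ) + 1 = i → q i = (d i - d j) * g i) :
    diagonal d * DD n g - DD n g * diagonal d = DD n q := by
  ext i j
  rw [Matrix.sub_apply, diagonal_mul, mul_diagonal]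
  simp only [DD, of_apply]
  split_ifs with h
  · rw [hd i j h]; ring
  · simp

/-- `[U g, D w]` is diagonal -/
lemma UU_DD (g w : ℕ → K) (h0 : w 0 = 0) (hn : w n = 0) :
    UU n g * DD n w - DD n w * UU n g = diagonal fun i : Fin n => g (i + 1) * w (i + 1) - w i * g i := by
  ext i j
  rw [Matrix.sub_apply]
  have e1 : (UU n g * DD n w) i j = if i = j then g (i+1) * w (i+1) else 0 := by
    rcases Nat.lt_or_ge ((i : ℕ) + 1) n with hj | hj
    · rw [UU_mul (i' := ⟨i + 1, hj⟩) _ _ _ rfl]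
      by_cases h : i = j
      · subst h; simp [DD]
      · have : (j : ℕ) ≠ i := fun h' => h (Fin.ext h'.symm)
        simp [DD, h, this]
    · rw [UU_mul_last _ _ _ (by omega), show (i : ℕ) + 1 = n by omega, hn]; simp
  have e2 : (DD n w * UU n g) i j = if i = j then w i * g i else 0 := by
    rcases Nat.eq_zero_or_pos (i : ℕ) with hj | hj
    · rw [DD_mul_zero _ _ _ hj, hj, h0]; simp
    · rw [DD_mul (i' := ⟨i - 1, by omega⟩) _ _ _ (by simp; omega)]
      by_cases h : i = j
      · subst h; simp [UU, show (i : ℕ) - 1 + 1 = i by omega]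
      · have : (j : ℕ) ≠ i := fun h' => h (Fin.ext h'.symm)
        have : (i : ℕ) - 1 + 1 ≠ j := by omega
        simp [UU, h, this]
  rw [e1, e2, diagonal_apply]
  split_ifs <;> simp

lemma UU_add (g g' : ℕ → K) : UU n (g + g') = UU n g + UU n g' := by
  ext i j; simp [UU]; split_ifs <;> simp
lemma UU_smul (c : K) (g : ℕ → K) : UU n (c • g) = c • UU n g := by
  ext i j; simp [UU]
lemma UU_zero : UU n (0 : ℕ → K) = 0 := by
  ext i j; simp [UU]
lemma UU_TT (g : ℕ → K) :
    (UU n g * DD n (wk K n) - DD n (wk K n) * UU n g) * UU n 1 - UU n 1 * (UU n g * DD n (wk K n) - DD n (wk K n) * UU n g)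
     = UU n (TT K n g) := by
  rw [UU_DD _ _ (wk_zero n) (wk_self n)]
  refine diag_UU _ _ _ fun i j h => ?_
  rw [TT_apply, ← h, Nat.add_sub_cancel]
  simp; ring
end C6
end

section
namespace C6
open Polynomial Matrix

variable {K : Type*} [Field K] [CharZero K] {n : ℕ}

def HH (K : Type*) [Field K] (n : ℕ) : Matrix (Fin n) (Fin n) K := diagonal fun i => (n : K) - 1 - 2 * (i : ℕ)

def brL (A : Matrix (Fin n) (Fin n) K) : Module.End K (Matrix (Fin n) (Fin n) K) :=
  LinearMap.mulLeft K A - LinearMap.mulRight K A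
lemma brL_apply (A X : Matrix (Fin n) (Fin n) K) : brL A X = A * X - X * A := rfl

lemma aeval_brL_HH (p : K[X]) (Y : Matrix (Fin n) (Fin n) K) (i j : Fin n) :
    (aeval (brL (HH K n)) p Y) i j = p.eval (2 * (((j : ℕ) : K) - (i : ℕ))) * Y i j := by
  induction p using Polynomial.induction_on' with
  | add p q hp hq => rw [map_add, LinearMap.add_apply, Matrix.add_apply, hp, hq, eval_add, add_mul]
  | monomial k a =>
    rw [aeval_monomial, Module.End.mul_apply, Module.algebraMap_end_apply, Matrix.smul_apply, eval_monomial,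
      smul_eq_mul, mul_assoc]
    congr 1
    induction k with
    | zero => simp
    | succ k ih =>
      rw [pow_succ', Module.End.mul_apply, brL_apply, Matrix.sub_apply, HH, diagonal_mul, mul_diagonal, ← HH, ih]
      ring

/-- homogeneous component -/
def cmp (k : ℤ) (X : Matrix (Fin n) (Fin n) K) : Matrix (Fin n) (Fin n) K :=
  Matrix.of fun i j => if ((j : ℕ) : ℤ) - (i : ℕ) = k then X i j else 0
lemma hom_cmp (k : ℤ) (X : Matrix (Fin n) (Fin n) K) : Hom k (cmp k X) := by
  intro i j h; simp [cmp, h]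
lemma sum_cmp (X : Matrix (Fin n) (Fin n) K) : ∑ k ∈ Finset.Ioo (-(n:ℤ)) n, cmp k X = X := by
  ext i j
  rw [Matrix.sum_apply, Finset.sum_eq_single (((j : ℕ) : ℤ) - (i : ℕ))]
  · simp [cmp]
  · intro b _ hb; simp [cmp, hb.symm]
  · intro h; exfalso; apply h; simp; omega

lemma cmp_mem (L : Submodule K (Matrix (Fin n) (Fin n) K)) (hL : ∀ X ∈ L, HH K n * X - X * HH K n ∈ L)
    (k : ℤ) {X : Matrix (Fin n) (Fin n) K} (hX : X ∈ L) : cmp k X ∈ L := by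
  classical
  by_cases hk : k ∈ Finset.Ioo (-(n:ℤ)) n
  · have := aeval_mem L (T := brL (HH K n)) hL (Lagrange.basis (Finset.Ioo (-(n:ℤ)) n) (fun k => 2 * (k : K)) k) hX
    convert this using 1
    ext i j
    rw [aeval_brL_HH]
    have hinj : Set.InjOn (fun k : ℤ => 2 * (k : K)) (Finset.Ioo (-(n:ℤ)) n : Finset ℤ) := by
      intro a _ b _ h
      have : (a : K) = b := by simpa using h
      exact_mod_cast this
    have hm : (((j : ℕ) : ℤ) - (i : ℕ)) ∈ Finset.Ioo (-(n:ℤ)) n := by simp; omega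
    have e : (2 * (((j : ℕ) : K) - (i : ℕ))) = (fun k : ℤ => 2 * (k : K)) (((j : ℕ) : ℤ) - (i : ℕ)) := by simp
    rw [e]
    simp only [cmp, of_apply]
    split_ifs with h
    · subst h
      rw [Lagrange.eval_basis_self hinj hm, one_mul]
    · have h0 := Lagrange.eval_basis_of_ne (v := fun k : ℤ => 2 * (k : K)) (Ne.symm h) hm
      have h0' : eval (2 * (((((j : ℕ) : ℤ) - (i : ℕ)) : ℤ) : K)) (Lagrange.basis (Finset.Ioo (-(n:ℤ)) n) (fun k : ℤ => 2 * (k : K)) k) = 0 := h0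
      rw [h0', zero_mul]
  · have : cmp k X = 0 := by
      ext i j
      simp only [cmp, of_apply, Matrix.zero_apply]
      rw [if_neg]
      rintro rfl
      apply hk; simp; omega
    rw [this]; exact L.zero_mem

def JJ (K : Type*) [Field K] (n : ℕ) : Matrix (Fin n) (Fin n) K :=
  Matrix.of fun i j => if (i : ℕ) + j + 1 = n then (-1) ^ (i : ℕ) else 0

lemma mul_JJ (X : Matrix (Fin n) (Fin n) K) (i j : Fin n) : (X * JJ K n) i j = X i j.rev * (-1) ^ (j.rev : ℕ) := by
  rw [Matrix.mul_apply, Finset.sum_eq_single j.rev]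
  · have : (j.rev : ℕ) + j + 1 = n := by rw [Fin.val_rev]; omega
    simp only [JJ, of_apply, if_pos this]
  · intro b _ hb
    have : (b : ℕ) + j + 1 ≠ n := by
      intro h; apply hb; ext; rw [Fin.val_rev]; omega
    simp [JJ, this]
  · simp
lemma JJ_mul (X : Matrix (Fin n) (Fin n) K) (i j : Fin n) : (JJ K n * X) i j = (-1) ^ (i : ℕ) * X i.rev j := by
  rw [Matrix.mul_apply, Finset.sum_eq_single i.rev]
  · have : (i : ℕ) + i.rev + 1 = n := by rw [Fin.val_rev]; omega
    simp only [JJ, of_apply, if_pos this]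
  · intro b _ hb
    have : (i : ℕ) + b + 1 ≠ n := by
      intro h; apply hb; ext; rw [Fin.val_rev]; omega
    simp [JJ, this]
  · simp

lemma e_JJ : UU n 1 * JJ K n + JJ K n * DD n 1 = 0 := by
  ext i j
  rw [Matrix.add_apply, Matrix.zero_apply, mul_JJ, JJ_mul]
  simp only [UU, DD, of_apply, Fin.val_rev, Pi.one_apply]
  by_cases h : (i : ℕ) + j + 2 = n
  · rw [if_pos (by omega), if_pos (by omega), show n - (j + 1) = i + 1 by omega, pow_succ]; ring
  · rw [if_neg (by omega), if_neg (by omega)]; simp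
lemma f_JJ : DD n (wk K n) * JJ K n + JJ K n * UU n (wk K n) = 0 := by
  ext i j
  rw [Matrix.add_apply, Matrix.zero_apply, mul_JJ, JJ_mul]
  simp only [UU, DD, of_apply, Fin.val_rev, Pi.one_apply]
  by_cases h : (i : ℕ) + j = n
  · rw [if_pos (by omega), if_pos (by omega), show (j : ℕ) = n - i by omega, wk_rev (by omega),
      show n - (n - i + 1) = i - 1 by omega]
    obtain ⟨k, hk⟩ : ∃ k, (i : ℕ) = k + 1 := ⟨i - 1, by omega⟩
    rw [hk, pow_succ, Nat.add_sub_cancel]; ring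
  · rw [if_neg (by omega), if_neg (by omega)]; simp

/-- the defect of X preserving the form J -/
def YY (X : Matrix (Fin n) (Fin n) K) : Matrix (Fin n) (Fin n) K := X * JJ K n + JJ K n * Xᵀ

lemma YY_br {A : Matrix (Fin n) (Fin n) K} (hA : A * JJ K n + JJ K n * Aᵀ = 0) (X : Matrix (Fin n) (Fin n) K) :
    YY (A * X - X * A) = A * YY X + YY X * Aᵀ := by
  have h : A * JJ K n = - (JJ K n * Aᵀ) := eq_neg_of_add_eq_zero_left hA
  have h1 : X * (A * JJ K n) = X * (-(JJ K n * Aᵀ)) := by rw [h]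
  have h2 : (A * JJ K n) * Xᵀ = -(JJ K n * Aᵀ) * Xᵀ := by rw [h]
  simp only [YY, transpose_sub, transpose_mul, mul_sub, sub_mul, mul_add, add_mul, mul_assoc, neg_mul, mul_neg] at h1 h2 ⊢
  rw [h1, h2]; abel

lemma YY_apply (X : Matrix (Fin n) (Fin n) K) (i j : Fin n) :
    YY X i j = X i j.rev * (-1) ^ (j.rev : ℕ) + (-1) ^ (i : ℕ) * X j i.rev := by
  rw [YY, Matrix.add_apply, mul_JJ, JJ_mul, transpose_apply]

lemma YY_hom {k : ℤ} {X : Matrix (Fin n) (Fin n) K} (hX : Hom k X) (i j : Fin n)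
    (h : ((i : ℕ) : ℤ) + (j : ℕ) ≠ n - 1 - k) : YY X i j = 0 := by
  rw [YY_apply, hX i j.rev, hX j i.rev]
  · simp
  · rw [Fin.val_rev]; have := i.2; push_cast [i.2]; omega
  · rw [Fin.val_rev]; have := j.2; push_cast [j.2]; omega

variable (L : Submodule K (Matrix (Fin n) (Fin n) K))

lemma even_case (hn : 3 ≤ n) (hodd : Odd n) (hbr : ∀ X ∈ L, ∀ Y ∈ L, X * Y - Y * X ∈ L) (htr : ∀ X ∈ L, trace X = 0)
    (he : UU n 1 ∈ L) (hf : DD n (wk K n) ∈ L) (hh : HH K n ∈ L)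
    (hev : ∀ g, UU n g ∈ L → ∀ j, 0 < j → j < n → g j = g (n - j)) : ∀ X ∈ L, YY X = 0 := by
  have he' : (UU n 1 : Matrix (Fin n) (Fin n) K) * JJ K n + JJ K n * (UU n 1)ᵀ = 0 := by rw [UU_transpose]; exact e_JJ
  have hf' : (DD n (wk K n) : Matrix (Fin n) (Fin n) K) * JJ K n + JJ K n * (DD n (wk K n))ᵀ = 0 := by
    rw [DD_transpose]; exact f_JJ
  have hpos : ∀ k : ℕ, ∀ X ∈ L, Hom (k + 1) X → YY X = 0 := by
    intro k
    induction k with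
    | zero =>
      intro X hX hh
      rw [Nat.cast_zero, zero_add] at hh
      have hU := UU_getU hh
      have hg := hev (getU X) (by rw [hU]; exact hX)
      ext i j
      by_cases h : ((i : ℕ) : ℤ) + (j : ℕ) = n - 1 - 1
      · have h' : (i : ℕ) + j + 2 = n := by omega
        rw [YY_apply, ← hU]
        simp only [UU, of_apply, Fin.val_rev, Matrix.zero_apply]
        rw [if_pos (by omega), if_pos (by omega), hg (n - (j + 1)) (by omega) (by omega),
          show n - (n - (j + 1)) = n - (i + 1) by omega, show n - (j + 1) = i + 1 by omega, pow_succ]; ring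
      · exact YY_hom hh i j (by exact h)
    | succ k ih =>
      intro X hX hh
      have h1 := ih _ (hbr _ hf _ hX) (by
        have := (hom_DD (n := n) (wk K n)).br hh
        convert this using 1; push_cast; ring)
      rw [YY_br hf', DD_transpose] at h1
      refine f_kill' h1 fun j hj i => YY_hom hh i j ?_
      push_cast; omega
  have hzero : ∀ X ∈ L, Hom 0 X → YY X = 0 := by
    intro X hX hh
    have h1 := hpos 0 _ (hbr _ he _ hX) (by
        have := (hom_UU (n := n) (1 : ℕ → K)).br hh
        convert this using 1; simp)
    rw [YY_br he', UU_transpose] at h1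
    have hsum : ∀ i : Fin n, X i i + X i.rev i.rev = X ⟨0, by omega⟩ ⟨0, by omega⟩ + X (Fin.rev ⟨0, by omega⟩) (Fin.rev ⟨0, by omega⟩) := by
      have : ∀ k : ℕ, ∀ hk : k < n, X ⟨k, hk⟩ ⟨k, hk⟩ + X (Fin.rev ⟨k, hk⟩) (Fin.rev ⟨k, hk⟩)= X ⟨0, by omega⟩ ⟨0, by omega⟩ + X (Fin.rev ⟨0, by omega⟩) (Fin.rev ⟨0, by omega⟩) := by
        intro k
        induction k with
        | zero => intro hk; rfl
        | succ k ih =>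
          intro hk
          rw [← ih (by omega)]
          have h2 := congrFun (congrFun h1 ⟨k, by omega⟩) (Fin.rev ⟨k + 1, hk⟩)
          rw [Matrix.add_apply, UU_mul (i' := ⟨k+1, hk⟩) _ _ _ rfl,
            mul_DD (j' := Fin.rev ⟨k, by omega⟩) _ _ _ (by simp only [Fin.val_rev]; omega), YY_apply, YY_apply] at h2
          simp only [Fin.rev_rev, Pi.one_apply, one_mul, mul_one, Matrix.zero_apply] at h2
          have hs : ((-1 : K) ^ k) ≠ 0 := pow_ne_zero _ (by simp)
          have : (-1 : K) ^ k * ((X ⟨k, by omega⟩ ⟨k, by omega⟩ + X (Fin.rev ⟨k, by omega⟩) (Fin.rev ⟨k, by omega⟩)) - (X ⟨k+1, hk⟩ ⟨k+1, hk⟩ + X (Fin.rev ⟨k+1, hk⟩) (Fin.rev ⟨k+1, hk⟩))) = 0 := by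
            rw [← h2, pow_succ]; ring
          have := (mul_eq_zero.1 this).resolve_left hs
          linear_combination -this
      intro i; exact this i i.2
    set c := X ⟨0, by omega⟩ ⟨0, by omega⟩ + X (Fin.rev ⟨0, by omega⟩) (Fin.rev ⟨0, by omega⟩) with hc
    have hc0 : c = 0 := by
      have h3 : ∑ i : Fin n, (X i i + X i.rev i.rev) = n * c := by
        rw [Finset.sum_congr rfl (fun i _ => hsum i)]; simp
      have h4 : ∑ i : Fin n, X i.rev i.rev = ∑ i : Fin n, X i i :=
        Equiv.sum_comp Fin.revPerm (fun i => X i i)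
      have h5 := htr X hX
      simp only [trace, diag_apply] at h5
      rw [Finset.sum_add_distrib, h4, h5, add_zero] at h3
      have : (n : K) ≠ 0 := by exact_mod_cast (by omega)
      simpa [this] using h3.symm
    ext i j
    by_cases h : ((i : ℕ) : ℤ) + (j : ℕ) = n - 1 - 0
    · have hj : j = i.rev := by ext; rw [Fin.val_rev]; omega
      subst hj
      rw [YY_apply, Fin.rev_rev]
      have := hsum i
      rw [hc0] at this
      rw [mul_comm, ← mul_add, this]; simp
    · exact YY_hom hh i j h
  have hneg : ∀ k : ℕ, ∀ X ∈ L, Hom (-(k:ℤ)) X → YY X = 0 := by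
    intro k
    induction k with
    | zero => intro X hX hh; exact hzero X hX (by simpa using hh)
    | succ k ih =>
      intro X hX hh
      have h1 := ih _ (hbr _ he _ hX) (by
        have := (hom_UU (n := n) (1 : ℕ → K)).br hh
        convert this using 1; push_cast; ring)
      rw [YY_br he', UU_transpose] at h1
      refine e_kill' h1 fun i hi j => YY_hom hh i j ?_
      have := j.2
      push_cast; omega
  intro X hX
  have hall : ∀ k : ℤ, YY (cmp k X) = 0 := by
    intro k
    have h1 := cmp_mem L (fun X hX => hbr _ hh _ hX) k hX
    rcases le_or_gt k 0 with hk | hk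
    · exact hneg (-k).toNat _ h1 (by rw [Int.toNat_of_nonneg (by omega), neg_neg]; exact hom_cmp k X)
    · refine hpos (k - 1).toNat _ h1 ?_
      rw [Int.toNat_of_nonneg (by omega), sub_add_cancel]; exact hom_cmp k X
  let YL : Matrix (Fin n) (Fin n) K →ₗ[K] Matrix (Fin n) (Fin n) K :=
    { toFun := YY
      map_add' := by intro a b; simp [YY, add_mul, mul_add]; abel
      map_smul' := by intro a b; simp [YY] }
  have : YL X = 0 := by
    rw [← sum_cmp X, map_sum]
    exact Finset.sum_eq_zero fun k _ => hall k
  exact this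

end C6
end

section
namespace C6
open Polynomial Matrix

variable {K : Type*} [Field K] [CharZero K] {n : ℕ}
variable (L : Submodule K (Matrix (Fin n) (Fin n) K))

lemma diag_commute {d : Fin n → K} (hn : 0 < n) (h : UU n 1 * diagonal d = diagonal d * UU n 1)
    (htr : trace (diagonal d) = 0) : diagonal d = 0 := by
  have h1 : ∀ k : ℕ, ∀ hk : k < n, d ⟨k, hk⟩ = d ⟨0, hn⟩ := by
    intro k
    induction k with
    | zero => intro _; rfl
    | succ k ih =>
      intro hk
      have := congrFun (congrFun h ⟨k, by omega⟩) ⟨k+1, hk⟩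
      rw [mul_diagonal, diagonal_mul] at this
      simp [UU] at this
      rw [this, ih]
  have h2 : d = fun _ => d ⟨0, hn⟩ := by ext i; exact h1 i i.2
  rw [h2] at htr ⊢
  have : (n : K) ≠ 0 := by exact_mod_cast hn.ne'
  simp [trace, this] at htr
  rw [htr]; simp

lemma exists_diag (hn : 3 ≤ n) (hbr : ∀ X ∈ L, ∀ Y ∈ L, X * Y - Y * X ∈ L) (htr : ∀ X ∈ L, trace X = 0)
    (he : UU n 1 ∈ L) (hf : DD n (wk K n) ∈ L) (g : ℕ → K) (hg : UU n g ∈ L) :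
    ∃ d : Fin n → K, diagonal d ∈ L ∧ ∀ i j : Fin n, (i : ℕ) + 1 = j → g j = d i - d j := by
  let L1 : Submodule K (Matrix (Fin n) (Fin n) K) :=
    { carrier := {X | X ∈ L ∧ Hom 1 X}
      zero_mem' := ⟨L.zero_mem, fun i j _ => rfl⟩
      add_mem' := by
        rintro a b ⟨h1, h2⟩ ⟨h3, h4⟩
        exact ⟨L.add_mem h1 h3, fun i j h => by rw [Matrix.add_apply, h2 i j h, h4 i j h, add_zero]⟩
      smul_mem' := by
        rintro c a ⟨h1, h2⟩
        exact ⟨L.smul_mem c h1, fun i j h => by rw [Matrix.smul_apply, h2 i j h, smul_zero]⟩ }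
  let ψ : Module.End K (Matrix (Fin n) (Fin n) K) := brL (UU n 1) * brL (DD n (wk K n))
  have hψ0 : ∀ X, ψ X = UU n 1 * (DD n (wk K n) * X - X * DD n (wk K n)) - (DD n (wk K n) * X - X * DD n (wk K n)) * UU n 1 := fun X => rfl
  have hψ : ∀ X ∈ L1, ψ X ∈ L1 := by
    rintro X ⟨h1, h2⟩
    refine ⟨hbr _ he _ (hbr _ hf _ h1), ?_⟩
    have := (hom_UU (n := n) (1 : ℕ → K)).br ((hom_DD (n := n) (wk K n)).br h2)
    rw [hψ0]
    convert this using 1; norm_num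
  have hinj : Function.Injective (ψ.restrict hψ) := by
    rw [← LinearMap.ker_eq_bot, LinearMap.ker_eq_bot']
    rintro ⟨X, hX⟩ h0
    have h1 : ψ X = 0 := congrArg Subtype.val h0
    rw [hψ0] at h1
    have hD : Hom 0 (DD n (wk K n) * X - X * DD n (wk K n)) := by
      have := (hom_DD (n := n) (wk K n)).br hX.2
      convert this using 1; norm_num
    have ht := htr _ (hbr _ hf _ hX.1)
    have hDz : DD n (wk K n) * X - X * DD n (wk K n) = 0 := by
      rw [hom_zero hD] at h1 ht ⊢
      exact diag_commute (by omega) (sub_eq_zero.1 h1) ht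
    apply Subtype.ext
    show X = 0
    exact f_kill (sub_eq_zero.1 hDz) fun j hj i => hX.2 i j (by omega)
  have hsurj := LinearMap.injective_iff_surjective.1 hinj
  obtain ⟨⟨X, hX⟩, hXg⟩ := hsurj ⟨UU n g, hg, hom_UU g⟩
  have h1 : ψ X = UU n g := congrArg Subtype.val hXg
  rw [hψ0] at h1
  have hD : Hom 0 (DD n (wk K n) * X - X * DD n (wk K n)) := by
    have := (hom_DD (n := n) (wk K n)).br hX.2
    convert this using 1; norm_num
  have hm := L.neg_mem (hbr _ hf _ hX.1)
  rw [hom_zero hD] at h1 hm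
  rw [diagonal_neg] at hm
  refine ⟨_, hm, fun i j h => ?_⟩
  have := congrFun (congrFun h1 i) j
  rw [Matrix.sub_apply, mul_diagonal, diagonal_mul] at this
  simp only [UU, of_apply, if_pos h, Pi.one_apply, one_mul, mul_one] at this
  rw [← this]; ring

lemma odd_case (hn : 3 ≤ n) (hbr : ∀ X ∈ L, ∀ Y ∈ L, X * Y - Y * X ∈ L) (htr : ∀ X ∈ L, trace X = 0)
    (he : UU n 1 ∈ L) (hf : DD n (wk K n) ∈ L)
    (hodd : ∃ g, UU n g ∈ L ∧ ∃ j, 0 < j ∧ j < n ∧ g j ≠ g (n - j)) : ∀ g, UU n g ∈ L := by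
  let M : Submodule K (ℕ → K) :=
    { carrier := {g | UU n g ∈ L}
      zero_mem' := by show UU n 0 ∈ L; rw [UU_zero]; exact L.zero_mem
      add_mem' := by intro a b ha hb; show UU n _ ∈ L; rw [UU_add]; exact L.add_mem ha hb
      smul_mem' := by intro a b ha; show UU n _ ∈ L; rw [UU_smul]; exact L.smul_mem _ ha }
  have hM : M = ⊤ := by
    refine M_top hn M ?_ ?_ he ?_ hodd
    · intro g g' h hg
      show UU n g' ∈ L
      rw [← UU_EE h]; exact hg
    · intro g hg
      show UU n _ ∈ L
      rw [← UU_TT]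
      exact hbr _ (hbr _ hg _ hf) _ he
    · intro g hg g' hg'
      show UU n _ ∈ L
      obtain ⟨d, hd, h⟩ := exists_diag L hn hbr htr he hf g hg
      rw [← diag_UU d g' (g * g') (fun i j hij => by rw [Pi.mul_apply, h i j hij])]
      exact hbr _ hd _ hg'
  intro g
  have : g ∈ M := by rw [hM]; trivial
  exact this

lemma all_diag (hn : 3 ≤ n) (hbr : ∀ X ∈ L, ∀ Y ∈ L, X * Y - Y * X ∈ L)
    (hf : DD n (wk K n) ∈ L) (hU : ∀ g, UU n g ∈ L) (d : Fin n → K) (hd : ∑ i, d i = 0) : diagonal d ∈ L := by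
  let d' : ℕ → K := fun i => if h : i < n then d ⟨i, h⟩ else 0
  have hd' : ∑ i ∈ Finset.range n, d' i = 0 := by
    rw [Finset.sum_range, ← hd]
    exact Finset.sum_congr rfl fun i _ => by simp [d']
  let s : ℕ → K := fun j => ∑ i ∈ Finset.range j, d' i
  have key := hbr _ (hU fun j => s j / wk K n j) _ hf
  rw [UU_DD _ _ (wk_zero n) (wk_self n)] at key
  have hs : ∀ j, j ≤ n → s j / wk K n j * wk K n j = s j := by
    intro j hj
    rcases Nat.eq_zero_or_pos j with rfl | h0
    · simp [s]
    rcases hj.lt_or_eq with h | rfl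
    · exact div_mul_cancel₀ _ (wk_ne h0 h)
    · rw [wk_self, mul_zero]; exact hd'.symm
  convert key using 1
  congr 1
  ext i
  rw [hs _ (by omega), mul_comm (wk K n _), hs _ (by omega)]
  simp only [s]
  rw [Finset.sum_range_succ]
  simp [d']

lemma all_DD (hn : 3 ≤ n) (hbr : ∀ X ∈ L, ∀ Y ∈ L, X * Y - Y * X ∈ L)
    (hf : DD n (wk K n) ∈ L) (hU : ∀ g, UU n g ∈ L) (g : ℕ → K) : DD n g ∈ L := by
  let s : Fin n → K := fun i => ∑ k ∈ Finset.range (i + 1), g k / wk K n k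
  let c : K := (∑ i, s i) / n
  have hnK : (n : K) ≠ 0 := by exact_mod_cast (by omega)
  have h1 := all_diag L hn hbr hf hU (fun i => s i - c) (by
    rw [Finset.sum_sub_distrib]; simp [c]; field_simp; ring)
  have := hbr _ h1 _ hf
  rwa [diag_DD _ _ g] at this
  intro i j hij
  simp only [s]
  rw [← hij, Finset.sum_range_succ _ ((j : ℕ) + 1)]
  have : wk K n (j + 1) ≠ 0 := wk_ne (by omega) (by rw [hij]; exact i.2)
  field_simp; ring

lemma all_mem (hn : 3 ≤ n) (hbr : ∀ X ∈ L, ∀ Y ∈ L, X * Y - Y * X ∈ L)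
    (hf : DD n (wk K n) ∈ L) (hU : ∀ g, UU n g ∈ L) (X : Matrix (Fin n) (Fin n) K) (hX : trace X = 0) : X ∈ L := by
  have step : ∀ i m j : Fin n, i ≠ j → Matrix.single i m (1 : K) ∈ L → Matrix.single m j (1 : K) ∈ L →
      Matrix.single i j (1 : K) ∈ L := by
    intro i m j hij h1 h2
    have := hbr _ h1 _ h2
    rw [Matrix.single_mul_single_same, Matrix.single_mul_single_of_ne _ _ _ _ hij.symm] at this
    simpa using this
  have up0 : ∀ i j : Fin n, (i : ℕ) + 1 = j → Matrix.single i j (1 : K) ∈ L := by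
    intro i j h
    convert hU (Pi.single (j : ℕ) 1) using 1
    ext a b
    simp only [Matrix.single_apply, UU, of_apply, Pi.single_apply]
    by_cases hb : b = j
    · subst hb
      by_cases ha : i = a
      · subst ha; simp; omega
      · have : (a : ℕ) + 1 ≠ b := fun h' => ha (Fin.ext (by omega))
        simp [ha, this]
    · have : (b : ℕ) ≠ j := fun h' => hb (Fin.ext h')
      simp [Ne.symm hb, this]
  have dn0 : ∀ i j : Fin n, (j : ℕ) + 1 = i → Matrix.single i j (1 : K) ∈ L := by
    intro i j h
    convert all_DD L hn hbr hf hU (Pi.single (i : ℕ) 1) using 1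
    ext a b
    simp only [Matrix.single_apply, DD, of_apply, Pi.single_apply]
    by_cases hb : a = i
    · subst hb
      by_cases ha : j = b
      · subst ha; simp; omega
      · have : (b : ℕ) + 1 ≠ a := fun h' => ha (Fin.ext (by omega))
        simp [ha, this]
    · have : (a : ℕ) ≠ i := fun h' => hb (Fin.ext h')
      simp [Ne.symm hb, this]
  have up : ∀ k : ℕ, ∀ i j : Fin n, (i : ℕ) + k + 1 = j → Matrix.single i j (1 : K) ∈ L := by
    intro k
    induction k with
    | zero => intro i j h; exact up0 i j h
    | succ k ih =>
      intro i j h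
      refine step i ⟨i + k + 1, by omega⟩ j ?_ (ih _ _ rfl) (up0 _ _ (by simp; omega))
      rintro rfl; omega
  have dn : ∀ k : ℕ, ∀ i j : Fin n, (j : ℕ) + k + 1 = i → Matrix.single i j (1 : K) ∈ L := by
    intro k
    induction k with
    | zero => intro i j h; exact dn0 i j h
    | succ k ih =>
      intro i j h
      refine step i ⟨j + k + 1, by omega⟩ j ?_ (dn0 _ _ (by simp; omega)) (ih _ _ rfl)
      rintro rfl; omega
  have hoff : ∀ i j : Fin n, i ≠ j → Matrix.single i j (1 : K) ∈ L := by
    intro i j hij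
    rcases Nat.lt_trichotomy i j with h | h | h
    · exact up (j - i - 1) i j (by omega)
    · exact absurd (Fin.ext h) hij
    · exact dn (i - j - 1) i j (by omega)
  have hdec : X = diagonal (fun i => X i i) + ∑ i, ∑ j, if i = j then 0 else X i j • Matrix.single i j (1 : K) := by
    conv_lhs => rw [matrix_eq_sum_single X]
    have : diagonal (fun i => X i i) = ∑ i, ∑ j, if i = j then X i j • Matrix.single i j (1 : K) else 0 := by
      simp only [Finset.sum_ite_eq, Finset.mem_univ, if_true]
      ext a b
      rw [Matrix.sum_apply, diagonal_apply]
      split_ifs with h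
      · subst h
        rw [Finset.sum_eq_single a] <;> simp +contextual [Matrix.single_apply]
      · refine (Finset.sum_eq_zero fun i _ => ?_).symm
        rw [Matrix.smul_apply, Matrix.single_apply, if_neg, smul_zero]
        rintro ⟨rfl, rfl⟩; exact h rfl
    rw [this, ← Finset.sum_add_distrib]
    refine Finset.sum_congr rfl fun i _ => ?_
    rw [← Finset.sum_add_distrib]
    refine Finset.sum_congr rfl fun j _ => ?_
    split_ifs <;> simp
  rw [hdec]
  refine L.add_mem (all_diag L hn hbr hf hU _ hX) (L.sum_mem fun i _ => L.sum_mem fun j _ => ?_)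
  split_ifs with h
  · exact L.zero_mem
  · exact L.smul_mem _ (hoff i j h)

lemma JJ_ne (hn : 3 ≤ n) : JJ K n ≠ 0 := by
  intro h
  have := congrFun (congrFun h ⟨0, by omega⟩) ⟨n - 1, by omega⟩
  simp only [JJ, of_apply] at this
  rw [if_pos (by simp; omega)] at this
  simp at this

theorem mat_main (hn : 3 ≤ n) (hodd : Odd n) (hbr : ∀ X ∈ L, ∀ Y ∈ L, X * Y - Y * X ∈ L)
    (htr : ∀ X ∈ L, trace X = 0) (he : UU n 1 ∈ L) (hf : DD n (wk K n) ∈ L) (hh : HH K n ∈ L)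
    (hform : ∀ Φ : Matrix (Fin n) (Fin n) K, (∀ X ∈ L, X * Φ + Φ * Xᵀ = 0) → Φ = 0) :
    ∀ X, trace X = 0 → X ∈ L := by
  by_cases h : ∃ g, UU n g ∈ L ∧ ∃ j, 0 < j ∧ j < n ∧ g j ≠ g (n - j)
  · exact all_mem L hn hbr hf (odd_case L hn hbr htr he hf h)
  · push Not at h
    exact absurd (hform _ (even_case L hn hodd hbr htr he hf hh h)) (JJ_ne hn)
end C6
end

section
namespace C5b
open Module LieModule

variable {K L V : Type*} [Field K] [CharZero K] [LieRing L] [LieAlgebra K L]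
  [AddCommGroup V] [Module K V] [LieRingModule L V] [LieModule K L V] [FiniteDimensional K V]

lemma exists_basis {h e f : L} (h1 : ⁅e,f⁆ = h) (h2 : ⁅h,e⁆ = (2:K)•e) (h3 : ⁅h,f⁆ = -((2:K)•f))
    (hd : ∀ c, finrank K (Module.End.eigenspace (toEnd K L V h) c) ≤ 1)
    (hs : ∃ c : K, ⨆ k : ℤ, Module.End.eigenspace (toEnd K L V h) (c + 2*k) = ⊤)
    (n : ℕ) (hn : finrank K V = n) (hn2 : 2 ≤ n) :
    ∃ b : Basis (Fin n) K V, (∀ j : Fin n, ⁅h, b j⁆ = ((n : K) - 1 - 2 * (j : ℕ)) • b j) ∧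
     (∀ j : Fin n, (j : ℕ) = 0 → ⁅e, b j⁆ = 0) ∧
     (∀ i j : Fin n, (i : ℕ) + 1 = j → ⁅e, b j⁆ = b i) ∧
     (∀ j : Fin n, (j : ℕ) + 1 = n → ⁅f, b j⁆ = 0) ∧
     (∀ i j : Fin n, (i : ℕ) + 1 = j → ⁅f, b i⁆ = C6.wk K n j • b j) := by
  classical
  have hh0 : h ≠ 0 := by
    rintro rfl
    have := hd 0
    have h4 : Module.End.eigenspace (toEnd K L V (0 : L)) 0 = ⊤ := by
      rw [eq_top_iff]; intro v _
      rw [Module.End.mem_eigenspace_iff]; simp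
    rw [h4, finrank_top] at this
    omega
  have t : IsSl2Triple h e f := ⟨hh0, h1, by rw [h2, two_smul, two_nsmul], by rw [h3, two_smul, two_nsmul]⟩
  obtain ⟨c, hs⟩ := hs
  let E : ℤ → Submodule K V := fun k => Module.End.eigenspace (toEnd K L V h) (c + 2*k)
  have hE : ∀ k v, v ∈ E k ↔ ⁅h, v⁆ = (c + 2 * k) • v := fun k v => by
    rw [Module.End.mem_eigenspace_iff]; rfl
  have hfin : {k : ℤ | E k ≠ ⊥}.Finite := by
    have := Module.End.finite_hasEigenvalue (toEnd K L V h)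
    refine Set.Finite.of_finite_image (f := fun k : ℤ => c + 2 * (k : K)) (this.subset ?_) ?_
    · rintro _ ⟨k, hk, rfl⟩; exact hk
    · intro a _ b _ hab
      have : (a : K) = b := by simpa using hab
      exact_mod_cast this
  have hne : {k : ℤ | E k ≠ ⊥}.Nonempty := by
    by_contra hcon
    rw [Set.not_nonempty_iff_eq_empty, Set.eq_empty_iff_forall_notMem] at hcon
    have : ∀ k, E k = ⊥ := fun k => by simpa using hcon k
    have : (⊥ : Submodule K V) = ⊤ := by rw [← hs]; exact (iSup_eq_bot.2 this).symm
    have h5 : finrank K (⊥ : Submodule K V) = finrank K (⊤ : Submodule K V) := by rw [this]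
    rw [finrank_bot, finrank_top] at h5; omega
  obtain ⟨k, hk, hkmax⟩ := hfin.exists_maximalFor id _ hne
  obtain ⟨k', hk', hkmin⟩ := hfin.exists_minimalFor id _ hne
  have hmax : ∀ l, E l ≠ ⊥ → l ≤ k := fun l hl => by
    rcases le_total l k with h | h
    · exact h
    · exact hkmax hl h
  have hmin : ∀ l, E l ≠ ⊥ → k' ≤ l := fun l hl => by
    rcases le_total k' l with h | h
    · exact h
    · exact hkmin hl h
  obtain ⟨v, hv, hv0⟩ := Submodule.exists_mem_ne_zero_of_ne_bot hk
  obtain ⟨v', hv', hv0'⟩ := Submodule.exists_mem_ne_zero_of_ne_bot hk'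
  rw [hE] at hv hv'
  have P : t.HasPrimitiveVectorWith v (c + 2 * (k : K)) := by
    refine ⟨hv0, hv, ?_⟩
    have : ⁅e, v⁆ ∈ E (k + 1) := by
      rw [hE, leibniz_lie, h2, hv, smul_lie, lie_smul, ← add_smul]; congr 1; push_cast; ring
    by_contra hcon
    have := hmax (k + 1) (fun hb => hcon (by rw [hb] at this; simpa using this))
    omega
  have P' : t.symm.HasPrimitiveVectorWith v' (-(c + 2 * (k' : K))) := by
    refine ⟨hv0', by rw [neg_lie, hv', neg_smul], ?_⟩
    have : ⁅f, v'⁆ ∈ E (k' - 1) := by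
      rw [hE, leibniz_lie, h3, hv', neg_lie, smul_lie, lie_smul, ← neg_smul, ← add_smul]; congr 1; push_cast; ring
    by_contra hcon
    have := hmin (k' - 1) (fun hb => hcon (by rw [hb] at this; simpa using this))
    omega
  obtain ⟨m, hm⟩ := P.exists_nat
  obtain ⟨m', hm'⟩ := P'.exists_nat
  have hkk : (m : ℤ) + m' = 2 * (k - k') := by
    have : ((m : K) + m') = 2 * (k - k') := by rw [← hm, ← hm']; ring
    exact_mod_cast this
  have hmm : m' ≤ m := by
    have h4 := P'.pow_toEnd_f_ne_zero_of_eq_nat hm' le_rfl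
    have h5 := P'.lie_h_pow_toEnd_f m'
    have : ((toEnd K L V e) ^ m') v' ∈ E (k' + m') := by
      rw [hE]
      rw [neg_lie] at h5
      rw [← neg_neg ⁅h, _⁆, h5, ← neg_smul]; congr 1; push_cast; ring
    have h6 := hmax _ (fun hb => h4 (by rw [hb] at this; simpa using this))
    omega
  let ψ : ℕ → V := fun i => ((toEnd K L V f) ^ i) v
  have hψ0 : ∀ i ≤ m, ψ i ≠ 0 := fun i hi => P.pow_toEnd_f_ne_zero_of_eq_nat hm hi
  have hψh : ∀ i, ⁅h, ψ i⁆ = ((m : K) - 2 * i) • ψ i := fun i => by rw [← hm]; exact P.lie_h_pow_toEnd_f i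
  have hψe : ∀ i, ⁅e, ψ (i+1)⁆ = ((i + 1 : K) * (m - i)) • ψ i := fun i => by rw [← hm]; exact P.lie_e_pow_succ_toEnd_f i
  have hψf : ∀ i, ⁅f, ψ i⁆ = ψ (i + 1) := fun i => P.lie_f_pow_toEnd_f i
  have hψl : ψ (m + 1) = 0 := P.pow_toEnd_f_eq_zero_of_eq_nat hm
  have hψe0 : ⁅e, ψ 0⁆ = 0 := P.lie_e
  clear_value ψ
  have hli : LinearIndependent K (fun i : Fin (m + 1) => ψ i) := by
    refine Module.End.eigenvectors_linearIndependent' (toEnd K L V h) (fun i : Fin (m+1) => (m : K) - 2 * (i : ℕ)) ?_ _ ?_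
    · intro a b hab
      have : ((a : ℕ) : K) = (b : ℕ) := by simpa using hab
      exact Fin.ext (by exact_mod_cast this)
    · intro i
      refine ⟨?_, hψ0 i (by omega)⟩
      rw [Module.End.mem_eigenspace_iff]; exact hψh i
  have hspan : ⊤ ≤ Submodule.span K (Set.range fun i : Fin (m + 1) => ψ i) := by
    rw [← hs]
    refine iSup_le fun l => ?_
    by_cases hl : E l = ⊥
    · show E l ≤ _
      rw [hl]; exact bot_le
    have ha := hmax l hl
    have hb := hmin l hl
    obtain ⟨i, hi⟩ := Int.eq_ofNat_of_zero_le (show 0 ≤ k - l by omega)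
    have him : i ≤ m := by omega
    have hmem : ψ i ∈ E l := by
      rw [hE, hψh, ← hm]
      congr 1
      have : l = k - i := by omega
      rw [this]; push_cast; ring
    intro x hx
    have h7 := finrank_le_one_iff.1 (hd (c + 2 * l))
    obtain ⟨y, hy⟩ := h7
    obtain ⟨a, ha⟩ := hy ⟨ψ i, hmem⟩
    obtain ⟨a', ha'⟩ := hy ⟨x, hx⟩
    have ha : a • (y : V) = ψ i := congrArg Subtype.val ha
    have ha' : a' • (y : V) = x := congrArg Subtype.val ha'
    have ha0 : a ≠ 0 := by
      rintro rfl; rw [zero_smul] at ha; exact hψ0 i him ha.symm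
    have : x = (a' * a⁻¹) • ψ i := by
      rw [← ha, smul_smul, mul_assoc, inv_mul_cancel₀ ha0, mul_one, ha']
    rw [this]
    exact Submodule.smul_mem _ _ (Submodule.subset_span ⟨⟨i, by omega⟩, rfl⟩)
  have hnm : n = m + 1 := by
    have := finrank_eq_card_basis (Basis.mk hli hspan)
    rw [hn] at this; simpa using this
  subst hnm
  let w : ℕ → K := fun j => C6.wk K (m + 1) (j + 1)
  have hw : ∀ j : ℕ, w j = (j + 1 : K) * (m - j) := fun j => by simp only [w, C6.wk]; push_cast; ring
  have hw0 : ∀ j < m, w j ≠ 0 := fun j hj => C6.wk_ne (by omega) (by omega)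
  let s : ℕ → K := fun i => ∏ j ∈ Finset.range i, (w j)⁻¹
  have hs0 : ∀ i ≤ m, s i ≠ 0 := fun i hi => Finset.prod_ne_zero_iff.2 fun j hj => inv_ne_zero (hw0 j (by simp at hj; omega))
  have hs1 : ∀ i, s (i+1) = s i * (w i)⁻¹ := fun i => Finset.prod_range_succ _ _
  let b0 := Basis.mk hli hspan
  let b := b0.unitsSMul (fun i : Fin (m+1) => Units.mk0 (s i) (hs0 i (by omega)))
  have hb : ∀ i : Fin (m+1), b i = s i • ψ i := by
    intro i; rw [Basis.unitsSMul_apply, Basis.mk_apply]; rfl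
  refine ⟨b, ?_, ?_, ?_, ?_, ?_⟩
  · intro j
    rw [hb, lie_smul, hψh, smul_comm]; congr 1; push_cast; ring
  · intro j hj
    rw [hb, hj, lie_smul, hψe0, smul_zero]
  · intro i j hij
    rw [hb, hb, ← hij, lie_smul, hψe, ← hw, hs1, smul_smul, mul_assoc, inv_mul_cancel₀ (hw0 i (by omega)), mul_one]
  · intro j hj
    rw [hb, lie_smul, hψf, hj, hψl, smul_zero]
  · intro i j hij
    rw [hb, hb, lie_smul, hψf, ← hij, hs1, smul_smul]
    congr 1
    show _ = w i * _
    rw [mul_comm, mul_assoc, inv_mul_cancel₀ (hw0 i (by omega)), mul_one]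

end C5b
end

section
namespace C7
open Module LieModule Matrix C6

variable {K : Type*} [Field K] {n : ℕ}

@[reducible] def lieRingS (L : Submodule K (Matrix (Fin n) (Fin n) K)) (hbr : ∀ X ∈ L, ∀ Y ∈ L, X * Y - Y * X ∈ L) :
    LieRing L where
  bracket X Y := ⟨X.1 * Y.1 - Y.1 * X.1, hbr _ X.2 _ Y.2⟩
  add_lie X Y Z := Subtype.ext (by simp [add_mul, mul_add]; abel)
  lie_add X Y Z := Subtype.ext (by simp [add_mul, mul_add]; abel)
  lie_self X := Subtype.ext (by simp)
  leibniz_lie X Y Z := Subtype.ext (by simp; noncomm_ring)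

@[reducible] def lieAlgS (L : Submodule K (Matrix (Fin n) (Fin n) K)) (hbr : ∀ X ∈ L, ∀ Y ∈ L, X * Y - Y * X ∈ L) :
    letI := lieRingS L hbr; LieAlgebra K L :=
  letI := lieRingS L hbr
  { lie_smul := fun c X Y => Subtype.ext (by simp [Bracket.bracket, smul_sub]) }

@[reducible] def lieModS (L : Submodule K (Matrix (Fin n) (Fin n) K)) (hbr : ∀ X ∈ L, ∀ Y ∈ L, X * Y - Y * X ∈ L) :
    letI := lieRingS L hbr; LieRingModule L (Fin n → K) :=
  letI := lieRingS L hbr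
  { bracket := fun X v => X.1 *ᵥ v
    add_lie := fun X Y v => by simp [Matrix.add_mulVec]
    lie_add := fun X v w => by simp [Matrix.mulVec_add]
    leibniz_lie := fun X Y v => by
      show X.1 *ᵥ (Y.1 *ᵥ v) = (X.1 * Y.1 - Y.1 * X.1) *ᵥ v + Y.1 *ᵥ (X.1 *ᵥ v)
      simp [Matrix.sub_mulVec] }

theorem gabber [CharZero K] [IsAlgClosed K] (hn : n.Prime) (hodd : Odd n)
    (L : Submodule K (Matrix (Fin n) (Fin n) K)) (hbr : ∀ X ∈ L, ∀ Y ∈ L, X * Y - Y * X ∈ L)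
    (htr : ∀ X ∈ L, trace X = 0) (hadj : Algebra.adjoin K (L : Set (Matrix (Fin n) (Fin n) K)) = ⊤)
    (hform : ∀ Φ : Matrix (Fin n) (Fin n) K, (∀ X ∈ L, X * Φ + Φ * Xᵀ = 0) → Φ = 0) :
    ∀ X, trace X = 0 → X ∈ L := by
  classical
  have hn3 : 3 ≤ n := by
    rcases hn.eq_two_or_odd with h | h
    · subst h; exact absurd hodd (by decide)
    · have := hn.two_le; omega
  letI := lieRingS L hbr
  letI := lieAlgS L hbr
  letI := lieModS L hbr
  have hact : ∀ (X : L) (v : Fin n → K), ⁅X, v⁆ = X.1 *ᵥ v := fun X v => rfl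
  haveI : LieModule K L (Fin n → K) :=
    { smul_lie := fun c X v => by simp [hact, Matrix.smul_mulVec]
      lie_smul := fun c X v => by simp [hact, Matrix.mulVec_smul] }
  haveI : LieModule.IsFaithful K L (Fin n → K) := by
    rw [isFaithful_iff']
    intro X hX
    apply Subtype.ext
    ext i j
    have := congrFun (hX (Pi.single j 1)) i
    rw [hact] at this
    simpa using this
  haveI : Nonempty (Fin n) := ⟨⟨0, by omega⟩⟩
  haveI : LieModule.IsIrreducible K L (Fin n → K) := by
    refine LieModule.IsIrreducible.mk fun N hN => ?_
    have hinv : ∀ X : Matrix (Fin n) (Fin n) K, ∀ v ∈ N, X *ᵥ v ∈ N := by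
      intro X
      have : X ∈ Algebra.adjoin K (L : Set (Matrix (Fin n) (Fin n) K)) := by rw [hadj]; trivial
      induction this using Algebra.adjoin_induction with
      | mem X hX => intro v hv; exact N.lie_mem (x := ⟨X, hX⟩) hv
      | algebraMap r =>
        intro v hv
        rw [Algebra.algebraMap_eq_smul_one, Matrix.smul_mulVec, Matrix.one_mulVec]
        exact N.smul_mem _ hv
      | add X Y _ _ h1 h2 => intro v hv; rw [Matrix.add_mulVec]; exact N.add_mem (h1 v hv) (h2 v hv)
      | mul X Y _ _ h1 h2 => intro v hv; rw [← Matrix.mulVec_mulVec]; exact h1 _ (h2 v hv)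
    obtain ⟨v, hv, hv0⟩ : ∃ v ∈ N, v ≠ 0 := by
      by_contra hcon
      push Not at hcon
      exact hN ((LieSubmodule.eq_bot_iff N).2 hcon)
    obtain ⟨i, hi⟩ := Function.ne_iff.1 hv0
    rw [eq_top_iff]
    intro u _
    have := hinv (Matrix.of fun a b => if b = i then u a * (v i)⁻¹ else 0) v hv
    convert this using 1
    ext a
    have hi : v i ≠ 0 := hi
    simp [Matrix.mulVec, dotProduct, hi]
  have htr' : ∀ x : L, LinearMap.trace K (Fin n → K) (toEnd K L (Fin n → K) x) = 0 := by
    intro x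
    have : toEnd K L (Fin n → K) x = Matrix.toLin' x.1 := by
      ext v; rfl
    rw [this, Matrix.trace_toLin'_eq]; exact htr _ x.2
  obtain ⟨h, e, f, h1, h2, h3, h4, h5⟩ := LieC1.exists_principal (K := K) (L := L) (V := Fin n → K) htr' (by simpa using hn)
  obtain ⟨b, hb, he0, he1, hf0, hf1⟩ := C5b.exists_basis h1 h2 h3 h4 h5 n (by simp) (by omega)
  simp only [hact] at hb he0 he1 hf0 hf1
  let Q : Matrix (Fin n) (Fin n) K := Matrix.of fun i j => b j i
  obtain ⟨Q', hQ1, hQ2⟩ : ∃ Q', Q * Q' = 1 ∧ Q' * Q = 1 := by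
    have h6 : Q = (Pi.basisFun K (Fin n)).toMatrix b := by ext i j; simp [Q, Basis.toMatrix_apply]
    refine ⟨b.toMatrix (Pi.basisFun K (Fin n)), ?_, ?_⟩
    · rw [h6]; exact Basis.toMatrix_mul_toMatrix_flip _ _
    · rw [h6]; exact Basis.toMatrix_mul_toMatrix_flip _ _
  have hcol : ∀ (X : Matrix (Fin n) (Fin n) K) i j, (X * Q) i j = (X *ᵥ b j) i := fun X i j => by
    simp [Matrix.mul_apply, Matrix.mulVec, dotProduct, Q]
  let L' : Submodule K (Matrix (Fin n) (Fin n) K) :=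
    L.comap ((LinearMap.mulLeft K Q).comp (LinearMap.mulRight K Q'))
  have hL' : ∀ Y, Y ∈ L' ↔ Q * (Y * Q') ∈ L := fun Y => Iff.rfl
  have hmem : ∀ (X : Matrix (Fin n) (Fin n) K) (hX : X ∈ L) Y, X * Q = Q * Y → Y ∈ L' := by
    intro X hX Y hXY
    rw [hL', ← mul_assoc, ← hXY, mul_assoc, hQ1, mul_one]; exact hX
  have main := mat_main L' hn3 hodd ?_ ?_ ?_ ?_ ?_ ?_
  · intro X hX
    have : Q' * X * Q ∈ L' := main _ (by rw [mul_assoc, trace_mul_comm, mul_assoc, hQ1, mul_one, hX])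
    rw [hL'] at this
    have e : Q * (Q' * X * Q * Q') = X := by
      rw [mul_assoc _ Q Q', hQ1, mul_one, ← mul_assoc, hQ1, one_mul]
    rwa [e] at this
  · intro X hX Y hY
    rw [hL'] at hX hY ⊢
    have := hbr _ hX _ hY
    convert this using 1
    have e : ∀ X Y : Matrix (Fin n) (Fin n) K, Q * (X * Q') * (Q * (Y * Q')) = Q * (X * Y * Q') := by
      intro X Y
      calc _ = Q * X * (Q' * Q) * Y * Q' := by simp only [mul_assoc]
        _ = _ := by rw [hQ2, mul_one]; simp only [mul_assoc]
    rw [e, e, sub_mul, mul_sub]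
  · intro X hX
    have := htr _ ((hL' X).1 hX)
    rw [trace_mul_comm, mul_assoc, hQ2, mul_one] at this
    exact this
  · refine hmem e.1 e.2 _ ?_
    ext i j
    rw [hcol]
    rcases Nat.eq_zero_or_pos (j : ℕ) with hj | hj
    · rw [he0 j hj, mul_UU_zero _ _ _ hj]; rfl
    · rw [he1 ⟨j - 1, by omega⟩ j (by simp; omega), mul_UU (j' := ⟨j - 1, by omega⟩) _ _ _ (by simp; omega)]
      simp [Q]
  · refine hmem f.1 f.2 _ ?_
    ext i j
    rw [hcol]
    rcases Nat.lt_or_ge ((j : ℕ) + 1) n with hj | hj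
    · rw [hf1 j ⟨j + 1, hj⟩ rfl, mul_DD (j' := ⟨j + 1, hj⟩) _ _ _ rfl]
      simp [Q, mul_comm]
    · rw [hf0 j (by omega), mul_DD_last _ _ _ (by omega)]; rfl
  · refine hmem h.1 h.2 _ ?_
    ext i j
    rw [hcol, hb, HH, mul_diagonal]
    simp [Q, mul_comm]
  · intro Φ hΦ
    have : Q * Φ * Qᵀ = 0 := by
      apply hform
      intro X hX
      have hY : Q' * X * Q ∈ L' := hmem X hX _ (by rw [← mul_assoc, ← mul_assoc, hQ1, one_mul])
      have h7 := hΦ _ hY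
      have e1 : X * (Q * Φ * Qᵀ) = Q * (Q' * X * Q * Φ) * Qᵀ := by
        calc _ = (1 : Matrix (Fin n) (Fin n) K) * X * Q * Φ * Qᵀ := by simp only [mul_assoc, one_mul]
          _ = _ := by rw [← hQ1]; simp only [mul_assoc]
      have e2 : Q * Φ * Qᵀ * Xᵀ = Q * (Φ * (Q' * X * Q)ᵀ) * Qᵀ := by
        rw [transpose_mul, transpose_mul]
        calc _ = Q * Φ * Qᵀ * Xᵀ * (Q * Q')ᵀ := by rw [hQ1, transpose_one, mul_one]
          _ = _ := by rw [transpose_mul]; simp only [mul_assoc]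
      rw [e1, e2, ← add_mul, ← mul_add, h7]; simp
    have h8 : Q' * (Q * Φ * Qᵀ) * Q'ᵀ = Φ := by
      calc _ = (Q' * Q) * Φ * (Q' * Q)ᵀ := by rw [transpose_mul]; simp only [mul_assoc]
        _ = _ := by rw [hQ2]; simp
    rw [← h8, this]; simp
end C7
end

section
namespace T1
open Matrix

theorem exists_hom (p : ℕ → ℕ) [∀ i, Fact (p i).Prime] (hp : ∀ i, i < p i) :
    ∃ (K : Type) (_ : Field K) (_ : CharZero K) (_ : IsAlgClosed K),
      Nonempty ((∀ i, ZMod (p i)) →+* K) := by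
  classical
  let R := ∀ i, ZMod (p i)
  let I : Ideal R :=
    { carrier := {f | ∃ N, ∀ i, N < i → f i = 0}
      zero_mem' := ⟨0, fun i _ => rfl⟩
      add_mem' := by
        rintro a b ⟨N, hN⟩ ⟨M, hM⟩
        refine ⟨max N M, fun i hi => ?_⟩
        rw [Pi.add_apply, hN i (lt_of_le_of_lt (le_max_left _ _) hi),
          hM i (lt_of_le_of_lt (le_max_right _ _) hi), add_zero]
      smul_mem' := by
        rintro c a ⟨N, hN⟩
        refine ⟨N, fun i hi => ?_⟩
        rw [smul_eq_mul, Pi.mul_apply, hN i hi, mul_zero] }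
  have hI : I ≠ ⊤ := by
    intro h
    have : (1 : R) ∈ I := h ▸ Submodule.mem_top
    obtain ⟨N, hN⟩ := this
    exact one_ne_zero (hN (N+1) (Nat.lt_succ_self N))
  obtain ⟨M, hM, hIM⟩ := Ideal.exists_le_maximal I hI
  letI : Field (R ⧸ M) := Ideal.Quotient.field M
  have hz : ∀ m : ℕ, (m : R ⧸ M) = 0 → m = 0 := by
    intro m h
    by_contra hm
    have h1 : (m : R) ∈ M := by
      rw [← Ideal.Quotient.eq_zero_iff_mem]
      exact (map_natCast (Ideal.Quotient.mk M) m).trans h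
    let g : R := fun i => (m : ZMod (p i))⁻¹
    have h2 : (m : R) * g - 1 ∈ I := by
      refine ⟨m, fun i hi => ?_⟩
      have : ((m : ℕ) : ZMod (p i)) ≠ 0 := by
        intro h0
        rw [ZMod.natCast_eq_zero_iff] at h0
        have := Nat.le_of_dvd (Nat.pos_of_ne_zero hm) h0
        have := hp i
        omega
      change (m : ZMod (p i)) * (m : ZMod (p i))⁻¹ - 1 = 0
      rw [mul_inv_cancel₀ this, sub_self]
    have h3 : (1 : R) ∈ M := by
      have := M.sub_mem (M.mul_mem_right g h1) (hIM h2)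
      simpa using this
    exact hM.ne_top ((Ideal.eq_top_iff_one M).2 h3)
  haveI : CharZero (R ⧸ M) := charZero_of_inj_zero hz
  haveI : CharZero (AlgebraicClosure (R ⧸ M)) :=
    charZero_of_injective_algebraMap (algebraMap (R ⧸ M) (AlgebraicClosure (R ⧸ M))).injective
  exact ⟨AlgebraicClosure (R ⧸ M), inferInstance, inferInstance, inferInstance,
    ⟨(algebraMap (R ⧸ M) _).comp (Ideal.Quotient.mk M)⟩⟩

section one
variable {F : Type*} [Field F] {n : ℕ}
local notation "Mat" F => Matrix (Fin n) (Fin n) F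

theorem exists_fam (L : Submodule F (Mat F)) : ∃ e : Fin n → Fin n → (Mat F),
    (∀ a b, e a b ∈ L) ∧ ∀ y ∈ L, y = ∑ a, ∑ b, y a b • e a b := by
  classical
  obtain ⟨q, hq⟩ := L.exists_isCompl
  let π := L.projectionOnto q hq
  refine ⟨fun a b => π (Matrix.single a b 1), fun a b => (π _).2, fun y hy => ?_⟩
  have h1 : (π y : Mat F) = y := by
    have := Submodule.projectionOnto_apply_left hq ⟨y, hy⟩
    exact congrArg Subtype.val this
  conv_lhs => rw [← h1]; enter [1, 2]; rw [Matrix.matrix_eq_sum_single y]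
  simp only [map_sum, AddSubmonoidClass.coe_finsetSum]
  refine Finset.sum_congr rfl fun a _ => Finset.sum_congr rfl fun b _ => ?_
  have : Matrix.single a b (y a b) = y a b • Matrix.single a b (1:F) := by
    rw [Matrix.smul_single, smul_eq_mul, mul_one]
  rw [this, map_smul, Submodule.coe_smul]

/-- words -/
def W (L : Submodule F (Mat F)) : ℕ → Submodule F (Mat F)
  | 0 => Submodule.span F {1}
  | k+1 => W L k ⊔ W L k * L

theorem W_stab (L : Submodule F (Mat F)) (hadj : Algebra.adjoin F (L : Set (Mat F)) = ⊤) :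
    W L (n * n) = ⊤ := by
  classical
  have hle : ∀ k, W L k ≤ W L (k+1) := fun k => le_sup_left
  have hmono : Monotone (W L) := monotone_nat_of_le_succ hle
  have key : ∀ k, W L k = W L (k+1) → W L k = ⊤ := by
    intro k hk
    have hmul : ∀ x ∈ W L k, ∀ y ∈ L, x * y ∈ W L k := by
      intro x hx y hy
      rw [hk]
      exact (le_sup_right : W L k * L ≤ _) (Submodule.mul_mem_mul hx hy)
    have h1 : (1 : Mat F) ∈ W L k :=
      hmono (Nat.zero_le k) (Submodule.subset_span rfl)
    have : ∀ y ∈ Algebra.adjoin F (L : Set (Mat F)), ∀ x ∈ W L k, x * y ∈ W L k := by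
      intro y hy
      induction hy using Algebra.adjoin_induction with
      | mem y hy => exact fun x hx => hmul x hx y hy
      | algebraMap r =>
        intro x hx
        rw [Algebra.algebraMap_eq_smul_one, mul_smul_comm, mul_one]
        exact Submodule.smul_mem _ _ hx
      | add y z _ _ h1 h2 => intro x hx; rw [mul_add]; exact add_mem (h1 x hx) (h2 x hx)
      | mul y z _ _ h1 h2 => intro x hx; rw [← mul_assoc]; exact h2 _ (h1 x hx)
    refine eq_top_iff.2 fun y _ => ?_
    have := this y (hadj ▸ Algebra.mem_top) 1 h1
    rwa [one_mul] at this
  have key2 : ∀ k, W L k = ⊤ ∨ k ≤ Module.finrank F (W L k) := by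
    intro k
    induction k with
    | zero => exact Or.inr (Nat.zero_le _)
    | succ k ih =>
      by_cases ht : W L k = ⊤
      · exact Or.inl (top_le_iff.1 (ht ▸ hle k))
      · have hlt : W L k < W L (k+1) := lt_of_le_of_ne (hle k) fun h => ht (key k h)
        have := Submodule.finrank_lt_finrank_of_lt hlt
        rcases ih with h | h
        · exact absurd h ht
        · right; omega
  rcases key2 (n*n) with h | h
  · exact h
  · refine Submodule.eq_top_of_finrank_eq (le_antisymm (Submodule.finrank_le _) ?_)
    rw [Module.finrank_matrix]
    simpa using h

theorem W_mem {L : Submodule F (Mat F)} {e : Fin n → Fin n → (Mat F)}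
    (he : ∀ y ∈ L, y = ∑ a, ∑ b, y a b • e a b) (k : ℕ) (x : Mat F) (hx : x ∈ W L (k+1)) :
    ∃ y ∈ W L k, ∃ z : Fin n → Fin n → (Mat F), (∀ a b, z a b ∈ W L k) ∧
      x = y + ∑ a, ∑ b, z a b * e a b := by
  obtain ⟨y, hy, w, hw, rfl⟩ := Submodule.mem_sup.1 hx
  refine ⟨y, hy, ?_⟩
  suffices h : ∃ z : Fin n → Fin n → (Mat F), (∀ a b, z a b ∈ W L k) ∧
      w = ∑ a, ∑ b, z a b * e a b by
    obtain ⟨z, h1, h2⟩ := h; exact ⟨z, h1, by rw [h2]⟩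
  clear hx
  induction hw using Submodule.mul_induction_on' with
  | mem_mul_mem m hm l hl =>
    refine ⟨fun a b => l a b • m, fun a b => Submodule.smul_mem _ _ hm, ?_⟩
    conv_lhs => rw [he l hl]
    simp only [Finset.mul_sum, mul_smul_comm, smul_mul_assoc]
  | add x hx' y hy' h1 h2 =>
    obtain ⟨z1, a1, b1⟩ := h1
    obtain ⟨z2, a2, b2⟩ := h2
    refine ⟨fun a b => z1 a b + z2 a b, fun a b => add_mem (a1 a b) (a2 a b), ?_⟩
    simp only [add_mul, Finset.sum_add_distrib, ← b1, ← b2]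

/-- left inverse witness for absence of forms -/
theorem form_wit (e : Fin n → Fin n → (Mat F))
    (h : ∀ Φ : Mat F, (∀ a b, e a b * Φ + Φ * (e a b)ᵀ = 0) → Φ = 0) :
    ∃ w : Fin n → Fin n → Fin n → Fin n → (Mat F), ∀ Φ : Mat F,
      Φ = ∑ a, ∑ b, ∑ c, ∑ d, (e a b * Φ + Φ * (e a b)ᵀ) c d • w a b c d := by
  classical
  let f : (Mat F) →ₗ[F] (Fin n → Fin n → (Mat F)) :=
    LinearMap.pi fun a => LinearMap.pi fun b =>
      LinearMap.mulLeft F (e a b) + LinearMap.mulRight F (e a b)ᵀ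
  have hf : LinearMap.ker f = ⊥ := by
    rw [LinearMap.ker_eq_bot']
    intro Φ hΦ
    exact h Φ fun a b => congrFun (congrFun hΦ a) b
  obtain ⟨g, hg⟩ := LinearMap.exists_leftInverse_of_injective f hf
  refine ⟨fun a b c d => g (Pi.single a (Pi.single b (Matrix.single c d 1))), fun Φ => ?_⟩
  have h1 : g (f Φ) = Φ := LinearMap.congr_fun hg Φ
  have h2 : ∀ y : Fin n → Fin n → (Mat F), y = ∑ a, ∑ b, ∑ c, ∑ d,
      y a b c d • (Pi.single a (Pi.single b (Matrix.single c d 1)) : Fin n → Fin n → (Mat F)) := by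
    intro y
    funext a b
    ext c d
    simp only [Finset.sum_apply, Matrix.sum_apply, Pi.smul_apply, Matrix.smul_apply]
    rw [Finset.sum_eq_single a, Finset.sum_eq_single b, Finset.sum_eq_single c,
      Finset.sum_eq_single d]
    · simp
    · intro x _ hx; simp [hx]
    · simp
    · intro x _ hx; simp [hx]
    · simp
    · intro x _ hx; simp [Pi.single_apply, hx.symm]
    · simp
    · intro x _ hx; simp [Pi.single_apply, hx.symm]
    · simp
  conv_lhs => rw [← h1, h2 (f Φ)]
  simp only [map_sum, map_smul]
  rfl
end one

theorem transfer (n : ℕ) (hn : n.Prime) (hodd : Odd n) : ∃ N : ℕ, ∀ p : ℕ, p.Prime → N < p →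
    ∀ L : Submodule (ZMod p) (Matrix (Fin n) (Fin n) (ZMod p)),
    (∀ X ∈ L, ∀ Y ∈ L, X * Y - Y * X ∈ L) → (∀ X ∈ L, trace X = 0) →
    Algebra.adjoin (ZMod p) (L : Set (Matrix (Fin n) (Fin n) (ZMod p))) = ⊤ →
    (∀ Φ, (∀ X ∈ L, X * Φ + Φ * Xᵀ = 0) → Φ = 0) → ∀ X, trace X = 0 → X ∈ L := by
  classical
  by_contra hcon
  push Not at hcon
  choose p hpp hlt L hbr htr hadj hform Y hY hYL using hcon
  haveI : ∀ i, Fact (p i).Prime := fun i => ⟨hpp i⟩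
  obtain ⟨K, _, _, _, ⟨ψ⟩⟩ := exists_hom p hlt
  let R := ∀ i, ZMod (p i)
  let π : ∀ i, R →+* ZMod (p i) := fun i => Pi.evalRingHom _ i
  -- matrices over R from families
  let mk : (∀ i, Matrix (Fin n) (Fin n) (ZMod (p i))) → Matrix (Fin n) (Fin n) R :=
    fun X a b i => X i a b
  let Ψ : Matrix (Fin n) (Fin n) R →+* Matrix (Fin n) (Fin n) K := ψ.mapMatrix
  let Pj : ∀ i, Matrix (Fin n) (Fin n) R →+* Matrix (Fin n) (Fin n) (ZMod (p i)) :=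
    fun i => (π i).mapMatrix
  have hPjmk : ∀ X i, Pj i (mk X) = X i := fun X i => rfl
  have hext : ∀ X Y : Matrix (Fin n) (Fin n) R, (∀ i, Pj i X = Pj i Y) → X = Y := by
    intro X Y h
    ext a b i
    exact congrFun (congrFun (h i) a) b
  have hΨt : ∀ X, Ψ Xᵀ = (Ψ X)ᵀ := fun X => rfl
  have hPjt : ∀ i X, Pj i Xᵀ = (Pj i X)ᵀ := fun i X => rfl
  have hΨs : ∀ (r : R) (M : Matrix (Fin n) (Fin n) R), Ψ (r • M) = ψ r • Ψ M := by
    intro r M; ext a b; exact map_mul ψ r (M a b)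
  have hPs : ∀ (i) (r : R) (M : Matrix (Fin n) (Fin n) R), Pj i (r • M) = r i • Pj i M :=
    fun i r M => rfl
  have hΨ1 : ∀ a b, Ψ (Matrix.single a b 1) = Matrix.single a b 1 := by
    intro a b
    ext c d
    change ψ (Matrix.single a b 1 c d) = _
    rw [Matrix.single_apply, Matrix.single_apply]
    split_ifs
    · exact map_one ψ
    · exact map_zero ψ
  have hΨtr : ∀ X, trace (Ψ X) = ψ (trace X) := fun X =>
    (AddMonoidHom.map_trace ψ.toAddMonoidHom X).symm
  have hPtr : ∀ i X, trace (Pj i X) = trace X i := fun i X =>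
    (AddMonoidHom.map_trace (π i).toAddMonoidHom X).symm
  let T : Set (Matrix (Fin n) (Fin n) R) := {X | ∀ i, Pj i X ∈ L i}
  let LK : Submodule K (Matrix (Fin n) (Fin n) K) := Submodule.span K (Ψ '' T)
  have hbrK : ∀ X ∈ LK, ∀ Y ∈ LK, X * Y - Y * X ∈ LK := by
    intro X hX Y hY
    induction hX using Submodule.span_induction with
    | mem X hX =>
      obtain ⟨X, hX, rfl⟩ := hX
      induction hY using Submodule.span_induction with
      | mem Y hY =>
        obtain ⟨Y, hY, rfl⟩ := hY
        refine Submodule.subset_span ⟨X * Y - Y * X, fun i => ?_, by simp only [map_sub, map_mul]⟩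
        simp only [map_sub, map_mul]
        exact hbr i _ (hX i) _ (hY i)
      | zero => simp
      | add a b _ _ h1 h2 =>
        have := add_mem h1 h2
        convert this using 1; noncomm_ring
      | smul c a _ h =>
        have := Submodule.smul_mem _ c h
        convert this using 1; simp [smul_sub]
    | zero => simp
    | add a b _ _ h1 h2 =>
      have := add_mem h1 h2
      convert this using 1; noncomm_ring
    | smul c a _ h =>
      have := Submodule.smul_mem _ c h
      convert this using 1; simp [smul_sub]
  have htrK : ∀ X ∈ LK, trace X = 0 := by
    intro X hX
    induction hX using Submodule.span_induction with
    | mem X hX =>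
      obtain ⟨X, hX, rfl⟩ := hX
      have h0 : trace X = 0 := by
        funext i
        exact (hPtr i X).symm.trans (htr i _ (hX i))
      rw [hΨtr, h0, map_zero]
    | zero => simp
    | add a b _ _ h1 h2 => rw [trace_add, h1, h2, add_zero]
    | smul c a _ h => rw [trace_smul, h, smul_zero]
  choose e heL he using fun i => exists_fam (L i)
  let eR : Fin n → Fin n → Matrix (Fin n) (Fin n) R := fun a b => mk fun i => e i a b
  have heT : ∀ a b, eR a b ∈ T := fun a b i => heL i a b
  have hWK : ∀ k, ∀ X : Matrix (Fin n) (Fin n) R, (∀ i, Pj i X ∈ W (L i) k) →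
      Ψ X ∈ Algebra.adjoin K (LK : Set (Matrix (Fin n) (Fin n) K)) := by
    intro k
    induction k with
    | zero =>
      intro X hX
      have : ∀ i, ∃ c : ZMod (p i), c • (1 : Matrix (Fin n) (Fin n) (ZMod (p i))) = Pj i X :=
        fun i => Submodule.mem_span_singleton.1 (hX i)
      choose c hc using this
      have h1 : X = (show R from c) • (1 : Matrix (Fin n) (Fin n) R) := by
        refine hext _ _ fun i => ?_
        rw [← hc i, hPs, map_one]
      have h2 : Ψ X = ψ c • (1 : Matrix (Fin n) (Fin n) K) := by
        rw [h1, hΨs, map_one]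
      rw [h2]
      exact Subalgebra.smul_mem _ (one_mem _) _
    | succ k ih =>
      intro X hX
      choose y hy z hz hxy using fun i => W_mem (he i) k _ (hX i)
      have h1 : X = mk y + ∑ a, ∑ b, (mk fun i => z i a b) * eR a b := by
        refine hext _ _ fun i => ?_
        simp only [map_add, map_sum, map_mul]
        exact hxy i
      rw [h1]
      simp only [map_add, map_sum, map_mul]
      refine add_mem (ih _ hy) (sum_mem fun a _ => sum_mem fun b _ => mul_mem (ih _ fun i => hz i a b) ?_)
      exact Algebra.subset_adjoin (Submodule.subset_span ⟨_, heT a b, rfl⟩)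
  have hadjK : Algebra.adjoin K (LK : Set (Matrix (Fin n) (Fin n) K)) = ⊤ := by
    refine Algebra.eq_top_iff.2 fun X => ?_
    rw [Matrix.matrix_eq_sum_single X]
    refine sum_mem fun a _ => sum_mem fun b _ => ?_
    have h1 : Matrix.single a b (X a b) = X a b • Ψ (Matrix.single a b 1) := by
      rw [hΨ1, Matrix.smul_single, smul_eq_mul, mul_one]
    rw [h1]
    refine Subalgebra.smul_mem _ (hWK (n*n) _ fun i => ?_) _
    rw [W_stab (L i) (hadj i)]
    exact Submodule.mem_top
  have hfw : ∀ i, ∃ w : Fin n → Fin n → Fin n → Fin n → (Matrix (Fin n) (Fin n) (ZMod (p i))),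
      ∀ Φ, Φ = ∑ a, ∑ b, ∑ c, ∑ d, (e i a b * Φ + Φ * (e i a b)ᵀ) c d • w a b c d := by
    intro i
    refine form_wit (e i) fun Φ hΦ => hform i Φ fun X hX => ?_
    rw [he i X hX]
    simp only [transpose_sum, transpose_smul, Finset.sum_mul, Finset.mul_sum, smul_mul_assoc,
      mul_smul_comm, ← Finset.sum_add_distrib, ← smul_add, hΦ, smul_zero, Finset.sum_const_zero]
  choose w hw using hfw
  let wR : Fin n → Fin n → Fin n → Fin n → Matrix (Fin n) (Fin n) R :=
    fun a b c d => mk fun i => w i a b c d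
  have hwR : ∀ Φ : Matrix (Fin n) (Fin n) R,
      Φ = ∑ a, ∑ b, ∑ c, ∑ d, (eR a b * Φ + Φ * (eR a b)ᵀ) c d • wR a b c d := by
    intro Φ
    refine hext _ _ fun i => ?_
    simp only [map_sum, hPs]
    have h2 : ∀ a b c d, (eR a b * Φ + Φ * (eR a b)ᵀ) c d i =
        (e i a b * Pj i Φ + Pj i Φ * (e i a b)ᵀ) c d := by
      intro a b c d
      have : Pj i (eR a b * Φ + Φ * (eR a b)ᵀ) = e i a b * Pj i Φ + Pj i Φ * (e i a b)ᵀ := by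
        simp only [map_add, map_mul, hPjt]; rfl
      rw [← this]; rfl
    simp only [h2]
    exact hw i _
  have hwK : ∀ Φ : Matrix (Fin n) (Fin n) K,
      Φ = ∑ a, ∑ b, ∑ c, ∑ d, (Ψ (eR a b) * Φ + Φ * (Ψ (eR a b))ᵀ) c d • Ψ (wR a b c d) := by
    let g : Matrix (Fin n) (Fin n) K →ₗ[K] Matrix (Fin n) (Fin n) K :=
      { toFun := fun Φ => ∑ a, ∑ b, ∑ c, ∑ d,
          (Ψ (eR a b) * Φ + Φ * (Ψ (eR a b))ᵀ) c d • Ψ (wR a b c d)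
        map_add' := by
          intro x y
          simp only [← Finset.sum_add_distrib, ← add_smul]
          refine Finset.sum_congr rfl fun a _ => Finset.sum_congr rfl fun b _ =>
            Finset.sum_congr rfl fun c _ => Finset.sum_congr rfl fun d _ => ?_
          congr 1
          simp only [mul_add, add_mul, Matrix.add_apply]; ring
        map_smul' := by
          intro r x
          simp only [Finset.smul_sum, smul_smul, RingHom.id_apply]
          refine Finset.sum_congr rfl fun a _ => Finset.sum_congr rfl fun b _ =>
            Finset.sum_congr rfl fun c _ => Finset.sum_congr rfl fun d _ => ?_
          congr 1
          simp only [mul_smul_comm, smul_mul_assoc, Matrix.add_apply, Matrix.smul_apply,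
            smul_eq_mul]; ring }
    have hg : g = LinearMap.id := by
      refine Matrix.ext_linearMap _ fun a' b' => ?_
      refine LinearMap.ext_ring ?_
      simp only [LinearMap.comp_apply, LinearMap.id_apply]
      have h1 : Matrix.singleLinearMap K a' b' (1 : K) = Ψ (Matrix.single a' b' 1) := by
        rw [hΨ1]; rfl
      rw [h1]
      conv_rhs => rw [hwR (Matrix.single a' b' 1)]
      simp only [map_sum, hΨs]
      have h2 : ∀ (S : Matrix (Fin n) (Fin n) R) a b c d, ψ ((eR a b * S + S * (eR a b)ᵀ) c d) =
          (Ψ (eR a b) * Ψ S + Ψ S * (Ψ (eR a b))ᵀ) c d := by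
        intro S a b c d
        rw [← hΨt, ← map_mul, ← map_mul, ← map_add]; rfl
      simp only [h2]
      rfl
    intro Φ
    exact (LinearMap.congr_fun hg Φ).symm
  have hformK : ∀ Φ, (∀ X ∈ LK, X * Φ + Φ * Xᵀ = 0) → Φ = 0 := by
    intro Φ h
    rw [hwK Φ]
    refine Finset.sum_eq_zero fun a _ => Finset.sum_eq_zero fun b _ =>
      Finset.sum_eq_zero fun c _ => Finset.sum_eq_zero fun d _ => ?_
    rw [h _ (Submodule.subset_span ⟨_, heT a b, rfl⟩), Matrix.zero_apply, zero_smul]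
  have hall := C7.gabber hn hodd LK hbrK htrK hadjK hformK
  -- functional
  have hfun : ∀ i, ∃ f : Fin n → Fin n → ZMod (p i), (∀ X ∈ L i, ∑ a, ∑ b, X a b * f a b = 0) ∧
      ∑ a, ∑ b, Y i a b * f a b = 1 := by
    intro i
    obtain ⟨f, hf1, hf2⟩ := Submodule.exists_le_ker_of_notMem (hYL i)
    refine ⟨fun a b => (f (Y i))⁻¹ * f (Matrix.single a b 1), ?_⟩
    have h3 : ∀ X : Matrix (Fin n) (Fin n) (ZMod (p i)),
        ∑ a, ∑ b, X a b * ((f (Y i))⁻¹ * f (Matrix.single a b 1)) = (f (Y i))⁻¹ * f X := by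
      intro X
      conv_rhs => rw [Matrix.matrix_eq_sum_single X]
      simp only [map_sum, Finset.mul_sum]
      refine Finset.sum_congr rfl fun a _ => Finset.sum_congr rfl fun b _ => ?_
      have : Matrix.single a b (X a b) = X a b • Matrix.single a b (1:ZMod (p i)) := by
        rw [Matrix.smul_single, smul_eq_mul, mul_one]
      rw [this, map_smul, smul_eq_mul]; ring
    refine ⟨fun X hX => ?_, ?_⟩
    · rw [h3, hf2 hX, mul_zero]
    · rw [h3]; exact inv_mul_cancel₀ hf1
  choose f hf0 hf1 using hfun
  let fR : Fin n → Fin n → R := fun a b i => f i a b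
  have hkill : ∀ X ∈ LK, ∑ a, ∑ b, X a b * ψ (fR a b) = 0 := by
    intro X hX
    induction hX using Submodule.span_induction with
    | mem X hX =>
      obtain ⟨X, hX, rfl⟩ := hX
      have h0 : ∑ a, ∑ b, X a b * fR a b = 0 := by
        funext i
        change π i (∑ a, ∑ b, X a b * fR a b) = 0
        simp only [map_sum, map_mul]
        exact hf0 i _ (hX i)
      have := congrArg ψ h0
      simp only [map_sum, map_mul, map_zero] at this
      exact this
    | zero => simp
    | add a b _ _ h1 h2 => simp only [Matrix.add_apply, add_mul, Finset.sum_add_distrib, h1, h2, add_zero]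
    | smul c a _ h => simp only [Matrix.smul_apply, smul_eq_mul, mul_assoc, ← Finset.mul_sum, h, mul_zero]
  have hYt : trace (Ψ (mk Y)) = 0 := by
    have h0 : trace (mk Y) = 0 := by
      funext i
      exact (hPtr i (mk Y)).symm.trans (hY i)
    rw [hΨtr, h0, map_zero]
  have h1 := hkill _ (hall _ hYt)
  have h2 : ∑ a, ∑ b, (mk Y) a b * fR a b = 1 := by
    funext i
    change π i (∑ a, ∑ b, mk Y a b * fR a b) = 1
    simp only [map_sum, map_mul]
    exact hf1 i
  have h3 := congrArg ψ h2
  simp only [map_sum, map_mul, map_one] at h3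
  exact zero_ne_one (h1.symm.trans h3)
end T1
end

section
namespace D1
open Matrix Polynomial
open scoped Nat

section exp
variable {F : Type*} [Field F] {A : Type*} [Ring A] [Algebra F A]

/-- truncated exponential -/
noncomputable def E (F : Type*) [Field F] {A : Type*} [Ring A] [Algebra F A] (n : ℕ) (X : A) : A :=
  ∑ k ∈ Finset.range n, ((k ! : ℕ) : F)⁻¹ • X ^ k

theorem E_zero {n : ℕ} (hn : 0 < n) : E F n (0 : A) = 1 := by
  unfold E
  rw [Finset.sum_eq_single 0]
  · simp
  · intro k _ hk; simp [hk]
  · intro h; exact absurd (Finset.mem_range.2 hn) h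

theorem E_add {n : ℕ} (hF : ∀ k < n, ((k ! : ℕ) : F) ≠ 0) {X Y : A} (hc : Commute X Y)
    (hz : ∀ i j, n ≤ i + j → X ^ i * Y ^ j = 0) : E F n (X + Y) = E F n X * E F n Y := by
  unfold E
  have h1 : ∀ m ∈ Finset.range n, ((m ! : ℕ) : F)⁻¹ • (X + Y) ^ m =
      ∑ k ∈ Finset.range (m+1), (((k ! : ℕ) : F)⁻¹ • X ^ k) * ((((m-k) ! : ℕ) : F)⁻¹ • Y ^ (m-k)) := by
    intro m hm
    rw [hc.add_pow, Finset.smul_sum]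
    refine Finset.sum_congr rfl fun k hk => ?_
    have hkm : k ≤ m := Nat.lt_succ_iff.1 (Finset.mem_range.1 hk)
    have hmn := Finset.mem_range.1 hm
    rw [smul_mul_smul_comm, ← Nat.cast_comm, ← nsmul_eq_mul, ← Nat.cast_smul_eq_nsmul F, smul_smul]
    congr 1
    have := Nat.choose_mul_factorial_mul_factorial hkm
    have h2 : ((m.choose k : ℕ) : F) * (k ! : ℕ) * ((m-k)! : ℕ) = (m ! : ℕ) := by
      rw [← this]; push_cast; ring
    have a1 := hF k (lt_of_le_of_lt hkm hmn)
    have a2 := hF (m-k) (lt_of_le_of_lt (Nat.sub_le _ _) hmn)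
    have a3 := hF m hmn
    rw [← mul_inv, eq_comm, inv_eq_iff_eq_inv, mul_inv, inv_inv, ← h2]
    have a4 : ((m.choose k : ℕ) : F) ≠ 0 := by
      intro h0; rw [h0] at h2; apply a3; rw [← h2]; ring
    field_simp
  rw [Finset.sum_congr rfl h1, Finset.sum_range_diag_flip n
    fun k l => (((k ! : ℕ) : F)⁻¹ • X ^ k) * (((l ! : ℕ) : F)⁻¹ • Y ^ l), Finset.sum_mul_sum]
  refine Finset.sum_congr rfl fun i hi => ?_
  refine Finset.sum_subset (fun j hj => ?_) fun j _ hj => ?_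
  · rw [Finset.mem_range] at *; omega
  · rw [Finset.mem_range] at hj
    rw [smul_mul_smul_comm, hz i j (by omega), smul_zero]

theorem E_sub_one {n : ℕ} (hF : ∀ k < n, ((k ! : ℕ) : F) ≠ 0) {X : A} (hX : X ^ n = 0)
    (h : E F n X = 1) : X = 0 := by
  by_contra hne
  -- minimal power vanishing
  have hex : ∃ k, X ^ k = 0 := ⟨n, hX⟩
  classical
  set m := Nat.find hex with hm
  have hmz : X ^ m = 0 := Nat.find_spec hex
  have hmn : m ≤ n := Nat.find_min' hex hX
  have hm2 : 2 ≤ m := by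
    by_contra hlt
    have : m = 0 ∨ m = 1 := by omega
    rcases this with h0 | h0 <;> rw [h0] at hmz
    · rw [pow_zero] at hmz; apply hne; rw [← mul_one X, hmz, mul_zero]
    · rw [pow_one] at hmz; exact hne hmz
  have h2 : X ^ (m-2) * E F n X = X ^ (m-2) := by rw [h, mul_one]
  unfold E at h2
  rw [Finset.mul_sum, ← Finset.sum_subset (Finset.range_subset_range.2 (hm2.trans hmn))] at h2
  · simp only [Finset.sum_range_succ, Finset.sum_range_zero, mul_smul_comm, ← pow_add, zero_add] at h2
    have h3 : X ^ (m - 2 + 1) = 0 := by simpa using h2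
    have := Nat.find_min' hex h3
    omega
  · intro k _ hk
    rw [Finset.mem_range] at hk
    rw [mul_smul_comm, ← pow_add, pow_eq_zero_of_le (show m ≤ m - 2 + k by omega) hmz, smul_zero]

theorem exists_log [Finite F] [Finite A] {n : ℕ} (hn : 0 < n) (hF : ∀ k < n, ((k ! : ℕ) : F) ≠ 0)
    (N : A) (hN : N ^ n = 0) : ∃ X : A, X ^ n = 0 ∧ ∀ t : ℕ, E F n ((t : F) • X) = (1 + N) ^ t := by
  classical
  -- the ideal generated by N inside F[N]
  let m : Set A := {x | ∃ q : F[X], x = aeval N (X * q)}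
  have hcomm : ∀ x ∈ m, ∀ y ∈ m, Commute x y := by
    rintro x ⟨q, rfl⟩ y ⟨r, rfl⟩
    change _ * _ = _ * _
    rw [← map_mul, ← map_mul, mul_comm]
  have hvan : ∀ x ∈ m, ∀ y ∈ m, ∀ i j, n ≤ i + j → x ^ i * y ^ j = 0 := by
    rintro x ⟨q, rfl⟩ y ⟨r, rfl⟩ i j hij
    rw [← map_pow, ← map_pow, ← map_mul]
    have : (X * q) ^ i * (X * r) ^ j = X ^ (i + j) * (q ^ i * r ^ j) := by ring
    rw [this, map_mul, map_pow, aeval_X, pow_eq_zero_of_le hij hN, zero_mul]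
  have hadd : ∀ x ∈ m, ∀ y ∈ m, x + y ∈ m := by
    rintro x ⟨q, rfl⟩ y ⟨r, rfl⟩
    exact ⟨q + r, by rw [← map_add, mul_add]⟩
  have hsm : ∀ (c : F), ∀ x ∈ m, c • x ∈ m := by
    rintro c x ⟨q, rfl⟩
    exact ⟨c • q, by rw [mul_smul_comm, map_smul]⟩
  have h0 : (0 : A) ∈ m := ⟨0, by simp⟩
  have hpow : ∀ x ∈ m, x ^ n = 0 := fun x hx => by
    have := hvan x hx x hx n 0 (by omega)
    simpa using this
  have hE : ∀ x ∈ m, E F n x - 1 ∈ m := by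
    rintro x ⟨q, rfl⟩
    obtain ⟨n, rfl⟩ : ∃ k, n = k + 1 := ⟨n - 1, by omega⟩
    refine ⟨∑ k ∈ Finset.range n, (((k+1) ! : ℕ) : F)⁻¹ • (q * (X * q) ^ k), ?_⟩
    unfold E
    rw [Finset.sum_range_succ']
    simp only [Nat.factorial_zero, Nat.cast_one, inv_one, pow_zero, one_smul, add_sub_cancel_right,
      Finset.mul_sum, map_sum]
    refine Finset.sum_congr rfl fun k _ => ?_
    rw [mul_smul_comm, map_smul, ← map_pow]
    congr 2
    ring
  let f : m → m := fun x => ⟨E F n x.1 - 1, hE _ x.2⟩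
  have hinj : Function.Injective f := by
    rintro ⟨x, hx⟩ ⟨y, hy⟩ hxy
    have h1 : E F n x = E F n y := by
      have := congrArg Subtype.val hxy
      simpa [f] using this
    have hy' : -y ∈ m := by simpa using hsm (-1) y hy
    have h2 : E F n (x + -y) = 1 := by
      rw [E_add hF (hcomm x hx _ hy') (hvan x hx _ hy'), h1,
        ← E_add hF (hcomm y hy _ hy') (hvan y hy _ hy'), add_neg_cancel, E_zero hn]
    have := E_sub_one hF (hpow _ (hadd _ hx _ hy')) h2
    exact Subtype.ext (by rwa [← sub_eq_add_neg, sub_eq_zero] at this)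
  have hNm : N ∈ m := ⟨1, by simp⟩
  obtain ⟨⟨x, hx⟩, hfx⟩ := (Finite.injective_iff_surjective.1 hinj) ⟨N, hNm⟩
  have hx1 : E F n x = 1 + N := by
    have : E F n x - 1 = N := congrArg Subtype.val hfx
    rw [← this]; abel
  refine ⟨x, hpow x hx, fun t => ?_⟩
  induction t with
  | zero => simp [E_zero hn]
  | succ t ih =>
    have : ((t + 1 : ℕ) : F) • x = (t : F) • x + x := by push_cast; rw [add_smul, one_smul]
    have hm := hsm (t : F) x hx
    rw [this, E_add hF (hcomm _ hm _ hx) (hvan _ hm _ hx), ih, hx1, pow_succ]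

theorem E_smul_add {n : ℕ} (hF : ∀ k < n, ((k ! : ℕ) : F) ≠ 0) {X : A} (hX : X ^ n = 0) (s t : F) :
    E F n ((s + t) • X) = E F n (s • X) * E F n (t • X) := by
  rw [add_smul]
  refine E_add hF ((Commute.refl X).smul_left _ |>.smul_right _) fun i j hij => ?_
  rw [_root_.smul_pow, _root_.smul_pow, smul_mul_smul_comm, ← pow_add, pow_eq_zero_of_le hij hX, smul_zero]
end exp
end D1
end

section
namespace D2
open MvPolynomial

section
variable {F : Type} [Field F] {d : ℕ}

local notation "I" => idealOfVars (Fin d) F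

theorem prod_sub_mem (f : Fin d → MvPolynomial (Fin d) F) (hf : ∀ j, f j - X j ∈ I ^ 2)
    (s : Fin d →₀ ℕ) : (s.prod fun j e => f j ^ e) - monomial s 1 ∈ I ^ (s.degree + 1) := by
  have hX : ∀ j, (X j : MvPolynomial (Fin d) F) ∈ I := fun j => Ideal.subset_span ⟨j, rfl⟩
  have hfI : ∀ j, f j ∈ I := fun j => by
    have := add_mem (Ideal.pow_le_self two_ne_zero (hf j)) (hX j)
    simpa using this
  have h1 : ∀ j (e : ℕ), f j ^ e - X j ^ e ∈ I ^ (e + 1) := by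
    intro j e
    induction e with
    | zero => simp
    | succ e ih =>
      have : f j ^ (e+1) - X j ^ (e+1) = (f j ^ e - X j ^ e) * f j + X j ^ e * (f j - X j) := by ring
      rw [this]
      refine add_mem ?_ ?_
      · rw [pow_succ]; exact Ideal.mul_mem_mul ih (hfI j)
      · have := Ideal.mul_mem_mul (Ideal.pow_mem_pow (hX j) e) (hf j)
        rwa [← pow_add] at this
  have h2 : ∀ t : Finset (Fin d), (∏ j ∈ t, f j ^ s j) - ∏ j ∈ t, X j ^ s j ∈
      I ^ ((∑ j ∈ t, s j) + 1) ∧ (∏ j ∈ t, f j ^ s j) ∈ I ^ (∑ j ∈ t, s j) := by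
    classical
    intro t
    induction t using Finset.induction_on with
    | empty => simp
    | insert a t ha ih =>
      rw [Finset.prod_insert ha, Finset.prod_insert ha, Finset.sum_insert ha]
      obtain ⟨ih1, ih2⟩ := ih
      constructor
      · have : f a ^ s a * ∏ j ∈ t, f j ^ s j - X a ^ s a * ∏ j ∈ t, X j ^ s j =
          (f a ^ s a - X a ^ s a) * (∏ j ∈ t, f j ^ s j) +
            X a ^ s a * ((∏ j ∈ t, f j ^ s j) - ∏ j ∈ t, X j ^ s j) := by ring
        rw [this]
        refine add_mem ?_ ?_
        · have := Ideal.mul_mem_mul (h1 a (s a)) ih2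
          rw [← pow_add] at this
          convert this using 2; ring
        · have := Ideal.mul_mem_mul (Ideal.pow_mem_pow (hX a) (s a)) ih1
          rw [← pow_add] at this
          convert this using 2; ring
      · have := Ideal.mul_mem_mul (Ideal.pow_mem_pow (hfI a) (s a)) ih2
        rwa [← pow_add] at this
  have h3 := (h2 Finset.univ).1
  rw [Finsupp.prod_fintype _ _ (fun j => pow_zero _), monomial_eq, C_1, one_mul,
    Finsupp.prod_fintype _ _ (fun j => pow_zero _), Finsupp.degree_eq_sum]
  exact h3

theorem bind_ne_zero (f : Fin d → MvPolynomial (Fin d) F) (hf : ∀ j, f j - X j ∈ I ^ 2)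
    (G : MvPolynomial (Fin d) F) (hG : G ≠ 0) : bind₁ f G ≠ 0 := by
  classical
  have hne : G.support.Nonempty := by
    rw [Finset.nonempty_iff_ne_empty]; intro h; exact hG (support_eq_empty.1 h)
  obtain ⟨s, hs, hmin⟩ := Finset.exists_min_image G.support (fun s => s.degree) hne
  have h1 : bind₁ f G - G ∈ I ^ (s.degree + 1) := by
    have : bind₁ f G - G = ∑ t ∈ G.support, C (coeff t G) *
        ((t.prod fun j e => f j ^ e) - monomial t 1) := by
      conv_lhs => rw [G.as_sum]
      rw [map_sum, ← Finset.sum_sub_distrib]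
      refine Finset.sum_congr rfl fun t _ => ?_
      rw [bind₁_monomial, mul_sub, C_mul_monomial, mul_one]
      rfl
    rw [this]
    refine sum_mem fun t ht => Ideal.mul_mem_left _ _ ?_
    exact Ideal.pow_le_pow_right (Nat.succ_le_succ (hmin t ht)) (prod_sub_mem f hf t)
  intro h0
  rw [h0, mem_pow_idealOfVars_iff'] at h1
  have := h1 s (Nat.lt_succ_self _)
  rw [coeff_sub, coeff_zero, zero_sub, neg_eq_zero] at this
  exact (mem_support_iff.1 hs) this

theorem card_range [Fintype F] (f : Fin d → MvPolynomial (Fin d) F)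
    (hf : ∀ j, f j - X j ∈ I ^ 2) (D k : ℕ) (hD : ∀ j, (f j).totalDegree ≤ D)
    (hk : k * d * D < Fintype.card F) :
    (k + 1) ^ d ≤ Nat.card (Set.range fun t : Fin d → F => fun j => eval t (f j)) := by
  classical
  set Y := Set.range fun t : Fin d → F => fun j => eval t (f j) with hY
  let toS : (Fin d → Fin (k+1)) → (Fin d →₀ ℕ) := fun a => Finsupp.equivFunOnFinite.symm fun j => (a j : ℕ)
  have htoS : Function.Injective toS := by
    intro a b h
    funext j
    have := DFunLike.congr_fun h j
    exact Fin.ext this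
  let φ : ((Fin d → Fin (k+1)) → F) →ₗ[F] MvPolynomial (Fin d) F :=
    Fintype.linearCombination F fun a => monomial (toS a) (1 : F)
  have hφ : ∀ c, φ c = 0 → c = 0 := by
    intro c h
    funext a
    have h2 := congrArg (coeff (toS a)) h
    simp only [φ, Fintype.linearCombination_apply, coeff_sum, coeff_smul, coeff_monomial,
      coeff_zero, smul_eq_mul, htoS.eq_iff] at h2
    simpa using h2
  let ψ : ((Fin d → Fin (k+1)) → F) →ₗ[F] (Y → F) :=
    LinearMap.pi fun y => (MvPolynomial.aeval (R := F) y.1).toLinearMap ∘ₗ φ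
  have hψ : Function.Injective ψ := by
    rw [← LinearMap.ker_eq_bot, LinearMap.ker_eq_bot']
    intro c hc
    apply hφ
    by_contra hne
    have hb := bind_ne_zero f hf _ hne
    apply hb
    have hdeg : (bind₁ f (φ c)).totalDegree ≤ k * d * D := by
      have : bind₁ f (φ c) = ∑ a, C (c a) * ∏ j, f j ^ (a j : ℕ) := by
        simp only [φ, Fintype.linearCombination_apply, map_sum, map_smul]
        refine Finset.sum_congr rfl fun a _ => ?_
        rw [bind₁_monomial, C_1, one_mul, smul_eq_C_mul]
        congr 1
        exact Finsupp.prod_fintype (toS a) _ (fun j => pow_zero _)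
      rw [this]
      refine totalDegree_finsetSum_le fun a _ => ?_
      refine (totalDegree_mul _ _).trans ?_
      rw [totalDegree_C, zero_add]
      refine (totalDegree_finsetProd _ _).trans ?_
      calc ∑ j, (f j ^ (a j : ℕ)).totalDegree ≤ ∑ j : Fin d, k * D := by
            refine Finset.sum_le_sum fun j _ => (totalDegree_pow _ _).trans ?_
            exact Nat.mul_le_mul (Nat.lt_succ_iff.1 (a j).2) (hD j)
        _ = k * d * D := by simp; ring
    refine eq_zero_of_eval_eq_zero (Fin d) F _ (fun v => ?_) ?_
    · have h1 := congrFun hc ⟨_, ⟨v, rfl⟩⟩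
      have h2 : eval v (bind₁ f (φ c)) = aeval (R := F) (fun j => eval v (f j)) (φ c) := by
        exact DFunLike.congr_fun (algHom_ext (R := F) (f := (aeval v).comp (bind₁ f))
          (g := aeval fun j => eval v (f j)) fun j => by simp [aeval_eq_eval]) (φ c)
      rw [h2]; exact h1
    · rw [mem_restrictDegree]
      intro s hs i
      have h1 := le_totalDegree hs
      have h2 : s i ≤ s.sum fun _ e => e := by
        rw [Finsupp.sum_fintype _ _ (fun _ => rfl)]
        exact Finset.single_le_sum (f := fun i => s i) (fun _ _ => Nat.zero_le _) (Finset.mem_univ i)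
      omega
  have := LinearMap.finrank_le_finrank_of_injective hψ
  rw [Module.finrank_fintype_fun_eq_card, Module.finrank_fintype_fun_eq_card] at this
  simpa [Nat.card_eq_fintype_card] using this
end
end D2
end

section
namespace D3
open Matrix

section
variable {F : Type*} [Field F] {n : ℕ}

theorem transv_gen (hn : 2 ≤ n) (P : Subgroup (SpecialLinearGroup (Fin n) F))
    (hP : ∀ (i j : Fin n) (hij : i ≠ j) (a : F), SpecialLinearGroup.transvection hij a ∈ P) :
    P = ⊤ := by
  haveI : Nontrivial (Fin n) := Fin.nontrivial_iff_two_le.2 hn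
  refine eq_top_iff.2 fun M _ => ?_
  refine SpecialLinearGroup.diagonal_transvection_induction' (fun g => g ∈ P) M ?_ hP
    fun A B hA hB => mul_mem hA hB
  intro i j hij c hc
  have h := mul_mem (mul_mem (mul_mem (hP i j hij c) (hP j i hij.symm (-c⁻¹))) (hP i j hij c))
    (mul_mem (mul_mem (hP i j hij (-1)) (hP j i hij.symm 1)) (hP i j hij (-1)))
  convert h using 1
  apply Subtype.ext
  change diagonal (fun k ↦ if k = i then c else if k = j then c⁻¹ else 1) =
    (1 + single i j c) * (1 + single j i (-c⁻¹)) * (1 + single i j c) *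
    ((1 + single i j (-1)) * (1 + single j i 1) * (1 + single i j (-1)))
  have e1 : ∀ (a : F), (single i j a : Matrix (Fin n) (Fin n) F) = a • single i j 1 := fun a => by
    rw [smul_single, smul_eq_mul, mul_one]
  have e2 : ∀ (a : F), (single j i a : Matrix (Fin n) (Fin n) F) = a • single j i 1 := fun a => by
    rw [smul_single, smul_eq_mul, mul_one]
  rw [e1 c, e2 (-c⁻¹), e1 (-1)]
  generalize hE : (single i j 1 : Matrix (Fin n) (Fin n) F) = E
  generalize hG : (single j i 1 : Matrix (Fin n) (Fin n) F) = G
  have hEE : E * E = 0 := by rw [← hE, single_mul_single_of_ne]; exact hij.symm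
  have hGG : G * G = 0 := by rw [← hG, single_mul_single_of_ne]; exact hij
  have hEGE : E * G * E = E := by rw [← hE, ← hG]; simp
  have hGEG : G * E * G = G := by rw [← hE, ← hG]; simp
  have w : ∀ a b : F, a * b = 1 → (1 + a • E) * (1 + (-b) • G) * (1 + a • E) =
      1 - E * G - G * E + a • E - b • G := by
    intro a b hab
    have : (1 + a • E) * (1 + (-b) • G) * (1 + a • E) = 1 + a • E + a • E - b • G
      - (a*b) • (E * G) - (a * b) • (G * E) + (a * a) • (E * E) - (a*b*a) • (E * G * E) := by
      simp only [mul_add, add_mul, mul_one, one_mul, smul_mul_smul_comm, smul_mul_assoc,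
        mul_smul_comm, smul_smul, neg_smul, mul_neg, neg_mul, smul_neg, mul_assoc]
      module
    rw [this, hab, hEE, hEGE]
    module
  have w1 := w c c⁻¹ (mul_inv_cancel₀ hc)
  have w2 := w (-1) (-1) (by ring)
  rw [neg_neg, one_smul] at w2
  rw [w1, w2]
  have h1 : (1 - E * G - G * E + c • E - c⁻¹ • G) * (1 - E * G - G * E + (-1 : F) • E - (-1 : F) • G)
      = 1 - E * G - G * E + c • (E * G) + c⁻¹ • (G * E) := by
    have a1 : E * (E * G) = 0 := by rw [← mul_assoc, hEE, zero_mul]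
    have a2 : G * (G * E) = 0 := by rw [← mul_assoc, hGG, zero_mul]
    have a3 : E * (G * E) = E := by rw [← mul_assoc, hEGE]
    have a4 : G * (E * G) = G := by rw [← mul_assoc, hGEG]
    simp only [mul_add, add_mul, mul_sub, sub_mul, mul_one, one_mul, smul_mul_assoc, mul_smul_comm,
      smul_smul, mul_assoc, hEE, hGG, a1, a2, a3, a4, smul_zero, mul_zero]
    module
  rw [h1, ← hE, ← hG]
  ext a b
  simp only [single_mul_single_same, Matrix.add_apply, Matrix.sub_apply, Matrix.smul_apply,
    Matrix.one_apply, diagonal_apply, single_apply, smul_eq_mul]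
  by_cases hab : a = b
  · subst hab
    by_cases hi : a = i
    · subst hi; simp [hij, hij.symm]
    · by_cases hj : a = j
      · subst hj; simp [hij, hij.symm]
      · simp [hi, hj, Ne.symm hi, Ne.symm hj]
  · have x1 : ¬ (i = a ∧ i = b) := fun h => hab (h.1.symm.trans h.2)
    have x2 : ¬ (j = a ∧ j = b) := fun h => hab (h.1.symm.trans h.2)
    simp [hab, x1, x2]
end

theorem top_of_index {n p : ℕ} [hp : Fact p.Prime] (hn : 2 ≤ n)
    (P : Subgroup (SpecialLinearGroup (Fin n) (ZMod p))) (hi : P.index < p) : P = ⊤ := by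
  refine transv_gen hn P fun i j hij a => ?_
  set g := SpecialLinearGroup.transvection hij a with hg
  have hgp : g ^ p = 1 := by
    have : ∀ k : ℕ, g ^ k = SpecialLinearGroup.transvection hij ((k : ZMod p) * a) := by
      intro k
      induction k with
      | zero => simp [SpecialLinearGroup.transvection_coeff_zero]
      | succ k ih =>
        rw [pow_succ, ih, hg, ← SpecialLinearGroup.transvection_add]
        congr 1; push_cast; ring
    rw [this]; simp [SpecialLinearGroup.transvection_coeff_zero]
  have h0 : P.index ≠ 0 := Subgroup.index_ne_zero_of_finite
  have h1 := Subgroup.pow_mem_of_index_ne_zero_of_dvd h0 g (n := Nat.factorial P.index)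
    fun m hm hle => Nat.dvd_factorial hm hle
  have hco : Nat.Coprime (Nat.factorial P.index) p :=
    Nat.coprime_comm.1 ((Nat.Prime.coprime_iff_not_dvd hp.out).2 fun h =>
      absurd ((Nat.Prime.dvd_factorial hp.out).1 h) (not_le.2 hi))
  have h2 : g ∈ Subgroup.zpowers (g ^ Nat.factorial P.index) := by
    have ho : (Nat.factorial P.index).Coprime (orderOf g) :=
      Nat.Coprime.coprime_dvd_right (orderOf_dvd_of_pow_eq_one hgp) hco
    obtain ⟨m, hm⟩ := exists_pow_eq_self_of_coprime ho
    exact ⟨m, by simpa using hm⟩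
  exact (Subgroup.zpowers_le.2 h1) h2

theorem card_SL {n p : ℕ} [hp : Fact p.Prime] (hn : 2 ≤ n) :
    Nat.card (SpecialLinearGroup (Fin n) (ZMod p)) ≤ 2 * p ^ (n * n - 1) := by
  classical
  let i0 : Fin n := ⟨0, by omega⟩
  let f : SpecialLinearGroup (Fin n) (ZMod p) × (ZMod p)ˣ → Matrix (Fin n) (Fin n) (ZMod p) :=
    fun x => (x.1 : Matrix (Fin n) (Fin n) (ZMod p)).updateRow i0
      ((x.2 : ZMod p) • (x.1 : Matrix (Fin n) (Fin n) (ZMod p)) i0)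
  have hf : Function.Injective f := by
    rintro ⟨g, a⟩ ⟨h, b⟩ hgh
    have hd : ∀ (g : SpecialLinearGroup (Fin n) (ZMod p)) (a : (ZMod p)ˣ), (f (g, a)).det = a := by
      intro g a
      simp only [f]
      rw [det_updateRow_smul, updateRow_eq_self, g.2, mul_one]
    have hab : a = b := by
      have := hd g a
      rw [hgh, hd] at this
      exact (Units.ext this).symm
    subst hab
    congr 1
    apply Subtype.ext
    ext i j
    have h1 := congrFun (congrFun hgh i) j
    simp only [f, updateRow_apply] at h1
    split_ifs at h1 with hi
    · subst hi
      exact mul_left_cancel₀ a.ne_zero h1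
    · exact h1
  have h1 := Nat.card_le_card_of_injective f hf
  rw [Nat.card_prod] at h1
  have h2 : Nat.card (Matrix (Fin n) (Fin n) (ZMod p)) = p ^ (n * n) := by
    change Nat.card (Fin n → Fin n → ZMod p) = _
    simp [Nat.card_eq_fintype_card, ZMod.card, pow_mul]
  have h3 : Nat.card (ZMod p)ˣ = p - 1 := by
    rw [Nat.card_eq_fintype_card, ZMod.card_units]
  rw [h2, h3] at h1
  have hp2 := hp.out.two_le
  have h4 : p ^ (n * n) = p * p ^ (n * n - 1) := by
    rw [← pow_succ']; congr 1
    have : 0 < n * n := by positivity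
    omega
  rw [h4] at h1
  obtain ⟨q, rfl⟩ : ∃ q, p = q + 1 := ⟨p - 1, by omega⟩
  have hq : 0 < q := by omega
  simp only [Nat.add_sub_cancel] at h1
  refine Nat.le_of_mul_le_mul_right (c := q) (h1.trans ?_) hq
  nlinarith [Nat.zero_le ((q+1) ^ (n*n-1)), Nat.mul_le_mul_right ((q+1) ^ (n*n-1)) hq]
end D3
end

section
namespace D4
open Matrix
open scoped Nat

/-- nilpotent matrices whose truncated exponential line lies in `P` -/
def logs {n p : ℕ} [Fact p.Prime] (P : Subgroup (SpecialLinearGroup (Fin n) (ZMod p))) :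
    Set (Matrix (Fin n) (Fin n) (ZMod p)) :=
  {X | X ^ n = 0 ∧ ∀ t : ZMod p, ∃ g ∈ P, (g : Matrix (Fin n) (Fin n) (ZMod p)) =
    D1.E (ZMod p) n (t • X)}

theorem fact_ne {n p : ℕ} [hp : Fact p.Prime] (h : n ≤ p) : ∀ k < n, ((k ! : ℕ) : ZMod p) ≠ 0 := by
  intro k hk h0
  rw [ZMod.natCast_eq_zero_iff, hp.out.dvd_factorial] at h0
  omega

section poly
variable {F : Type} [Field F] {n d : ℕ}

/-- entries in an ideal -/
def En {R : Type*} [CommRing R] (J : Ideal R) (M : Matrix (Fin n) (Fin n) R) : Prop :=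
  ∀ a b, M a b ∈ J

theorem En.add {R : Type*} [CommRing R] {J : Ideal R} {M N : Matrix (Fin n) (Fin n) R}
    (h1 : En J M) (h2 : En J N) : En J (M + N) := fun a b => add_mem (h1 a b) (h2 a b)

theorem En.mul {R : Type*} [CommRing R] {J K : Ideal R} {M N : Matrix (Fin n) (Fin n) R}
    (h1 : En J M) (h2 : En K N) : En (J * K) (M * N) := fun a b => by
  rw [Matrix.mul_apply]; exact sum_mem fun c _ => Ideal.mul_mem_mul (h1 a c) (h2 c b)

theorem En.mul_right {R : Type*} [CommRing R] {J : Ideal R} {M : Matrix (Fin n) (Fin n) R}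
    (h1 : En J M) (N) : En J (M * N) := fun a b => by
  rw [Matrix.mul_apply]; exact sum_mem fun c _ => Ideal.mul_mem_right _ _ (h1 a c)

theorem En.mul_left {R : Type*} [CommRing R] {J : Ideal R} {M : Matrix (Fin n) (Fin n) R}
    (h1 : En J M) (N) : En J (N * M) := fun a b => by
  rw [Matrix.mul_apply]; exact sum_mem fun c _ => Ideal.mul_mem_left _ _ (h1 c b)

/-- generic one-parameter matrix -/
noncomputable def ep (X : Fin d → Matrix (Fin n) (Fin n) F) (i : Fin d) :
    Matrix (Fin n) (Fin n) (MvPolynomial (Fin d) F) :=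
  ∑ k ∈ Finset.range n, (MvPolynomial.C (((k ! : ℕ) : F)⁻¹) * MvPolynomial.X i ^ k) •
    (X i ^ k).map MvPolynomial.C

noncomputable def lin (X : Fin d → Matrix (Fin n) (Fin n) F) (i : Fin d) :
    Matrix (Fin n) (Fin n) (MvPolynomial (Fin d) F) :=
  (MvPolynomial.X i : MvPolynomial (Fin d) F) • (X i).map MvPolynomial.C

local notation "I" => MvPolynomial.idealOfVars (Fin d) F

theorem ep_approx (hn : 2 ≤ n) (X : Fin d → Matrix (Fin n) (Fin n) F) (i : Fin d) :
    En (I ^ 2) (ep X i - 1 - lin X i) := by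
  obtain ⟨m, rfl⟩ : ∃ m, n = m + 2 := ⟨n - 2, by omega⟩
  have : ep X i - 1 - lin X i = ∑ k ∈ Finset.range m,
      (MvPolynomial.C ((((k+2) ! : ℕ) : F)⁻¹) * MvPolynomial.X i ^ (k+2)) •
        (X i ^ (k+2)).map MvPolynomial.C := by
    unfold ep lin
    rw [Finset.sum_range_succ', Finset.sum_range_succ']
    have h1 : ((1 : Matrix (Fin (m+2)) (Fin (m+2)) F).map (MvPolynomial.C (σ := Fin d))) = 1 :=
      Matrix.map_one _ (map_zero _) (map_one _)
    simp only [zero_add, Nat.factorial_zero, Nat.factorial_one, Nat.cast_one, inv_one, map_one,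
      pow_zero, pow_one, one_mul, one_smul, h1]
    abel
  rw [this]
  intro a b
  rw [Matrix.sum_apply]
  refine sum_mem fun k _ => ?_
  rw [Matrix.smul_apply, smul_eq_mul]
  refine Ideal.mul_mem_right _ _ (Ideal.mul_mem_left _ _ ?_)
  exact Ideal.pow_le_pow_right (show 2 ≤ k + 2 by omega)
    (Ideal.pow_mem_pow (Ideal.subset_span (Set.mem_range_self i)) _)

theorem prod_approx (hn : 2 ≤ n) (X : Fin d → Matrix (Fin n) (Fin n) F) (l : List (Fin d)) :
    En (I ^ 2) ((l.map (ep X)).prod - 1 - (l.map (lin X)).sum) ∧ En I (l.map (lin X)).sum := by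
  have hlin : ∀ i, En I (lin X i) := fun i a b =>
    Ideal.mul_mem_right _ _ (Ideal.subset_span (Set.mem_range_self i))
  induction l with
  | nil => refine ⟨fun a b => ?_, fun a b => ?_⟩ <;> simp
  | cons i l ih =>
    obtain ⟨h1, h2⟩ := ih
    simp only [List.map_cons, List.prod_cons, List.sum_cons]
    refine ⟨?_, (hlin i).add h2⟩
    have h3 := ep_approx hn X i
    set P := (l.map (ep X)).prod
    set S := (l.map (lin X)).sum
    have : ep X i * P - 1 - (lin X i + S) = (ep X i - 1 - lin X i) * P +
        ((P - 1 - S) + (lin X i * (P - 1 - S) + lin X i * S)) := by noncomm_ring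
    rw [this]
    refine (h3.mul_right _).add (h1.add ((h1.mul_left _).add ?_))
    have := (hlin i).mul h2
    rwa [← pow_two] at this

theorem prod_deg (X : Fin d → Matrix (Fin n) (Fin n) F) (l : List (Fin d)) (a b : Fin n) :
    (((l.map (ep X)).prod) a b).totalDegree ≤ l.length * n := by
  induction l generalizing a b with
  | nil =>
    simp only [List.map_nil, List.prod_nil, Matrix.one_apply]
    split_ifs <;> simp
  | cons i l ih =>
    simp only [List.map_cons, List.prod_cons, Matrix.mul_apply, List.length_cons]
    refine MvPolynomial.totalDegree_finsetSum_le fun c _ => ?_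
    refine (MvPolynomial.totalDegree_mul _ _).trans ?_
    have h1 : (ep X i a c).totalDegree ≤ n := by
      unfold ep
      rw [Matrix.sum_apply]
      refine MvPolynomial.totalDegree_finsetSum_le fun k hk => ?_
      rw [Matrix.smul_apply, smul_eq_mul]
      refine (MvPolynomial.totalDegree_mul _ _).trans ?_
      rw [Matrix.map_apply, MvPolynomial.totalDegree_C, add_zero]
      refine (MvPolynomial.totalDegree_mul _ _).trans ?_
      rw [MvPolynomial.totalDegree_C, zero_add]
      refine (MvPolynomial.totalDegree_pow _ _).trans ?_
      rw [MvPolynomial.totalDegree_X]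
      have := Finset.mem_range.1 hk
      omega
    have h2 := ih c b
    calc _ ≤ n + l.length * n := add_le_add h1 h2
      _ = _ := by ring

theorem eval_prod (X : Fin d → Matrix (Fin n) (Fin n) F) (l : List (Fin d)) (t : Fin d → F) :
    (MvPolynomial.eval t).mapMatrix ((l.map (ep X)).prod) =
      (l.map fun i => D1.E F n (t i • X i)).prod := by
  rw [map_list_prod, List.map_map]
  congr 1
  refine List.map_congr_left fun i _ => ?_
  simp only [Function.comp, ep, D1.E, map_sum]
  refine Finset.sum_congr rfl fun k _ => ?_
  ext a b
  simp only [RingHom.mapMatrix_apply, Matrix.map_apply, Matrix.smul_apply, smul_eq_mul, map_mul,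
    MvPolynomial.eval_C, map_pow, MvPolynomial.eval_X, smul_pow]
  ring

theorem exists_polys (hn : 2 ≤ n) (X : Fin d → Matrix (Fin n) (Fin n) F)
    (hX : LinearIndependent F X) : ∃ (ℓ : Matrix (Fin n) (Fin n) F →ₗ[F] (Fin d → F))
      (f : Fin d → MvPolynomial (Fin d) F), (∀ j, f j - MvPolynomial.X j ∈ I ^ 2) ∧
      (∀ j, (f j).totalDegree ≤ d * n) ∧ ∀ t j, MvPolynomial.eval t (f j) =
        ℓ (((List.finRange d).map fun i => D1.E F n (t i • X i)).prod - 1) j := by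
  classical
  obtain ⟨ℓ, hℓ⟩ := LinearMap.exists_leftInverse_of_injective (Fintype.linearCombination F X)
    (LinearMap.ker_eq_bot'.2 fun g hg => funext (Fintype.linearIndependent_iff.1 hX g hg))
  have hℓX : ∀ i, ℓ (X i) = Pi.single i 1 := fun i => by
    have := LinearMap.congr_fun hℓ (Pi.single i 1)
    simpa using this
  set Pm := ((List.finRange d).map (ep X)).prod with hPm
  have hℓexp : ∀ (M : Matrix (Fin n) (Fin n) F) j, ℓ M j = ∑ a, ∑ b, ℓ (single a b 1) j * M a b := by
    intro M j
    conv_lhs => rw [Matrix.matrix_eq_sum_single M]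
    simp only [map_sum, Finset.sum_apply]
    refine Finset.sum_congr rfl fun a _ => Finset.sum_congr rfl fun b _ => ?_
    have : Matrix.single a b (M a b) = M a b • Matrix.single a b (1:F) := by
      rw [Matrix.smul_single, smul_eq_mul, mul_one]
    rw [this, map_smul, Pi.smul_apply, smul_eq_mul, mul_comm]
  let f : Fin d → MvPolynomial (Fin d) F := fun j =>
    ∑ a, ∑ b, MvPolynomial.C (ℓ (single a b 1) j) * (Pm - 1) a b
  refine ⟨ℓ, f, fun j => ?_, fun j => ?_, fun t j => ?_⟩
  · have h1 := (prod_approx hn X (List.finRange d)).1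
    have h2 : (MvPolynomial.X j : MvPolynomial (Fin d) F) = ∑ a, ∑ b, MvPolynomial.C (ℓ (single a b 1) j) *
        ((List.finRange d).map (lin X)).sum a b := by
      have h3 : ((List.finRange d).map (lin X)).sum = ∑ i, lin X i := by
        rw [← List.sum_ofFn, List.ofFn_eq_map]
      have h4 : ∀ i, ∑ a, ∑ b, MvPolynomial.C (ℓ (single a b 1) j) * lin X i a b =
          MvPolynomial.X i * MvPolynomial.C ((Pi.single i 1 : Fin d → F) j) := by
        intro i
        rw [← hℓX, hℓexp]
        simp only [map_sum, map_mul, Finset.mul_sum, lin, Matrix.smul_apply, Matrix.map_apply,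
          smul_eq_mul]
        refine Finset.sum_congr rfl fun a _ => Finset.sum_congr rfl fun b _ => ?_
        ring
      rw [h3]
      simp only [Matrix.sum_apply, Finset.mul_sum]
      have h5 : ∑ a, ∑ b, ∑ i, MvPolynomial.C (ℓ (single a b 1) j) * lin X i a b =
          ∑ i, ∑ a, ∑ b, MvPolynomial.C (ℓ (single a b 1) j) * lin X i a b := by
        rw [Finset.sum_comm' (t' := Finset.univ) (s' := fun _ => Finset.univ) (by simp)]
        rw [Finset.sum_comm]
        refine (Finset.sum_congr rfl fun a _ => Finset.sum_comm).trans ?_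
        rw [Finset.sum_comm]
      rw [h5, Finset.sum_congr rfl fun i _ => h4 i, Finset.sum_eq_single j]
      · simp
      · intro i _ hi; simp [Pi.single_apply, hi.symm]
      · simp
    rw [h2]
    simp only [f, ← Finset.sum_sub_distrib, ← mul_sub]
    exact sum_mem fun a _ => sum_mem fun b _ => Ideal.mul_mem_left _ _ (h1 a b)
  · refine MvPolynomial.totalDegree_finsetSum_le fun a _ =>
      MvPolynomial.totalDegree_finsetSum_le fun b _ => ?_
    refine (MvPolynomial.totalDegree_mul _ _).trans ?_
    rw [MvPolynomial.totalDegree_C, zero_add, Matrix.sub_apply]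
    refine (MvPolynomial.totalDegree_sub _ _).trans (max_le ?_ ?_)
    · have := prod_deg X (List.finRange d) a b
      simpa using this
    · rw [Matrix.one_apply]; split_ifs <;> simp
  · rw [hℓexp]
    simp only [f, map_sum, map_mul, MvPolynomial.eval_C]
    refine Finset.sum_congr rfl fun a _ => Finset.sum_congr rfl fun b _ => ?_
    rw [← eval_prod]
    congr 1
    simp only [Matrix.sub_apply, map_sub, RingHom.mapMatrix_apply, Matrix.map_apply, Matrix.one_apply]
    split_ifs <;> simp [hPm]
end poly

theorem main (n : ℕ) (hn : 2 ≤ n) : ∃ N : ℕ, ∀ (p : ℕ) [Fact p.Prime], N < p →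
    ∀ P : Subgroup (SpecialLinearGroup (Fin n) (ZMod p)),
    (∀ M, trace M = 0 → M ∈ Submodule.span (ZMod p) (logs P)) → P = ⊤ := by
  classical
  set d := n * n - 1 with hd
  have hd0 : 0 < d := by
    have : 2 * 2 ≤ n * n := Nat.mul_le_mul hn hn
    omega
  refine ⟨2 * (d * (d * n)) ^ d, fun p hp hN P hP => ?_⟩
  have hrank : d ≤ Module.finrank (ZMod p) (Submodule.span (ZMod p) (logs P)) := by
    let tr : Matrix (Fin n) (Fin n) (ZMod p) →ₗ[ZMod p] ZMod p := traceLinearMap (Fin n) (ZMod p) (ZMod p)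
    have h1 := LinearMap.finrank_range_add_finrank_ker tr
    have h2 : Module.finrank (ZMod p) (LinearMap.range tr) ≤ 1 := by
      have := Submodule.finrank_le (LinearMap.range tr)
      simpa using this
    have h3 : LinearMap.ker tr ≤ Submodule.span (ZMod p) (logs P) := fun M hM => hP M hM
    have h4 := Submodule.finrank_mono h3
    rw [Module.finrank_matrix] at h1
    simp at h1
    omega
  obtain ⟨X0, hX0s, -, hX0⟩ := Submodule.exists_fun_fin_finrank_span_eq (ZMod p) (logs P)
  let X : Fin d → Matrix (Fin n) (Fin n) (ZMod p) := fun i => X0 (Fin.castLE hrank i)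
  have hX : LinearIndependent (ZMod p) X := hX0.comp _ (Fin.castLE_injective hrank)
  have hXs : ∀ i, X i ∈ logs P := fun i => hX0s _
  obtain ⟨ℓ, f, hf1, hf2, hf3⟩ := exists_polys hn X hX
  set k := (p - 1) / (d * (d * n)) with hk
  have hdn : 0 < d * (d * n) := by positivity
  have hp2 := hp.out.two_le
  have hk1 : k * d * (d * n) < Fintype.card (ZMod p) := by
    rw [ZMod.card]
    have : k * (d * (d * n)) ≤ p - 1 := Nat.div_mul_le_self _ _
    calc k * d * (d * n) = k * (d * (d * n)) := by ring
      _ ≤ p - 1 := this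
      _ < p := by omega
  have hcard := D2.card_range f hf1 (d * n) k hf2 hk1
  have hle : Nat.card (Set.range fun t : Fin d → ZMod p => fun j => MvPolynomial.eval t (f j)) ≤
      Nat.card P := by
    have hsub : (Set.range fun t : Fin d → ZMod p => fun j => MvPolynomial.eval t (f j)) ⊆
        Set.range (fun g : P => ℓ ((g.1 : Matrix (Fin n) (Fin n) (ZMod p)) - 1)) := by
      rintro _ ⟨t, rfl⟩
      choose g hg hge using fun i => (hXs i).2 (t i)
      refine ⟨⟨((List.finRange d).map g).prod, P.list_prod_mem fun x hx => ?_⟩, ?_⟩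
      · obtain ⟨i, -, rfl⟩ := List.mem_map.1 hx
        exact hg i
      · funext j
        simp only [hf3]
        have := map_list_prod (SpecialLinearGroup.coeMonoidHom (ι := Fin n) (R := ZMod p))
          ((List.finRange d).map g)
        rw [SpecialLinearGroup.coeMonoidHom_apply] at this
        rw [this, List.map_map]
        have e : List.map ((SpecialLinearGroup.coeMonoidHom (ι := Fin n) (R := ZMod p)) ∘ g)
            (List.finRange d) = List.map (fun i => D1.E (ZMod p) n (t i • X i)) (List.finRange d) :=
          List.map_congr_left fun i _ => hge i
        rw [e]
    calc _ ≤ Nat.card (Set.range (fun g : P => ℓ ((g.1 : Matrix (Fin n) (Fin n) (ZMod p)) - 1))) :=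
          Nat.card_mono (Set.toFinite _) hsub
      _ ≤ Nat.card P := Finite.card_range_le _
  have h1 : p ≤ (k + 1) * (d * (d * n)) := by
    have := Nat.lt_div_mul_add (a := p - 1) hdn
    rw [← hk] at this
    rw [add_mul, one_mul]; omega
  have h2 : p ^ d ≤ Nat.card P * (d * (d * n)) ^ d := by
    calc p ^ d ≤ ((k + 1) * (d * (d * n))) ^ d := Nat.pow_le_pow_left h1 d
      _ = (k+1) ^ d * (d * (d * n)) ^ d := mul_pow _ _ _
      _ ≤ _ := Nat.mul_le_mul_right _ (hcard.trans hle)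
  have h3 := D3.card_SL (n := n) (p := p) hn
  have h4 := P.card_mul_index
  have hpos : 0 < Nat.card P := Nat.card_pos
  refine D3.top_of_index hn P (lt_of_le_of_lt ?_ hN)
  refine Nat.le_of_mul_le_mul_left (c := Nat.card P) ?_ hpos
  rw [h4]
  calc _ ≤ 2 * p ^ d := h3
    _ ≤ 2 * (Nat.card P * (d * (d * n)) ^ d) := Nat.mul_le_mul_left _ h2
    _ = _ := by ring
end D4
end

section
namespace B1
open Module

variable {F V : Type*} [Field F] [AddCommGroup V] [Module F V] [FiniteDimensional F V]

theorem dvd_of_cover (S : Set (End F V)) (d : ℕ) (𝓛 : Set (Submodule F V))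
    (hinv : ∀ W ∈ 𝓛, ∀ f ∈ S, W ≤ W.comap f)
    (hmin : ∀ W ∈ 𝓛, ∀ U : Submodule F V, (∀ f ∈ S, U ≤ U.comap f) → U ≤ W → U = ⊥ ∨ U = W)
    (hd : ∀ W ∈ 𝓛, finrank F W = d) (hsup : sSup 𝓛 = ⊤) : d ∣ finrank F V := by
  obtain ⟨U, ⟨hU1, hU2⟩, hU3⟩ := WellFounded.has_min (wellFounded_gt (α := Submodule F V))
    {U | (∀ f ∈ S, U ≤ U.comap f) ∧ d ∣ finrank F U} ⟨⊥, by simp⟩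
  by_cases hT : U = ⊤
  · subst hT; simpa using hU2
  exfalso
  obtain ⟨W, hW, hWU⟩ : ∃ W ∈ 𝓛, ¬ W ≤ U := by
    by_contra h
    push Not at h
    exact hT (top_le_iff.1 (hsup ▸ sSup_le h))
  have h1 : U ⊓ W = ⊥ := by
    refine (hmin W hW (U ⊓ W) (fun f hf x hx => ⟨hU1 f hf hx.1, hinv W hW f hf hx.2⟩)
      inf_le_right).resolve_right fun h => hWU ?_
    rw [← h]; exact inf_le_left
  refine hU3 (U ⊔ W) ⟨fun f hf => ?_, ?_⟩ (left_lt_sup.2 hWU)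
  · exact sup_le ((hU1 f hf).trans (Submodule.comap_mono le_sup_left))
      ((hinv W hW f hf).trans (Submodule.comap_mono le_sup_right))
  · have := Submodule.finrank_sup_add_finrank_inf_eq U W
    rw [h1, finrank_bot, hd W hW] at this
    rw [show finrank F ↥(U ⊔ W) = finrank F U + d by simpa using this]
    exact dvd_add hU2 dvd_rfl

/-- irreducibility of a set of endomorphisms -/
def Irr (T : Set (End F V)) : Prop :=
  ∀ W : Submodule F V, (∀ f ∈ T, W ≤ W.comap f) → W = ⊥ ∨ W = ⊤

theorem Irr.bij {T : Set (End F V)} (hT : Irr T) {x : End F V} (hx : ∀ f ∈ T, f * x = x * f)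
    (h0 : x ≠ 0) : Function.Injective x := by
  rw [← LinearMap.ker_eq_bot]
  refine (hT (LinearMap.ker x) fun f hf v hv => ?_).resolve_right fun h => h0 ?_
  · have := LinearMap.congr_fun (hx f hf) v
    simp only [Module.End.mul_apply] at this
    rw [LinearMap.mem_ker] at hv
    rw [Submodule.mem_comap, LinearMap.mem_ker, ← this, hv, map_zero]
  · exact LinearMap.ker_eq_top.1 h

theorem burnside_of_scalar {T : Set (End F V)} (hT : Irr T) (hV : Nontrivial V)
    (hc : ∀ x : End F V, (∀ f ∈ T, f * x = x * f) → ∃ c : F, x = algebraMap F _ c) :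
    Algebra.adjoin F T = ⊤ := by
  set A := Algebra.adjoin F T
  have hsimple : IsSimpleModule A V := by
    have : IsSimpleOrder (Submodule A V) := by
      refine { exists_pair_ne := ⟨⊥, ⊤, bot_ne_top⟩, eq_bot_or_eq_top := fun W => ?_ }
      rcases hT (W.restrictScalars F) (fun f hf v hv =>
        W.smul_mem (⟨f, Algebra.subset_adjoin hf⟩ : A) hv) with h | h
      · left; exact (Submodule.restrictScalars_eq_bot_iff F A V).1 h
      · right; exact (Submodule.restrictScalars_eq_top_iff F A V).1 h
    exact ⟨⟩
  rw [eq_top_iff]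
  intro f _
  have hsc : ∀ e : End A V, ∃ c : F, ∀ v, e v = c • v := by
    intro e
    obtain ⟨c, hc⟩ := hc (e.restrictScalars F) (fun g hg => by
      ext v
      exact (e.map_smul (⟨g, Algebra.subset_adjoin hg⟩ : A) v).symm)
    exact ⟨c, fun v => by simpa using LinearMap.congr_fun hc v⟩
  let f' : End (End A V) V :=
    { toFun := f
      map_add' := map_add f
      map_smul' := fun e v => by
        obtain ⟨c, hc⟩ := hsc e
        simp [hc] }
  obtain ⟨s, hs⟩ := Module.Finite.fg_top (R := F) (M := V)
  obtain ⟨r, hr⟩ := jacobson_density (R := A) f' s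
  have : f = r.1 := by
    apply LinearMap.ext_on hs
    intro m hm
    exact hr m hm
  rw [this]; exact r.2

theorem burnside_or_comm {T : Set (End F V)} (hT : Irr T) (hn : (finrank F V).Prime) :
    Algebra.adjoin F T = ⊤ ∨ ∀ f ∈ T, ∀ g ∈ T, f * g = g * f := by
  have hV : Nontrivial V := Module.nontrivial_of_finrank_pos hn.pos
  by_cases hc : ∀ x : End F V, (∀ f ∈ T, f * x = x * f) → ∃ c : F, x = algebraMap F _ c
  · exact Or.inl (burnside_of_scalar hT hV hc)
  right
  push Not at hc
  obtain ⟨x, hx, hxs⟩ := hc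
  set K := Algebra.adjoin F {x}
  have hK : ∀ k ∈ K, ∀ f ∈ T, f * k = k * f := by
    intro k hk f hf
    induction hk using Algebra.adjoin_induction with
    | mem y hy => rw [Set.mem_singleton_iff.1 hy]; exact hx f hf
    | algebraMap r => exact (Algebra.commutes r f).symm
    | add a b _ _ ha hb => rw [mul_add, add_mul, ha, hb]
    | mul a b _ _ ha hb => rw [← mul_assoc, ha, mul_assoc, hb, mul_assoc]
  let ev : V → (K.toSubmodule →ₗ[F] V) := fun v => (LinearMap.applyₗ v).comp K.toSubmodule.subtype
  have hev : ∀ v ≠ 0, Function.Injective (ev v) := by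
    intro v hv
    rw [← LinearMap.ker_eq_bot, LinearMap.ker_eq_bot']
    rintro ⟨k, hk⟩ h
    by_contra hne
    have hk0 : k ≠ 0 := fun h0 => hne (Subtype.ext h0)
    exact hv (hT.bij (hK k hk) hk0 ((show k v = 0 from h).trans (map_zero k).symm))
  have hrk : ∀ v ≠ 0, finrank F (LinearMap.range (ev v)) = finrank F K.toSubmodule := fun v hv =>
    LinearMap.finrank_range_of_inj (hev v hv)
  have hself : ∀ v, v ∈ LinearMap.range (ev v) := fun v => ⟨⟨1, one_mem K⟩, rfl⟩
  have hxK : x ∈ K := Algebra.subset_adjoin rfl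
  have hdvd := dvd_of_cover (V := V) {x} (finrank F K.toSubmodule)
    {W | ∃ v ≠ 0, W = LinearMap.range (ev v)} ?_ ?_ ?_ ?_
  rotate_left
  · rintro _ ⟨v, hv, rfl⟩ f hf _ ⟨k, rfl⟩
    rw [Set.mem_singleton_iff.1 hf]
    exact ⟨⟨x * k.1, K.mul_mem hxK k.2⟩, rfl⟩
  · rintro _ ⟨v, hv, rfl⟩ U hU hUW
    by_cases hU0 : U = ⊥
    · exact Or.inl hU0
    right
    obtain ⟨w, hw, hw0⟩ := (Submodule.ne_bot_iff _).1 hU0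
    have hxU := hU x rfl
    have hle : LinearMap.range (ev w) ≤ U := by
      rintro _ ⟨⟨k, hk⟩, rfl⟩
      change k w ∈ U
      have : ∀ u ∈ U, k u ∈ U := by
        change k ∈ K at hk
        induction hk using Algebra.adjoin_induction with
        | mem y hy => rw [Set.mem_singleton_iff.1 hy]; exact fun u hu => hxU hu
        | algebraMap r => intro u hu; simpa using U.smul_mem r hu
        | add a b _ _ ha hb => intro u hu; exact U.add_mem (ha u hu) (hb u hu)
        | mul a b _ _ ha hb => intro u hu; exact ha _ (hb u hu)
      exact this w hw
    refine Submodule.eq_of_le_of_finrank_le hUW ?_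
    rw [hrk v hv, ← hrk w hw0]
    exact Submodule.finrank_mono hle
  · rintro _ ⟨v, hv, rfl⟩; exact hrk v hv
  · rw [eq_top_iff]
    intro v _
    by_cases hv : v = 0
    · rw [hv]; exact zero_mem _
    · have hm : LinearMap.range (ev v) ∈ {W | ∃ v ≠ 0, W = LinearMap.range (ev v)} := ⟨v, hv, rfl⟩
      exact (le_sSup hm) (hself v)
  obtain ⟨v, hv⟩ := exists_ne (0 : V)
  have hKn : finrank F K.toSubmodule = finrank F V := by
    rcases (Nat.dvd_prime hn).1 hdvd with h | h
    · exfalso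
      have h1 : (1 : End F V) ≠ 0 := one_ne_zero
      obtain ⟨c, hc⟩ := (finrank_eq_one_iff_of_nonzero' (⟨1, one_mem K⟩ : K.toSubmodule)
        (fun h => h1 (congrArg Subtype.val h))).1 h ⟨x, hxK⟩
      refine hxs c ?_
      have := congrArg Subtype.val hc
      rw [Algebra.algebraMap_eq_smul_one]
      exact this.symm
    · exact h
  have htop : LinearMap.range (ev v) = ⊤ := by
    apply Submodule.eq_top_of_finrank_eq
    rw [hrk v hv, hKn]
  -- every element of `T` lies in `K`
  have hTK : ∀ f ∈ T, f ∈ K := by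
    intro f hf
    obtain ⟨k, hk⟩ : f v ∈ LinearMap.range (ev v) := htop ▸ Submodule.mem_top
    have : f = k.1 := by
      ext w
      obtain ⟨l, rfl⟩ : w ∈ LinearMap.range (ev v) := htop ▸ Submodule.mem_top
      change f (l.1 v) = k.1 (l.1 v)
      have h1 := LinearMap.congr_fun (hK l.1 l.2 f hf) v
      have h2 : k.1 v = f v := hk
      have h3 : k.1 * l.1 = l.1 * k.1 := by
        have : ∀ a ∈ K, a * x = x * a := by
          intro a ha
          induction ha using Algebra.adjoin_induction with
          | mem y hy => rw [Set.mem_singleton_iff.1 hy]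
          | algebraMap r => exact (Algebra.commutes r x)
          | add a b _ _ ha hb => rw [mul_add, add_mul, ha, hb]
          | mul a b _ _ ha hb => rw [mul_assoc, hb, ← mul_assoc, ha, mul_assoc]
        have hl : l.1 ∈ K := l.2
        generalize l.1 = l at hl
        induction hl using Algebra.adjoin_induction with
        | mem y hy => rw [Set.mem_singleton_iff.1 hy]; exact this _ k.2
        | algebraMap r => exact (Algebra.commutes r k.1).symm
        | add a b _ _ ha hb => rw [mul_add, add_mul, ha, hb]
        | mul a b _ _ ha hb => rw [← mul_assoc, ha, mul_assoc, hb, mul_assoc]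
      have h4 := LinearMap.congr_fun h3 v
      simp only [Module.End.mul_apply] at h1 h4
      rw [h1, h4, h2]
    rw [this]; exact k.2
  intro f hf g hg
  exact hK g (hTK g hg) f hf

section mat
open Matrix
variable {n : ℕ}

theorem mat_burnside {F : Type*} [Field F] (hn : n.Prime) (T : Set (Matrix (Fin n) (Fin n) F))
    (hT : ∀ W : Submodule F (Fin n → F), (∀ f ∈ T, W.map (toLin' f) ≤ W) → W = ⊥ ∨ W = ⊤) :
    Algebra.adjoin F T = ⊤ ∨ ∀ f ∈ T, ∀ g ∈ T, f * g = g * f := by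
  have h := burnside_or_comm (F := F) (V := Fin n → F)
    (T := (Matrix.toLinAlgEquiv' : Matrix (Fin n) (Fin n) F ≃ₐ[F] _) '' T) (fun W hW => hT W fun f hf =>
      Submodule.map_le_iff_le_comap.2 (hW _ ⟨f, hf, rfl⟩)) (by simpa using hn)
  refine h.imp (fun h => ?_) (fun h f hf g hg => ?_)
  · have h2 := AlgHom.map_adjoin (Matrix.toLinAlgEquiv' : Matrix (Fin n) (Fin n) F ≃ₐ[F] _).toAlgHom T
    have h3 : (Algebra.adjoin F T).map
        (Matrix.toLinAlgEquiv' : Matrix (Fin n) (Fin n) F ≃ₐ[F] _).toAlgHom = ⊤ := by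
      rw [h2]; exact h
    rw [eq_top_iff]
    intro X _
    have : (Matrix.toLinAlgEquiv' : Matrix (Fin n) (Fin n) F ≃ₐ[F] _) X ∈
      (Algebra.adjoin F T).map (Matrix.toLinAlgEquiv' : Matrix (Fin n) (Fin n) F ≃ₐ[F] _).toAlgHom := by
      rw [h3]; trivial
    obtain ⟨Y, hY, hYX⟩ := this
    rwa [← (Matrix.toLinAlgEquiv' : Matrix (Fin n) (Fin n) F ≃ₐ[F] _).injective hYX]
  · have := h _ ⟨f, hf, rfl⟩ _ ⟨g, hg, rfl⟩
    rw [← map_mul, ← map_mul] at this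
    exact Matrix.toLinAlgEquiv'.injective this
end mat
end B1
end

section
namespace B2
open Module Matrix

variable {F : Type*} [Field F] {n : ℕ}

theorem irr_of_adjoin (T : Set (Matrix (Fin n) (Fin n) F)) (hT : Algebra.adjoin F T = ⊤)
    (W : Submodule F (Fin n → F)) (hW : ∀ f ∈ T, ∀ v ∈ W, f *ᵥ v ∈ W) : W = ⊥ ∨ W = ⊤ := by
  classical
  have hall : ∀ f : Matrix (Fin n) (Fin n) F, ∀ v ∈ W, f *ᵥ v ∈ W := by
    intro f
    have hf : f ∈ Algebra.adjoin F T := hT ▸ Algebra.mem_top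
    induction hf using Algebra.adjoin_induction with
    | mem y hy => exact hW y hy
    | algebraMap r =>
      intro v hv
      rw [Algebra.algebraMap_eq_smul_one, smul_mulVec, one_mulVec]; exact W.smul_mem r hv
    | add a b _ _ ha hb => intro v hv; rw [add_mulVec]; exact W.add_mem (ha v hv) (hb v hv)
    | mul a b _ _ ha hb => intro v hv; rw [← mulVec_mulVec]; exact ha _ (hb v hv)
  by_cases h0 : W = ⊥
  · exact Or.inl h0
  right
  obtain ⟨v, hv, hv0⟩ := (Submodule.ne_bot_iff _).1 h0
  obtain ⟨i, hi⟩ := Function.ne_iff.1 hv0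
  rw [eq_top_iff]
  intro w _
  have : w = (Matrix.of fun a b => if b = i then w a * (v i)⁻¹ else 0) *ᵥ v := by
    ext a
    simp [mulVec, dotProduct, mul_assoc, inv_mul_cancel₀ (show v i ≠ 0 from hi)]
  rw [this]
  exact hall _ v hv

theorem cover (hn : n.Prime) (Γ : Subgroup (SpecialLinearGroup (Fin n) F))
    (hΓ : Algebra.adjoin F ((fun g : SpecialLinearGroup (Fin n) F => (g : Matrix (Fin n) (Fin n) F)) ''
      (Γ : Set (SpecialLinearGroup (Fin n) F))) = ⊤)
    (U : Set (SpecialLinearGroup (Fin n) F)) (hconj : ∀ g ∈ Γ, ∀ u ∈ U, g * u * g⁻¹ ∈ U) :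
    ∃ W : Submodule F (Fin n → F), W ≠ ⊥ ∧
      (∀ u ∈ U, ∀ v ∈ W, (u : Matrix (Fin n) (Fin n) F) *ᵥ v ∈ W) ∧
      (∀ U' : Submodule F (Fin n → F), (∀ u ∈ U, ∀ v ∈ U', (u : Matrix (Fin n) (Fin n) F) *ᵥ v ∈ U') →
        U' ≤ W → U' = ⊥ ∨ U' = W) ∧
      sSup {W' | ∃ g ∈ Γ, W' = W.map (toLin' g.1)} = ⊤ ∧ (finrank F W = 1 ∨ finrank F W = n) ∧
      ∀ g ∈ Γ, ∀ u ∈ U, ∃ u' ∈ U, (u : Matrix (Fin n) (Fin n) F) * g = (g : Matrix (Fin n) (Fin n) F) * u' := by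
  classical
  have hn0 : NeZero n := ⟨hn.ne_zero⟩
  -- the action
  have key : ∀ g ∈ Γ, ∀ u ∈ U, ∃ u' ∈ U, (u : Matrix (Fin n) (Fin n) F) * g = (g : Matrix (Fin n) (Fin n) F) * u' := by
    intro g hg u hu
    refine ⟨_, hconj g⁻¹ (Γ.inv_mem hg) u hu, ?_⟩
    have : u * g = g * (g⁻¹ * u * g⁻¹⁻¹) := by group
    exact congrArg Subtype.val this
  obtain ⟨W, ⟨hW0, hWi⟩, hWm⟩ := WellFounded.has_min (wellFounded_lt (α := Submodule F (Fin n → F)))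
    {W | W ≠ ⊥ ∧ ∀ u ∈ U, ∀ v ∈ W, (u : Matrix (Fin n) (Fin n) F) *ᵥ v ∈ W}
    ⟨⊤, ⟨by
      intro h
      have : (fun _ => 1 : Fin n → F) ∈ (⊤ : Submodule F (Fin n → F)) := trivial
      rw [h, Submodule.mem_bot] at this
      exact one_ne_zero (congrFun this 0), fun _ _ _ _ => trivial⟩⟩
  let tr : SpecialLinearGroup (Fin n) F → Submodule F (Fin n → F) := fun g => W.map (toLin' g.1)
  have hinj : ∀ g : SpecialLinearGroup (Fin n) F, Function.Injective (toLin' g.1) := by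
    intro g
    refine Function.LeftInverse.injective (g := toLin' (g⁻¹).1) fun v => ?_
    have e : (g⁻¹).1 * g.1 = 1 := congrArg Subtype.val (inv_mul_cancel g)
    rw [toLin'_apply, toLin'_apply, mulVec_mulVec, e, one_mulVec]
  have hsup : sSup {W' | ∃ g ∈ Γ, W' = tr g} = ⊤ := by
    refine (irr_of_adjoin _ hΓ _ ?_).resolve_left ?_
    · rintro _ ⟨g, hg, rfl⟩
      have : sSup {W' | ∃ g ∈ Γ, W' = tr g} ≤ (sSup {W' | ∃ g ∈ Γ, W' = tr g}).comap (toLin' g.1) := by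
        refine sSup_le ?_
        rintro _ ⟨h, hh, rfl⟩
        rw [← Submodule.map_le_iff_le_comap]
        have e : (tr h).map (toLin' g.1) = tr (g * h) := by
          have e1 : (g * h).1 = g.1 * h.1 := rfl
          simp only [tr]
          rw [e1, toLin'_mul, Submodule.map_comp]
        rw [e]
        exact le_sSup ⟨_, Γ.mul_mem hg hh, rfl⟩
      exact this
    · intro h
      have h1 : tr 1 ≤ ⊥ := h ▸ le_sSup ⟨1, Γ.one_mem, rfl⟩
      apply hW0
      have h2 : tr 1 = W := by
        have e1 : (1 : SpecialLinearGroup (Fin n) F).1 = 1 := rfl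
        simp only [tr]
        rw [e1, toLin'_one, Submodule.map_id]
      rw [h2] at h1
      exact le_bot_iff.1 h1
  have hWmin : ∀ U' : Submodule F (Fin n → F), (∀ u ∈ U, ∀ v ∈ U', (u : Matrix (Fin n) (Fin n) F) *ᵥ v ∈ U') →
      U' ≤ W → U' = ⊥ ∨ U' = W := by
    intro U' h1 h2
    by_contra h
    push Not at h
    exact hWm U' ⟨h.1, h1⟩ (lt_of_le_of_ne h2 h.2)
  have hdvd := B1.dvd_of_cover (F := F) (V := Fin n → F) ((fun u : SpecialLinearGroup (Fin n) F => toLin' u.1) '' U)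
    (finrank F W) {W' | ∃ g ∈ Γ, W' = tr g} ?_ ?_ ?_ hsup
  rotate_left
  · rintro _ ⟨g, hg, rfl⟩ _ ⟨u, hu, rfl⟩ _ ⟨w, hw, rfl⟩
    obtain ⟨u', hu', he⟩ := key g hg u hu
    refine ⟨(u' : Matrix (Fin n) (Fin n) F) *ᵥ w, hWi u' hu' w hw, ?_⟩
    simp only [toLin'_apply, mulVec_mulVec]
    rw [he]
  · rintro _ ⟨g, hg, rfl⟩ U' hU' hle
    have hh := hWmin (U'.comap (toLin' g.1)) ?_ ?_
    rotate_left
    · intro u hu v hv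
      obtain ⟨u', hu', he⟩ := key g⁻¹ (Γ.inv_mem hg) u hu
      have e2 : (g : Matrix (Fin n) (Fin n) F) * u = u' * g := by
        have e3 : u * g⁻¹ = g⁻¹ * u' := Subtype.ext he
        have e4 : g * u = u' * g := by
          calc g * u = g * (u * g⁻¹) * g := by group
            _ = _ := by rw [e3]; group
        exact congrArg Subtype.val e4
      rw [Submodule.mem_comap, toLin'_apply, mulVec_mulVec, e2, ← mulVec_mulVec]
      exact hU' _ ⟨u', hu', rfl⟩ hv
    · intro v hv
      obtain ⟨w, hw, he⟩ := hle (show toLin' g.1 v ∈ U' from hv)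
      rwa [← hinj g he]
    rcases hh with h | h
    · left
      rw [Submodule.eq_bot_iff]
      intro x hx
      obtain ⟨w, hw, rfl⟩ := hle hx
      have : w ∈ U'.comap (toLin' g.1) := hx
      rw [h, Submodule.mem_bot] at this
      rw [this, map_zero]
    · right
      refine le_antisymm hle ?_
      change W.map (toLin' g.1) ≤ U'
      rw [Submodule.map_le_iff_le_comap, h]
  · rintro _ ⟨g, hg, rfl⟩
    exact (LinearEquiv.finrank_eq (Submodule.equivMapOfInjective _ (hinj g) W)).symm
  rw [Module.finrank_fin_fun] at hdvd
  exact ⟨W, hW0, hWi, hWmin, hsup, (Nat.dvd_prime hn).1 hdvd, key⟩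

theorem clifford (hn : n.Prime) (Γ : Subgroup (SpecialLinearGroup (Fin n) F))
    (hΓ : Algebra.adjoin F ((fun g : SpecialLinearGroup (Fin n) F => (g : Matrix (Fin n) (Fin n) F)) ''
      (Γ : Set (SpecialLinearGroup (Fin n) F))) = ⊤)
    (U : Set (SpecialLinearGroup (Fin n) F)) (hconj : ∀ g ∈ Γ, ∀ u ∈ U, g * u * g⁻¹ ∈ U)
    (hnil : ∀ u ∈ U, ((u : Matrix (Fin n) (Fin n) F) - 1) ^ n = 0) (hU : ∃ u ∈ U, u ≠ 1) :
    Algebra.adjoin F ((fun g : SpecialLinearGroup (Fin n) F => (g : Matrix (Fin n) (Fin n) F)) '' U) = ⊤ := by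
  classical
  have hn0 : NeZero n := ⟨hn.ne_zero⟩
  obtain ⟨W, hW0, hWi, hWmin, hsup, hd, key⟩ := cover hn Γ hΓ U hconj
  obtain ⟨u, hu, hu1⟩ := hU
  rcases hd with h1 | h1
  · exfalso
    apply hu1
    have hfix : ∀ u ∈ U, ∀ w ∈ W, (u : Matrix (Fin n) (Fin n) F) *ᵥ w = w := by
      intro u hu w hw
      by_cases hw0 : w = 0
      · rw [hw0, mulVec_zero]
      obtain ⟨c, hc⟩ := (finrank_eq_one_iff_of_nonzero' (⟨w, hw⟩ : W)
        (fun h => hw0 (congrArg Subtype.val h))).1 h1 ⟨_, hWi u hu w hw⟩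
      have hc' : c • w = (u : Matrix (Fin n) (Fin n) F) *ᵥ w := congrArg Subtype.val hc
      have hpow : ∀ k : ℕ, (((u : Matrix (Fin n) (Fin n) F) - 1) ^ k) *ᵥ w = (c - 1) ^ k • w := by
        intro k
        induction k with
        | zero => simp
        | succ k ih =>
          rw [pow_succ', ← mulVec_mulVec, ih, mulVec_smul, sub_mulVec, one_mulVec, ← hc',
            pow_succ, mul_smul, sub_smul, one_smul]
      have h2 := hpow n
      rw [hnil u hu, zero_mulVec] at h2
      have h3 : c = 1 := by
        rcases smul_eq_zero.1 h2.symm with h | h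
        · exact sub_eq_zero.1 (pow_eq_zero_iff (hn.ne_zero) |>.1 h)
        · exact absurd h hw0
      rw [← hc', h3, one_smul]
    have hker : (⊤ : Submodule F (Fin n → F)) ≤ LinearMap.ker (toLin' (u.1 - 1)) := by
      rw [← hsup]
      refine sSup_le ?_
      rintro _ ⟨g, hg, rfl⟩ _ ⟨w, hw, rfl⟩
      obtain ⟨u', hu', he⟩ := key g hg u hu
      rw [LinearMap.mem_ker, toLin'_apply, toLin'_apply, sub_mulVec, one_mulVec, mulVec_mulVec, he,
        ← mulVec_mulVec, hfix u' hu' w hw, sub_self]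
    have h0 : toLin' (u.1 - 1) = 0 := LinearMap.ker_eq_top.1 (top_le_iff.1 hker)
    have := (map_eq_zero_iff _ (toLin' (R := F) (m := Fin n) (n := Fin n)).injective).1 h0
    exact Subtype.ext (sub_eq_zero.1 this)
  · have hWt : W = ⊤ := by
      apply Submodule.eq_top_of_finrank_eq
      rw [h1, Module.finrank_fin_fun]
    refine (B1.mat_burnside hn _ fun W' hW' => ?_).resolve_right fun hcomm => ?_
    · have := hWmin W' (fun u hu v hv => hW' _ ⟨u, hu, rfl⟩ ⟨v, hv, rfl⟩) (hWt ▸ le_top)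
      rwa [hWt] at this
    · have hN : u.1 - 1 ≠ 0 := fun h => hu1 (Subtype.ext (sub_eq_zero.1 h))
      have hh := hWmin (LinearMap.ker (toLin' (u.1 - 1))) ?_ (hWt ▸ le_top)
      rotate_left
      · intro u' hu' v hv
        rw [LinearMap.mem_ker, toLin'_apply] at hv ⊢
        have e : (u.1 - 1) * u'.1 = u'.1 * (u.1 - 1) := by
          rw [sub_mul, mul_sub, one_mul, mul_one, hcomm _ ⟨u, hu, rfl⟩ _ ⟨u', hu', rfl⟩]
        rw [mulVec_mulVec, e, ← mulVec_mulVec, hv, mulVec_zero]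
      rcases hh with h | h
      · have h2 : Function.Injective (toLin' (u.1 - 1)) := LinearMap.ker_eq_bot.1 h
        have h3 : IsUnit (u.1 - 1) := by
          have := LinearEquiv.ofInjectiveEndo _ h2
          exact Matrix.mulVec_injective_iff_isUnit.1 h2
        have h4 := h3.pow n
        rw [hnil u hu] at h4
        have : Nonempty (Fin n) := ⟨0⟩
        exact not_isUnit_zero h4
      · rw [hWt] at h
        have h0 := LinearMap.ker_eq_top.1 h
        exact hN ((map_eq_zero_iff _ (toLin' (R := F) (m := Fin n) (n := Fin n)).injective).1 h0)

theorem clifford_comm (hn : n.Prime) (Γ : Subgroup (SpecialLinearGroup (Fin n) F))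
    (hΓ : Algebra.adjoin F ((fun g : SpecialLinearGroup (Fin n) F => (g : Matrix (Fin n) (Fin n) F)) ''
      (Γ : Set (SpecialLinearGroup (Fin n) F))) = ⊤)
    (U : Set (SpecialLinearGroup (Fin n) F)) (hconj : ∀ g ∈ Γ, ∀ u ∈ U, g * u * g⁻¹ ∈ U) :
    Algebra.adjoin F ((fun g : SpecialLinearGroup (Fin n) F => (g : Matrix (Fin n) (Fin n) F)) '' U) = ⊤ ∨
      ∀ u ∈ U, ∀ u' ∈ U, u * u' = u' * u := by
  classical
  obtain ⟨W, hW0, hWi, hWmin, hsup, hd, key⟩ := cover hn Γ hΓ U hconj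
  rcases hd with h1 | h1
  · right
    have hsc : ∀ u ∈ U, ∀ g ∈ Γ, ∃ c : F, ∀ w ∈ W,
        (u : Matrix (Fin n) (Fin n) F) *ᵥ ((g : Matrix (Fin n) (Fin n) F) *ᵥ w) =
          c • ((g : Matrix (Fin n) (Fin n) F) *ᵥ w) := by
      intro u hu g hg
      obtain ⟨u', hu', he⟩ := key g hg u hu
      obtain ⟨w0, hw0, hw00⟩ := (Submodule.ne_bot_iff _).1 hW0
      have hone := (finrank_eq_one_iff_of_nonzero' (⟨w0, hw0⟩ : W)
        (fun h => hw00 (congrArg Subtype.val h))).1 h1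
      obtain ⟨c, hc⟩ := hone ⟨_, hWi u' hu' w0 hw0⟩
      have hc' : c • w0 = (u' : Matrix (Fin n) (Fin n) F) *ᵥ w0 := congrArg Subtype.val hc
      refine ⟨c, fun w hw => ?_⟩
      obtain ⟨d, hd⟩ := hone ⟨w, hw⟩
      have hd' : d • w0 = w := congrArg Subtype.val hd
      rw [mulVec_mulVec, he, ← mulVec_mulVec, ← hd', mulVec_smul, ← hc', smul_comm, mulVec_smul]
    intro u hu u' hu'
    have hker : (⊤ : Submodule F (Fin n → F)) ≤ LinearMap.ker (toLin' (u.1 * u'.1 - u'.1 * u.1)) := by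
      rw [← hsup]
      refine sSup_le ?_
      rintro _ ⟨g, hg, rfl⟩ _ ⟨w, hw, rfl⟩
      obtain ⟨c, hc⟩ := hsc u hu g hg
      obtain ⟨c', hc'⟩ := hsc u' hu' g hg
      rw [LinearMap.mem_ker, toLin'_apply, toLin'_apply, sub_mulVec, ← mulVec_mulVec, ← mulVec_mulVec,
        hc w hw, hc' w hw, mulVec_smul, mulVec_smul, hc w hw, hc' w hw, smul_comm, sub_self]
    have h0 : toLin' (u.1 * u'.1 - u'.1 * u.1) = 0 := LinearMap.ker_eq_top.1 (top_le_iff.1 hker)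
    have := (map_eq_zero_iff _ (toLin' (R := F) (m := Fin n) (n := Fin n)).injective).1 h0
    exact Subtype.ext (sub_eq_zero.1 this)
  · have hWt : W = ⊤ := by
      apply Submodule.eq_top_of_finrank_eq
      rw [h1, Module.finrank_fin_fun]
    refine (B1.mat_burnside hn _ fun W' hW' => ?_).imp id fun hcomm u hu u' hu' => ?_
    · have := hWmin W' (fun u hu v hv => hW' _ ⟨u, hu, rfl⟩ ⟨v, hv, rfl⟩) (hWt ▸ le_top)
      rwa [hWt] at this
    · exact Subtype.ext (hcomm _ ⟨u, hu, rfl⟩ _ ⟨u', hu', rfl⟩)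
end B2
end

section
namespace B3
open Module Matrix
open scoped Nat

section gen
variable {F : Type*} [Field F] {n : ℕ}

theorem scalar_of_commute (T : Set (Matrix (Fin n) (Fin n) F)) (hT : Algebra.adjoin F T = ⊤)
    (Z : Matrix (Fin n) (Fin n) F) (hZ : ∀ u ∈ T, u * Z = Z * u) : ∃ c : F, Z = c • 1 := by
  have hall : ∀ f : Matrix (Fin n) (Fin n) F, f * Z = Z * f := by
    intro f
    have hf : f ∈ Algebra.adjoin F T := hT ▸ Algebra.mem_top
    induction hf using Algebra.adjoin_induction with
    | mem y hy => exact hZ y hy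
    | algebraMap r => exact Algebra.commutes r Z
    | add a b _ _ ha hb => rw [mul_add, add_mul, ha, hb]
    | mul a b _ _ ha hb => rw [mul_assoc, hb, ← mul_assoc, ha, mul_assoc]
  obtain ⟨c, hc⟩ := Matrix.mem_range_scalar_of_commute_single (M := Z) (fun i j _ => hall _)
  exact ⟨c, by rw [← hc, Matrix.smul_one_eq_diagonal]; rfl⟩

theorem form_unique (T : Set (Matrix (Fin n) (Fin n) F)) (hT : Algebra.adjoin F T = ⊤)
    (hdet : ∀ u ∈ T, IsUnit u.det) (Φ Ψ : Matrix (Fin n) (Fin n) F) (h0 : Φ ≠ 0)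
    (hΦ : ∀ u ∈ T, u * Φ * uᵀ = Φ) (hΨ : ∀ u ∈ T, u * Ψ * uᵀ = Ψ) :
    IsUnit Φ ∧ ∃ c : F, Ψ = c • Φ := by
  have hswap : ∀ Θ : Matrix (Fin n) (Fin n) F, (∀ u ∈ T, u * Θ * uᵀ = Θ) →
      ∀ u ∈ T, u * Θ = Θ * (uᵀ)⁻¹ := by
    intro Θ h u hu
    have hu' : IsUnit (uᵀ).det := by rw [det_transpose]; exact hdet u hu
    conv_rhs => rw [← h u hu]
    rw [mul_assoc, Matrix.mul_nonsing_inv _ hu', mul_one]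
  have hunit : IsUnit Φ := by
    have h1 := B2.irr_of_adjoin T hT (LinearMap.range (toLin' Φ)) (fun f hf v hv => by
      obtain ⟨w, rfl⟩ := hv
      refine ⟨((fᵀ)⁻¹) *ᵥ w, ?_⟩
      rw [toLin'_apply, toLin'_apply, mulVec_mulVec, mulVec_mulVec, hswap Φ hΦ f hf])
    rcases h1 with h1 | h1
    · exfalso
      apply h0
      have := LinearMap.range_eq_bot.1 h1
      exact (map_eq_zero_iff _ (toLin' (R := F) (m := Fin n) (n := Fin n)).injective).1 this
    · rw [← Matrix.mulVec_surjective_iff_isUnit]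
      exact LinearMap.range_eq_top.1 h1
  refine ⟨hunit, ?_⟩
  have hd : IsUnit Φ.det := (Matrix.isUnit_iff_isUnit_det _).1 hunit
  obtain ⟨c, hc⟩ := scalar_of_commute T hT (Ψ * Φ⁻¹) (fun u hu => by
    have h2 : (uᵀ)⁻¹ * Φ⁻¹ = Φ⁻¹ * u := by
      have h3 := hswap Φ hΦ u hu
      calc (uᵀ)⁻¹ * Φ⁻¹ = Φ⁻¹ * (Φ * (uᵀ)⁻¹) * Φ⁻¹ := by
            rw [← mul_assoc Φ⁻¹, Matrix.nonsing_inv_mul _ hd, one_mul]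
        _ = _ := by rw [← h3, mul_assoc, mul_assoc, Matrix.mul_nonsing_inv _ hd, mul_one]
    rw [← mul_assoc, hswap Ψ hΨ u hu, mul_assoc, h2, mul_assoc])
  refine ⟨c, ?_⟩
  calc Ψ = Ψ * Φ⁻¹ * Φ := by rw [mul_assoc, Matrix.nonsing_inv_mul _ hd, mul_one]
    _ = _ := by rw [hc, smul_mul_assoc, one_mul]

theorem pow_n_of_nilp (N : Matrix (Fin n) (Fin n) F) (h : IsNilpotent N) : N ^ n = 0 := by
  have h1 := (Matrix.isNilpotent_charpoly_sub_pow_of_isNilpotent h).eq_zero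
  have h2 := Matrix.aeval_self_charpoly N
  rw [sub_eq_zero.1 h1] at h2
  simpa using h2

/-- bracket extraction -/
theorem bracket_mem [Fintype F] (hn : 2 ≤ n) (hc : 2 * n ≤ Fintype.card F)
    (S : Submodule F (Matrix (Fin n) (Fin n) F)) (X Y : Matrix (Fin n) (Fin n) F)
    (h : ∀ t : F, D1.E F n (t • X) * Y * D1.E F n ((-t) • X) ∈ S) : X * Y - Y * X ∈ S := by
  by_contra hne
  obtain ⟨ℓ, hℓ1, hℓ2⟩ := Submodule.exists_le_ker_of_notMem hne
  apply hℓ1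
  obtain ⟨m, rfl⟩ : ∃ m, n = m + 2 := ⟨n - 2, by omega⟩
  let co : ℕ → ℕ → F := fun i j => ((i ! : ℕ) : F)⁻¹ * ((j ! : ℕ) : F)⁻¹ * (-1) ^ j * ℓ (X ^ i * Y * X ^ j)
  let q : Polynomial F := ∑ i ∈ Finset.range (m+2), ∑ j ∈ Finset.range (m+2),
    Polynomial.C (co i j) * Polynomial.X ^ (i + j)
  have hq0 : q = 0 := by
    refine Polynomial.eq_zero_of_natDegree_lt_card_of_eval_eq_zero q (f := id)
      Function.injective_id (fun t => ?_) (lt_of_lt_of_le ?_ hc)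
    · have h1 := hℓ2 (h t)
      rw [LinearMap.mem_ker] at h1
      rw [← h1]
      simp only [D1.E, q, Finset.sum_mul, Finset.mul_sum, Polynomial.eval_finsetSum, map_sum,
        Polynomial.eval_mul, Polynomial.eval_C, Polynomial.eval_pow, Polynomial.eval_X, id]
      rw [Finset.sum_comm]
      refine Finset.sum_congr rfl fun i _ => Finset.sum_congr rfl fun j _ => ?_
      simp only [_root_.smul_pow, smul_mul_assoc, mul_smul_comm, map_smul, smul_eq_mul, co]
      rw [neg_pow t]
      ring
    · refine lt_of_le_of_lt (Polynomial.natDegree_sum_le_of_forall_le (n := 2 * (m+2) - 2) _ _ fun i hi =>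
        Polynomial.natDegree_sum_le_of_forall_le _ _ fun j hj => ?_) (by omega)
      refine (Polynomial.natDegree_C_mul_X_pow_le _ _).trans ?_
      have := Finset.mem_range.1 hi
      have := Finset.mem_range.1 hj
      omega
  have h1 : q.coeff 1 = ℓ (X * Y - Y * X) := by
    simp only [q, Polynomial.finsetSum_coeff, Polynomial.coeff_C_mul, Polynomial.coeff_X_pow]
    rw [Finset.sum_range_succ', Finset.sum_range_succ']
    rw [Finset.sum_eq_zero fun i _ => Finset.sum_eq_zero fun j _ => by rw [if_neg (by omega), mul_zero]]
    rw [Finset.sum_eq_single (a := 0) (s := Finset.range (m+2)) (f := fun j => co (0+1) j * _),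
      Finset.sum_eq_single (a := 1) (s := Finset.range (m+2)) (f := fun j => co 0 j * _)]
    · simp [co]
      ring
    · intro j _ hj; rw [if_neg (by omega), mul_zero]
    · intro h; exact absurd (Finset.mem_range.2 (by omega)) h
    · intro j _ hj; rw [if_neg (by omega), mul_zero]
    · intro h; exact absurd (Finset.mem_range.2 (by omega)) h
  rw [← h1, hq0, Polynomial.coeff_zero]

theorem E_conj (g h X : Matrix (Fin n) (Fin n) F) (hg : h * g = 1) :
    D1.E F n (g * X * h) = g * D1.E F n X * h := by
  have hp : ∀ k, (g * X * h) ^ k = g * X ^ k * h := by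
    intro k
    induction k with
    | zero => rw [pow_zero, pow_zero, mul_one, mul_eq_one_comm.1 hg]
    | succ k ih =>
      rw [pow_succ, ih, pow_succ]
      calc _ = g * X ^ k * (h * g) * X * h := by noncomm_ring
        _ = _ := by rw [hg]; noncomm_ring
  simp only [D1.E, hp, Finset.mul_sum, Finset.sum_mul, mul_smul_comm, smul_mul_assoc]

theorem E_form (hF : ∀ k < n, ((k ! : ℕ) : F) ≠ 0) (hn : 0 < n) (X Φ : Matrix (Fin n) (Fin n) F)
    (hX : X ^ n = 0) (h : X * Φ + Φ * Xᵀ = 0) :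
    D1.E F n X * Φ * (D1.E F n X)ᵀ = Φ := by
  have h1 : X * Φ = Φ * (-Xᵀ) := by rw [mul_neg]; exact eq_neg_of_add_eq_zero_left h
  have h2 : ∀ k, X ^ k * Φ = Φ * (-Xᵀ) ^ k := by
    intro k
    induction k with
    | zero => simp
    | succ k ih => rw [pow_succ, mul_assoc, h1, ← mul_assoc, ih, mul_assoc, ← pow_succ]
  have h3 : D1.E F n X * Φ = Φ * D1.E F n (-Xᵀ) := by
    simp only [D1.E, Finset.sum_mul, Finset.mul_sum, smul_mul_assoc, mul_smul_comm, h2]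
  have h4 : (D1.E F n X)ᵀ = D1.E F n Xᵀ := by
    simp only [D1.E, transpose_sum, transpose_smul, transpose_pow]
  have hXt : (Xᵀ) ^ n = 0 := by rw [← transpose_pow, hX, transpose_zero]
  have h5 := D1.E_smul_add hF hXt (-1) 1
  rw [neg_add_cancel, zero_smul, D1.E_zero hn, neg_one_smul, one_smul] at h5
  rw [h3, h4, mul_assoc, ← h5, mul_one]
end gen

theorem main (n : ℕ) (hn : n.Prime) (hodd : Odd n) : ∃ N : ℕ, ∀ (p : ℕ) [Fact p.Prime], N < p →
    ∀ Γ : Subgroup (SpecialLinearGroup (Fin n) (ZMod p)),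
    Algebra.adjoin (ZMod p) ((fun g : SpecialLinearGroup (Fin n) (ZMod p) =>
      (g : Matrix (Fin n) (Fin n) (ZMod p))) '' (Γ : Set (SpecialLinearGroup (Fin n) (ZMod p)))) = ⊤ →
    p ∣ Nat.card Γ → Γ = ⊤ ∨ ∃ Φ : Matrix (Fin n) (Fin n) (ZMod p), IsUnit Φ ∧ ∀ g ∈ Γ, ∃ c : ZMod p,
      (g : Matrix (Fin n) (Fin n) (ZMod p)) * Φ * (g : Matrix (Fin n) (Fin n) (ZMod p))ᵀ = c • Φ := by
  obtain ⟨N1, hN1⟩ := T1.transfer n hn hodd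
  obtain ⟨N2, hN2⟩ := D4.main n hn.two_le
  refine ⟨N1 + N2 + 2 * n, fun p hp hNp Γ hΓ hpΓ => ?_⟩
  classical
  have hF := D4.fact_ne (n := n) (p := p) (by omega)
  have hn0 : NeZero n := ⟨hn.ne_zero⟩
  let U : Set (SpecialLinearGroup (Fin n) (ZMod p)) := {u | u ∈ Γ ∧ u ^ p = 1}
  let P := Subgroup.closure U
  have hPΓ : P ≤ Γ := (Subgroup.closure_le _).2 fun u hu => hu.1
  have hconj : ∀ g ∈ Γ, ∀ u ∈ U, g * u * g⁻¹ ∈ U := by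
    intro g hg u hu
    refine ⟨Γ.mul_mem (Γ.mul_mem hg hu.1) (Γ.inv_mem hg), ?_⟩
    rw [conj_pow, hu.2, mul_one, mul_inv_cancel]
  have hnil : ∀ u ∈ U, ((u : Matrix (Fin n) (Fin n) (ZMod p)) - 1) ^ n = 0 := by
    intro u hu
    refine pow_n_of_nilp _ ⟨p, ?_⟩
    have : (u : Matrix (Fin n) (Fin n) (ZMod p)) ^ p = 1 := congrArg Subtype.val hu.2
    rw [sub_pow_char_of_commute p (Commute.one_right _), this, one_pow, sub_self]
  have hU1 : ∃ u ∈ U, u ≠ 1 := by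
    obtain ⟨x, hx⟩ := exists_prime_orderOf_dvd_card' (G := Γ) p hpΓ
    refine ⟨x.1, ⟨x.2, ?_⟩, fun h => ?_⟩
    · have : x ^ p = 1 := by
        have := pow_orderOf_eq_one x
        rwa [hx] at this
      exact congrArg Subtype.val this
    · have h1 : x = 1 := Subtype.ext h
      rw [h1, orderOf_one] at hx
      exact hp.out.one_lt.ne hx
  have hadjU := B2.clifford hn Γ hΓ U hconj hnil hU1
  set S := Submodule.span (ZMod p) (D4.logs P) with hS
  have hlog : ∀ u ∈ U, ∃ X ∈ D4.logs P, D1.E (ZMod p) n X = (u : Matrix (Fin n) (Fin n) (ZMod p)) := by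
    intro u hu
    obtain ⟨X, hX, hXt⟩ := D1.exists_log (F := ZMod p) hn.pos hF _ (hnil u hu)
    rw [add_sub_cancel] at hXt
    refine ⟨X, ⟨hX, fun t => ⟨u ^ t.val, P.pow_mem (Subgroup.subset_closure hu) _, ?_⟩⟩, ?_⟩
    · have := hXt t.val
      rw [ZMod.natCast_zmod_val] at this
      rw [this]; rfl
    · have := hXt 1
      rwa [Nat.cast_one, one_smul, pow_one] at this
  have hconjlog : ∀ X ∈ D4.logs P, ∀ Y ∈ D4.logs P, ∀ t : ZMod p,
      D1.E (ZMod p) n (t • X) * Y * D1.E (ZMod p) n ((-t) • X) ∈ D4.logs P := by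
    intro X hX Y hY t
    have h1 := D1.E_smul_add hF hX.1 (-t) t
    rw [neg_add_cancel, zero_smul, D1.E_zero hn.pos] at h1
    obtain ⟨g, hg, hge⟩ := hX.2 t
    obtain ⟨g', hg', hge'⟩ := hX.2 (-t)
    refine ⟨?_, fun s => ?_⟩
    · refine pow_n_of_nilp _ ⟨n, ?_⟩
      have : ∀ k, (D1.E (ZMod p) n (t • X) * Y * D1.E (ZMod p) n ((-t) • X)) ^ (k + 1) =
          D1.E (ZMod p) n (t • X) * Y ^ (k + 1) * D1.E (ZMod p) n ((-t) • X) := by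
        intro k
        generalize D1.E (ZMod p) n (t • X) = a at *
        generalize D1.E (ZMod p) n ((-t) • X) = b at *
        induction k with
        | zero => simp
        | succ k ih =>
          rw [pow_succ, ih, pow_succ Y (k+1)]
          calc _ = a * Y ^ (k+1) * (b * a) * Y * b := by noncomm_ring
            _ = _ := by rw [← h1]; noncomm_ring
      obtain ⟨m, hm⟩ : ∃ m, n = m + 1 := ⟨n - 1, by have := hn.pos; omega⟩
      have h2 := this m
      rw [← hm] at h2
      rw [h2, hY.1, mul_zero, zero_mul]
    · obtain ⟨k, hk, hke⟩ := hY.2 s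
      refine ⟨g * k * g', P.mul_mem (P.mul_mem hg hk) hg', ?_⟩
      have : s • (D1.E (ZMod p) n (t • X) * Y * D1.E (ZMod p) n ((-t) • X)) =
        D1.E (ZMod p) n (t • X) * (s • Y) * D1.E (ZMod p) n ((-t) • X) := by
        rw [mul_smul_comm, smul_mul_assoc]
      rw [this, E_conj _ _ _ h1.symm, ← hge, ← hke, ← hge']
      rfl
  have hbr0 : ∀ X ∈ D4.logs P, ∀ Y ∈ D4.logs P, X * Y - Y * X ∈ S := fun X hX Y hY =>
    bracket_mem hn.two_le (by rw [ZMod.card]; omega) S X Y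
      (fun t => Submodule.subset_span (hconjlog X hX Y hY t))
  have hbr : ∀ X ∈ S, ∀ Y ∈ S, X * Y - Y * X ∈ S := by
    intro X hX Y hY
    induction hX using Submodule.span_induction with
    | mem X hX =>
      induction hY using Submodule.span_induction with
      | mem Y hY => exact hbr0 X hX Y hY
      | zero => simp
      | add a b _ _ ha hb =>
        rw [show X * (a + b) - (a + b) * X = (X * a - a * X) + (X * b - b * X) by noncomm_ring]
        exact S.add_mem ha hb
      | smul c a _ ha =>
        rw [mul_smul_comm, smul_mul_assoc, ← smul_sub]; exact S.smul_mem c ha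
    | zero => simp
    | add a b _ _ ha hb =>
      rw [show (a + b) * Y - Y * (a + b) = (a * Y - Y * a) + (b * Y - Y * b) by noncomm_ring]
      exact S.add_mem ha hb
    | smul c a _ ha =>
      rw [mul_smul_comm, smul_mul_assoc, ← smul_sub]; exact S.smul_mem c ha
  have htr : ∀ X ∈ S, trace X = 0 := by
    intro X hX
    induction hX using Submodule.span_induction with
    | mem X hX => exact (Matrix.isNilpotent_trace_of_isNilpotent ⟨n, hX.1⟩).eq_zero
    | zero => simp
    | add a b _ _ ha hb => rw [trace_add, ha, hb, add_zero]
    | smul c a _ ha => rw [trace_smul, ha, smul_zero]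
  have hadjS : Algebra.adjoin (ZMod p) (S : Set (Matrix (Fin n) (Fin n) (ZMod p))) = ⊤ := by
    rw [eq_top_iff, ← hadjU]
    refine Algebra.adjoin_le ?_
    rintro _ ⟨u, hu, rfl⟩
    obtain ⟨X, hX, hXu⟩ := hlog u hu
    have hXS : X ∈ Algebra.adjoin (ZMod p) (S : Set (Matrix (Fin n) (Fin n) (ZMod p))) :=
      Algebra.subset_adjoin (Submodule.subset_span hX)
    change (u : Matrix (Fin n) (Fin n) (ZMod p)) ∈ Algebra.adjoin (ZMod p) (S : Set (Matrix (Fin n) (Fin n) (ZMod p)))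
    rw [← hXu]
    exact sum_mem fun k _ => Subalgebra.smul_mem _ (pow_mem hXS k) _
  by_cases hform : ∀ Φ : Matrix (Fin n) (Fin n) (ZMod p), (∀ X ∈ S, X * Φ + Φ * Xᵀ = 0) → Φ = 0
  · left
    have h1 := hN1 p hp.out (by omega) S hbr htr hadjS hform
    have h2 := hN2 p (by omega) P h1
    rw [eq_top_iff, ← h2]
    exact hPΓ
  · right
    push Not at hform
    obtain ⟨Φ, hΦ, hΦ0⟩ := hform
    have hinv : ∀ u ∈ U, (u : Matrix (Fin n) (Fin n) (ZMod p)) * Φ *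
        (u : Matrix (Fin n) (Fin n) (ZMod p))ᵀ = Φ := by
      intro u hu
      obtain ⟨X, hX, hXu⟩ := hlog u hu
      rw [← hXu]
      exact E_form hF hn.pos X Φ hX.1 (hΦ X (Submodule.subset_span hX))
    have huni := fun Ψ => form_unique _ hadjU (by rintro _ ⟨u, _, rfl⟩; rw [u.2]; exact isUnit_one)
      Φ Ψ hΦ0 (by rintro _ ⟨u, hu, rfl⟩; exact hinv u hu)
    refine ⟨Φ, (huni Φ (by rintro _ ⟨u, hu, rfl⟩; exact hinv u hu)).1, fun g hg => ?_⟩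
    refine (huni _ ?_).2
    rintro _ ⟨u, hu, rfl⟩
    have hu' := hinv _ (hconj g⁻¹ (Γ.inv_mem hg) u hu)
    have e : (u : Matrix (Fin n) (Fin n) (ZMod p)) * g =
        g * (g⁻¹ * u * g⁻¹⁻¹ : SpecialLinearGroup (Fin n) (ZMod p)) := by
      have : u * g = g * (g⁻¹ * u * g⁻¹⁻¹) := by group
      exact congrArg Subtype.val this
    generalize ((g⁻¹ * u * g⁻¹⁻¹ : SpecialLinearGroup (Fin n) (ZMod p)) :
      Matrix (Fin n) (Fin n) (ZMod p)) = w at *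
    change (u : Matrix (Fin n) (Fin n) (ZMod p)) * (g * Φ * (g : Matrix (Fin n) (Fin n) (ZMod p))ᵀ) *
      (u : Matrix (Fin n) (Fin n) (ZMod p))ᵀ = _
    generalize (u : Matrix (Fin n) (Fin n) (ZMod p)) = u at *
    generalize (g : Matrix (Fin n) (Fin n) (ZMod p)) = g at *
    calc _ = (u * g) * Φ * (u * g)ᵀ := by
          rw [transpose_mul]; noncomm_ring
      _ = g * (w * Φ * wᵀ) * gᵀ := by
          rw [e, transpose_mul]; noncomm_ring
      _ = _ := by rw [hu']
end B3
end

section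
namespace P0
open Module Matrix

theorem clear_denoms {ι : Type*} (S : Set (ι → ℤ)) (v : ι → ℚ)
    (hv : v ∈ Submodule.span ℚ ((fun s : ι → ℤ => fun i => (s i : ℚ)) '' S)) :
    ∃ D : ℤ, D ≠ 0 ∧ ∃ z ∈ Submodule.span ℤ S, ∀ i, (D : ℚ) * v i = z i := by
  induction hv using Submodule.span_induction with
  | mem x hx =>
    obtain ⟨s, hs, rfl⟩ := hx
    exact ⟨1, one_ne_zero, s, Submodule.subset_span hs, fun i => by simp⟩
  | zero => exact ⟨1, one_ne_zero, 0, zero_mem _, fun i => by simp⟩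
  | add a b _ _ ha hb =>
    obtain ⟨D, hD, z, hz, h⟩ := ha
    obtain ⟨D', hD', z', hz', h'⟩ := hb
    refine ⟨D * D', mul_ne_zero hD hD', D' • z + D • z',
      add_mem (Submodule.smul_mem _ _ hz) (Submodule.smul_mem _ _ hz'), fun i => ?_⟩
    simp only [Pi.add_apply, Pi.smul_apply, smul_eq_mul]
    push_cast
    rw [← h, ← h']; ring
  | smul q a _ ha =>
    obtain ⟨D, hD, z, hz, h⟩ := ha
    refine ⟨D * q.den, mul_ne_zero hD (by exact_mod_cast q.den_nz), q.num • z,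
      Submodule.smul_mem _ _ hz, fun i => ?_⟩
    simp only [Pi.smul_apply, smul_eq_mul]
    push_cast
    rw [← h]
    have : (q.den : ℚ) * q = q.num := by rw [mul_comm]; exact Rat.mul_den_eq_num q
    linear_combination (D : ℚ) * a i * this

theorem linsys {ι : Type} [Fintype ι] [DecidableEq ι] (S : Set (ι → ℤ)) (Q : Set ℕ) (hinf : Q.Infinite)
    (hP : ∀ p ∈ Q, p.Prime ∧ ∃ x : ι → ZMod p, x ≠ 0 ∧ ∀ s ∈ S, ∑ i, (s i : ZMod p) * x i = 0) :
    ∃ x : ι → ℚ, x ≠ 0 ∧ ∀ s ∈ S, ∑ i, (s i : ℚ) * x i = 0 := by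
  by_cases hT : Submodule.span ℚ ((fun s : ι → ℤ => fun i => (s i : ℚ)) '' S) = ⊤
  · exfalso
    choose D hD z hz h using fun i => clear_denoms S (Pi.single i 1 : ι → ℚ) (hT ▸ Submodule.mem_top)
    obtain ⟨p, hp, hpl⟩ := hinf.exists_gt (∑ i, (D i).natAbs)
    obtain ⟨hpp, x, hx0, hx⟩ := hP p hp
    have hxz : ∀ z ∈ Submodule.span ℤ S, ∑ i, (z i : ZMod p) * x i = 0 := by
      intro z hz
      induction hz using Submodule.span_induction with
      | mem s hs => exact hx s hs
      | zero => simp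
      | add a b _ _ ha hb =>
        simp only [Pi.add_apply, Int.cast_add, add_mul, Finset.sum_add_distrib, ha, hb, add_zero]
      | smul c a _ ha =>
        simp only [Pi.smul_apply, smul_eq_mul, Int.cast_mul, mul_assoc, ← Finset.mul_sum, ha, mul_zero]
    apply hx0
    funext i
    have h1 := hxz (z i) (hz i)
    have h2 : ∀ j, z i j = if j = i then D i else 0 := by
      intro j
      have := h i j
      rw [Pi.single_apply] at this
      split_ifs at this ⊢
      · rw [mul_one] at this; exact_mod_cast this.symm
      · rw [mul_zero] at this; exact_mod_cast this.symm
    simp only [h2, Int.cast_ite, Int.cast_zero, ite_mul, zero_mul, Finset.sum_ite_eq', Finset.mem_univ,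
      if_true] at h1
    have := Fact.mk hpp
    refine (mul_eq_zero.1 h1).resolve_left fun h3 => ?_
    rw [ZMod.intCast_zmod_eq_zero_iff_dvd] at h3
    have h4 := Nat.le_of_dvd (Int.natAbs_pos.2 (hD i)) (Int.natCast_dvd.1 h3)
    have h5 : (D i).natAbs ≤ ∑ i, (D i).natAbs :=
      Finset.single_le_sum (f := fun i => (D i).natAbs) (fun _ _ => Nat.zero_le _) (Finset.mem_univ i)
    omega
  · obtain ⟨ℓ, hℓ0, hℓ⟩ := Submodule.exists_le_ker_of_lt_top _ (lt_top_iff_ne_top.2 hT)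
    have hexp : ∀ v : ι → ℚ, ℓ v = ∑ i, v i * ℓ (Pi.single i 1) := by
      intro v
      rw [LinearMap.pi_apply_eq_sum_univ ℓ v]
      refine Finset.sum_congr rfl fun i _ => ?_
      rw [smul_eq_mul]
      congr 2
      funext j
      simp [Pi.single_apply, eq_comm]
    refine ⟨fun i => ℓ (Pi.single i 1), fun h0 => hℓ0 ?_, fun s hs => ?_⟩
    · ext i
      simpa using congrFun h0 i
    · have := hℓ (Submodule.subset_span ⟨s, hs, rfl⟩)
      rw [LinearMap.mem_ker, hexp] at this
      exact this

variable {n : ℕ}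

theorem matQ_mul (a b : SL n ℤ) : matQ (a * b) = matQ a * matQ b := by
  exact Matrix.map_mul (f := Int.castRingHom ℚ)

theorem matQ_one : matQ (1 : SL n ℤ) = 1 := by
  exact Matrix.map_one _ Int.cast_zero Int.cast_one

theorem matQ_inj {a b : SL n ℤ} (h : matQ a = matQ b) : a = b := by
  refine Subtype.ext (Matrix.ext fun i j => ?_)
  have := congrFun (congrFun h i) j
  exact Int.cast_injective (α := ℚ) this

theorem matQ_det (a : SL n ℤ) : (matQ a).det = 1 := by
  have := (Int.castRingHom ℚ).map_det (a : Matrix (Fin n) (Fin n) ℤ)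
  rw [a.2, map_one] at this
  exact this.symm

theorem solvable_of_comm (H : Subgroup (SL n ℤ)) (h : ∀ a ∈ H, ∀ b ∈ H, a * b = b * a) : IsSolvable H :=
  Group.isSolvable_of_comm fun a b => Subtype.ext (h a a.2 b b.2)

theorem abs_irr (hn : n.Prime) (H : Subgroup (SL n ℤ)) (hns : ¬ IsSolvable H) (hi : IrreducibleQ H) :
    AbsIrredQ H := by
  refine (B1.mat_burnside hn (matQ '' (H : Set (SL n ℤ)))
    fun W hW => hi W fun g hg => hW _ ⟨g, hg, rfl⟩).resolve_right fun h => ?_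
  refine hns (solvable_of_comm H fun a ha b hb => matQ_inj ?_)
  rw [matQ_mul, matQ_mul]
  exact h _ ⟨a, ha, rfl⟩ _ ⟨b, hb, rfl⟩

theorem red_apply (p : ℕ) (g : SL n ℤ) (i j : Fin n) :
    ((redMod n p g : SL n (ZMod p)) : Matrix (Fin n) (Fin n) (ZMod p)) i j =
      (((g : Matrix (Fin n) (Fin n) ℤ) i j : ℤ) : ZMod p) := rfl

theorem mod_span (H : Subgroup (SL n ℤ)) (hH : AbsIrredQ H) :
    {p : ℕ | p.Prime ∧ ¬ AbsIrredMod (H.map (redMod n p))}.Finite := by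
  classical
  by_contra hinf
  obtain ⟨x, hx0, hx⟩ := linsys (ι := Fin n × Fin n)
    ((fun g : SL n ℤ => fun ij : Fin n × Fin n => (g : Matrix (Fin n) (Fin n) ℤ) ij.1 ij.2) '' (H : Set (SL n ℤ)))
    _ hinf (fun p hp => ⟨hp.1, by
      have := Fact.mk hp.1
      set A := Algebra.adjoin (ZMod p)
        ((fun g : SL n (ZMod p) => (g : Matrix (Fin n) (Fin n) (ZMod p))) '' (H.map (redMod n p) : Set _)) with hA
      have hlt : A.toSubmodule < ⊤ := lt_top_iff_ne_top.2 fun h => hp.2 (Algebra.toSubmodule_eq_top.1 h)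
      obtain ⟨ℓ, hℓ0, hℓ⟩ := Submodule.exists_le_ker_of_lt_top _ hlt
      refine ⟨fun ij => ℓ (Matrix.single ij.1 ij.2 1), fun h0 => hℓ0 ?_, ?_⟩
      · exact Matrix.ext_linearMap _ fun a b => LinearMap.ext_ring (congrFun h0 (a, b))
      · rintro _ ⟨g, hg, rfl⟩
        have h1 := hℓ (show ((redMod n p g : SL n (ZMod p)) : Matrix (Fin n) (Fin n) (ZMod p)) ∈ A.toSubmodule from
          Algebra.subset_adjoin ⟨_, ⟨g, hg, rfl⟩, rfl⟩)
        rw [LinearMap.mem_ker, Matrix.matrix_eq_sum_single (redMod n p g : Matrix (Fin n) (Fin n) (ZMod p))] at h1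
        simp only [map_sum] at h1
        rw [Fintype.sum_prod_type, ← h1]
        refine Finset.sum_congr rfl fun a _ => Finset.sum_congr rfl fun b _ => ?_
        rw [← red_apply, ← smul_eq_mul, ← map_smul, Matrix.smul_single, smul_eq_mul, mul_one]⟩)
  -- functional over ℚ
  let ℓ : Matrix (Fin n) (Fin n) ℚ →ₗ[ℚ] ℚ := ∑ i, ∑ j, x (i, j) • Matrix.entryLinearMap ℚ ℚ i j
  have hℓ : ∀ M : Matrix (Fin n) (Fin n) ℚ, ℓ M = ∑ i, ∑ j, x (i, j) * M i j := by
    intro M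
    simp [ℓ, LinearMap.sum_apply]
  have hspan : (Algebra.adjoin ℚ (matQ '' (H : Set (SL n ℤ)))).toSubmodule ≤ LinearMap.ker ℓ := by
    rw [Algebra.adjoin_eq_span, Submodule.span_le]
    intro M hM
    have : M ∈ matQ '' (H : Set (SL n ℤ)) := by
      induction hM using Submonoid.closure_induction with
      | mem x hx => exact hx
      | one => exact ⟨1, H.one_mem, matQ_one⟩
      | mul a b _ _ ha hb =>
        obtain ⟨g, hg, rfl⟩ := ha
        obtain ⟨h, hh, rfl⟩ := hb
        exact ⟨g * h, H.mul_mem hg hh, matQ_mul g h⟩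
    obtain ⟨g, hg, rfl⟩ := this
    have h1 := hx _ ⟨g, hg, rfl⟩
    rw [Fintype.sum_prod_type] at h1
    change ℓ (matQ g) = 0
    rw [hℓ, ← h1]
    refine Finset.sum_congr rfl fun a _ => Finset.sum_congr rfl fun b _ => ?_
    exact mul_comm _ _
  have hH' : Algebra.adjoin ℚ (matQ '' (H : Set (SL n ℤ))) = ⊤ := hH
  rw [hH'] at hspan
  apply hx0
  funext ij
  have h1 : ℓ (Matrix.single ij.1 ij.2 1) = 0 := hspan (by simp)
  rw [hℓ, Finset.sum_eq_single ij.1, Finset.sum_eq_single ij.2] at h1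
  · simpa using h1
  · intro b _ hb; rw [Matrix.single_apply, if_neg (by tauto), mul_zero]
  · simp
  · intro b _ hb
    refine Finset.sum_eq_zero fun c _ => ?_
    rw [Matrix.single_apply, if_neg (by tauto), mul_zero]
  · simp
end P0
end

section
namespace E1
open Module Matrix
open scoped commutatorElement
variable {n : ℕ}

theorem solvable_of_commutators {G : Type*} [Group G]
    (h : ∀ a b c d : G, ⁅a, b⁆ * ⁅c, d⁆ = ⁅c, d⁆ * ⁅a, b⁆) : IsSolvable G := by
  refine ⟨2, ?_⟩
  rw [derivedSeries_succ, derivedSeries_one, Subgroup.commutator_eq_bot_iff_le_centralizer, commutator_eq_closure,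
    Subgroup.closure_le]
  rintro _ ⟨a, b, rfl⟩
  rw [Subgroup.centralizer_closure]
  simp only [SetLike.mem_coe, Subgroup.mem_centralizer_iff]
  rintro _ ⟨c, d, rfl⟩
  exact h c d a b

/-- reduction to rational matrices -/
def toQ (n : ℕ) : SL n ℤ →* SL n ℚ := Matrix.SpecialLinearGroup.map (Int.castRingHom ℚ)

theorem toQ_inj {g h : SL n ℤ} (e : toQ n g = toQ n h) : g = h :=
  P0.matQ_inj (congrArg Subtype.val e)

theorem toQ_adjoin (H : Subgroup (SL n ℤ)) (hH : AbsIrredQ H) :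
    Algebra.adjoin ℚ ((fun g : SpecialLinearGroup (Fin n) ℚ => (g : Matrix (Fin n) (Fin n) ℚ)) ''
      (H.map (toQ n) : Set (SpecialLinearGroup (Fin n) ℚ))) = ⊤ := by
  have hH' : Algebra.adjoin ℚ (matQ '' (H : Set (SL n ℤ))) = ⊤ := hH
  rw [← hH']
  congr 1
  ext M
  constructor
  · rintro ⟨_, ⟨g, hg, rfl⟩, rfl⟩; exact ⟨g, hg, rfl⟩
  · rintro ⟨g, hg, rfl⟩; exact ⟨_, ⟨g, hg, rfl⟩, rfl⟩

theorem comm_pres {F : Type*} [Field F] (Φ : Matrix (Fin n) (Fin n) F) (hΦ : IsUnit Φ)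
    (a b : SpecialLinearGroup (Fin n) F) (ha : ∃ c : F, a.1 * Φ * a.1ᵀ = c • Φ)
    (hb : ∃ c : F, b.1 * Φ * b.1ᵀ = c • Φ) : ⁅a, b⁆.1 * Φ * ⁅a, b⁆.1ᵀ = Φ := by
  obtain ⟨c, hc⟩ := ha
  obtain ⟨d, hd⟩ := hb
  have h1 : ⁅a, b⁆.1 * (b.1 * a.1) = a.1 * b.1 :=
    congrArg Subtype.val (show ⁅a, b⁆ * (b * a) = a * b by rw [commutatorElement_def]; group)
  have h2 : (a.1 * b.1) * Φ * (a.1 * b.1)ᵀ = (c * d) • Φ := by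
    rw [transpose_mul, show a.1 * b.1 * Φ * (b.1ᵀ * a.1ᵀ) = a.1 * (b.1 * Φ * b.1ᵀ) * a.1ᵀ by
      simp only [Matrix.mul_assoc], hd, Matrix.mul_smul, Matrix.smul_mul, hc, smul_smul, mul_comm]
  have h3 : (b.1 * a.1) * Φ * (b.1 * a.1)ᵀ = (c * d) • Φ := by
    rw [transpose_mul, show b.1 * a.1 * Φ * (a.1ᵀ * b.1ᵀ) = b.1 * (a.1 * Φ * a.1ᵀ) * b.1ᵀ by
      simp only [Matrix.mul_assoc], hc, Matrix.mul_smul, Matrix.smul_mul, hd, smul_smul]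
  by_cases h0 : c * d = 0
  · -- then `Φ = 0`
    rw [h0, zero_smul] at h2
    have e1 : IsUnit (a.1 * b.1) := by
      rw [Matrix.isUnit_iff_isUnit_det, det_mul, a.2, b.2]; simp
    have e2 : IsUnit (a.1 * b.1)ᵀ := by
      rw [Matrix.isUnit_iff_isUnit_det, det_transpose, det_mul, a.2, b.2]; simp
    have := (e1.mul hΦ).mul e2
    rw [h2] at this
    have hs := isUnit_zero_iff.1 this
    have : Subsingleton (Matrix (Fin n) (Fin n) F) := subsingleton_of_zero_eq_one hs
    exact Subsingleton.elim _ _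
  · have h4 : (⁅a, b⁆.1 * (b.1 * a.1)) * Φ * (⁅a, b⁆.1 * (b.1 * a.1))ᵀ = (c * d) • Φ := by rw [h1, h2]
    rw [transpose_mul (⁅a, b⁆.1), show ⁅a, b⁆.1 * (b.1 * a.1) * Φ * ((b.1 * a.1)ᵀ * ⁅a, b⁆.1ᵀ) =
      ⁅a, b⁆.1 * ((b.1 * a.1) * Φ * (b.1 * a.1)ᵀ) * ⁅a, b⁆.1ᵀ by simp only [Matrix.mul_assoc], h3,
      Matrix.mul_smul, Matrix.smul_mul] at h4
    exact smul_right_injective _ h0 h4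

theorem form_case (hn : n.Prime) (hodd : Odd n) (H : Subgroup (SL n ℤ)) (hH : AbsIrredQ H)
    (hns : ¬ IsSolvable H) (Q : Set ℕ) (hQ : Q.Infinite) (hP : ∀ p ∈ Q, p.Prime ∧
      ∃ Φ : Matrix (Fin n) (Fin n) (ZMod p), IsUnit Φ ∧ ∀ g ∈ H.map (redMod n p), ∃ c : ZMod p,
        g.1 * Φ * g.1ᵀ = c • Φ) : IsometryGroupQ H := by
  classical
  have hn0 : NeZero n := ⟨hn.ne_zero⟩
  let U : Set (SL n ℤ) := {u | ∃ a ∈ H, ∃ b ∈ H, u = ⁅a, b⁆}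
  obtain ⟨x, hx0, hx⟩ := P0.linsys (ι := Fin n × Fin n)
    {s | ∃ u ∈ U, ∃ i j : Fin n, s = fun kl => u.1 i kl.1 * u.1 j kl.2 - if (i, j) = kl then 1 else 0} Q hQ
    (fun p hp => ⟨(hP p hp).1, by
      have := Fact.mk (hP p hp).1
      obtain ⟨-, Φ, hΦ, h⟩ := hP p hp
      refine ⟨fun kl => Φ kl.1 kl.2, fun h0 => hΦ.ne_zero (Matrix.ext fun i j => congrFun h0 (i, j)), ?_⟩
      rintro _ ⟨_, ⟨a, ha, b, hb, rfl⟩, i, j, rfl⟩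
      have h1 := comm_pres Φ hΦ (redMod n p a) (redMod n p b) (h _ ⟨a, ha, rfl⟩) (h _ ⟨b, hb, rfl⟩)
      rw [← map_commutatorElement] at h1
      have h2 := congrFun (congrFun h1 i) j
      generalize ⁅a, b⁆ = u at h2 ⊢
      simp only [Int.cast_sub, sub_mul, Finset.sum_sub_distrib, Int.cast_ite, Int.cast_one, Int.cast_zero, ite_mul,
        one_mul, zero_mul, Finset.sum_ite_eq, Finset.mem_univ, if_true]
      rw [sub_eq_zero, ← h2, Fintype.sum_prod_type_right, Matrix.mul_apply]
      refine Finset.sum_congr rfl fun k _ => ?_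
      rw [Matrix.mul_apply, Finset.sum_mul]
      refine Finset.sum_congr rfl fun l _ => ?_
      rw [Matrix.transpose_apply, P0.red_apply, P0.red_apply]
      push_cast; ring⟩)
  let Φ : Matrix (Fin n) (Fin n) ℚ := Matrix.of fun i j => x (i, j)
  have hΦ0 : Φ ≠ 0 := fun h => hx0 (funext fun ij => congrFun (congrFun h ij.1) ij.2)
  have hΦ : ∀ u ∈ U, matQ u * Φ * (matQ u)ᵀ = Φ := by
    intro u hu
    ext i j
    have h2 := hx _ ⟨u, hu, i, j, rfl⟩
    simp only [Int.cast_sub, sub_mul, Finset.sum_sub_distrib, Int.cast_ite, Int.cast_one, Int.cast_zero, ite_mul,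
        one_mul, zero_mul, Finset.sum_ite_eq, Finset.mem_univ, if_true] at h2
    rw [sub_eq_zero, Fintype.sum_prod_type_right] at h2
    change _ = x (i, j)
    rw [← h2, Matrix.mul_apply]
    refine Finset.sum_congr rfl fun k _ => ?_
    rw [Matrix.mul_apply, Finset.sum_mul]
    refine Finset.sum_congr rfl fun l _ => ?_
    change (u.1 i l : ℚ) * x (l, k) * (u.1 j k : ℚ) = _
    push_cast; ring
  have hconjU : ∀ g ∈ H, ∀ u ∈ U, g * u * g⁻¹ ∈ U := by
    rintro g hg _ ⟨a, ha, b, hb, rfl⟩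
    exact ⟨g * a * g⁻¹, H.mul_mem (H.mul_mem hg ha) (H.inv_mem hg), g * b * g⁻¹,
      H.mul_mem (H.mul_mem hg hb) (H.inv_mem hg), by simp only [commutatorElement_def]; group⟩
  rcases B2.clifford_comm hn (H.map (toQ n)) (toQ_adjoin H hH) (toQ n '' U) (by
    rintro _ ⟨g, hg, rfl⟩ _ ⟨u, hu, rfl⟩
    exact ⟨g * u * g⁻¹, hconjU g hg u hu, by simp only [map_mul, map_inv]⟩) with h | h
  · rw [Set.image_image] at h
    have hU : ∀ Ψ : Matrix (Fin n) (Fin n) ℚ, (∀ u ∈ U, matQ u * Ψ * (matQ u)ᵀ = Ψ) →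
        IsUnit Φ ∧ ∃ c : ℚ, Ψ = c • Φ := fun Ψ hΨ => B3.form_unique _ h (by
      rintro _ ⟨u, hu, rfl⟩; change IsUnit (matQ u).det; rw [P0.matQ_det]; exact isUnit_one) Φ Ψ hΦ0
      (by rintro _ ⟨u, hu, rfl⟩; exact hΦ u hu) (by rintro _ ⟨u, hu, rfl⟩; exact hΨ u hu)
    have hunit := (hU Φ hΦ).1
    refine ⟨Φ, hunit, fun g hg => ?_⟩
    obtain ⟨c, hc⟩ := (hU (matQ g * Φ * (matQ g)ᵀ) (by
      intro u hu
      have h1 := hΦ _ (hconjU g⁻¹ (H.inv_mem hg) u hu)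
      have h2 : matQ u * matQ g = matQ g * matQ (g⁻¹ * u * g⁻¹⁻¹) := by
        rw [← P0.matQ_mul, ← P0.matQ_mul]; congr 1; group
      calc matQ u * (matQ g * Φ * (matQ g)ᵀ) * (matQ u)ᵀ = (matQ u * matQ g) * Φ * (matQ u * matQ g)ᵀ := by
            rw [transpose_mul]; simp only [Matrix.mul_assoc]
        _ = matQ g * (matQ (g⁻¹ * u * g⁻¹⁻¹) * Φ * (matQ (g⁻¹ * u * g⁻¹⁻¹))ᵀ) * (matQ g)ᵀ := by
            rw [h2, transpose_mul]; simp only [Matrix.mul_assoc]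
        _ = _ := by rw [h1])).2
    have hd := congrArg Matrix.det hc
    rw [det_mul, det_mul, det_transpose, P0.matQ_det, one_mul, mul_one, det_smul, Fintype.card_fin] at hd
    have hd0 : Φ.det ≠ 0 := ((Matrix.isUnit_iff_isUnit_det _).1 hunit).ne_zero
    have hc1 : c ^ n = 1 := by
      field_simp at hd
      exact hd.symm
    rw [hc, show c = 1 from hodd.strictMono_pow.injective (by simpa using hc1), one_smul]
  · refine absurd (solvable_of_commutators fun a b c d => Subtype.ext ?_) hns
    have := h _ ⟨_, ⟨a, a.2, b, b.2, rfl⟩, rfl⟩ _ ⟨_, ⟨c, c.2, d, d.2, rfl⟩, rfl⟩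
    rw [← map_mul, ← map_mul] at this
    exact toQ_inj this
end E1
end

section
namespace A3
open Module Matrix
open scoped commutatorElement
variable {n : ℕ}

theorem finite_of_exp (H : Subgroup (SL n ℤ)) (m : ℕ) (hm : 0 < m) (h : ∀ g ∈ H, g ^ m = 1) : Finite H := by
  obtain ⟨q, hq, hqp⟩ := Nat.exists_infinite_primes (m + 1)
  have := Fact.mk hqp
  refine Finite.of_injective (fun g : H => redMod n q g.1) ?_
  refine (injective_iff_map_eq_one ((redMod n q).comp H.subtype)).2 fun k hk => Subtype.ext ?_
  have hk' : redMod n q k.1 = 1 := hk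
  have hkm := congrArg Subtype.val (h k.1 k.2)
  generalize k.1 = g at hk' hkm
  have hkm' : g.1 ^ m = 1 := (Matrix.SpecialLinearGroup.coe_pow g m).symm.trans hkm
  have hg1 : g.1.map (Int.castRingHom (ZMod q)) = 1 := congrArg Subtype.val hk'
  have hS : (∑ i ∈ Finset.range m, g.1 ^ i).det ≠ 0 := by
    intro h0
    have h1 := (Int.castRingHom (ZMod q)).map_det (∑ i ∈ Finset.range m, g.1 ^ i)
    rw [h0, map_zero, map_sum] at h1
    simp only [map_pow] at h1
    rw [show (Int.castRingHom (ZMod q)).mapMatrix g.1 = 1 from hg1] at h1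
    simp only [one_pow, Finset.sum_const, Finset.card_range] at h1
    rw [← Nat.cast_smul_eq_nsmul (ZMod q), det_smul, det_one, mul_one] at h1
    have h2 : (m : ZMod q) = 0 := eq_zero_of_pow_eq_zero h1.symm
    rw [ZMod.natCast_eq_zero_iff] at h2
    have := Nat.le_of_dvd hm h2
    omega
  have h3 : (g.1 - 1) * ∑ i ∈ Finset.range m, g.1 ^ i = 0 := by
    rw [mul_geom_sum, hkm', sub_self]
  have h4 := congrArg (· * (∑ i ∈ Finset.range m, g.1 ^ i).adjugate) h3
  simp only [Matrix.mul_assoc, mul_adjugate, Matrix.zero_mul, Matrix.mul_smul, Matrix.mul_one] at h4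
  exact Subtype.ext (sub_eq_zero.1 ((smul_eq_zero.1 h4).resolve_left hS))

theorem eig_int (u : SL n ℤ) (c : ℚ) (v : Fin n → ℚ) (hv : v ≠ 0) (h : matQ u *ᵥ v = c • v) :
    ∃ z : ℤ, (z : ℚ) = c := by
  have hi : IsIntegral ℤ c := by
    refine ⟨u.1.charpoly, charpoly_monic _, ?_⟩
    have e : u.1.charpoly.map (algebraMap ℤ ℚ) = (matQ u).charpoly := (charpoly_map u.1 (algebraMap ℤ ℚ)).symm
    rw [← Polynomial.eval_map, e, eval_charpoly]
    refine Matrix.exists_mulVec_eq_zero_iff.1 ⟨v, hv, ?_⟩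
    rw [sub_mulVec, h, scalar_apply, ← smul_one_eq_diagonal, smul_mulVec, one_mulVec, sub_self]
  exact IsIntegrallyClosed.isIntegral_iff.1 hi

theorem eig_sq (u : SL n ℤ) (c : ℚ) (v : Fin n → ℚ) (hv : v ≠ 0) (h : matQ u *ᵥ v = c • v) : c ^ 2 = 1 := by
  have h1 : matQ u⁻¹ *ᵥ (matQ u *ᵥ v) = v := by
    rw [mulVec_mulVec, ← P0.matQ_mul, inv_mul_cancel, P0.matQ_one, one_mulVec]
  rw [h, mulVec_smul] at h1
  have hc : c ≠ 0 := by rintro rfl; rw [zero_smul] at h1; exact hv h1.symm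
  have h2 : matQ u⁻¹ *ᵥ v = c⁻¹ • v := by
    rw [eq_inv_smul_iff₀ hc]; exact h1
  obtain ⟨z, hz⟩ := eig_int u c v hv h
  obtain ⟨y, hy⟩ := eig_int u⁻¹ c⁻¹ v hv h2
  have h3 : z * y = 1 := by
    have : (z : ℚ) * y = 1 := by rw [hz, hy, mul_inv_cancel₀ hc]
    exact_mod_cast this
  rw [← hz]
  rcases Int.eq_one_or_neg_one_of_mul_eq_one h3 with rfl | rfl <;> norm_num

theorem aut_comm (E : Type*) [Field E] [Algebra ℚ E] (h : (finrank ℚ E).Prime) (σ τ : E →ₐ[ℚ] E) (x : E) :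
    σ (τ x) = τ (σ x) := by
  have : FiniteDimensional ℚ E := Module.finite_of_finrank_pos h.pos
  have hb : ∀ σ : E →ₐ[ℚ] E, Function.Bijective σ := fun σ => Algebra.IsAlgebraic.algHom_bijective σ
  have hc := IntermediateField.finrank_fixedField_eq_card (F := ℚ) (E := E) ⊤
  have hd : Nat.card (E ≃ₐ[ℚ] E) ∣ finrank ℚ E := by
    rw [← Subgroup.card_top, ← hc]
    exact ⟨finrank ℚ (IntermediateField.fixedField (⊤ : Subgroup (E ≃ₐ[ℚ] E))), by
      rw [mul_comm, finrank_mul_finrank]⟩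
  have key : ∀ a b : E ≃ₐ[ℚ] E, a * b = b * a := by
    rcases (Nat.dvd_prime h).1 hd with h1 | h1
    · intro a b
      have := (Nat.card_eq_one_iff_unique.1 h1).1
      exact Subsingleton.elim _ _
    · have := Fact.mk h
      have := isCyclic_of_prime_card h1
      exact (IsCyclic.commGroup (α := E ≃ₐ[ℚ] E)).mul_comm
  exact congrArg (· x) (key (AlgEquiv.ofBijective σ (hb σ)) (AlgEquiv.ofBijective τ (hb τ)))

/-- conjugation -/
def cj (g : SL n ℤ) : Matrix (Fin n) (Fin n) ℚ →ₐ[ℚ] Matrix (Fin n) (Fin n) ℚ :=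
  AlgHom.ofLinearMap ((LinearMap.mulRight ℚ (matQ g⁻¹)).comp (LinearMap.mulLeft ℚ (matQ g)))
    (by simp [← P0.matQ_mul, P0.matQ_one]) fun x y => by
      have h : matQ g⁻¹ * matQ g = 1 := by rw [← P0.matQ_mul, inv_mul_cancel, P0.matQ_one]
      change matQ g * (x * y) * matQ g⁻¹ = (matQ g * x * matQ g⁻¹) * (matQ g * y * matQ g⁻¹)
      rw [show (matQ g * x * matQ g⁻¹) * (matQ g * y * matQ g⁻¹) =
        matQ g * x * (matQ g⁻¹ * matQ g) * y * matQ g⁻¹ by simp only [Matrix.mul_assoc], h]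
      simp only [Matrix.mul_assoc, Matrix.one_mul]

theorem cj_apply (g : SL n ℤ) (x : Matrix (Fin n) (Fin n) ℚ) : cj g x = matQ g * x * matQ g⁻¹ := rfl

theorem cj_mul (g h : SL n ℤ) (x : Matrix (Fin n) (Fin n) ℚ) : cj (g * h) x = cj g (cj h x) := by
  simp only [cj_apply, _root_.mul_inv_rev, P0.matQ_mul, Matrix.mul_assoc]

theorem comm_of_irr (hn : n.Prime) (H : Subgroup (SL n ℤ)) (E : Subalgebra ℚ (Matrix (Fin n) (Fin n) ℚ))
    (hE : ∀ a ∈ E, ∀ b ∈ E, a * b = b * a) (hconj : ∀ g ∈ H, ∀ e ∈ E, cj g e ∈ E)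
    (hirr : ∀ W : Submodule ℚ (Fin n → ℚ), (∀ e ∈ E, ∀ v ∈ W, e *ᵥ v ∈ W) → W = ⊥ ∨ W = ⊤) : IsSolvable H := by
  have hn0 : NeZero n := ⟨hn.ne_zero⟩
  let ev (v : Fin n → ℚ) : E →ₗ[ℚ] (Fin n → ℚ) :=
    { toFun := fun e => e.1 *ᵥ v
      map_add' := fun a b => add_mulVec _ _ _
      map_smul' := fun c a => smul_mulVec _ _ _ }
  have hsurj : ∀ v ≠ 0, ∀ w, ∃ e ∈ E, e *ᵥ v = w := by
    intro v hv w
    have := hirr (LinearMap.range (ev v)) (by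
      rintro e he _ ⟨e', rfl⟩
      exact ⟨⟨e, he⟩ * e', (mulVec_mulVec v e e'.1).symm⟩)
    rcases this with h | h
    · refine absurd ?_ hv
      have : ev v 1 ∈ LinearMap.range (ev v) := ⟨1, rfl⟩
      rw [h, Submodule.mem_bot] at this
      rw [← this]
      exact (one_mulVec v).symm
    · obtain ⟨e, he⟩ : w ∈ LinearMap.range (ev v) := h ▸ Submodule.mem_top
      exact ⟨e.1, e.2, he⟩
  let v₀ : Fin n → ℚ := Pi.single 0 1
  have hv₀ : v₀ ≠ 0 := by simp [v₀]
  -- matrices commuting with `E` are determined by their value at `v₀`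
  have hdet : ∀ a b : Matrix (Fin n) (Fin n) ℚ, (∀ e ∈ E, a * e = e * a) → (∀ e ∈ E, b * e = e * b) →
      a *ᵥ v₀ = b *ᵥ v₀ → a = b := by
    intro a b ha hb hab
    refine Matrix.toLin'.injective (LinearMap.ext fun w => ?_)
    obtain ⟨e, he, rfl⟩ := hsurj v₀ hv₀ w
    rw [toLin'_apply, toLin'_apply, mulVec_mulVec, mulVec_mulVec, ha e he, hb e he, ← mulVec_mulVec, hab,
      mulVec_mulVec]
  have hcent : ∀ a : Matrix (Fin n) (Fin n) ℚ, (∀ e ∈ E, a * e = e * a) → a ∈ E := by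
    intro a ha
    obtain ⟨e, he, h⟩ := hsurj v₀ hv₀ (a *ᵥ v₀)
    rwa [hdet a e ha (hE e he) h.symm]
  have hfield : IsField E := by
    refine ⟨⟨0, 1, fun h => ?_⟩, fun a b => Subtype.ext (hE _ a.2 _ b.2), fun {a} ha => ?_⟩
    · have := congrArg Subtype.val h
      exact zero_ne_one (α := Matrix (Fin n) (Fin n) ℚ) this
    · have h1 : a.1 *ᵥ v₀ ≠ 0 := fun h0 => ha (Subtype.ext (hdet _ _ (hE _ a.2) (by simp) (by rw [h0]; simp)))
      obtain ⟨e, he, h⟩ := hsurj _ h1 v₀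
      refine ⟨⟨e, he⟩, Subtype.ext ?_⟩
      change a.1 * e = 1
      rw [hE _ a.2 e he]
      refine hdet _ _ (hE _ (E.mul_mem he a.2)) (by simp) ?_
      rw [← mulVec_mulVec, h, one_mulVec]
  have hfin : finrank ℚ E = n := by
    rw [LinearEquiv.finrank_eq (LinearEquiv.ofBijective (ev v₀) ⟨?_, ?_⟩), finrank_fin_fun]
    · exact fun a b hab => Subtype.ext (hdet _ _ (hE _ a.2) (hE _ b.2) hab)
    · intro w
      obtain ⟨e, he, h⟩ := hsurj v₀ hv₀ w
      exact ⟨⟨e, he⟩, h⟩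
  have hcomm : ∀ a ∈ H, ∀ b ∈ H, ∀ e ∈ E, cj a (cj b e) = cj b (cj a e) := by
    intro a ha b hb e he
    let σ (g : SL n ℤ) (hg : g ∈ H) : E →ₐ[ℚ] E := ((cj g).comp E.val).codRestrict E fun e => hconj g hg e e.2
    have hpr : (finrank ℚ E).Prime := by rw [hfin]; exact hn
    let _ := hfield.toField
    exact congrArg Subtype.val (aut_comm E hpr (σ a ha) (σ b hb) ⟨e, he⟩)
  have hc : ∀ a ∈ H, ∀ b ∈ H, ∀ e ∈ E, matQ ⁅a, b⁆ * e = e * matQ ⁅a, b⁆ := by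
    intro a ha b hb e he
    have h1 := hcomm a ha b hb _ (hconj (b * a)⁻¹ (H.inv_mem (H.mul_mem hb ha)) e he)
    rw [← cj_mul, ← cj_mul, ← cj_mul, ← cj_mul, mul_inv_cancel,
      show a * b * (b * a)⁻¹ = ⁅a, b⁆ by rw [commutatorElement_def]; group, cj_apply, cj_apply, inv_one, P0.matQ_one,
      Matrix.one_mul, Matrix.mul_one] at h1
    conv_rhs => rw [← h1]
    rw [Matrix.mul_assoc, ← P0.matQ_mul, inv_mul_cancel, P0.matQ_one, Matrix.mul_one]
  refine E1.solvable_of_commutators fun a b c d => Subtype.ext (P0.matQ_inj ?_)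
  change matQ (⁅a.1, b.1⁆ * ⁅c.1, d.1⁆) = matQ (⁅c.1, d.1⁆ * ⁅a.1, b.1⁆)
  rw [P0.matQ_mul, P0.matQ_mul]
  exact hc _ a.2 _ b.2 _ (hcent _ (hc _ c.2 _ d.2))

theorem main (hn : n.Prime) (H : Subgroup (SL n ℤ)) (hH : AbsIrredQ H)
    (hinf : Infinite H) (hns : ¬ IsSolvable H) (m : ℕ) (hm : 0 < m)
    (hcomm : ∀ g ∈ H, ∀ h ∈ H, g ^ m * h ^ m = h ^ m * g ^ m) : False := by
  classical
  have hn0 : NeZero n := ⟨hn.ne_zero⟩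
  let U : Set (SL n ℤ) := {u | ∃ g ∈ H, u = g ^ m}
  have hconjU : ∀ g ∈ H, ∀ u ∈ U, g * u * g⁻¹ ∈ U := by
    rintro g hg _ ⟨a, ha, rfl⟩
    exact ⟨g * a * g⁻¹, H.mul_mem (H.mul_mem hg ha) (H.inv_mem hg), conj_pow.symm⟩
  obtain ⟨W, hW0, hWi, hWmin, hsup, hd, key⟩ := B2.cover hn (H.map (E1.toQ n)) (E1.toQ_adjoin H hH) (E1.toQ n '' U) (by
    rintro _ ⟨g, hg, rfl⟩ _ ⟨u, hu, rfl⟩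
    exact ⟨g * u * g⁻¹, hconjU g hg u hu, by simp only [map_mul, map_inv]⟩)
  rcases hd with h1 | h1
  · refine not_finite_iff_infinite.2 hinf (finite_of_exp H (m * 2) (by omega) fun g hg => P0.matQ_inj ?_)
    rw [pow_mul, pow_two, P0.matQ_mul, P0.matQ_one]
    have hK : (⊤ : Submodule ℚ (Fin n → ℚ)) ≤
        LinearMap.ker (toLin' (matQ (g ^ m) * matQ (g ^ m) - 1)) := by
      rw [← hsup, sSup_le_iff]
      rintro _ ⟨x, hx, rfl⟩ _ ⟨w, hw, rfl⟩
      obtain ⟨u', hu', e⟩ := key x hx _ ⟨_, ⟨g, hg, rfl⟩, rfl⟩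
      obtain ⟨w₀, hw₀, hspan⟩ := finrank_eq_one_iff'.1 h1
      obtain ⟨c, hc⟩ : ∃ c : ℚ, u'.1 *ᵥ w = c • w := by
        by_cases hw' : w = 0
        · exact ⟨0, by simp [hw']⟩
        · obtain ⟨c₁, e₁⟩ := hspan ⟨w, hw⟩
          obtain ⟨c₂, e₂⟩ := hspan ⟨_, hWi u' hu' w hw⟩
          have e₁' : c₁ • w₀.1 = w := congrArg Subtype.val e₁
          have e₂' : c₂ • w₀.1 = u'.1 *ᵥ w := congrArg Subtype.val e₂
          have : c₁ ≠ 0 := by rintro rfl; rw [zero_smul] at e₁'; exact hw' e₁'.symm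
          exact ⟨c₂ / c₁, by rw [← e₂', ← e₁', smul_smul, div_mul_cancel₀ _ this]⟩
      have h2 : matQ (g ^ m) *ᵥ (x.1 *ᵥ w) = c • (x.1 *ᵥ w) := by
        have e' : matQ (g ^ m) * x.1 = x.1 * u'.1 := e
        rw [mulVec_mulVec, e', ← mulVec_mulVec, hc, mulVec_smul]
      rw [LinearMap.mem_ker, toLin'_apply, toLin'_apply]
      by_cases h0 : x.1 *ᵥ w = 0
      · rw [h0, mulVec_zero]
      · have := eig_sq (g ^ m) c _ h0 h2
        rw [sub_mulVec, ← mulVec_mulVec, h2, mulVec_smul, h2, smul_smul, ← pow_two, this, one_smul, one_mulVec,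
          sub_self]
    have := LinearMap.ker_eq_top.1 (top_le_iff.1 hK)
    exact sub_eq_zero.1 (Matrix.toLin'.injective (this.trans (map_zero _).symm))
  · have hWt : W = ⊤ := Submodule.eq_top_of_finrank_eq (by rw [h1, finrank_fin_fun])
    refine hns (comm_of_irr hn H (Algebra.adjoin ℚ (matQ '' U)) ?_ ?_ ?_)
    · have := Algebra.isMulCommutative_adjoin ℚ (s := matQ '' U) (by
        rintro _ ⟨_, ⟨a, ha, rfl⟩, rfl⟩ _ ⟨_, ⟨b, hb, rfl⟩, rfl⟩
        rw [← P0.matQ_mul, ← P0.matQ_mul, hcomm a ha b hb])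
      exact fun a ha b hb => congrArg Subtype.val (this.1.1 ⟨a, ha⟩ ⟨b, hb⟩)
    · intro g hg e he
      have : Algebra.adjoin ℚ (matQ '' U) ≤ (Algebra.adjoin ℚ (matQ '' U)).comap (cj g) := by
        rw [Algebra.adjoin_le_iff]
        rintro _ ⟨u, hu, rfl⟩
        refine Algebra.subset_adjoin ⟨g * u * g⁻¹, hconjU g hg u hu, ?_⟩
        rw [P0.matQ_mul, P0.matQ_mul]; rfl
      exact this he
    · intro V hV
      have := hWmin V (by
        rintro _ ⟨u, hu, rfl⟩ v hv
        exact hV _ (Algebra.subset_adjoin ⟨u, hu, rfl⟩) v hv) (hWt ▸ le_top)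
      rwa [hWt] at this
end A3
end

section
namespace A2
open Module
open scoped commutatorElement

section core
variable {E : Type*} [NormedAddCommGroup E] [InnerProductSpace ℂ E] [FiniteDimensional ℂ E]
  {G : Type*} [Group G] [Finite G]

theorem exists_eig (f : End ℂ E) (K : Submodule ℂ E) (hK : K ≠ ⊥) (hf : ∀ x ∈ K, f x ∈ K) :
    ∃ x ∈ K, x ≠ 0 ∧ ∃ μ : ℂ, f x = μ • x := by
  have : Nontrivial K := Submodule.nontrivial_iff_ne_bot.2 hK
  obtain ⟨μ, hμ⟩ := Module.End.exists_eigenvalue (f.restrict hf)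
  obtain ⟨x, hx⟩ := hμ.exists_hasEigenvector
  refine ⟨x.1, x.2, fun h => hx.2 (Subtype.ext h), μ, ?_⟩
  exact congrArg Subtype.val (Module.End.mem_eigenspace_iff.1 hx.1)

variable (τ : G →* (E →L[ℂ] E)) (hτ : ∀ g x, ‖τ g x‖ = ‖x‖)

theorem mul_app (g h : G) (x : E) : τ (g * h) x = τ g (τ h x) := by rw [map_mul]; rfl

theorem inv_app (g : G) (x : E) : τ g⁻¹ (τ g x) = x := by rw [← mul_app, inv_mul_cancel, map_one]; rfl

theorem inner_app (hτ : ∀ g x, ‖τ g x‖ = ‖x‖) (g : G) (x y : E) : inner ℂ (τ g x) (τ g y) = inner ℂ x y :=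
  (LinearIsometry.mk (τ g).toLinearMap (hτ g)).inner_map_map x y

theorem orth (hτ : ∀ g x, ‖τ g x‖ = ‖x‖) (g : G) (x y : E) (a b : ℂ) (hx : τ g x = a • x) (hy : τ g y = b • y)
    (hab : a ≠ b) : inner ℂ x y = 0 := by
  by_cases hx0 : x = 0
  · rw [hx0, inner_zero_left]
  have h1 := inner_app τ hτ g x y
  have h2 := inner_app τ hτ g x x
  rw [hx, hy, inner_smul_left, inner_smul_right] at h1
  rw [hx, inner_smul_left, inner_smul_right, ← mul_assoc] at h2
  have h3 : (starRingEnd ℂ) a * a = 1 := mul_right_cancel₀ (inner_self_ne_zero.2 hx0) (h2.trans (one_mul _).symm)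
  by_contra h0
  have h4 : (starRingEnd ℂ) a * b = 1 := mul_right_cancel₀ h0 (by rw [mul_assoc, h1, one_mul])
  have h5 : (starRingEnd ℂ) a ≠ 0 := left_ne_zero_of_mul_eq_one h3
  exact hab (mul_left_cancel₀ h5 (h3.trans h4.symm))

theorem frob (hτ : ∀ g x, ‖τ g x‖ = ‖x‖) (g h : G) (hc : τ ⁅g, ⁅g, h⁆⁆ = 1) (hh : ‖τ h - 1‖ < 1) :
    τ ⁅g, h⁆ = 1 := by
  by_contra hne
  set c := ⁅g, h⁆ with hcdef
  have hgc : ∀ x, τ g (τ c x) = τ c (τ g x) := by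
    intro x
    have : g * c = ⁅g, c⁆ * (c * g) := by rw [commutatorElement_def]; group
    rw [← mul_app, ← mul_app, this, map_mul, hc, one_mul]
  -- an eigenvector of `c` with eigenvalue `≠ 1`
  let R := LinearMap.range ((τ c - 1 : E →L[ℂ] E) : E →ₗ[ℂ] E)
  have hR : R ≠ ⊥ := fun h0 => hne (sub_eq_zero.1 (ContinuousLinearMap.coe_injective (LinearMap.range_eq_bot.1 h0)))
  obtain ⟨x₁, ⟨y, hy⟩, hx₁, κ, hκ⟩ := exists_eig (τ c).toLinearMap R hR (by
    rintro _ ⟨y, rfl⟩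
    exact ⟨τ c y, by simp⟩)
  have hκ' : τ c x₁ = κ • x₁ := hκ
  have hy' : τ c y = y + x₁ := by rw [← hy]; simp
  have hκ1 : κ ≠ 1 := by
    rintro rfl
    rw [one_smul] at hκ'
    have hk : ∀ k : ℕ, τ (c ^ k) y = y + (k : ℂ) • x₁ := by
      intro k
      induction k with
      | zero => simp
      | succ k ih =>
        rw [pow_succ', mul_app, ih, map_add, map_smul, hκ', hy', Nat.cast_succ, add_smul, one_smul]
        abel
    have h1 := hk (orderOf c)
    rw [pow_orderOf_eq_one, map_one] at h1
    have h2 : ((orderOf c : ℕ) : ℂ) • x₁ = 0 := by simpa using h1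
    rcases smul_eq_zero.1 h2 with h3 | h3
    · exact (orderOf_pos c).ne' (by exact_mod_cast h3)
    · exact hx₁ h3
  obtain ⟨x, hx, hx0, μ, hμ⟩ := exists_eig (τ g).toLinearMap (End.eigenspace (τ c).toLinearMap κ)
    (fun h0 => hx₁ (by
      have : x₁ ∈ End.eigenspace (τ c).toLinearMap κ := End.mem_eigenspace_iff.2 hκ
      rwa [h0, Submodule.mem_bot] at this)) (by
    intro z hz
    rw [End.mem_eigenspace_iff] at hz ⊢
    change τ c (τ g z) = κ • τ g z
    rw [← hgc, show τ c z = κ • z from hz, map_smul])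
  have hcx : τ c x = κ • x := End.mem_eigenspace_iff.1 hx
  have hgx : τ g x = μ • x := hμ
  have hμ0 : μ ≠ 0 := by
    rintro rfl
    rw [zero_smul] at hgx
    exact hx0 (by rw [← inv_app τ g x, hgx, map_zero])
  have hκ0 : κ ≠ 0 := by
    rintro rfl
    rw [zero_smul] at hcx
    exact hx0 (by rw [← inv_app τ c x, hcx, map_zero])
  let v := τ h⁻¹ x
  have hv : τ h v = x := by
    change τ h (τ h⁻¹ x) = x
    rw [← mul_app, mul_inv_cancel, map_one]; rfl
  have hv0 : v ≠ 0 := by rintro h0; rw [h0, map_zero] at hv; exact hx0 hv.symm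
  have hci : τ c⁻¹ x = κ⁻¹ • x := by
    rw [eq_inv_smul_iff₀ hκ0, ← map_smul, ← hcx, inv_app]
  have hgv : τ g v = (κ⁻¹ * μ) • v := by
    have e : h * g = c⁻¹ * (g * h) := by rw [hcdef, commutatorElement_def]; group
    have : τ h (τ g v) = (κ⁻¹ * μ) • τ h v := by
      rw [← mul_app, e, mul_app, mul_app, hv, hgx, map_smul, hci, smul_smul, mul_comm]
    rw [← inv_app τ h (τ g v), this, map_smul, inv_app]
  have h0 := orth τ hτ g v x _ _ hgv hgx (fun h => hκ1 (by
    have : κ⁻¹ = 1 := mul_right_cancel₀ hμ0 (h.trans (one_mul _).symm)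
    rwa [inv_eq_one] at this))
  have h1 : inner ℂ v ((τ h - 1) v) = - inner ℂ v v := by
    simp [inner_sub_right, hv, h0]
  have h2 : ‖v‖ ^ 2 ≤ ‖τ h - 1‖ * ‖v‖ ^ 2 := by
    have h3 : ‖inner ℂ v ((τ h - 1) v)‖ ≤ ‖v‖ * (‖τ h - 1‖ * ‖v‖) :=
      (norm_inner_le_norm _ _).trans (mul_le_mul_of_nonneg_left ((τ h - 1).le_opNorm v) (norm_nonneg _))
    rw [h1, norm_neg, inner_self_eq_norm_sq_to_K, norm_pow, RCLike.norm_ofReal, abs_norm] at h3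
    linarith
  have h3 : 0 < ‖v‖ ^ 2 := by positivity
  nlinarith

theorem norm_le_one (hτ : ∀ g x, ‖τ g x‖ = ‖x‖) (g : G) : ‖τ g‖ ≤ 1 :=
  ContinuousLinearMap.opNorm_le_bound _ zero_le_one fun x => by rw [hτ, one_mul]

theorem comm_bound (hτ : ∀ g x, ‖τ g x‖ = ‖x‖) (g h : G) : ‖τ ⁅g, h⁆ - 1‖ ≤ 2 * ‖τ g - 1‖ * ‖τ h - 1‖ := by
  have e1 : τ ⁅g, h⁆ - 1 = ((τ g - 1) * (τ h - 1) - (τ h - 1) * (τ g - 1)) * τ (h * g)⁻¹ := by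
    have e2 : (τ g - 1) * (τ h - 1) - (τ h - 1) * (τ g - 1) = τ (g * h) - τ (h * g) := by
      rw [map_mul, map_mul]; noncomm_ring
    rw [e2, sub_mul, ← map_mul, ← map_mul, mul_inv_cancel, map_one,
      show g * h * (h * g)⁻¹ = ⁅g, h⁆ by rw [commutatorElement_def]; group]
  rw [e1]
  calc _ ≤ ‖(τ g - 1) * (τ h - 1) - (τ h - 1) * (τ g - 1)‖ * 1 :=
        (norm_mul_le _ _).trans (mul_le_mul_of_nonneg_left (norm_le_one τ hτ _) (norm_nonneg _))
    _ ≤ (‖(τ g - 1) * (τ h - 1)‖ + ‖(τ h - 1) * (τ g - 1)‖) * 1 := by gcongr; exact norm_sub_le _ _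
    _ ≤ (‖τ g - 1‖ * ‖τ h - 1‖ + ‖τ h - 1‖ * ‖τ g - 1‖) * 1 := by gcongr <;> exact norm_mul_le _ _
    _ = _ := by ring

theorem near_comm (hτ : ∀ g x, ‖τ g x‖ = ‖x‖) (g h : G) (hg : ‖τ g - 1‖ ≤ 1 / 4) (hh : ‖τ h - 1‖ ≤ 1 / 4) :
    τ ⁅g, h⁆ = 1 := by
  let c : ℕ → G := fun k => Nat.rec h (fun _ x => ⁅g, x⁆) k
  have hcs : ∀ k, c (k + 1) = ⁅g, c k⁆ := fun k => rfl
  have hstep : ∀ k, ‖τ (c (k + 1)) - 1‖ ≤ 1 / 2 * ‖τ (c k) - 1‖ := fun k => by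
    have := comm_bound τ hτ g (c k)
    rw [hcs]
    nlinarith [norm_nonneg (τ (c k) - 1)]
  have hsmall : ∀ k, ‖τ (c k) - 1‖ < 1 := by
    intro k
    induction k with
    | zero => exact lt_of_le_of_lt hh (by norm_num)
    | succ k ih => have := hstep k; linarith [norm_nonneg (τ (c k) - 1)]
  have hex : ∃ k, τ (c k) = 1 := by
    by_contra hne
    push Not at hne
    have hanti : StrictAnti fun k => ‖τ (c k) - 1‖ := strictAnti_nat_of_succ_lt fun k => by
      have := hstep k
      have h0 : 0 < ‖τ (c k) - 1‖ := norm_pos_iff.2 (sub_ne_zero.2 (hne k))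
      linarith
    have hinj : Function.Injective c := fun i j hij => hanti.injective (by simp only [hij])
    exact not_injective_infinite_finite c hinj
  have hdesc : ∀ k, τ (c (k + 1)) = 1 → τ (c 1) = 1 := by
    intro k
    induction k with
    | zero => exact id
    | succ k ih => exact fun h1 => ih (frob τ hτ g (c k) h1 (hsmall k))
  obtain ⟨k, hk⟩ := hex
  refine hdesc k ?_
  rw [hcs, commutatorElement_def, map_mul, map_mul, map_mul, hk, mul_one, ← map_mul, mul_inv_cancel, map_one, one_mul]
  have := map_mul τ (c k) (c k)⁻¹
  rw [mul_inv_cancel, map_one, hk, one_mul] at this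
  exact this.symm
end core

theorem pigeon (A : Type*) [NormedRing A] [ProperSpace A] :
    ∃ M : ℕ, ∀ (G : Type) [Group G] (τ : G →* A), (∀ g, ‖τ g‖ ≤ 1) → ∀ g : G,
      ∃ d, 0 < d ∧ d ≤ M ∧ ‖τ (g ^ d) - 1‖ ≤ 1 / 4 := by
  obtain ⟨t, -, htf, ht⟩ := (isCompact_closedBall (0 : A) 1).finite_cover_balls (e := 1 / 8) (by norm_num)
  refine ⟨htf.toFinset.card, fun G _ τ hnorm g => ?_⟩
  have hx : ∀ i : ℕ, ∃ x ∈ t, ‖τ (g ^ i) - x‖ < 1 / 8 := by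
    intro i
    have := ht (mem_closedBall_zero_iff.2 (hnorm (g ^ i)))
    simp only [Set.mem_iUnion, Metric.mem_ball, dist_eq_norm, exists_prop] at this
    exact this
  choose f hf hfd using hx
  obtain ⟨i, hi, j, hj, hij, e⟩ := Finset.exists_ne_map_eq_of_card_lt_of_maps_to (s := Finset.range (htf.toFinset.card + 1))
    (t := htf.toFinset) (by simp) (f := f) (fun i _ => by simpa using hf i)
  have key : ∀ i j, i < j → j ≤ htf.toFinset.card → f i = f j →
      ∃ d, 0 < d ∧ d ≤ htf.toFinset.card ∧ ‖τ (g ^ d) - 1‖ ≤ 1 / 4 := by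
    intro i j hij hj e
    refine ⟨j - i, by omega, by omega, ?_⟩
    have h1 : τ (g ^ (j - i)) - 1 = τ (g ^ i)⁻¹ * ((τ (g ^ j) - f j) - (τ (g ^ i) - f i)) := by
      rw [e, show τ (g ^ j) - f j - (τ (g ^ i) - f j) = τ (g ^ j) - τ (g ^ i) by abel, mul_sub, ← map_mul, ← map_mul, inv_mul_cancel, map_one,
        show (g ^ i)⁻¹ * g ^ j = g ^ (j - i) by
          rw [inv_mul_eq_iff_eq_mul, ← pow_add]; congr 1; omega]
    rw [h1]
    refine (norm_mul_le _ _).trans ?_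
    have h2 := norm_sub_le (τ (g ^ j) - f j) (τ (g ^ i) - f i)
    have h3 := hfd i
    have h4 := hfd j
    have h5 := hnorm (g ^ i)⁻¹
    refine (mul_le_of_le_one_left (norm_nonneg _) h5).trans ?_
    linarith
  simp only [Finset.mem_range] at hi hj
  rcases lt_or_gt_of_ne hij with h | h
  · exact key i j h (by omega) e
  · exact key j i h (by omega) e.symm

theorem unitary_case (E : Type*) [NormedAddCommGroup E] [InnerProductSpace ℂ E] [FiniteDimensional ℂ E] :
    ∃ m : ℕ, 0 < m ∧ ∀ (G : Type) [Group G] [Finite G] (τ : G →* (E →L[ℂ] E)), (∀ g x, ‖τ g x‖ = ‖x‖) → ∀ g h : G,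
      τ ⁅g ^ m, h ^ m⁆ = 1 := by
  have : ProperSpace (E →L[ℂ] E) := FiniteDimensional.proper ℂ _
  obtain ⟨M, hM⟩ := pigeon (E →L[ℂ] E)
  refine ⟨M.factorial, M.factorial_pos, fun G _ _ τ hτ g h => ?_⟩
  obtain ⟨d, hd, hdM, h1⟩ := hM G τ (norm_le_one τ hτ) g
  obtain ⟨d', hd', hdM', h2⟩ := hM G τ (norm_le_one τ hτ) h
  have h3 := near_comm τ hτ _ _ h1 h2
  obtain ⟨k, hk⟩ := Nat.dvd_factorial hd hdM
  obtain ⟨k', hk'⟩ := Nat.dvd_factorial hd' hdM'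
  have h4 : ⁅τ.toHomUnits (g ^ d), τ.toHomUnits (h ^ d')⁆ = 1 := by
    rw [← map_commutatorElement]; exact Units.ext h3
  have h5 : Commute (τ.toHomUnits (g ^ d) ^ k) (τ.toHomUnits (h ^ d') ^ k') :=
    (commutatorElement_eq_one_iff_commute.1 h4).pow_pow k k'
  have h6 := commutatorElement_eq_one_iff_commute.2 h5
  rw [← map_pow, ← map_pow, ← map_commutatorElement, ← pow_mul, ← pow_mul, ← hk, ← hk'] at h6
  exact congrArg Units.val h6
end A2
end

section
namespace A2
open Module Matrix
open scoped commutatorElement MatrixOrder ComplexOrder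

theorem unitarize {n : ℕ} {G : Type} [Group G] [Finite G] (ρ : G →* Matrix (Fin n) (Fin n) ℂ) :
    ∃ B : Matrix (Fin n) (Fin n) ℂ, IsUnit B.det ∧ ∀ g, (ρ g)ᴴ * (Bᴴ * B) * ρ g = Bᴴ * B := by
  classical
  have := Fintype.ofFinite G
  let P := ∑ g, (ρ g)ᴴ * ρ g
  have hP : P.PosDef := by
    change (∑ g, (ρ g)ᴴ * ρ g).PosDef
    rw [← Finset.add_sum_erase _ _ (Finset.mem_univ (1 : G)), map_one, conjTranspose_one, Matrix.one_mul]
    exact PosDef.one.add_posSemidef (posSemidef_sum _ fun g _ => posSemidef_conjTranspose_mul_self _)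
  have h0 : 0 ≤ P := nonneg_iff_posSemidef.2 hP.posSemidef
  have hs : (CFC.sqrt P)ᴴ = CFC.sqrt P := (nonneg_iff_posSemidef.1 (CFC.sqrt_nonneg P)).1
  have e : (CFC.sqrt P)ᴴ * CFC.sqrt P = P := by rw [hs]; exact CFC.sqrt_mul_sqrt_self P h0
  refine ⟨CFC.sqrt P, ?_, fun g => ?_⟩
  · have h1 := congrArg det e
    rw [det_mul] at h1
    have h2 : IsUnit P.det := (Matrix.isUnit_iff_isUnit_det _).1 hP.isUnit
    rw [← h1] at h2
    exact isUnit_of_mul_isUnit_right h2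
  · rw [e]
    change (ρ g)ᴴ * (∑ k, (ρ k)ᴴ * ρ k) * ρ g = ∑ k, (ρ k)ᴴ * ρ k
    rw [Finset.mul_sum, Finset.sum_mul, ← Equiv.sum_comp (Equiv.mulRight g) fun k => (ρ k)ᴴ * ρ k]
    refine Finset.sum_congr rfl fun k _ => ?_
    rw [Equiv.coe_mulRight, map_mul, conjTranspose_mul]
    simp only [Matrix.mul_assoc]

theorem norm_unitary {n : ℕ} (M : Matrix (Fin n) (Fin n) ℂ) (h : star M * M = 1) (x : EuclideanSpace ℂ (Fin n)) :
    ‖toEuclideanCLM (n := Fin n) (𝕜 := ℂ) M x‖ = ‖x‖ := by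
  refine ContinuousLinearMap.norm_map_of_mem_unitary ?_ x
  rw [Unitary.mem_iff, ← map_star, ← map_mul, ← map_mul, h, mul_eq_one_comm.1 h, map_one]
  exact ⟨rfl, rfl⟩

theorem jordan (n : ℕ) : ∃ m : ℕ, 0 < m ∧ ∀ (G : Type) [Group G] [Finite G] (ρ : G →* Matrix (Fin n) (Fin n) ℂ)
    (g h : G), ρ ⁅g ^ m, h ^ m⁆ = 1 := by
  obtain ⟨m, hm, H⟩ := unitary_case (EuclideanSpace ℂ (Fin n))
  refine ⟨m, hm, fun G _ _ ρ g h => ?_⟩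
  obtain ⟨B, hB, hinv⟩ := unitarize ρ
  have h1 : B⁻¹ * B = 1 := nonsing_inv_mul _ hB
  have h2 : B * B⁻¹ = 1 := mul_nonsing_inv _ hB
  let τ : G →* Matrix (Fin n) (Fin n) ℂ :=
    { toFun := fun g => B * ρ g * B⁻¹
      map_one' := by rw [map_one, Matrix.mul_one, h2]
      map_mul' := fun a b => by
        rw [show B * ρ a * B⁻¹ * (B * ρ b * B⁻¹) = B * ρ a * (B⁻¹ * B) * ρ b * B⁻¹ by simp only [Matrix.mul_assoc],
          h1, map_mul]
        simp only [Matrix.mul_assoc, Matrix.one_mul] }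
  have hτ : ∀ g, star (τ g) * τ g = 1 := by
    intro g
    have h3 : (B⁻¹)ᴴ * Bᴴ = 1 := by rw [← conjTranspose_mul, h2, conjTranspose_one]
    change (B * ρ g * B⁻¹)ᴴ * (B * ρ g * B⁻¹) = 1
    rw [conjTranspose_mul, conjTranspose_mul, show (B⁻¹)ᴴ * ((ρ g)ᴴ * Bᴴ) * (B * ρ g * B⁻¹) =
      (B⁻¹)ᴴ * ((ρ g)ᴴ * (Bᴴ * B) * ρ g) * B⁻¹ by simp only [Matrix.mul_assoc], hinv,
      ← Matrix.mul_assoc, h3, Matrix.one_mul, h2]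
  let σ : G →* (EuclideanSpace ℂ (Fin n) →L[ℂ] EuclideanSpace ℂ (Fin n)) :=
    { toFun := fun g => toEuclideanCLM (n := Fin n) (𝕜 := ℂ) (τ g)
      map_one' := by rw [map_one, map_one]
      map_mul' := fun a b => by rw [map_mul, map_mul] }
  have h3 := H G σ (fun g x => norm_unitary _ (hτ g) x) g h
  have h4 : τ ⁅g ^ m, h ^ m⁆ = 1 := by
    refine (toEuclideanCLM (n := Fin n) (𝕜 := ℂ)).injective ?_
    rw [map_one]; exact h3
  generalize ⁅g ^ m, h ^ m⁆ = k at h4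
  have h5 : B * ρ k * B⁻¹ = 1 := h4
  calc ρ k = (B⁻¹ * B) * ρ k * (B⁻¹ * B) := by rw [h1, Matrix.one_mul, Matrix.mul_one]
    _ = B⁻¹ * (B * ρ k * B⁻¹) * B := by simp only [Matrix.mul_assoc]
    _ = 1 := by rw [h5, Matrix.mul_one, h1]
end A2
end

section
namespace A1
open Matrix
open scoped commutatorElement TensorProduct

theorem sect {G U V : Type} [Group G] [Group U] [Group V] [Finite G] [Finite U] (p k : ℕ)
    (hp : p.Prime) (hG : ¬ p ∣ Nat.card G) (f : U →* V) (ι : G →* V) (hs : ∀ g, ∃ u, f u = ι g)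
    (hk : ∀ u, f u = 1 → u ^ p ^ k = 1) : ∃ s : G →* U, ∀ g, f (s g) = ι g := by
  have := Fact.mk hp
  let A : Subgroup (G × U) := MonoidHom.eqLocus (ι.comp (.fst G U)) (f.comp (.snd G U))
  let π : A →* G := (MonoidHom.fst G U).comp A.subtype
  have hπ : Function.Surjective π := fun g => by
    obtain ⟨u, hu⟩ := hs g
    exact ⟨⟨(g, u), hu.symm⟩, rfl⟩
  have hA : ∀ a : A, ι a.1.1 = f a.1.2 := fun a => a.2
  have hK : IsPGroup p π.ker := fun a => by
    refine ⟨k, Subtype.ext (Subtype.ext (Prod.ext ?_ (hk _ ?_)))⟩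
    · have : a.1.1.1 = 1 := a.2
      change a.1.1.1 ^ p ^ k = 1
      rw [this, one_pow]
    · have : a.1.1.1 = 1 := a.2
      rw [← hA, this, map_one]
  obtain ⟨r, hr⟩ := IsPGroup.iff_card.1 hK
  have hi : π.ker.index = Nat.card G := by
    rw [Subgroup.index_ker, MonoidHom.range_eq_top.2 hπ, Subgroup.card_top]
  obtain ⟨C, hC⟩ := Subgroup.exists_right_complement'_of_coprime (N := π.ker) (by
    rw [hr, hi]; exact ((Nat.Prime.coprime_iff_not_dvd hp).2 hG).pow_left _)
  have hb : Function.Bijective (π.comp C.subtype) := by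
    constructor
    · rw [← MonoidHom.ker_eq_bot_iff, eq_bot_iff]
      intro c hc
      have : c.1 ∈ π.ker ⊓ C := ⟨hc, c.2⟩
      rw [hC.disjoint.eq_bot] at this
      exact Subtype.ext this
    · intro g
      obtain ⟨a, rfl⟩ := hπ g
      obtain ⟨⟨x, y⟩, h⟩ := hC.2 a
      refine ⟨y, ?_⟩
      change (x : A) * y = a at h
      rw [← h, map_mul, show π x = 1 from x.2, one_mul]; rfl
  let e := MulEquiv.ofBijective _ hb
  refine ⟨((MonoidHom.snd G U).comp A.subtype).comp (C.subtype.comp e.symm.toMonoidHom), fun g => ?_⟩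
  have h := hA (e.symm g)
  exact h.symm.trans (congrArg ι (e.apply_symm_apply g))

theorem dvd_of {p k : ℕ} (hp : p.Prime) (φ : ZMod (p ^ (k + 1)) →+* ZMod p) (x : ZMod (p ^ (k + 1)))
    (h : φ x = 0) : ∃ y, x = p * y := by
  have : NeZero (p ^ (k + 1)) := ⟨(pow_pos hp.pos _).ne'⟩
  rw [← ZMod.natCast_zmod_val x, map_natCast, ZMod.natCast_eq_zero_iff] at h
  obtain ⟨y, hy⟩ := h
  exact ⟨y, by rw [← ZMod.natCast_zmod_val x, hy, Nat.cast_mul]⟩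

theorem pow_one {p k : ℕ} {M : Type} [Ring M] [Algebra (ZMod (p ^ (k + 1))) M] (y : M) :
    (1 + (p : M) * y) ^ p ^ k = 1 := by
  have h := dvd_sub_pow_of_dvd_sub (R := Polynomial (ZMod (p ^ (k + 1)))) (p := p)
    (a := 1 + (p : Polynomial (ZMod (p ^ (k + 1)))) * Polynomial.X) (b := 1) (by simp) k
  have h0 : ((p : Polynomial (ZMod (p ^ (k + 1)))) ^ (k + 1)) = 0 := by
    rw [← Nat.cast_pow, ← map_natCast Polynomial.C, ZMod.natCast_self, map_zero]
  rw [h0, zero_dvd_iff, one_pow, sub_eq_zero] at h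
  simpa using congrArg (Polynomial.aeval y) h

theorem lift {n p : ℕ} (hp : p.Prime) (Γ : Subgroup (SpecialLinearGroup (Fin n) (ZMod p)))
    (hΓ : ¬ p ∣ Nat.card Γ) (k : ℕ) (φ : ZMod (p ^ (k + 1)) →+* ZMod p)
    (hφ : Function.Surjective φ) :
    ∃ s : Γ →* Matrix (Fin n) (Fin n) (ZMod (p ^ (k + 1))), ∀ g, (s g).map φ = g.1.1 := by
  have := Fact.mk hp
  have : NeZero (p ^ (k + 1)) := ⟨(pow_pos hp.pos _).ne'⟩
  have : Finite (Matrix (Fin n) (Fin n) (ZMod (p ^ (k + 1)))) := Matrix.instFinite ..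
  let f := Units.map (φ.mapMatrix (m := Fin n)).toMonoidHom
  let ι := (SpecialLinearGroup.toGL (n := Fin n) (R := ZMod p)).comp Γ.subtype
  obtain ⟨s, hs⟩ := sect p k hp hΓ f ι (fun g => by
    choose r hr using hφ
    let M : Matrix (Fin n) (Fin n) (ZMod (p ^ (k + 1))) := g.1.1.map r
    have hM : φ.mapMatrix M = g.1.1 := by ext i j; exact hr _
    obtain ⟨y, hy⟩ := dvd_of hp φ (M.det - 1) (by
      rw [map_sub, RingHom.map_det, hM, g.1.2, map_one, sub_self])
    have h1 : M.det ^ p ^ k = 1 := by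
      rw [sub_eq_iff_eq_add'.1 hy]; exact pow_one y
    have hu : IsUnit M := (isUnit_iff_isUnit_det _).2
      (IsUnit.of_pow_eq_one h1 (pow_pos hp.pos _).ne')
    exact ⟨hu.unit, Units.ext hM⟩) (fun u hu => by
    have h1 : ∀ i j, ∃ y, (u.1 - 1) i j = p * y := fun i j => dvd_of hp φ _ (by
      have : φ.mapMatrix (u.1 - 1) = 0 := by
        rw [map_sub, map_one, sub_eq_zero]; exact congrArg Units.val hu
      exact congrFun (congrFun this i) j)
    choose y hy using h1
    have h2 : u.1 = 1 + (p : Matrix (Fin n) (Fin n) (ZMod (p ^ (k + 1)))) * of y := by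
      rw [← sub_eq_iff_eq_add', ← nsmul_eq_mul]
      ext i j
      rw [hy, Matrix.smul_apply, nsmul_eq_mul]; rfl
    refine Units.ext ?_
    rw [Units.val_pow_eq_pow_val, h2]; exact pow_one _)
  exact ⟨(Units.coeHom _).comp s, fun g => congrArg Units.val (hs g)⟩

theorem toC0 (A : Type) [CommRing A] [Algebra ℚ A] [Nontrivial A] [Algebra.FiniteType ℚ A] :
    Nonempty (A →+* ℂ) := by
  obtain ⟨m, hm⟩ := Ideal.exists_maximal A
  let _ := Ideal.Quotient.field m
  have : Module.Finite ℚ (A ⧸ m) := finite_of_finite_type_of_isJacobsonRing _ _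
  exact ⟨(IsAlgClosed.lift (R := ℚ) (S := A ⧸ m) (M := ℂ)).toRingHom.comp (Ideal.Quotient.mk m)⟩

theorem map_sum_det {n : ℕ} {A B : Type} [CommRing A] [CommRing B] (f : A →+* B)
    (x : Matrix (Fin n) (Fin n) A) (o : ℕ) :
    (∑ i ∈ Finset.range o, f.mapMatrix x ^ i).det = f (∑ i ∈ Finset.range o, x ^ i).det := by
  rw [RingHom.map_det, map_sum]
  simp only [map_pow]

theorem toC1 {n : ℕ} {G T : Type} [Group G] [Finite G] [CommRing T] [Algebra ℚ T] [Nontrivial T]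
    (ρ : G →* Matrix (Fin n) (Fin n) T) : ∃ σ : G →* Matrix (Fin n) (Fin n) ℂ,
    ∀ c o, (∑ i ∈ Finset.range o, ρ c ^ i).det = 0 → (∑ i ∈ Finset.range o, σ c ^ i).det = 0 := by
  obtain ⟨A, hft, hmem⟩ : ∃ A : Subalgebra ℚ T, Algebra.FiniteType ℚ A ∧ ∀ g a b, ρ g a b ∈ A :=
    ⟨Algebra.adjoin ℚ (Set.range fun x : G × Fin n × Fin n => ρ x.1 x.2.1 x.2.2),
      (Subalgebra.fg_iff_finiteType _).1 (Subalgebra.fg_def.2 ⟨_, Set.finite_range _, rfl⟩),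
      fun g a b => Algebra.subset_adjoin ⟨(g, a, b), rfl⟩⟩
  obtain ⟨θ⟩ := toC0 A
  let v : A →+* T := A.val.toRingHom
  have hv : Function.Injective v := Subtype.val_injective
  have hvM : Function.Injective (v.mapMatrix (m := Fin n)) := Matrix.map_injective hv
  let τ0 : G → Matrix (Fin n) (Fin n) A := fun g => of fun a b => ⟨_, hmem g a b⟩
  have hτ : ∀ g, v.mapMatrix (τ0 g) = ρ g := fun g => rfl
  let τ : G →* Matrix (Fin n) (Fin n) A :=
    { toFun := τ0
      map_one' := hvM (by rw [hτ, map_one, map_one])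
      map_mul' := fun g h => hvM (by rw [map_mul, hτ, hτ, hτ, map_mul]) }
  refine ⟨θ.mapMatrix.toMonoidHom.comp τ, fun c o h => ?_⟩
  have h1 : (∑ i ∈ Finset.range o, τ c ^ i).det = 0 :=
    hv ((map_sum_det v (τ c) o).symm.trans (h.trans (map_zero v).symm))
  exact (map_sum_det θ (τ c) o).trans (by rw [h1, map_zero])

theorem toC {n : ℕ} {G R : Type} [Group G] [Finite G] [CommRing R] [CharZero R]
    (ρ : G →* Matrix (Fin n) (Fin n) R) : ∃ σ : G →* Matrix (Fin n) (Fin n) ℂ,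
    ∀ c o, (∑ i ∈ Finset.range o, ρ c ^ i).det = 0 → (∑ i ∈ Finset.range o, σ c ^ i).det = 0 := by
  let j : R →+* ℚ ⊗[ℤ] R := (Algebra.TensorProduct.includeRight (R := ℤ)).toRingHom
  have hT : Nontrivial (ℚ ⊗[ℤ] R) := by
    have h := Module.Flat.lTensor_preserves_injective_linearMap (M := ℚ)
      (Algebra.linearMap ℤ R) (RingHom.injective_int (algebraMap ℤ R))
    have h2 : Nontrivial (ℚ ⊗[ℤ] ℤ) := (TensorProduct.rid ℤ ℚ).toEquiv.nontrivial
    exact h.nontrivial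
  obtain ⟨σ, hσ⟩ := toC1 (j.mapMatrix.toMonoidHom.comp ρ)
  exact ⟨σ, fun c o h => hσ c o ((map_sum_det j (ρ c) o).trans (by rw [h, map_zero]))⟩

theorem sum_det {n p k : ℕ} (hp : p.Prime) (φ : ZMod (p ^ (k + 1)) →+* ZMod p) (o : ℕ)
    (ho : p.Coprime o) (x : Matrix (Fin n) (Fin n) (ZMod (p ^ (k + 1)))) (hx : x ^ o = 1)
    (h1 : φ.mapMatrix x ≠ 1) : (∑ i ∈ Finset.range o, x ^ i).det = 0 := by
  have := Fact.mk hp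
  set S := ∑ i ∈ Finset.range o, x ^ i with hS
  have hz : (x - 1) * S = 0 := by rw [mul_geom_sum, hx, sub_self]
  have hxS : ∀ i, x ^ i * S = S := fun i => by
    induction i with
    | zero => rw [pow_zero, one_mul]
    | succ i ih => rw [pow_succ x i, mul_assoc, show x * S = S by
        rwa [sub_mul, one_mul, sub_eq_zero] at hz, ih]
  have hSS : S * S = (o : ZMod (p ^ (k + 1))) • S := by
    conv_lhs => rw [hS, Finset.sum_mul]
    rw [Finset.sum_congr rfl fun i _ => hxS i]
    rw [Finset.sum_const, Finset.card_range, Nat.cast_smul_eq_nsmul]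
  have hd : S.det * S.det = (o : ZMod (p ^ (k + 1))) ^ n * S.det := by
    rw [← det_mul, hSS, det_smul, Fintype.card_fin]
  have h0 : φ S.det = 0 := by
    by_contra hne
    rw [RingHom.map_det] at hne
    have hu : IsUnit (φ.mapMatrix S) := (isUnit_iff_isUnit_det _).2 (isUnit_iff_ne_zero.2 hne)
    have := congrArg φ.mapMatrix hz
    rw [map_mul, map_zero, hu.mul_left_eq_zero, map_sub, map_one, sub_eq_zero] at this
    exact h1 this
  obtain ⟨y, hy⟩ := dvd_of hp φ _ h0
  have hn : S.det ^ (k + 1) = 0 := by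
    rw [hy, mul_pow, ← Nat.cast_pow, ZMod.natCast_self, zero_mul]
  have hj : ∀ j, S.det ^ (j + 1) = ((o : ZMod (p ^ (k + 1))) ^ n) ^ j * S.det := fun j => by
    induction j with
    | zero => simp
    | succ j ih => rw [pow_succ S.det, ih, mul_assoc, hd]; ring
  have hu : IsUnit (o : ZMod (p ^ (k + 1))) := (ZMod.isUnit_iff_coprime _ _).2 (ho.symm.pow_right _)
  rw [hj] at hn
  exact ((hu.pow n).pow k).mul_right_eq_zero.1 hn

theorem main (n : ℕ) : ∃ m, 0 < m ∧ ∀ p, p.Prime →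
    ∀ Γ : Subgroup (SpecialLinearGroup (Fin n) (ZMod p)), ¬ p ∣ Nat.card Γ →
    ∀ g h : Γ, ⁅g ^ m, h ^ m⁆ = 1 := by
  obtain ⟨m, hm, hJ⟩ := A2.jordan n
  refine ⟨m, hm, fun p hp Γ hΓ g h => ?_⟩
  have := Fact.mk hp
  by_contra hc
  let φ := fun k => ZMod.castHom (dvd_pow_self p (Nat.succ_ne_zero k)) (ZMod p)
  choose s hs using fun k => lift hp Γ hΓ k (φ k) (ZMod.castHom_surjective _)
  let R := ∀ k : ℕ, ZMod (p ^ (k + 1))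
  have : CharZero R := charZero_of_inj_zero fun a ha => by
    have h1 := congrFun ha a
    change ((a : ℕ) : ZMod (p ^ (a + 1))) = 0 at h1
    rw [ZMod.natCast_eq_zero_iff] at h1
    by_contra h0
    have := Nat.le_of_dvd (Nat.pos_of_ne_zero h0) h1
    have := Nat.lt_pow_self hp.one_lt (n := a + 1)
    omega
  let ρ : Γ →* Matrix (Fin n) (Fin n) R :=
    { toFun := fun g => of fun i j k => s k g i j
      map_one' := by
        ext i j k
        change s k 1 i j = _
        rw [map_one]
        by_cases e : i = j
        · subst e; simp; rfl
        · simp [e]; rfl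
      map_mul' := fun g h => by
        ext i j k
        change s k (g * h) i j = _
        rw [map_mul, mul_apply, mul_apply, Finset.sum_apply]; rfl }
  obtain ⟨σ, hσ⟩ := toC ρ
  generalize hc' : ⁅g ^ m, h ^ m⁆ = c at hc
  have h1 : σ c = 1 := hc' ▸ hJ Γ σ g h
  have ho : 0 < orderOf c := orderOf_pos c
  have h2 := hσ c (orderOf c) (by
    funext k
    have e := (Pi.evalRingHom (fun k : ℕ => ZMod (p ^ (k + 1))) k).map_det
      (∑ i ∈ Finset.range (orderOf c), ρ c ^ i)
    refine e.trans ?_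
    rw [map_sum]
    simp only [map_pow]
    refine sum_det hp (φ k) _ ((Nat.Prime.coprime_iff_not_dvd hp).2 fun h =>
      hΓ (h.trans (orderOf_dvd_natCard c))) (s k c) ?_ fun h => hc ?_
    · rw [← map_pow, pow_orderOf_eq_one, map_one]
    · exact Subtype.ext (Subtype.ext ((hs k c).symm.trans h)))
  rw [h1] at h2
  simp only [one_pow, Finset.sum_const, Finset.card_range] at h2
  rw [nsmul_eq_mul, mul_one, ← diagonal_natCast, det_diagonal] at h2
  simp [ho.ne'] at h2

end A1
end

open Matrix
open scoped commutatorElement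

namespace M0

theorem eq_of_inf {n : ℕ} (x y : SL n ℤ) (Q : Set ℕ) (hQ : Q.Infinite)
    (h : ∀ p ∈ Q, redMod n p x = redMod n p y) : x = y := by
  refine Subtype.ext (Matrix.ext fun i j => ?_)
  by_contra hne
  refine hQ ((Set.finite_Iic (x.1 i j - y.1 i j).natAbs).subset fun p hp => ?_)
  have h1 := congrFun (congrFun (congrArg Subtype.val (h p hp)) i) j
  change ((x.1 i j : ℤ) : ZMod p) = ((y.1 i j : ℤ) : ZMod p) at h1
  have h2 := (ZMod.intCast_eq_intCast_iff_dvd_sub _ _ _).1 h1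
  exact Nat.le_of_dvd (Int.natAbs_pos.2 (sub_ne_zero.2 hne))
    (Int.natCast_dvd.1 ((dvd_sub_comm).1 h2))

theorem coprime_case {n : ℕ} (hn : n.Prime) (H : Subgroup (SL n ℤ)) (hH : AbsIrredQ H)
    (hinf : Infinite H) (hns : ¬ IsSolvable H) (Q : Set ℕ) (hQ : Q.Infinite)
    (h : ∀ p ∈ Q, p.Prime ∧ ¬ p ∣ Nat.card (H.map (redMod n p))) : False := by
  obtain ⟨m, hm, hJ⟩ := A1.main n
  refine A3.main hn H hH hinf hns m hm fun g hg k hk => eq_of_inf _ _ Q hQ fun p hp => ?_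
  have h1 := hJ p (h p hp).1 (H.map (redMod n p)) (h p hp).2 ⟨_, Subgroup.mem_map_of_mem _ hg⟩
    ⟨_, Subgroup.mem_map_of_mem _ hk⟩
  have h2 := congrArg Subtype.val (commutatorElement_eq_one_iff_mul_comm.1 h1)
  change redMod n p g ^ m * redMod n p k ^ m = redMod n p k ^ m * redMod n p g ^ m at h2
  rw [map_mul, map_mul, map_pow, map_pow, h2]

end M0

theorem exceptional_primes_finite_of_primitive (n : ℕ) (hn : n.Prime) (hodd : Odd n)
    (H : Subgroup (SL n ℤ)) (hFG : H.FG) (hinf : Infinite H) (hns : ¬ IsSolvable H)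
    (hprim : PrimitiveQ H) (hiso : ¬ IsometryGroupQ H) :
    {p : ℕ | p.Prime ∧ H.map (redMod n p) ≠ ⊤}.Finite := by
  have hH := P0.abs_irr hn H hns hprim.1
  obtain ⟨N, hN⟩ := B3.main n hn hodd
  let Q1 := {p : ℕ | p.Prime ∧ ¬ p ∣ Nat.card (H.map (redMod n p))}
  let Q2 := {p : ℕ | p.Prime ∧ ∃ Φ : Matrix (Fin n) (Fin n) (ZMod p), IsUnit Φ ∧
    ∀ g ∈ H.map (redMod n p), ∃ c : ZMod p, g.1 * Φ * g.1ᵀ = c • Φ}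
  have h1 : Q1.Finite := by
    by_contra hQ
    exact M0.coprime_case hn H hH hinf hns Q1 hQ fun p hp => hp
  have h2 : Q2.Finite := by
    by_contra hQ
    exact hiso (E1.form_case hn hodd H hH hns Q2 hQ fun p hp => hp)
  refine ((((Set.finite_Iic N).union (P0.mod_span H hH)).union h1).union h2).subset ?_
  rintro p ⟨hp, hne⟩
  have := Fact.mk hp
  by_contra hc
  simp only [Set.mem_union, not_or] at hc
  obtain ⟨⟨⟨a1, a2⟩, a3⟩, a4⟩ := hc
  rcases hN p (not_le.1 a1) _ (by_contra fun h => a2 ⟨hp, h⟩) (by_contra fun h => a3 ⟨hp, h⟩)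
    with h | h
  · exact hne h
  · exact a4 ⟨hp, h⟩
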